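/- For every real number δ < 8/9 there exists a constant C > 0 such that for all integers n ≥ 2, |Σ_{n^{2/3} ≤ p ≤ 2n, p prime} α*_p(n)·log p − Σ_{n^{2/3} ≤ p ≤ 2n, p prime} (1 + (−1/p))·n·log p/(p−1)| ≤ C·n/(log n)^{δ/2}. -/

import Mathlib

open Polynomial in
/-- The polynomial step of Stepanov's method over a field with `Q ^ 2` elements. -/
theorem stepanov_card_le {K : Type*} [Field K] [Finite K] {p M m Q : ℕ} [hp : Fact p.Prime]
    [CharP K p] (hM : 0 < M) (hQM : Q = M * p) (hQ : Q = p ^ m) (P : K[X])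
    (hP : P.natDegree = 2 * M) (S : Finset K) (hS0 : ∀ x ∈ S, x ≠ 0)
    (hS1 : ∀ x ∈ S, x ^ (Q * Q) = x)
    (hS2 : ∀ x ∈ S, P.eval x ^ Q * x ^ M = - (x ^ (Q * M) * P.eval x)) :
    S.card ≤ M * (p - 1) + Q * (M + 2) := by
  classical
  have hp2 := hp.out.two_le
  obtain ⟨r, hr⟩ : ∃ r, p = r + 1 := ⟨p - 1, by omega⟩
  have hP0 : P ≠ 0 := by
    rintro rfl
    simp at hP
    omega
  let I := Fin M × Fin (M + 2) × Fin p
  let mon : I → K[X] := fun v =>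
    X ^ ((v.1 : ℕ) * Q + v.2.1) * X ^ (M * (r - v.2.2)) * (-P) ^ (v.2.2 : ℕ)
  set N := (M - 1) * Q + M + 2 + 2 * M * r with hN
  have hmon : ∀ v, (mon v).natDegree < N := by
    rintro ⟨i, j, l⟩
    have h1 : (mon (i, j, l)).natDegree ≤ (i * Q + j) + (M * (r - l)) + l * (2 * M) := by
      refine (natDegree_mul_le).trans (add_le_add ((natDegree_mul_le).trans (add_le_add ?_ ?_)) ?_)
      · simp
      · simp
      · refine natDegree_pow_le.trans ?_
        simp [hP]
    have hi : (i : ℕ) * Q ≤ (M - 1) * Q := Nat.mul_le_mul_right _ (by omega)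
    have hl : (l : ℕ) ≤ r := by have := l.2; omega
    have h2 : M * (r - l) + l * (2 * M) ≤ 2 * M * r := by
      obtain ⟨s, rfl⟩ := Nat.exists_eq_add_of_le hl
      simp only [Nat.add_sub_cancel_left]
      nlinarith [Nat.zero_le (M * s)]
    have := j.2
    omega
  let F : (I → K) →ₗ[K] (Fin N → K) :=
    { toFun := fun μ n => (∑ v, C (μ v) * mon v).coeff n
      map_add' := by
        intro x y; ext n
        simp [add_mul, Finset.sum_add_distrib]
      map_smul' := by
        intro c x; ext n
        simp [Finset.mul_sum, mul_assoc] }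
  have hker : LinearMap.ker F ≠ ⊥ := by
    apply LinearMap.ker_ne_bot_of_finrank_lt
    simp only [Module.finrank_fintype_fun_eq_card, Fintype.card_fin, I, Fintype.card_prod]
    rw [hN, hQM, hr]
    obtain ⟨k, rfl⟩ : ∃ k, M = k + 1 := ⟨M - 1, by omega⟩
    have : 1 ≤ r := by omega
    simp only [Nat.add_sub_cancel]
    nlinarith [Nat.zero_le (k * r), Nat.zero_le k]
  obtain ⟨μ, hμker, hμ0⟩ := (Submodule.ne_bot_iff _).1 hker
  have hH : ∑ v, C (μ v) * mon v = 0 := by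
    ext n
    by_cases hn : n < N
    · have := congrFun (LinearMap.mem_ker.1 hμker) ⟨n, hn⟩
      simpa [F] using this
    · rw [coeff_zero]
      apply coeff_eq_zero_of_natDegree_lt
      refine lt_of_lt_of_le ?_ (not_lt.1 hn)
      refine lt_of_le_of_lt (natDegree_sum_le_of_forall_le (n := N - 1) _ _ ?_) (by omega)
      intro v _
      have := hmon v
      exact (natDegree_C_mul_le _ _).trans (by omega)
  -- Frobenius surjectivity
  have hfrob : ∀ y : K, ∃ x : K, x ^ Q = y := by
    have hinj : Function.Injective (iterateFrobenius K p m) := (iterateFrobenius K p m).injective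
    intro y
    obtain ⟨x, hx⟩ := (Finite.surjective_of_injective hinj) y
    exact ⟨x, by rw [← hx, iterateFrobenius_def, hQ]⟩
  choose rt hrt using hfrob
  let g : I → K[X] := fun v =>
    C (rt (μ v)) * (X ^ ((v.1 : ℕ) + v.2.1 * Q) * X ^ (M * (r - v.2.2)) * P ^ (v.2.2 : ℕ))
  let G : K[X] := ∑ v, g v
  have hQ0 : Q ≠ 0 := by rw [hQM]; positivity
  have hrt0 : ∀ y, rt y = 0 ↔ y = 0 := by
    intro y
    constructor
    · intro h; have := hrt y; rw [h, zero_pow hQ0] at this; exact this.symm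
    · intro h; have := hrt y; rw [h] at this
      rw [h]
      exact eq_zero_of_pow_eq_zero this
  have hgdeg : ∀ v, rt (μ v) ≠ 0 →
      (g v).natDegree = M * r + ((v.1 : ℕ) + M * (v.2.2 + p * v.2.1)) := by
    rintro ⟨i, j, l⟩ hv
    simp only [g]
    have hl : (l : ℕ) ≤ r := by have := l.2; omega
    rw [natDegree_C_mul hv, natDegree_mul (by simp [X_ne_zero]) (pow_ne_zero _ hP0),
      natDegree_mul (by simp [X_ne_zero]) (by simp [X_ne_zero]),
      natDegree_X_pow, natDegree_X_pow, natDegree_pow, hP, hQM]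
    obtain ⟨s, rfl⟩ := Nat.exists_eq_add_of_le hl
    simp only [Nat.add_sub_cancel_left]
    ring
  have hdeg_inj : ∀ v w : I, (v.1 : ℕ) + M * (v.2.2 + p * v.2.1) = (w.1 : ℕ) + M * (w.2.2 + p * w.2.1)
      → v = w := by
    rintro ⟨i, j, l⟩ ⟨i', j', l'⟩ h
    simp only at h
    have e1 : (i : ℕ) = i' := by
      have := congrArg (· % M) h
      simpa [Nat.add_mul_mod_self_left, Nat.mod_eq_of_lt i.2, Nat.mod_eq_of_lt i'.2] using this
    have e2 : (l : ℕ) + p * j = l' + p * j' := by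
      rw [e1] at h
      exact Nat.eq_of_mul_eq_mul_left hM (Nat.add_left_cancel h)
    have e3 : (l : ℕ) = l' := by
      have := congrArg (· % p) e2
      simpa [Nat.add_mul_mod_self_left, Nat.mod_eq_of_lt l.2, Nat.mod_eq_of_lt l'.2] using this
    have e4 : (j : ℕ) = j' := by
      rw [e3] at e2
      exact Nat.eq_of_mul_eq_mul_left hp.out.pos (Nat.add_left_cancel e2)
    ext <;> simp [*]
  have hG0 : G ≠ 0 := by
    have hdisj : Set.Pairwise {v | v ∈ (Finset.univ : Finset I) ∧ g v ≠ 0} (Function.onFun Ne (degree ∘ g)) := by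
      rintro v ⟨_, hv⟩ w ⟨_, hw⟩ hvw heq
      apply hvw
      apply hdeg_inj
      have h1 : rt (μ v) ≠ 0 := by rintro h; exact hv (by simp [g, h])
      have h2 : rt (μ w) ≠ 0 := by rintro h; exact hw (by simp [g, h])
      have h3 : (g v).natDegree = (g w).natDegree := natDegree_eq_of_degree_eq heq
      rw [hgdeg v h1, hgdeg w h2] at h3
      exact Nat.add_left_cancel h3
    have hsum := degree_sum_eq_of_disjoint g Finset.univ hdisj
    intro hG
    obtain ⟨v, hv⟩ : ∃ v, μ v ≠ 0 := by
      by_contra! h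
      exact hμ0 (funext h)
    have hgv : g v ≠ 0 := by
      simp only [g]
      refine mul_ne_zero ?_ (mul_ne_zero (mul_ne_zero (by simp [X_ne_zero]) (by simp [X_ne_zero]))
        (pow_ne_zero _ hP0))
      rw [Ne, C_eq_zero, hrt0]; exact hv
    have h1 : (g v).degree ≤ Finset.univ.sup fun i => (g i).degree :=
      Finset.le_sup (f := fun i => (g i).degree) (Finset.mem_univ v)
    rw [← hsum] at h1
    change (g v).degree ≤ degree G at h1
    rw [hG, degree_zero, le_bot_iff, degree_eq_bot] at h1
    exact hgv h1
  have hGdeg : G.natDegree ≤ M * (p - 1) + Q * (M + 2) := by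
    apply natDegree_sum_le_of_forall_le
    rintro ⟨i, j, l⟩ _
    by_cases h : rt (μ (i, j, l)) = 0
    · simp [g, h]
    · rw [hgdeg _ h]
      have hpr : p - 1 = r := by omega
      rw [hpr]
      refine Nat.add_le_add_left ?_ _
      simp only
      rw [hQM]
      have hi := i.2
      have hj := j.2
      have hl := l.2
      have h1 : (l : ℕ) + p * j + 1 ≤ p * (M + 2) := by
        calc (l : ℕ) + p * j + 1 ≤ p + p * j := by omega
          _ = p * (j + 1) := by ring
          _ ≤ _ := Nat.mul_le_mul_left _ hj
      calc (i : ℕ) + M * (l + p * j) ≤ M * (l + p * j + 1) := by nlinarith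
        _ ≤ M * (p * (M + 2)) := Nat.mul_le_mul_left _ h1
        _ = _ := by ring
  have hroot : ∀ x ∈ S, G.IsRoot x := by
    intro x hx
    have hx0 := hS0 x hx
    have hx1 := hS1 x hx
    have hx2 := hS2 x hx
    rw [IsRoot.def]
    apply eq_zero_of_pow_eq_zero (n := Q)
    have hHx : ∑ v, μ v * (mon v).eval x = 0 := by
      have := congrArg (eval x) hH
      simpa [eval_finsetSum] using this
    have key : (G.eval x) ^ Q * x ^ (M * r) = x ^ (Q * (M * r)) * ∑ v, μ v * (mon v).eval x := by
      simp only [G, eval_finsetSum]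
      rw [hQ, sum_pow_char_pow, ← hQ, Finset.sum_mul, Finset.mul_sum]
      refine Finset.sum_congr rfl ?_
      rintro ⟨i, j, l⟩ _
      have hl : (l : ℕ) ≤ r := by have := l.2; omega
      simp only [g, mon, eval_mul, eval_C, eval_pow, eval_X, eval_neg]
      rw [mul_pow, hrt]
      obtain ⟨s, hs⟩ := Nat.exists_eq_add_of_le hl
      rw [hs]
      simp only [Nat.add_sub_cancel_left]
      have e1 : (x ^ ((i : ℕ) + j * Q)) ^ Q = x ^ ((i : ℕ) * Q + j) := by
        rw [← pow_mul, add_mul, mul_assoc, pow_add, pow_mul' x (j : ℕ), hx1, pow_add]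
      have e2 : (eval x P ^ (l : ℕ)) ^ Q * x ^ (M * l) =
          (x ^ (Q * M)) ^ (l : ℕ) * (- eval x P) ^ (l : ℕ) := by
        rw [← pow_mul, mul_comm (l : ℕ) Q, pow_mul, pow_mul, ← mul_pow, hx2, ← mul_pow]
        congr 1; ring
      rw [mul_pow, mul_pow, e1]
      calc μ (i, j, l) * (x ^ ((i : ℕ) * Q + j) * (x ^ (M * s)) ^ Q * (eval x P ^ (l : ℕ)) ^ Q) *
            x ^ (M * (l + s))
          = μ (i, j, l) * x ^ ((i : ℕ) * Q + j) * (x ^ (M * s)) ^ Q * x ^ (M * s) *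
            ((eval x P ^ (l : ℕ)) ^ Q * x ^ (M * l)) := by rw [mul_add, pow_add]; ring
        _ = _ := by
            rw [e2, ← pow_mul, ← pow_mul]
            have : x ^ (Q * (M * (l + s))) = x ^ (M * s * Q) * x ^ (Q * M * l) := by
              rw [← pow_add]; congr 1; ring
            rw [this]; ring
    rw [hHx, mul_zero] at key
    exact (mul_eq_zero.1 key).resolve_right (pow_ne_zero _ hx0)
  calc S.card ≤ G.roots.toFinset.card := by
        apply Finset.card_le_card
        intro x hx
        rw [Multiset.mem_toFinset, mem_roots hG0]
        exact hroot x hx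
    _ ≤ _ := (Multiset.toFinset_card_le _).trans ((card_roots' G).trans hGdeg)

/-- Number of points with prescribed trace of `a x + b / x`. -/
theorem card_trace_eq_le {K : Type*} [Field K] [Fintype K] [DecidableEq K] {p m : ℕ}
    [hp : Fact p.Prime]
    [Algebra (ZMod p) K] (hm : 0 < m) (hK : Fintype.card K = p ^ (2 * m)) (a b : K) (ha : a ≠ 0)
    (c : ZMod p) :
    ((Finset.univ.filter fun x : K => x ≠ 0 ∧
      Algebra.trace (ZMod p) K (a * x + b * x⁻¹) = c).card : ℝ) ≤
      p ^ (2 * m) / p + 3 * p ^ m := by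
  have hchar : CharP K p := charP_of_injective_algebraMap (algebraMap (ZMod p) K).injective p
  have hp1 := hp.out.one_lt
  have hrank : Module.finrank (ZMod p) K = 2 * m := by
    have h := Module.card_eq_pow_finrank (K := ZMod p) (V := K)
    rw [hK, ZMod.card] at h
    exact (Nat.pow_right_injective hp.out.two_le h).symm
  obtain ⟨t, ht⟩ := Algebra.trace_surjective (ZMod p) K (-c)
  set M := p ^ (m - 1) with hM
  set Q := p ^ m with hQ
  have hM0 : 0 < M := pow_pos hp.out.pos _
  have hQM : Q = M * p := by rw [hM, hQ, ← pow_succ]; congr 1; omega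
  have hle : ∀ l ∈ Finset.range m, p ^ l ≤ M := fun l hl =>
    Nat.pow_le_pow_right hp.out.pos (by have := Finset.mem_range.1 hl; omega)
  let term : ℕ → Polynomial K := fun l =>
    Polynomial.C (a ^ p ^ l) * Polynomial.X ^ (M + p ^ l) +
      Polynomial.C (b ^ p ^ l) * Polynomial.X ^ (M - p ^ l) +
      Polynomial.C (t ^ p ^ l) * Polynomial.X ^ M
  let P : Polynomial K := ∑ l ∈ Finset.range m, term l
  have hPeval : ∀ x : K, x ≠ 0 →
      P.eval x = x ^ M * ∑ l ∈ Finset.range m, (a * x + b * x⁻¹ + t) ^ p ^ l := by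
    intro x hx
    simp only [P, Polynomial.eval_finsetSum, Finset.mul_sum]
    refine Finset.sum_congr rfl fun l hl => ?_
    have h1 := hle l hl
    simp only [term, Polynomial.eval_add, Polynomial.eval_mul, Polynomial.eval_C,
      Polynomial.eval_pow, Polynomial.eval_X]
    rw [add_pow_char_pow, add_pow_char_pow, mul_pow, mul_pow, inv_pow, pow_add,
      pow_sub₀ x hx h1]
    ring
  have htdeg : ∀ l ∈ Finset.range m, (term l).natDegree ≤ M + p ^ l := by
    intro l hl
    refine Polynomial.natDegree_add_le_of_degree_le (Polynomial.natDegree_add_le_of_degree_le ?_ ?_) ?_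
    · exact Polynomial.natDegree_C_mul_X_pow_le _ _
    · exact (Polynomial.natDegree_C_mul_X_pow_le _ _).trans (by omega)
    · exact (Polynomial.natDegree_C_mul_X_pow_le _ _).trans (by omega)
  have hPdeg : P.natDegree = 2 * M := by
    apply le_antisymm
    · refine Polynomial.natDegree_sum_le_of_forall_le _ _ fun l hl => ?_
      have := htdeg l hl
      have := hle l hl
      omega
    · apply Polynomial.le_natDegree_of_ne_zero
      have hmem : m - 1 ∈ Finset.range m := Finset.mem_range.2 (by omega)
      simp only [P, Polynomial.finsetSum_coeff]
      rw [Finset.sum_eq_single_of_mem _ hmem]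
      · simp only [term, Polynomial.coeff_add, Polynomial.coeff_C_mul, Polynomial.coeff_X_pow]
        rw [if_pos (by omega), if_neg (by have := Nat.sub_le M (p ^ (m-1)); omega), if_neg (by omega)]
        simp only [mul_one, mul_zero, add_zero]
        exact pow_ne_zero _ ha
      · intro l hl hne
        apply Polynomial.coeff_eq_zero_of_natDegree_lt
        have h1 := htdeg l hl
        have h2 : p ^ l < M := Nat.pow_lt_pow_right hp1 (by
          have := Finset.mem_range.1 hl; omega)
        omega
  set S := Finset.univ.filter fun x : K => x ≠ 0 ∧
      Algebra.trace (ZMod p) K (a * x + b * x⁻¹) = c with hS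
  have hQQ : Q * Q = Fintype.card K := by rw [hK, hQ, ← pow_add]; congr 1; omega
  have hmain := stepanov_card_le (p := p) hM0 hQM hQ P hPdeg S
    (fun x hx => (Finset.mem_filter.1 hx).2.1)
    (fun x _ => by rw [hQQ]; exact FiniteField.pow_card x) ?_
  · have h1 : S.card ≤ Q * M + 3 * Q := by
      refine hmain.trans ?_
      have : M * (p - 1) ≤ Q := by rw [hQM]; exact Nat.mul_le_mul_left _ (by omega)
      nlinarith
    have h2 : ((Q * M : ℕ) : ℝ) = (p : ℝ) ^ (2 * m) / p := by
      rw [eq_div_iff (by exact_mod_cast hp.out.ne_zero)]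
      have : Q * M * p = p ^ (2 * m) := by rw [mul_assoc, ← hQM, hQQ, hK]
      exact_mod_cast this
    calc (S.card : ℝ) ≤ ((Q * M + 3 * Q : ℕ) : ℝ) := by exact_mod_cast h1
      _ = _ := by rw [Nat.cast_add, h2, hQ]; push_cast; ring
  · intro x hx
    obtain ⟨hx0, hxc⟩ := (Finset.mem_filter.1 hx).2
    rw [hPeval x hx0]
    set f := a * x + b * x⁻¹ + t with hf
    have htr : Algebra.trace (ZMod p) K f = 0 := by rw [hf, map_add, hxc, ht]; ring
    have hsum := FiniteField.algebraMap_trace_eq_sum_pow (ZMod p) K f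
    rw [htr, map_zero, hrank, Nat.card_zmod, two_mul, Finset.sum_range_add] at hsum
    have hY : (∑ l ∈ Finset.range m, f ^ p ^ l) ^ Q = ∑ l ∈ Finset.range m, f ^ p ^ (m + l) := by
      rw [hQ, sum_pow_char_pow]
      refine Finset.sum_congr rfl fun l _ => ?_
      rw [← pow_mul, ← pow_add, add_comm]
    rw [← hY] at hsum
    set Y := ∑ l ∈ Finset.range m, f ^ p ^ l
    have hY2 : Y ^ Q = - Y := by linear_combination -hsum
    rw [mul_pow, hY2, ← pow_mul, mul_comm M Q]
    ring

/-- Kloosterman sums over finite fields. -/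
noncomputable def fieldKloosterman (p : ℕ) [Fact p.Prime] (K : Type) [Field K] [Fintype K]
    [DecidableEq K] [Algebra (ZMod p) K] (a b : K) : ℂ :=
  ∑ x : K, if x = 0 then 0 else ZMod.stdAddChar (Algebra.trace (ZMod p) K (a * x + b * x⁻¹))

theorem fieldKloosterman_stepanov {K : Type} [Field K] [Fintype K] [DecidableEq K] {p m : ℕ}
    [hp : Fact p.Prime] [Algebra (ZMod p) K] (hm : 0 < m) (hK : Fintype.card K = p ^ (2 * m))
    (a b : K) (ha : a ≠ 0) :
    ‖fieldKloosterman p K a b‖ ≤ (3 * p + 1) * p ^ m := by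
  set N : ZMod p → ℝ := fun c => ((Finset.univ.filter fun x : K => x ≠ 0 ∧
      Algebra.trace (ZMod p) K (a * x + b * x⁻¹) = c).card : ℝ) with hN
  set B : ℝ := p ^ (2 * m) / p + 3 * p ^ m with hB
  have hp0 : (0 : ℝ) < p := by exact_mod_cast hp.out.pos
  have hNB : ∀ c, N c ≤ B := fun c => card_trace_eq_le hm hK a b ha c
  have h1 : fieldKloosterman p K a b = ∑ c : ZMod p, (N c : ℂ) * ZMod.stdAddChar c := by
    have hsplit : fieldKloosterman p K a b = ∑ x ∈ Finset.univ.filter (fun x : K => x ≠ 0),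
        (ZMod.stdAddChar (Algebra.trace (ZMod p) K (a * x + b * x⁻¹)) : ℂ) := by
      rw [fieldKloosterman, Finset.sum_filter]
      refine Finset.sum_congr rfl fun x _ => ?_
      by_cases h : x = 0 <;> simp [h]
    rw [hsplit, ← Finset.sum_fiberwise_of_maps_to
      (g := fun x => Algebra.trace (ZMod p) K (a * x + b * x⁻¹)) (t := Finset.univ) (by simp)]
    refine Finset.sum_congr rfl fun c _ => ?_
    rw [Finset.sum_congr rfl (g := fun _ => (ZMod.stdAddChar c : ℂ))]
    · rw [Finset.sum_const, Finset.filter_filter, nsmul_eq_mul, hN]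
      simp
    · intro x hx
      rw [(Finset.mem_filter.1 hx).2]
  have h0 : ∑ c : ZMod p, (ZMod.stdAddChar c : ℂ) = 0 := by
    apply AddChar.sum_eq_zero_of_ne_one
    intro h
    have := ZMod.isPrimitive_stdAddChar p (a := 1) one_ne_zero
    apply this
    rw [AddChar.mulShift_one]; exact h
  have h2 : fieldKloosterman p K a b = - ∑ c : ZMod p, ((B - N c : ℝ) : ℂ) * ZMod.stdAddChar c := by
    have : ∑ c : ZMod p, ((B - N c : ℝ) : ℂ) * ZMod.stdAddChar c
        = B * ∑ c : ZMod p, (ZMod.stdAddChar c : ℂ) - ∑ c : ZMod p, (N c : ℂ) * ZMod.stdAddChar c := by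
      rw [Finset.mul_sum, ← Finset.sum_sub_distrib]
      refine Finset.sum_congr rfl fun c _ => ?_
      push_cast; ring
    rw [this, h0, h1]; ring
  have h3 : ∑ c : ZMod p, N c = p ^ (2 * m) - 1 := by
    have : ∑ c : ZMod p, (Finset.univ.filter fun x : K => x ≠ 0 ∧
      Algebra.trace (ZMod p) K (a * x + b * x⁻¹) = c).card
        = (Finset.univ.filter fun x : K => x ≠ 0).card := by
      rw [Finset.card_eq_sum_card_fiberwise (t := Finset.univ)
        (f := fun x => Algebra.trace (ZMod p) K (a * x + b * x⁻¹)) (by simp)]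
      simp [Finset.filter_filter]
    have h4 : (Finset.univ.filter fun x : K => x ≠ 0).card = p ^ (2 * m) - 1 := by
      rw [Finset.filter_ne', Finset.card_erase_of_mem (Finset.mem_univ _), Finset.card_univ, hK]
    rw [h4] at this
    simp only [hN]
    rw [← Nat.cast_sum, this, Nat.cast_sub (Nat.one_le_pow _ _ hp.out.pos)]
    push_cast; ring
  rw [h2, norm_neg]
  calc ‖∑ c : ZMod p, ((B - N c : ℝ) : ℂ) * ZMod.stdAddChar c‖
      ≤ ∑ c : ZMod p, (B - N c) := by
        refine (norm_sum_le _ _).trans (Finset.sum_le_sum fun c _ => ?_)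
        rw [norm_mul, AddChar.norm_apply, mul_one, Complex.norm_real, Real.norm_of_nonneg]
        linarith [hNB c]
    _ = p * B - (p ^ (2 * m) - 1) := by
        rw [Finset.sum_sub_distrib, h3]; simp [ZMod.card]
    _ = 3 * p * p ^ m + 1 := by rw [hB]; field_simp; ring
    _ ≤ _ := by
        have : (1 : ℝ) ≤ p ^ m := one_le_pow₀ (by exact_mod_cast hp.out.one_le)
        linarith

theorem sum_sq_add_sum_nonsquare_mul_sq {K : Type*} [Field K] [Fintype K] [DecidableEq K]
    (hK : ringChar K ≠ 2) {d : K} (hd : ¬ IsSquare d) (G : K → ℂ) :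
    ∑ v, G (d * v ^ 2) + ∑ w, G (w ^ 2) = 2 * ∑ s, G s := by
  have key : ∀ F : K → ℂ, ∑ w, F (w ^ 2) = ∑ s, ((quadraticChar K s : ℂ) + 1) * F s := by
    intro F
    rw [← Finset.sum_fiberwise_of_maps_to (g := fun w : K => w ^ 2) (t := Finset.univ) (by simp)]
    refine Finset.sum_congr rfl fun s _ => ?_
    rw [Finset.sum_congr rfl (g := fun _ => F s)
      (fun x hx => by rw [(Finset.mem_filter.1 hx).2]), Finset.sum_const, nsmul_eq_mul]
    congr 1
    have h := quadraticChar_card_sqrts hK s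
    have : {x : K | x ^ 2 = s}.toFinset = Finset.univ.filter (fun x : K => x ^ 2 = s) := by
      ext; simp
    rw [this] at h
    exact_mod_cast h
  have hd0 : d ≠ 0 := by rintro rfl; exact hd (IsSquare.zero)
  rw [key G, key fun s => G (d * s),
    ← Equiv.sum_comp (Equiv.mulLeft₀ d hd0) fun s => ((quadraticChar K s : ℂ) + 1) * G s,
    ← Equiv.sum_comp (Equiv.mulLeft₀ d hd0) G, ← Finset.sum_add_distrib, Finset.mul_sum]
  refine Finset.sum_congr rfl fun s _ => ?_
  simp only [Equiv.mulLeft₀_apply, map_mul, quadraticChar_neg_one_iff_not_isSquare.2 hd]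
  push_cast; ring

theorem QuadraticAlgebra.trace_eq_two_mul_re {K : Type*} [Field K] (d : K)
    (z : QuadraticAlgebra K d 0) :
    Algebra.trace K (QuadraticAlgebra K d 0) z = 2 * z.re := by
  rw [Algebra.trace_eq_matrix_trace (QuadraticAlgebra.basis d 0), Matrix.trace_fin_two,
    Algebra.leftMulMatrix_eq_repr_mul, Algebra.leftMulMatrix_eq_repr_mul]
  have h0 : (QuadraticAlgebra.basis d 0 : Module.Basis (Fin 2) K _) 0 = ⟨1, 0⟩ := by
    apply (QuadraticAlgebra.basis d 0).repr.injective
    ext i; fin_cases i <;> simp [QuadraticAlgebra.basis_repr_apply]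
  have h1 : (QuadraticAlgebra.basis d 0 : Module.Basis (Fin 2) K _) 1 = ⟨0, 1⟩ := by
    apply (QuadraticAlgebra.basis d 0).repr.injective
    ext i; fin_cases i <;> simp [QuadraticAlgebra.basis_repr_apply]
  rw [h0, h1]
  simp [QuadraticAlgebra.basis_repr_apply]
  ring

theorem fieldKloosterman_quadratic {K : Type} [Field K] [Fintype K] [DecidableEq K] {p : ℕ}
    [hp : Fact p.Prime] (hp2 : p ≠ 2) [Algebra (ZMod p) K] (a b : K) (ha : a ≠ 0) (hb : b ≠ 0)
    (d : K) (hd : ¬ IsSquare d) [Fact (∀ r : K, r ^ 2 ≠ d + 0 * r)]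
    [Fintype (QuadraticAlgebra K d 0)] [DecidableEq (QuadraticAlgebra K d 0)] :
    fieldKloosterman p (QuadraticAlgebra K d 0) (algebraMap K _ a) (algebraMap K _ b)
      + fieldKloosterman p K a b ^ 2 = 2 * Fintype.card K := by
  have hchar : CharP K p := charP_of_injective_algebraMap (algebraMap (ZMod p) K).injective p
  have hring : ringChar K ≠ 2 := by rwa [ringChar.eq K p]
  have h20 : (2 : K) ≠ 0 := Ring.two_ne_zero hring
  let ψ : K → ℂ := fun x => ZMod.stdAddChar (Algebra.trace (ZMod p) K x)
  have hψadd : ∀ x y, ψ (x + y) = ψ x * ψ y := by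
    intro x y; simp only [ψ, map_add, AddChar.map_add_eq_mul]
  let g : K → K → ℂ := fun u N => if N = 0 then 0 else ψ (2 * u * (a + b * N⁻¹))
  have hL : fieldKloosterman p (QuadraticAlgebra K d 0) (algebraMap K _ a) (algebraMap K _ b)
      = ∑ u, ∑ v, g u (u ^ 2 - d * v ^ 2) := by
    rw [fieldKloosterman, ← Fintype.sum_prod_type' (f := fun u v => g u (u ^ 2 - d * v ^ 2)),
      ← Equiv.sum_comp (QuadraticAlgebra.equivProd d 0).symm]
    refine Finset.sum_congr rfl ?_
    rintro ⟨u, v⟩ _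
    have he : (QuadraticAlgebra.equivProd d 0).symm (u, v) = ⟨u, v⟩ := rfl
    rw [he]
    have hn : QuadraticAlgebra.norm (⟨u, v⟩ : QuadraticAlgebra K d 0) = u ^ 2 - d * v ^ 2 := by
      rw [QuadraticAlgebra.norm_def]; simp; ring
    have hz : (⟨u, v⟩ : QuadraticAlgebra K d 0) = 0 ↔ u ^ 2 - d * v ^ 2 = 0 := by
      rw [← QuadraticAlgebra.norm_eq_zero_iff_eq_zero, hn]
    simp only [hz, g]
    split_ifs with h
    · rfl
    · simp only [ψ]
      rw [← Algebra.trace_trace (S := K), QuadraticAlgebra.trace_eq_two_mul_re]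
      congr 2
      rw [QuadraticAlgebra.inv_def, hn]
      simp [QuadraticAlgebra.algebraMap_eq]
      ring
  have hK2 : fieldKloosterman p K a b ^ 2 = ∑ u, ∑ w, g u (u ^ 2 - w ^ 2) := by
    rw [fieldKloosterman, sq, Finset.sum_mul_sum,
      ← Fintype.sum_prod_type' (f := fun u v => g u (u ^ 2 - v ^ 2)), ← Fintype.sum_prod_type']
    let e : K × K ≃ K × K :=
      { toFun := fun z => (z.1 + z.2, z.1 - z.2)
        invFun := fun z => ((z.1 + z.2) / 2, (z.1 - z.2) / 2)
        left_inv := by rintro ⟨x, y⟩; ext <;> simp <;> field_simp <;> ring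
        right_inv := by rintro ⟨x, y⟩; ext <;> simp <;> field_simp <;> ring }
    rw [← Equiv.sum_comp e]
    refine Finset.sum_congr rfl ?_
    rintro ⟨u, w⟩ _
    simp only [e, Equiv.coe_fn_mk]
    by_cases h1 : u + w = 0
    · have : u ^ 2 - w ^ 2 = 0 := by linear_combination (u - w) * h1
      simp [h1, g, this]
    by_cases h2 : u - w = 0
    · have : u ^ 2 - w ^ 2 = 0 := by linear_combination (u + w) * h2
      simp [h2, g, this]
    have h3 : u ^ 2 - w ^ 2 ≠ 0 := by
      have : u ^ 2 - w ^ 2 = (u + w) * (u - w) := by ring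
      rw [this]; exact mul_ne_zero h1 h2
    simp only [h1, h2, if_false, g, h3]
    rw [← AddChar.map_add_eq_mul, ← map_add]
    simp only [ψ]
    congr 2
    have : (u ^ 2 - w ^ 2)⁻¹ = (u + w)⁻¹ * (u - w)⁻¹ := by
      rw [← mul_inv]; congr 1; ring
    rw [this]
    field_simp
    ring
  have hsum : ∀ u, ∑ v, g u (u ^ 2 - d * v ^ 2) + ∑ w, g u (u ^ 2 - w ^ 2) = 2 * ∑ N, g u N := by
    intro u
    rw [sum_sq_add_sum_nonsquare_mul_sq hring hd fun s => g u (u ^ 2 - s)]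
    congr 1
    exact Equiv.sum_comp (Equiv.subLeft (u ^ 2)) (g u)
  rw [hL, hK2, ← Finset.sum_add_distrib, Finset.sum_congr rfl fun u _ => hsum u, ← Finset.mul_sum,
    Finset.sum_comm]
  congr 1
  have hinner : ∀ N, ∑ u, g u N = if N = - b / a then (Fintype.card K : ℂ) else 0 := by
    intro N
    by_cases hN : N = 0
    · rw [if_neg]
      · simp [g, hN]
      · rw [hN]; intro h; exact (div_ne_zero (neg_ne_zero.2 hb) ha) h.symm
    simp only [g, hN, if_false]
    set e := a + b * N⁻¹ with he
    have hiff : e = 0 ↔ N = -b / a := by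
      rw [he, eq_div_iff ha]
      constructor
      · intro h; field_simp at h; linear_combination h
      · intro h; field_simp; linear_combination h
    by_cases hE : e = 0
    · rw [if_pos (hiff.1 hE)]
      simp [hE, ψ, AddChar.map_zero_eq_one]
    · rw [if_neg (fun h => hE (hiff.2 h))]
      let χ : AddChar K ℂ :=
        { toFun := ψ
          map_zero_eq_one' := by simp [ψ, AddChar.map_zero_eq_one]
          map_add_eq_mul' := hψadd }
      have hχ : χ ≠ 1 := by
        obtain ⟨t, ht⟩ := Algebra.trace_surjective (ZMod p) K 1
        intro h
        have h1 : χ.mulShift (1 : K) = 1 := by rw [AddChar.mulShift_one, h]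
        have hprim := ZMod.isPrimitive_stdAddChar p (a := 1) one_ne_zero
        apply hprim
        rw [AddChar.mulShift_one]
        ext y
        obtain ⟨s, hs⟩ := Algebra.trace_surjective (ZMod p) K y
        have := DFunLike.congr_fun h s
        rw [← hs]
        exact this
      have := AddChar.sum_eq_zero_of_ne_one hχ
      rw [← this]
      have h2e : 2 * e ≠ 0 := mul_ne_zero h20 hE
      rw [← Equiv.sum_comp (Equiv.mulLeft₀ (2 * e) h2e) χ]
      refine Finset.sum_congr rfl fun u _ => ?_
      simp only [Equiv.mulLeft₀_apply]
      change ψ _ = ψ _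
      congr 1; ring
  rw [Finset.sum_congr rfl fun N _ => hinner N]
  simp

/-- The Weil bound for Kloosterman sums, via iterated quadratic extensions. -/
theorem fieldKloosterman_iterate {p : ℕ} [hp : Fact p.Prime] (hp2 : p ≠ 2) (j : ℕ) :
    ∀ (K : Type) [Field K] [Fintype K] [DecidableEq K] [Algebra (ZMod p) K] (a b : K),
      a ≠ 0 → b ≠ 0 → ‖fieldKloosterman p K a b‖ ≤
        (2 + (3 * p + 1) / 4 ^ j) * √(Fintype.card K) := by
  have hext : ∀ (K : Type) [Field K] [Fintype K] [DecidableEq K] [Algebra (ZMod p) K] (a b : K),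
      a ≠ 0 → b ≠ 0 → ∃ (L : Type) (_ : Field L) (_ : Fintype L) (_ : DecidableEq L)
        (_ : Algebra (ZMod p) L) (a' b' : L), a' ≠ 0 ∧ b' ≠ 0 ∧
        Fintype.card L = Fintype.card K ^ 2 ∧
        ‖fieldKloosterman p K a b‖ ^ 2 ≤
          ‖fieldKloosterman p L a' b'‖ + 2 * Fintype.card K := by
    intro K _ _ _ _ a b ha hb
    have hchar : CharP K p := charP_of_injective_algebraMap (algebraMap (ZMod p) K).injective p
    have hring : ringChar K ≠ 2 := by rwa [ringChar.eq K p]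
    obtain ⟨d, hd⟩ := FiniteField.exists_nonsquare hring
    have : Fact (∀ r : K, r ^ 2 ≠ d + 0 * r) := ⟨fun r h => hd ⟨r, by
      rw [← sq, h]; ring⟩⟩
    let _ : Fintype (QuadraticAlgebra K d 0) :=
      Fintype.ofEquiv _ (QuadraticAlgebra.equivProd d 0).symm
    let _ : DecidableEq (QuadraticAlgebra K d 0) := Classical.decEq _
    refine ⟨QuadraticAlgebra K d 0, inferInstance, inferInstance, inferInstance, inferInstance,
      algebraMap K _ a, algebraMap K _ b, by simpa using ha, by simpa using hb, ?_, ?_⟩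
    · rw [Fintype.card_congr (QuadraticAlgebra.equivProd d 0), Fintype.card_prod, sq]
    · have h := fieldKloosterman_quadratic hp2 a b ha hb d hd
      rw [← norm_pow, eq_sub_of_add_eq' h]
      refine (norm_sub_le _ _).trans ?_
      rw [add_comm]
      simp
  induction j with
  | zero =>
    intro K _ _ _ _ a b ha hb
    obtain ⟨L, _, _, _, _, a', b', ha', hb', hcard, hle⟩ := hext K a b ha hb
    obtain ⟨m, hm⟩ : ∃ m, Fintype.card K = p ^ m :=
      ⟨_, by rw [Module.card_eq_pow_finrank (K := ZMod p) (V := K), ZMod.card]⟩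
    have hm0 : 0 < m := by
      rcases Nat.eq_zero_or_pos m with h | h
      · subst h
        have := Fintype.one_lt_card (α := K)
        simp [hm] at this
      · exact h
    have h1 := fieldKloosterman_stepanov (p := p) hm0
      (by rw [hcard, hm, ← pow_mul, mul_comm]) a' b' ha'
    have hs : √(Fintype.card K : ℝ) ^ 2 = p ^ m := by
      rw [Real.sq_sqrt (by positivity), hm]; push_cast; rfl
    have hc : (Fintype.card K : ℝ) = p ^ m := by rw [hm]; push_cast; rfl
    have hp1 : (1 : ℝ) ≤ p := by exact_mod_cast hp.out.one_le
    apply le_of_sq_le_sq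
    · rw [mul_pow, hs]
      refine hle.trans ?_
      rw [hc]
      have : (0 : ℝ) < p ^ m := by positivity
      simp only [pow_zero, div_one]
      nlinarith
    · positivity
  | succ j ih =>
    intro K _ _ _ _ a b ha hb
    obtain ⟨L, _, _, _, _, a', b', ha', hb', hcard, hle⟩ := hext K a b ha hb
    have h1 := ih L a' b' ha' hb'
    have hs : √(Fintype.card K : ℝ) ^ 2 = Fintype.card K := Real.sq_sqrt (by positivity)
    have hsL : √(Fintype.card L : ℝ) = Fintype.card K := by
      rw [hcard]; push_cast; exact Real.sqrt_sq (by positivity)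
    rw [hsL] at h1
    apply le_of_sq_le_sq
    · rw [mul_pow, hs]
      have hc : (0 : ℝ) < Fintype.card K := by exact_mod_cast Fintype.card_pos
      have hε : (0 : ℝ) ≤ (3 * p + 1) / 4 ^ (j + 1) := by positivity
      have hε2 : ((3 * p + 1) / 4 ^ j : ℝ) = 4 * ((3 * p + 1) / 4 ^ (j + 1)) := by
        rw [pow_succ]; field_simp
      rw [hε2] at h1
      nlinarith [mul_nonneg hc.le (sq_nonneg ((3 * p + 1) / 4 ^ (j + 1) : ℝ))]
    · positivity

theorem fieldKloosterman_weil {p : ℕ} [hp : Fact p.Prime] (hp2 : p ≠ 2) (a b : ZMod p)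
    (ha : a ≠ 0) (hb : b ≠ 0) : ‖fieldKloosterman p (ZMod p) a b‖ ≤ 2 * √p := by
  have hlim : Filter.Tendsto (fun j : ℕ => (2 + (3 * p + 1 : ℝ) / 4 ^ j) * √(p : ℝ)) Filter.atTop
      (nhds ((2 + 0) * √(p : ℝ))) := by
    apply Filter.Tendsto.mul_const
    apply Filter.Tendsto.const_add
    have := (tendsto_pow_atTop_nhds_zero_of_lt_one (r := (1 / 4 : ℝ)) (by norm_num)
      (by norm_num)).const_mul (3 * p + 1 : ℝ)
    simpa [div_eq_mul_inv] using this
  rw [add_zero] at hlim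
  refine ge_of_tendsto' hlim fun j => ?_
  have := fieldKloosterman_iterate hp2 j (ZMod p) a b ha hb
  rwa [ZMod.card] at this

/-- The Kloosterman sum `S(a, b; c)`. -/
noncomputable def kloosterman (c : ℕ) [NeZero c] (a b : ZMod c) : ℂ :=
  ∑ u : (ZMod c)ˣ, ZMod.stdAddChar (a * (u : ZMod c) + b * ((u⁻¹ : (ZMod c)ˣ) : ZMod c))

theorem norm_kloosterman_le (c : ℕ) [NeZero c] (a b : ZMod c) : ‖kloosterman c a b‖ ≤ c := by
  refine (norm_sum_le _ _).trans ?_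
  simp only [AddChar.norm_apply, Finset.sum_const, Finset.card_univ, nsmul_eq_mul, mul_one,
    ZMod.card_units_eq_totient]
  exact_mod_cast Nat.totient_le c

theorem norm_kloosterman_prime_le {p : ℕ} [hp : Fact p.Prime] (a b : ZMod p)
    (ha : a ≠ 0) (hb : b ≠ 0) : ‖kloosterman p a b‖ ≤ 2 * √p := by
  by_cases hp2 : p = 2
  · subst hp2
    refine (norm_kloosterman_le 2 a b).trans ?_
    have : (1 : ℝ) ≤ √((2 : ℕ) : ℝ) := Real.one_le_sqrt.2 (by norm_num)
    push_cast at *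
    linarith
  · convert fieldKloosterman_weil hp2 a b ha hb using 2
    rw [kloosterman, fieldKloosterman]
    have htr : ∀ x : ZMod p, Algebra.trace (ZMod p) (ZMod p) x = x := by
      intro x; exact Algebra.trace_self_apply x
    simp only [htr]
    rw [← Finset.sum_filter_add_sum_filter_not Finset.univ (fun x : ZMod p => x = 0)]
    rw [Finset.sum_eq_zero (s := Finset.univ.filter fun x : ZMod p => x = 0)
      (fun x hx => by simp [(Finset.mem_filter.1 hx).2]), zero_add]
    refine Finset.sum_bij' (fun u _ => (u : ZMod p))
      (fun x hx => Units.mk0 x (Finset.mem_filter.1 hx).2) ?_ ?_ ?_ ?_ ?_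
    · intro u _; simp
    · intro x _; simp
    · intro u _; ext; simp
    · intro x _; simp
    · intro u _; rw [if_neg u.ne_zero, Units.val_inv_eq_inv_val]

theorem stdAddChar_mul_of_coprime {m n : ℕ} [NeZero m] [NeZero n] (h : m.Coprime n)
    [NeZero (m * n)] (x : ZMod (m * n)) :
    (ZMod.stdAddChar x : ℂ) =
      ZMod.stdAddChar ((n : ZMod m)⁻¹ * (ZMod.cast x : ZMod m)) *
      ZMod.stdAddChar ((m : ZMod n)⁻¹ * (ZMod.cast x : ZMod n)) := by
  obtain ⟨j, rfl⟩ := ZMod.intCast_surjective x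
  have hbez : (1 : ℤ) = m * Nat.gcdA m n + n * Nat.gcdB m n := by
    have := Nat.gcd_eq_gcd_ab m n
    rw [h] at this; exact_mod_cast this
  have h1 : (n : ZMod m)⁻¹ = ((Nat.gcdB m n : ℤ) : ZMod m) := by
    have e : (n : ZMod m) * ((Nat.gcdB m n : ℤ) : ZMod m) = 1 := by
      have := congrArg (Int.cast : ℤ → ZMod m) hbez
      push_cast at this
      rw [ZMod.natCast_self, zero_mul, zero_add] at this
      exact this.symm
    exact ZMod.inv_eq_of_mul_eq_one _ _ _ e
  have h2 : (m : ZMod n)⁻¹ = ((Nat.gcdA m n : ℤ) : ZMod n) := by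
    have e : (m : ZMod n) * ((Nat.gcdA m n : ℤ) : ZMod n) = 1 := by
      have := congrArg (Int.cast : ℤ → ZMod n) hbez
      push_cast at this
      rw [ZMod.natCast_self, zero_mul, add_zero] at this
      exact this.symm
    exact ZMod.inv_eq_of_mul_eq_one _ _ _ e
  rw [h1, h2, ZMod.cast_intCast (dvd_mul_right m n), ZMod.cast_intCast (dvd_mul_left n m),
    ← Int.cast_mul, ← Int.cast_mul, ZMod.stdAddChar_coe, ZMod.stdAddChar_coe,
    ZMod.stdAddChar_coe, ← Complex.exp_add]
  congr 1
  have hm : (m : ℂ) ≠ 0 := by exact_mod_cast NeZero.ne m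
  have hn : (n : ℂ) ≠ 0 := by exact_mod_cast NeZero.ne n
  have hb : (1 : ℂ) = m * Nat.gcdA m n + n * Nat.gcdB m n := by exact_mod_cast hbez
  push_cast
  field_simp
  linear_combination (j : ℂ) * hb

theorem kloosterman_mul {m n : ℕ} [NeZero m] [NeZero n] (h : m.Coprime n)
    [NeZero (m * n)] (a b : ZMod (m * n)) :
    kloosterman (m * n) a b =
      kloosterman m ((n : ZMod m)⁻¹ * ZMod.cast a) ((n : ZMod m)⁻¹ * ZMod.cast b) *
      kloosterman n ((m : ZMod n)⁻¹ * ZMod.cast a) ((m : ZMod n)⁻¹ * ZMod.cast b) := by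
  rw [kloosterman, kloosterman, kloosterman, Finset.sum_mul_sum, ← Fintype.sum_prod_type']
  let e : (ZMod (m * n))ˣ ≃ (ZMod m)ˣ × (ZMod n)ˣ :=
    ((Units.mapEquiv (ZMod.chineseRemainder h).toMulEquiv).trans MulEquiv.prodUnits).toEquiv
  have e1 : ∀ u, ((e u).1 : ZMod m) = ZMod.cast (u : ZMod (m * n)) := fun u => by
    simp [e, ZMod.chineseRemainder, MulEquiv.prodUnits]
  have e2 : ∀ u, ((e u).2 : ZMod n) = ZMod.cast (u : ZMod (m * n)) := fun u => by
    simp [e, ZMod.chineseRemainder, MulEquiv.prodUnits]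
  have einv : ∀ u, e u⁻¹ = (e u)⁻¹ := fun u => by simp [e]
  rw [← Equiv.sum_comp e]
  refine Finset.sum_congr rfl fun u _ => ?_
  have f1 : (((e u).1⁻¹ : (ZMod m)ˣ) : ZMod m) = ZMod.cast ((u⁻¹ : (ZMod (m * n))ˣ) : ZMod (m * n)) := by
    rw [← e1, einv]; rfl
  have f2 : (((e u).2⁻¹ : (ZMod n)ˣ) : ZMod n) = ZMod.cast ((u⁻¹ : (ZMod (m * n))ˣ) : ZMod (m * n)) := by
    rw [← e2, einv]; rfl
  rw [stdAddChar_mul_of_coprime h, f1, f2, e1, e2,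
    ZMod.cast_add (dvd_mul_right m n), ZMod.cast_mul (dvd_mul_right m n),
    ZMod.cast_mul (dvd_mul_right m n), ZMod.cast_add (dvd_mul_left n m),
    ZMod.cast_mul (dvd_mul_left n m), ZMod.cast_mul (dvd_mul_left n m)]
  congr 2 <;> ring

theorem exists_kloosterman_bound (k : ℤ) (c : ℕ) (hc : 0 < c) :
    ∃ c₁ a b : ℕ, c = c₁ * (a ^ 2 * b ^ 3) ∧
      ∀ [NeZero c] (u v : (ZMod c)ˣ), ‖kloosterman c (k * u) (k * v)‖ ≤
        (a ^ 2 * b ^ 3 : ℕ) * (c₁.divisors.card * √(Int.gcd k c₁ * c₁ : ℕ)) := by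
  induction c using Nat.recOnPosPrimePosCoprime with
  | zero => omega
  | one =>
    refine ⟨1, 1, 1, rfl, fun u v => ?_⟩
    refine (norm_kloosterman_le _ _ _).trans ?_
    simp
  | prime_pow p n hp hn =>
    have := Fact.mk hp
    by_cases hn1 : n = 1
    · subst hn1
      refine ⟨p, 1, 1, by simp, ?_⟩
      rw [pow_one]
      intro _ u v
      have hd : p.divisors.card = 2 := by
        rw [hp.divisors, Finset.card_pair hp.one_lt.ne]
      rw [hd]
      by_cases hk : (k : ZMod p) = 0
      · have hdvd : (p : ℤ) ∣ k := (ZMod.intCast_zmod_eq_zero_iff_dvd k p).1 hk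
        have hg : Int.gcd k p = p := by
          rw [Int.gcd_eq_natAbs, Int.natAbs_natCast]
          exact Nat.gcd_eq_right (Int.natCast_dvd.1 hdvd)
        refine (norm_kloosterman_le _ _ _).trans ?_
        rw [hg]
        push_cast
        rw [Real.sqrt_mul_self (by positivity)]
        have : (0 : ℝ) ≤ p := by positivity
        linarith
      · refine (norm_kloosterman_prime_le _ _ (mul_ne_zero hk u.ne_zero)
          (mul_ne_zero hk v.ne_zero)).trans ?_
        have hg : 1 ≤ Int.gcd k p := Int.gcd_pos_of_ne_zero_right _ (by exact_mod_cast hp.ne_zero)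
        have : √(p : ℝ) ≤ √((Int.gcd k p * p : ℕ) : ℝ) := by
          apply Real.sqrt_le_sqrt
          exact_mod_cast Nat.le_mul_of_pos_left _ hg
        push_cast at *
        linarith
    · refine ⟨1, ?_⟩
      have key : ∃ a b : ℕ, p ^ n = a ^ 2 * b ^ 3 := by
        rcases Nat.even_or_odd' n with ⟨s, h | h⟩
        · exact ⟨p ^ s, 1, by rw [h]; ring⟩
        · exact ⟨p ^ (s - 1), p, by
            rw [h, ← pow_mul, ← pow_add]; congr 1; omega⟩
      obtain ⟨a, b, hab⟩ := key
      refine ⟨a, b, by rw [one_mul, hab], fun u v => ?_⟩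
      refine (norm_kloosterman_le _ _ _).trans ?_
      rw [← hab]
      simp
  | coprime m n hm hn hmn ihm ihn =>
    obtain ⟨c₁, a, b, hc₁, h₁⟩ := ihm (by omega)
    obtain ⟨c₂, a', b', hc₂, h₂⟩ := ihn (by omega)
    refine ⟨c₁ * c₂, a * a', b * b', by rw [hc₁, hc₂]; ring, ?_⟩
    intro _ u v
    have : NeZero m := ⟨by omega⟩
    have : NeZero n := ⟨by omega⟩
    have hcop : c₁.Coprime c₂ := Nat.Coprime.of_dvd (hc₁ ▸ dvd_mul_right _ _)
      (hc₂ ▸ dvd_mul_right _ _) hmn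
    let u1 := ZMod.unitsMap (dvd_mul_right m n) u
    let v1 := ZMod.unitsMap (dvd_mul_right m n) v
    let u2 := ZMod.unitsMap (dvd_mul_left n m) u
    let v2 := ZMod.unitsMap (dvd_mul_left n m) v
    let w1 := (ZMod.unitOfCoprime n hmn.symm)⁻¹
    let w2 := (ZMod.unitOfCoprime m hmn)⁻¹
    have hw1 : ((w1 : (ZMod m)ˣ) : ZMod m) = (n : ZMod m)⁻¹ := by
      rw [← ZMod.inv_coe_unit]; simp
    have hw2 : ((w2 : (ZMod n)ˣ) : ZMod n) = (m : ZMod n)⁻¹ := by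
      rw [← ZMod.inv_coe_unit]; simp
    have k1 := h₁ (w1 * u1) (w1 * v1)
    have k2 := h₂ (w2 * u2) (w2 * v2)
    rw [kloosterman_mul hmn, norm_mul, ZMod.cast_mul (dvd_mul_right m n),
      ZMod.cast_mul (dvd_mul_right m n), ZMod.cast_mul (dvd_mul_left n m),
      ZMod.cast_mul (dvd_mul_left n m), ZMod.cast_intCast (dvd_mul_right m n),
      ZMod.cast_intCast (dvd_mul_left n m), ← hw1, ← hw2]
    have r1 : ∀ (t : (ZMod (m * n))ˣ), ((w1 : (ZMod m)ˣ) : ZMod m) * ((k : ZMod m) * ZMod.cast (t : ZMod (m * n))) =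
        k * ((w1 * ZMod.unitsMap (dvd_mul_right m n) t : (ZMod m)ˣ) : ZMod m) := by
      intro t; rw [Units.val_mul, ZMod.unitsMap_val]; ring
    have r2 : ∀ (t : (ZMod (m * n))ˣ), ((w2 : (ZMod n)ˣ) : ZMod n) * ((k : ZMod n) * ZMod.cast (t : ZMod (m * n))) =
        k * ((w2 * ZMod.unitsMap (dvd_mul_left n m) t : (ZMod n)ˣ) : ZMod n) := by
      intro t; rw [Units.val_mul, ZMod.unitsMap_val]; ring
    rw [r1, r1, r2, r2]
    refine (mul_le_mul k1 k2 (norm_nonneg _) (by positivity)).trans (le_of_eq ?_)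
    rw [hcop.card_divisors_mul]
    have hg : Int.gcd k (c₁ * c₂ : ℕ) = Int.gcd k c₁ * Int.gcd k c₂ := by
      simp only [Int.gcd_eq_natAbs, Int.natAbs_natCast]
      exact Nat.Coprime.gcd_mul _ hcop
    rw [hg]
    have hs : √((Int.gcd k c₁ * Int.gcd k c₂ * (c₁ * c₂) : ℕ) : ℝ) =
        √((Int.gcd k c₁ * c₁ : ℕ) : ℝ) * √((Int.gcd k c₂ * c₂ : ℕ) : ℝ) := by
      rw [← Real.sqrt_mul (by positivity)]
      congr 1; push_cast; ring
    rw [hs]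
    push_cast
    ring

theorem sum_Icc_filter_dvd {M : Type*} [AddCommMonoid M] (m N : ℕ) (hm : 0 < m) (f : ℕ → M) :
    ∑ j ∈ (Finset.Icc 1 N).filter (m ∣ ·), f j = ∑ j ∈ Finset.Icc 1 (N / m), f (m * j) := by
  symm
  refine Finset.sum_bij (fun j _ => m * j) ?_ ?_ ?_ ?_
  · intro j hj
    rw [Finset.mem_Icc] at hj
    rw [Finset.mem_filter, Finset.mem_Icc]
    refine ⟨⟨Nat.mul_pos hm hj.1, ?_⟩, dvd_mul_right _ _⟩
    calc m * j ≤ m * (N / m) := Nat.mul_le_mul_left _ hj.2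
      _ ≤ N := Nat.mul_div_le N m
  · intro a _ b _ h; exact Nat.eq_of_mul_eq_mul_left hm h
  · intro j hj
    rw [Finset.mem_filter, Finset.mem_Icc] at hj
    obtain ⟨⟨h1, h2⟩, i, rfl⟩ := hj
    exact ⟨i, Finset.mem_Icc.2 ⟨Nat.pos_of_ne_zero (by rintro rfl; simp at h1),
      (Nat.le_div_iff_mul_le hm).2 (by rwa [mul_comm])⟩, rfl⟩
  · intro _ _; rfl

theorem sum_Icc_sum_divisors {M : Type*} [AddCommMonoid M] (N : ℕ) (F : ℕ → ℕ → M) :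
    ∑ j ∈ Finset.Icc 1 N, ∑ d ∈ j.divisors, F d j =
      ∑ d ∈ Finset.Icc 1 N, ∑ m ∈ Finset.Icc 1 (N / d), F d (d * m) := by
  rw [Finset.sum_comm' (t' := Finset.Icc 1 N) (s' := fun d => (Finset.Icc 1 N).filter (d ∣ ·))]
  · refine Finset.sum_congr rfl fun d hd => ?_
    rw [sum_Icc_filter_dvd d N (Finset.mem_Icc.1 hd).1]
  · intro j d
    simp only [Finset.mem_Icc, Nat.mem_divisors, Finset.mem_filter]
    constructor
    · rintro ⟨⟨h1, h2⟩, h3, h4⟩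
      exact ⟨⟨⟨h1, h2⟩, h3⟩, Nat.pos_of_dvd_of_pos h3 h1, (Nat.le_of_dvd h1 h3).trans h2⟩
    · rintro ⟨⟨⟨h1, h2⟩, h3⟩, h4, h5⟩
      exact ⟨⟨h1, h2⟩, h3, by omega⟩

theorem one_add_log_nonneg (N : ℕ) : 0 ≤ 1 + Real.log N := by
  have := Real.log_natCast_nonneg N; linarith

theorem one_add_log_mono {M N : ℕ} (h : M ≤ N) : 1 + Real.log M ≤ 1 + Real.log N := by
  rcases Nat.eq_zero_or_pos M with rfl | hM
  · simpa using Real.log_natCast_nonneg N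
  · have := Real.log_le_log (by exact_mod_cast hM : (0 : ℝ) < M) (by exact_mod_cast h : (M : ℝ) ≤ N)
    linarith

theorem sum_Icc_inv_le (N : ℕ) : ∑ j ∈ Finset.Icc 1 N, (1 : ℝ) / j ≤ 1 + Real.log N := by
  have h := harmonic_le_one_add_log N
  rw [harmonic_eq_sum_Icc] at h
  push_cast at h
  simpa [one_div] using h

theorem sum_Icc_inv_sqrt_le (N : ℕ) : ∑ j ∈ Finset.Icc 1 N, 1 / √(j : ℝ) ≤ 2 * √N := by
  induction N with
  | zero => simp
  | succ n ih =>
    rw [Finset.sum_Icc_succ_top (by omega)]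
    have h1 : (0 : ℝ) < √((n + 1 : ℕ) : ℝ) := Real.sqrt_pos.2 (by positivity)
    have h2 : √((n + 1 : ℕ) : ℝ) ^ 2 = n + 1 := by rw [Real.sq_sqrt (by positivity)]; simp
    have h3 : √(n : ℝ) ^ 2 = n := Real.sq_sqrt (by positivity)
    have h4 : 0 ≤ √(n : ℝ) := Real.sqrt_nonneg _
    have : 1 / √((n + 1 : ℕ) : ℝ) ≤ 2 * (√((n + 1 : ℕ) : ℝ) - √(n : ℝ)) := by
      rw [div_le_iff₀ h1]
      nlinarith [sq_nonneg (√((n + 1 : ℕ) : ℝ) - √(n : ℝ))]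
    linarith

theorem sum_Icc_card_divisors_div_sqrt_le (N : ℕ) :
    ∑ j ∈ Finset.Icc 1 N, (j.divisors.card : ℝ) / √j ≤ 2 * √N * (1 + Real.log N) := by
  have : ∀ j : ℕ, (j.divisors.card : ℝ) / √j = ∑ d ∈ j.divisors, 1 / √(j : ℝ) := by
    intro j; rw [Finset.sum_const, nsmul_eq_mul, mul_one_div]
  simp only [this]
  rw [sum_Icc_sum_divisors]
  calc ∑ d ∈ Finset.Icc 1 N, ∑ m ∈ Finset.Icc 1 (N / d), 1 / √((d * m : ℕ) : ℝ)
      ≤ ∑ d ∈ Finset.Icc 1 N, 2 * √N * (1 / d) := by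
        refine Finset.sum_le_sum fun d hd => ?_
        have hd0 : (0 : ℝ) < d := by exact_mod_cast (Finset.mem_Icc.1 hd).1
        have h1 : ∀ m : ℕ, 1 / √((d * m : ℕ) : ℝ) = 1 / √(d : ℝ) * (1 / √(m : ℝ)) := by
          intro m; push_cast; rw [Real.sqrt_mul hd0.le, one_div_mul_one_div]
        simp only [h1]
        rw [← Finset.mul_sum]
        have h2 : √((N / d : ℕ) : ℝ) ≤ √N / √(d : ℝ) := by
          rw [← Real.sqrt_div (by positivity)]
          exact Real.sqrt_le_sqrt Nat.cast_div_le
        calc 1 / √(d : ℝ) * ∑ m ∈ Finset.Icc 1 (N / d), 1 / √(m : ℝ)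
            ≤ 1 / √(d : ℝ) * (2 * (√N / √(d : ℝ))) := by
              gcongr
              exact (sum_Icc_inv_sqrt_le _).trans (by gcongr)
          _ = 2 * √N * (1 / (√(d : ℝ) * √(d : ℝ))) := by ring
          _ = 2 * √N * (1 / d) := by rw [Real.mul_self_sqrt hd0.le]
    _ ≤ _ := by
        rw [← Finset.mul_sum]
        gcongr
        exact sum_Icc_inv_le N

theorem card_divisors_mul_le (m n : ℕ) :
    (m * n).divisors.card ≤ m.divisors.card * n.divisors.card := by
  rw [Nat.divisors_mul]
  exact Finset.card_mul_le

theorem sum_Icc_dvd_card_divisors_div_sqrt_le (m N : ℕ) (hm : 0 < m) :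
    ∑ j ∈ (Finset.Icc 1 N).filter (m ∣ ·), (j.divisors.card : ℝ) / √j ≤
      2 * m.divisors.card / m * √N * (1 + Real.log N) := by
  have hm0 : (0 : ℝ) < m := by exact_mod_cast hm
  rw [sum_Icc_filter_dvd m N hm]
  calc ∑ j ∈ Finset.Icc 1 (N / m), ((m * j).divisors.card : ℝ) / √((m * j : ℕ) : ℝ)
      ≤ ∑ j ∈ Finset.Icc 1 (N / m), m.divisors.card / √(m : ℝ) * (j.divisors.card / √(j : ℝ)) := by
        refine Finset.sum_le_sum fun j _ => ?_
        push_cast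
        rw [Real.sqrt_mul hm0.le, div_mul_div_comm]
        gcongr
        exact_mod_cast card_divisors_mul_le m j
    _ ≤ m.divisors.card / √(m : ℝ) * (2 * (√N / √(m : ℝ)) * (1 + Real.log N)) := by
        rw [← Finset.mul_sum]
        gcongr
        refine (sum_Icc_card_divisors_div_sqrt_le _).trans ?_
        have h2 : √((N / m : ℕ) : ℝ) ≤ √N / √(m : ℝ) := by
          rw [← Real.sqrt_div (by positivity)]
          exact Real.sqrt_le_sqrt Nat.cast_div_le
        have h3 := one_add_log_mono (Nat.div_le_self N m)
        have h4 := one_add_log_nonneg (N / m)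
        gcongr
    _ = 2 * m.divisors.card * (1 / (√(m : ℝ) * √(m : ℝ))) * √N * (1 + Real.log N) := by ring
    _ = _ := by rw [Real.mul_self_sqrt hm0.le]; ring

theorem sum_Icc_gcd_div_le (q N : ℕ) (hq : 0 < q) :
    ∑ a ∈ Finset.Icc 1 N, (Nat.gcd q a : ℝ) / a ≤ q.divisors.card * (1 + Real.log N) := by
  calc ∑ a ∈ Finset.Icc 1 N, (Nat.gcd q a : ℝ) / a
      ≤ ∑ a ∈ Finset.Icc 1 N, ∑ d ∈ q.divisors, if d ∣ a then (d : ℝ) / a else 0 := by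
        refine Finset.sum_le_sum fun a ha => ?_
        rw [← Finset.sum_filter]
        exact Finset.single_le_sum (f := fun d : ℕ => (d : ℝ) / a) (fun i _ => by positivity)
          (Finset.mem_filter.2 ⟨Nat.mem_divisors.2 ⟨Nat.gcd_dvd_left q a, hq.ne'⟩,
            Nat.gcd_dvd_right q a⟩)
    _ = ∑ d ∈ q.divisors, ∑ a ∈ (Finset.Icc 1 N).filter (d ∣ ·), (d : ℝ) / a := by
        rw [Finset.sum_comm]
        simp only [Finset.sum_filter]
    _ ≤ ∑ d ∈ q.divisors, (1 + Real.log N) := by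
        refine Finset.sum_le_sum fun d hd => ?_
        have hd0 := Nat.pos_of_mem_divisors hd
        rw [sum_Icc_filter_dvd d N hd0]
        have : ∀ j : ℕ, (d : ℝ) / (d * j : ℕ) = 1 / j := by
          intro j
          have : (d : ℝ) ≠ 0 := by exact_mod_cast hd0.ne'
          push_cast
          rw [div_mul_eq_div_div, div_self this]
        simp only [this]
        exact (sum_Icc_inv_le _).trans (one_add_log_mono (Nat.div_le_self N d))
    _ = _ := by rw [Finset.sum_const, nsmul_eq_mul]

/-- The ternary divisor function. -/
def tauThree (k : ℕ) : ℕ := ∑ d ∈ k.divisors, d.divisors.card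

/-- `‖S(k, k; c)‖`, extended by zero to `c = 0`. -/
noncomputable def kloostermanNorm (k : ℤ) (c : ℕ) : ℝ :=
  if h : c = 0 then 0 else have : NeZero c := ⟨h⟩; ‖kloosterman c (k : ZMod c) k‖

theorem sum_dvd_card_divisors_sqrt_gcd_le (e N k : ℕ) (he : 0 < e) (hk : 0 < k) :
    ∑ c ∈ (Finset.Icc 1 N).filter (e ∣ ·), (c.divisors.card : ℝ) * √(Nat.gcd k c) / √c ≤
      2 * e.divisors.card * tauThree k * Nat.gcd k e / e * √N * (1 + Real.log N) := by
  calc ∑ c ∈ (Finset.Icc 1 N).filter (e ∣ ·), (c.divisors.card : ℝ) * √(Nat.gcd k c) / √c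
      ≤ ∑ c ∈ (Finset.Icc 1 N).filter (e ∣ ·), ∑ d ∈ k.divisors,
          if d ∣ c then √(d : ℝ) * (c.divisors.card / √c) else 0 := by
        refine Finset.sum_le_sum fun c _ => ?_
        rw [← Finset.sum_filter]
        refine le_trans (le_of_eq ?_) (Finset.single_le_sum
          (f := fun d : ℕ => √(d : ℝ) * (c.divisors.card / √(c : ℝ)))
          (fun i _ => by positivity)
          (Finset.mem_filter.2 ⟨Nat.mem_divisors.2 ⟨Nat.gcd_dvd_left k c, hk.ne'⟩,
            Nat.gcd_dvd_right k c⟩))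
        ring
    _ = ∑ d ∈ k.divisors, √(d : ℝ) *
          ∑ c ∈ (Finset.Icc 1 N).filter (Nat.lcm d e ∣ ·), (c.divisors.card : ℝ) / √c := by
        rw [Finset.sum_comm]
        refine Finset.sum_congr rfl fun d _ => ?_
        rw [← Finset.sum_filter, Finset.filter_filter, Finset.mul_sum]
        refine Finset.sum_congr (Finset.filter_congr fun c _ => ?_) fun _ _ => rfl
        rw [Nat.lcm_dvd_iff, and_comm]
    _ ≤ ∑ d ∈ k.divisors, d.divisors.card *
          (2 * e.divisors.card * Nat.gcd k e / e * √N * (1 + Real.log N)) := by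
        refine Finset.sum_le_sum fun d hd => ?_
        have hd0 := Nat.pos_of_mem_divisors hd
        have hd1 : (1 : ℝ) ≤ d := by exact_mod_cast hd0
        have hl : 0 < Nat.lcm d e := Nat.lcm_pos hd0 he
        have hl0 : (0 : ℝ) < Nat.lcm d e := by exact_mod_cast hl
        have he0 : (0 : ℝ) < e := by exact_mod_cast he
        refine (mul_le_mul_of_nonneg_left
          (sum_Icc_dvd_card_divisors_div_sqrt_le _ N hl) (Real.sqrt_nonneg _)).trans ?_
        have h1 : ((Nat.lcm d e).divisors.card : ℝ) ≤ d.divisors.card * e.divisors.card := by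
          refine le_trans ?_ (Nat.cast_le.2 (card_divisors_mul_le d e) |>.trans (Nat.cast_mul _ _).le)
          exact_mod_cast Finset.card_le_card
            (Nat.divisors_subset_of_dvd (by positivity) (Nat.lcm_dvd_mul d e))
        have h2 : (Nat.gcd d e : ℝ) ≤ Nat.gcd k e := by
          exact_mod_cast Nat.le_of_dvd (Nat.gcd_pos_of_pos_left _ hk)
            (Nat.gcd_dvd_gcd_of_dvd_left _ (Nat.dvd_of_mem_divisors hd))
        have h3 : (Nat.gcd d e : ℝ) * Nat.lcm d e = d * e := by
          exact_mod_cast Nat.gcd_mul_lcm d e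
        have h4 : √(d : ℝ) ≤ d := by
          rw [Real.sqrt_le_left (by positivity)]; nlinarith
        have h5 : √(d : ℝ) / Nat.lcm d e ≤ Nat.gcd k e / e := by
          rw [div_le_div_iff₀ hl0 he0]
          calc √(d : ℝ) * e ≤ d * e := by gcongr
            _ = Nat.gcd d e * Nat.lcm d e := h3.symm
            _ ≤ _ := by gcongr
        have h6 := one_add_log_nonneg N
        calc √(d : ℝ) * (2 * (Nat.lcm d e).divisors.card / Nat.lcm d e * √N * (1 + Real.log N))
            = 2 * (Nat.lcm d e).divisors.card * (√(d : ℝ) / Nat.lcm d e) * √N * (1 + Real.log N) := by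
              ring
          _ ≤ 2 * (d.divisors.card * e.divisors.card) * (Nat.gcd k e / e) * √N *
                (1 + Real.log N) := by gcongr
          _ = _ := by ring
    _ = _ := by
        rw [← Finset.sum_mul, tauThree]
        push_cast
        ring

theorem kloostermanNorm_div_le (k : ℤ) (c : ℕ) (hc : 0 < c) :
    ∃ t : ℕ × ℕ × ℕ, c = t.1 * (t.2.1 ^ 2 * t.2.2 ^ 3) ∧
      kloostermanNorm k c / c ≤ t.1.divisors.card * √(Nat.gcd k.natAbs t.1) / √t.1 := by
  obtain ⟨c₁, a, b, h, hb⟩ := exists_kloosterman_bound k c hc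
  refine ⟨(c₁, a, b), h, ?_⟩
  have : NeZero c := ⟨hc.ne'⟩
  have h1 := hb 1 1
  simp only [Units.val_one, mul_one] at h1
  rw [kloostermanNorm, dif_neg hc.ne']
  have hc0 : (0 : ℝ) < c := by exact_mod_cast hc
  have hc1 : (0 : ℝ) < c₁ := by
    have : c₁ ≠ 0 := by rintro rfl; simp at h; omega
    exact_mod_cast Nat.pos_of_ne_zero this
  have hr : (0 : ℝ) < (a ^ 2 * b ^ 3 : ℕ) := by
    have : a ^ 2 * b ^ 3 ≠ 0 := by intro h0; rw [h0] at h; simp at h; omega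
    exact_mod_cast Nat.pos_of_ne_zero this
  rw [div_le_div_iff₀ hc0 (Real.sqrt_pos.2 hc1)]
  have hg : Int.gcd k c₁ = Nat.gcd k.natAbs c₁ := by simp [Int.gcd_eq_natAbs]
  rw [hg] at h1
  push_cast at h1
  rw [Real.sqrt_mul (by positivity)] at h1
  have hs := Real.mul_self_sqrt hc1.le
  have hce : (c : ℝ) = c₁ * (a ^ 2 * b ^ 3) := by exact_mod_cast h
  simp only
  rw [hce]
  calc ‖kloosterman c (k : ZMod c) k‖ * √(c₁ : ℝ)
      ≤ (a ^ 2 * b ^ 3 * (c₁.divisors.card * (√(Nat.gcd k.natAbs c₁ : ℝ) * √c₁))) * √(c₁ : ℝ) := by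
        gcongr
    _ = (a ^ 2 * b ^ 3 * (c₁.divisors.card * √(Nat.gcd k.natAbs c₁ : ℝ))) * (√c₁ * √(c₁ : ℝ)) := by
        ring
    _ = _ := by rw [hs]; ring

theorem sum_kloostermanNorm_div_le (k : ℤ) (hk : k ≠ 0) (q X : ℕ) (hq : Squarefree q) :
    ∑ c ∈ (Finset.Icc 1 X).filter (q ∣ ·), kloostermanNorm k c / c ≤
      2 * q.divisors.card ^ 3 * tauThree k.natAbs * Nat.gcd k.natAbs q / q * √X *
        (1 + Real.log X) ^ 3 := by
  have hq0 : 0 < q := Nat.pos_of_ne_zero hq.ne_zero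
  have hk0 : 0 < k.natAbs := Int.natAbs_pos.2 hk
  obtain ⟨K, hK⟩ : ∃ K, K = k.natAbs := ⟨_, rfl⟩
  rw [← hK] at hk0 ⊢
  have hqr : (0 : ℝ) < q := by exact_mod_cast hq0
  have hL := one_add_log_nonneg X
  let g : ℕ × ℕ × ℕ → ℝ := fun t => t.1.divisors.card * √(Nat.gcd K t.1) / √t.1
  have hg : ∀ t, 0 ≤ g t := fun t => by positivity
  let e : ℕ → ℕ → ℕ := fun a b => q / Nat.gcd q (a * b)
  let B := (Finset.Icc 1 X ×ˢ Finset.Icc 1 X).sigma fun p =>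
    (Finset.Icc 1 (X / (p.1 ^ 2 * p.2 ^ 3))).filter (e p.1 p.2 ∣ ·)
  have key : ∑ c ∈ (Finset.Icc 1 X).filter (q ∣ ·), kloostermanNorm k c / c ≤
      ∑ s ∈ B, g (s.2, s.1.1, s.1.2) := by
    have hex : ∀ c : ℕ, ∃ t : ℕ × ℕ × ℕ, 0 < c → c = t.1 * (t.2.1 ^ 2 * t.2.2 ^ 3) ∧
        kloostermanNorm k c / c ≤ t.1.divisors.card * √(Nat.gcd K t.1) / √t.1 := by
      intro c
      by_cases hc : 0 < c
      · obtain ⟨t, ht⟩ := kloostermanNorm_div_le k c hc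
        rw [← hK] at ht
        exact ⟨t, fun _ => ht⟩
      · exact ⟨0, fun h => absurd h hc⟩
    choose t ht using hex
    calc ∑ c ∈ (Finset.Icc 1 X).filter (q ∣ ·), kloostermanNorm k c / c
        ≤ ∑ c ∈ (Finset.Icc 1 X).filter (q ∣ ·), g (t c) := by
          refine Finset.sum_le_sum fun c hc => ?_
          exact (ht c (Finset.mem_Icc.1 (Finset.mem_filter.1 hc).1).1).2
      _ ≤ ∑ s ∈ B, g (s.2, s.1.1, s.1.2) := by
          let f : ℕ → (Σ _ : ℕ × ℕ, ℕ) := fun c => ⟨((t c).2.1, (t c).2.2), (t c).1⟩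
          have hinj : Set.InjOn f ((Finset.Icc 1 X).filter (q ∣ ·) : Finset ℕ) := by
            intro c hc c' hc' h
            rw [Finset.mem_coe, Finset.mem_filter, Finset.mem_Icc] at hc hc'
            have h1 := (ht c hc.1.1).1
            have h2 := (ht c' hc'.1.1).1
            simp only [f, Sigma.mk.injEq, Prod.mk.injEq, heq_eq_eq] at h
            rw [h1, h2, h.2, h.1.1, h.1.2]
          have : ∑ c ∈ (Finset.Icc 1 X).filter (q ∣ ·), g (t c) =
              ∑ s ∈ ((Finset.Icc 1 X).filter (q ∣ ·)).image f, g (s.2, s.1.1, s.1.2) := by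
            rw [Finset.sum_image hinj]
          rw [this]
          refine Finset.sum_le_sum_of_subset_of_nonneg ?_ fun _ _ _ => hg _
          intro s hs
          obtain ⟨c, hc, rfl⟩ := Finset.mem_image.1 hs
          rw [Finset.mem_filter, Finset.mem_Icc] at hc
          have h1 := (ht c hc.1.1).1
          set c₁ := (t c).1 with hc₁
          set a := (t c).2.1 with ha
          set b := (t c).2.2 with hb
          have hc1 : 0 < c₁ := Nat.pos_of_ne_zero (by intro h; rw [h] at h1; simp at h1; omega)
          have ha1 : 0 < a := Nat.pos_of_ne_zero (by intro h; rw [h] at h1; simp at h1; omega)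
          have hb1 : 0 < b := Nat.pos_of_ne_zero (by intro h; rw [h] at h1; simp at h1; omega)
          have hac : a ≤ c := by
            rw [h1]
            exact (Nat.le_of_dvd (by positivity) ⟨c₁ * (a * b ^ 3), by ring⟩)
          have hbc : b ≤ c := by
            rw [h1]
            exact (Nat.le_of_dvd (by positivity) ⟨c₁ * (a ^ 2 * b ^ 2), by ring⟩)
          simp only [B, f, Finset.mem_sigma, Finset.mem_product, Finset.mem_Icc, Finset.mem_filter]
          refine ⟨⟨⟨ha1, hac.trans hc.1.2⟩, hb1, hbc.trans hc.1.2⟩, ⟨hc1, ?_⟩, ?_⟩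
          · rw [Nat.le_div_iff_mul_le (by positivity), ← h1]; exact hc.1.2
          · have hqd : q ∣ c₁ * (a * b) := by
              rw [← hq.dvd_pow_iff_dvd (n := 3) (by norm_num)]
              refine hc.2.trans ?_
              rw [h1]
              exact ⟨c₁ ^ 2 * a, by ring⟩
            have hgp : 0 < Nat.gcd q (a * b) := Nat.gcd_pos_of_pos_left _ hq0
            exact Nat.Coprime.dvd_of_dvd_mul_right
              (Nat.coprime_div_gcd_div_gcd hgp)
              (by
                obtain ⟨r, hr⟩ := hqd
                obtain ⟨u, hu⟩ := Nat.gcd_dvd_left q (a * b)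
                obtain ⟨v, hv⟩ := Nat.gcd_dvd_right q (a * b)
                refine ⟨r, Nat.eq_of_mul_eq_mul_left hgp ?_⟩
                rw [← mul_assoc, ← mul_assoc, Nat.mul_div_cancel' (Nat.gcd_dvd_left q _), ← hr]
                rw [mul_comm _ c₁, mul_assoc, Nat.mul_div_cancel' (Nat.gcd_dvd_right q _)])
  refine key.trans ?_
  clear key hK hk
  calc ∑ s ∈ B, g (s.2, s.1.1, s.1.2)
      = ∑ p ∈ Finset.Icc 1 X ×ˢ Finset.Icc 1 X,
          ∑ c ∈ (Finset.Icc 1 (X / (p.1 ^ 2 * p.2 ^ 3))).filter (e p.1 p.2 ∣ ·),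
            (c.divisors.card : ℝ) * √(Nat.gcd K c) / √c := by
        rw [Finset.sum_sigma]
    _ ≤ ∑ p ∈ Finset.Icc 1 X ×ˢ Finset.Icc 1 X,
          (2 * q.divisors.card * tauThree K * Nat.gcd K q / q * √X *
            (1 + Real.log X)) * ((Nat.gcd q p.1 / p.1) * (Nat.gcd q p.2 / p.2)) := by
        refine Finset.sum_le_sum fun p hp => ?_
        obtain ⟨a, b⟩ := p
        rw [Finset.mem_product, Finset.mem_Icc, Finset.mem_Icc] at hp
        obtain ⟨⟨ha, _⟩, hb, _⟩ := hp
        simp only at ha hb ⊢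
        have ha0 : (0 : ℝ) < a := by exact_mod_cast ha
        have hb1 : (1 : ℝ) ≤ b := by exact_mod_cast hb
        have hgp : 0 < Nat.gcd q (a * b) := Nat.gcd_pos_of_pos_left _ hq0
        have hed : e a b ∣ q := Nat.div_dvd_of_dvd (Nat.gcd_dvd_left _ _)
        have he : 0 < e a b := Nat.pos_of_dvd_of_pos hed hq0
        have he0 : (0 : ℝ) < e a b := by exact_mod_cast he
        refine (sum_dvd_card_divisors_sqrt_gcd_le (e a b) _ _ he hk0).trans ?_
        have h1 : ((e a b).divisors.card : ℝ) ≤ q.divisors.card := by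
          exact_mod_cast Finset.card_le_card (Nat.divisors_subset_of_dvd hq0.ne' hed)
        have h2 : (Nat.gcd K (e a b) : ℝ) ≤ Nat.gcd K q := by
          exact_mod_cast Nat.le_of_dvd (Nat.gcd_pos_of_pos_left _ hk0)
            (Nat.gcd_dvd_gcd_of_dvd_right _ hed)
        have h3 : (e a b : ℝ) * Nat.gcd q (a * b) = q := by
          exact_mod_cast Nat.div_mul_cancel (Nat.gcd_dvd_left q (a * b))
        have h4 : (Nat.gcd q (a * b) : ℝ) ≤ Nat.gcd q a * Nat.gcd q b := by
          exact_mod_cast Nat.le_of_dvd (Nat.mul_pos (Nat.gcd_pos_of_pos_left _ hq0)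
            (Nat.gcd_pos_of_pos_left _ hq0)) (Nat.gcd_mul_right_dvd_mul_gcd q a b)
        have h5 : 1 / (e a b : ℝ) ≤ Nat.gcd q a * Nat.gcd q b / q := by
          rw [div_le_div_iff₀ he0 hqr]
          calc 1 * (q : ℝ) = Nat.gcd q (a * b) * e a b := by rw [← h3]; ring
            _ ≤ _ := by gcongr
        have h6 : √((X / (a ^ 2 * b ^ 3) : ℕ) : ℝ) ≤ √X / (a * b) := by
          rw [Real.sqrt_le_left (by positivity), div_pow, Real.sq_sqrt (by positivity)]
          refine Nat.cast_div_le.trans ?_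
          push_cast
          gcongr
          rw [mul_pow]
          gcongr
          · norm_num
        have h7 := one_add_log_mono (Nat.div_le_self X (a ^ 2 * b ^ 3))
        have h8 := one_add_log_nonneg (X / (a ^ 2 * b ^ 3))
        calc 2 * ((e a b).divisors.card : ℝ) * tauThree K * Nat.gcd K (e a b) / (e a b) *
              √((X / (a ^ 2 * b ^ 3) : ℕ) : ℝ) * (1 + Real.log (X / (a ^ 2 * b ^ 3) : ℕ))
            = 2 * ((e a b).divisors.card : ℝ) * tauThree K * Nat.gcd K (e a b) *
              (1 / (e a b)) *
              √((X / (a ^ 2 * b ^ 3) : ℕ) : ℝ) * (1 + Real.log (X / (a ^ 2 * b ^ 3) : ℕ)) := by ring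
          _ ≤ 2 * (q.divisors.card : ℝ) * tauThree K * Nat.gcd K q *
              (Nat.gcd q a * Nat.gcd q b / q) * (√X / (a * b)) * (1 + Real.log X) := by
              gcongr
          _ = _ := by field_simp
    _ = (2 * q.divisors.card * tauThree K * Nat.gcd K q / q * √X *
            (1 + Real.log X)) * ((∑ a ∈ Finset.Icc 1 X, (Nat.gcd q a : ℝ) / a) *
              (∑ b ∈ Finset.Icc 1 X, (Nat.gcd q b : ℝ) / b)) := by
        rw [← Finset.mul_sum, Finset.sum_product, Finset.sum_mul_sum]
    _ ≤ (2 * q.divisors.card * tauThree K * Nat.gcd K q / q * √X *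
            (1 + Real.log X)) * ((q.divisors.card * (1 + Real.log X)) *
              (q.divisors.card * (1 + Real.log X))) := by
        have h1 := sum_Icc_gcd_div_le q X hq0
        gcongr
    _ = _ := by ring

section

open UpperHalfPlane MeasureTheory ModularGroup
open scoped MatrixGroups

namespace UpperHalfPlane

theorem measurable_re : Measurable UpperHalfPlane.re := continuous_re.measurable

theorem measurable_im : Measurable UpperHalfPlane.im := continuous_im.measurable

theorem sl_im_smul (g : SL(2, ℤ)) (z : ℍ) : (g • z).im =
    z.im / ((g 1 0 * z.re + g 1 1) ^ 2 + (g 1 0 * z.im) ^ 2) := by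
  rw [ModularGroup.im_smul_eq_div_normSq, ModularGroup.denom_apply, Complex.normSq_apply]
  simp [← sq]

theorem sl_normSq_smul (g : SL(2, ℤ)) (z : ℍ) : (g 0 0 * z.re + g 0 1) ^ 2 + (g 0 0 * z.im) ^ 2 =
    ((g • z).re ^ 2 + (g • z).im ^ 2) * ((g 1 0 * z.re + g 1 1) ^ 2 + (g 1 0 * z.im) ^ 2) := by
  have h := coe_specialLinearGroup_apply g z
  have hd : ((g 1 0 : ℂ) * z + (g 1 1 : ℂ)) ≠ 0 := by
    have := denom_ne_zero (Matrix.SpecialLinearGroup.mapGL ℝ g : GL (Fin 2) ℝ) z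
    simpa [denom] using this
  simp only [algebraMap_int_eq, eq_intCast, Complex.ofReal_intCast] at h
  rw [eq_div_iff hd] at h
  have h2 := congrArg Complex.normSq h
  rw [Complex.normSq_mul] at h2
  simp only [Complex.normSq_apply] at h2
  simp [-ModularGroup.sl_moeb] at h2
  linear_combination -h2

/-- The box `|Re z| ≤ 1`, `y₁ ≤ Im z ≤ y₂`. -/
def box (y₁ y₂ : ℝ) : Set ℍ := {z | |z.re| ≤ 1 ∧ y₁ ≤ z.im ∧ z.im ≤ y₂}

theorem abs_le_of_sq_add_sq_le {p q : ℤ} {x y y₁ M : ℝ} (hx : |x| ≤ 1) (hy₁ : 0 < y₁)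
    (hy : y₁ ≤ y) (h : (p * x + q) ^ 2 + (p * y) ^ 2 ≤ M) :
    |(p : ℝ)| ≤ M / y₁ ^ 2 + M + 1 ∧ |(q : ℝ)| ≤ M / y₁ ^ 2 + M + 1 := by
  have hM : 0 ≤ M := by nlinarith [sq_nonneg (p * x + q), sq_nonneg (p * y)]
  have hp2 : (p : ℝ) ^ 2 ≤ M / y₁ ^ 2 := by
    rw [le_div_iff₀ (by positivity), ← mul_pow]
    have : (p * y₁) ^ 2 ≤ (p * y) ^ 2 := by
      rw [mul_pow, mul_pow]; gcongr
    nlinarith [sq_nonneg (p * x + q)]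
  have hp : |(p : ℝ)| ≤ M / y₁ ^ 2 := by
    refine le_trans ?_ hp2
    have : |p| ≤ p ^ 2 := by
      rw [← Int.natCast_natAbs]; exact Int.natAbs_le_self_sq p
    exact_mod_cast this
  have hq : |(p * x + q : ℝ)| ≤ M + 1 := by
    have : (p * x + q) ^ 2 ≤ M := by nlinarith [sq_nonneg (p * y)]
    refine abs_le_of_sq_le_sq ?_ (by linarith) 
    nlinarith
  have hpx : |(p * x : ℝ)| ≤ M / y₁ ^ 2 := by
    rw [abs_mul]
    nlinarith [abs_nonneg (p : ℝ)]
  refine ⟨by linarith, ?_⟩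
  have : (q : ℝ) = (p * x + q) - p * x := by ring
  rw [this]
  refine (abs_sub _ _).trans ?_
  linarith

theorem finite_abs_le (K : ℝ) : {g : SL(2, ℤ) | ∀ i j, |((g i j : ℤ) : ℝ)| ≤ K}.Finite := by
  have : Function.Injective (fun (g : SL(2, ℤ)) (i j : Fin 2) => g i j) := by
    intro g h hgh
    ext i j
    exact congrFun (congrFun hgh i) j
  refine Set.Finite.of_finite_image (f := fun (g : SL(2, ℤ)) (i j : Fin 2) => g i j) ?_ this.injOn
  refine Set.Finite.subset (Set.Finite.pi (t := fun _ : Fin 2 => Set.univ.pi fun _ : Fin 2 =>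
    Set.Icc (-⌊K⌋) ⌊K⌋) fun _ => Set.Finite.pi fun _ => Set.finite_Icc _ _) ?_
  rintro _ ⟨g, hg, rfl⟩
  simp only [Set.mem_pi, Set.mem_univ, forall_true_left, Set.mem_Icc]
  intro i j
  rw [← abs_le]
  refine Int.le_floor.2 ?_
  exact_mod_cast hg i j

theorem finite_box_return {y₁ : ℝ} (hy₁ : 0 < y₁) (y₂ : ℝ) :
    {g : SL(2, ℤ) | ∃ z ∈ box y₁ y₂, g • z ∈ box y₁ y₂}.Finite := by
  set M := y₂ / y₁
  set M' := (1 + y₂ ^ 2) * M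
  refine (finite_abs_le (max (M / y₁ ^ 2 + M + 1) (M' / y₁ ^ 2 + M' + 1))).subset ?_
  rintro g ⟨z, ⟨hz1, hz2, hz3⟩, hg1, hg2, hg3⟩
  have h1 := sl_im_smul g z
  have h2 := sl_normSq_smul g z
  set D := (g 1 0 * z.re + g 1 1) ^ 2 + (g 1 0 * z.im) ^ 2 with hD
  have hDpos : 0 < D := by
    rcases (by positivity : 0 ≤ D).eq_or_lt with h | h
    · rw [← h, div_zero] at h1
      have := (g • z).im_pos; linarith
    · exact h
  have hDM : D ≤ M := by
    rw [le_div_iff₀ hy₁]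
    have : z.im = (g • z).im * D := by rw [h1]; field_simp
    nlinarith
  have hN : (g 0 0 * z.re + g 0 1) ^ 2 + (g 0 0 * z.im) ^ 2 ≤ M' := by
    rw [h2]
    have : (g • z).re ^ 2 ≤ 1 := (sq_le_one_iff_abs_le_one _).2 hg1
    have : (g • z).im ^ 2 ≤ y₂ ^ 2 := by
      have := (g • z).im_pos
      gcongr
    exact mul_le_mul (by linarith) hDM hDpos.le (by positivity)
  have e1 := abs_le_of_sq_add_sq_le hz1 hy₁ hz2 hDM
  have e2 := abs_le_of_sq_add_sq_le hz1 hy₁ hz2 hN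
  intro i j
  fin_cases i <;> fin_cases j
  · exact e2.1.trans (le_max_right _ _)
  · exact e2.2.trans (le_max_right _ _)
  · exact e1.1.trans (le_max_left _ _)
  · exact e1.2.trans (le_max_left _ _)

theorem finite_fd_return : {g : SL(2, ℤ) | ∃ z ∈ fd, g • z ∈ fd}.Finite := by
  have hf : ∀ X : SL(2, ℤ), {g : SL(2, ℤ) | g = X ∨ g = -X}.Finite := fun X =>
    (Set.toFinite ({X} ∪ {-X} : Set SL(2, ℤ)))
  refine Set.Finite.subset (((hf 1).union ((hf T).union ((hf T⁻¹).union ((hf S).union ((hf (T * S)).union ((hf (T⁻¹ * S * T⁻¹)).union ((hf (S * T⁻¹)).union ((hf (S * T)).union ((hf (T * S * T)).union ((hf (T⁻¹ * S))))))))))))) ?_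
  rintro g ⟨z, hz, hg⟩
  rcases cases_of_mem_fd_smul_mem_fd hz hg with h | ⟨h, -⟩ | ⟨h, -⟩ | ⟨h, -⟩ | ⟨h, -⟩ | ⟨h, -⟩ | ⟨h, -⟩ | ⟨h, -⟩ | ⟨h, -⟩ | ⟨h, -⟩
  · exact Or.inl h
  · exact Or.inr (Or.inl h)
  · exact Or.inr (Or.inr (Or.inl h))
  · exact Or.inr (Or.inr (Or.inr (Or.inl h)))
  · exact Or.inr (Or.inr (Or.inr (Or.inr (Or.inl h))))
  · exact Or.inr (Or.inr (Or.inr (Or.inr (Or.inr (Or.inl h)))))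
  · exact Or.inr (Or.inr (Or.inr (Or.inr (Or.inr (Or.inr (Or.inl h))))))
  · exact Or.inr (Or.inr (Or.inr (Or.inr (Or.inr (Or.inr (Or.inr (Or.inl h)))))))
  · exact Or.inr (Or.inr (Or.inr (Or.inr (Or.inr (Or.inr (Or.inr (Or.inr (Or.inl h))))))))
  · exact Or.inr (Or.inr (Or.inr (Or.inr (Or.inr (Or.inr (Or.inr (Or.inr (Or.inr (h)))))))))

theorem exists_finset_fd_return :
    ∃ F : Finset SL(2, ℤ), ∀ g : SL(2, ℤ), ∀ z ∈ fd, g • z ∈ fd → g ∈ F :=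
  ⟨finite_fd_return.toFinset, fun _ z hz hg => finite_fd_return.mem_toFinset.2 ⟨z, hz, hg⟩⟩

end UpperHalfPlane

end

section

open UpperHalfPlane MeasureTheory ModularGroup
open scoped MatrixGroups

namespace UpperHalfPlane

/-- The rectangle `x₁ ≤ Re z ≤ x₂`, `y₁ ≤ Im z ≤ y₂`. -/
def rect (x₁ x₂ y₁ y₂ : ℝ) : Set ℍ := {z | x₁ ≤ z.re ∧ z.re ≤ x₂ ∧ y₁ ≤ z.im ∧ z.im ≤ y₂}

theorem measurableSet_rect (x₁ x₂ y₁ y₂ : ℝ) : MeasurableSet (rect x₁ x₂ y₁ y₂) :=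
  (measurableSet_le measurable_const measurable_re).inter
    ((measurableSet_le measurable_re measurable_const).inter
      ((measurableSet_le measurable_const measurable_im).inter
        (measurableSet_le measurable_im measurable_const)))

theorem volume_coe_image_rect {x₁ x₂ y₁ y₂ : ℝ} (hy₁ : 0 < y₁) :
    volume ((↑) '' rect x₁ x₂ y₁ y₂ : Set ℂ) =
      ENNReal.ofReal (x₂ - x₁) * ENNReal.ofReal (y₂ - y₁) := by
  have h : ((↑) '' rect x₁ x₂ y₁ y₂ : Set ℂ) =
      Complex.measurableEquivRealProd ⁻¹' (Set.Icc x₁ x₂ ×ˢ Set.Icc y₁ y₂) := by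
    ext z
    simp only [rect, Set.mem_image, Set.mem_ofPred_eq, Set.mem_preimage, Set.mem_prod, Set.mem_Icc,
      Complex.measurableEquivRealProd_apply]
    constructor
    · rintro ⟨w, ⟨h1, h2, h3, h4⟩, rfl⟩
      exact ⟨⟨h1, h2⟩, h3, h4⟩
    · rintro ⟨⟨h1, h2⟩, h3, h4⟩
      exact ⟨⟨z, hy₁.trans_le h3⟩, ⟨h1, h2, h3, h4⟩, rfl⟩
  rw [h, Complex.volume_preserving_equiv_real_prod.measure_preimage
    (measurableSet_Icc.prod measurableSet_Icc).nullMeasurableSet, Measure.volume_eq_prod,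
    Measure.prod_prod, Real.volume_Icc, Real.volume_Icc]

theorem volume_rect_le {x₁ x₂ y₁ y₂ : ℝ} (hx : x₁ ≤ x₂) (hy₁ : 0 < y₁) :
    volume (rect x₁ x₂ y₁ y₂) ≤ ENNReal.ofReal ((x₂ - x₁) * y₂ / y₁ ^ 2) := by
  rw [volume_eq_lintegral]
  refine (setLIntegral_mono (g := fun _ => ENNReal.ofReal (1 / y₁ ^ 2)) measurable_const ?_).trans ?_
  · rintro _ ⟨z, ⟨-, -, h3, -⟩, rfl⟩
    rw [ENNReal.coe_nnreal_eq]
    refine ENNReal.ofReal_le_ofReal ?_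
    push_cast
    simp only [Real.norm_eq_abs, coe_im, one_div]
    rw [abs_of_pos z.im_pos, ← inv_pow]
    gcongr
  · rw [setLIntegral_const, volume_coe_image_rect hy₁, ← ENNReal.ofReal_mul (by linarith),
      ← ENNReal.ofReal_mul (by positivity)]
    refine ENNReal.ofReal_le_ofReal ?_
    rw [one_div_mul_eq_div]
    have : 0 ≤ x₂ - x₁ := by linarith
    gcongr
    linarith

theorem le_volume_rect {x₁ x₂ y₁ y₂ : ℝ} (hx : x₁ ≤ x₂) (hy₁ : 0 < y₁) :
    ENNReal.ofReal ((x₂ - x₁) * (y₂ - y₁) / y₂ ^ 2) ≤ volume (rect x₁ x₂ y₁ y₂) := by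
  rw [volume_eq_lintegral]
  refine le_trans ?_ (setLIntegral_mono' (f := fun _ => ENNReal.ofReal (1 / y₂ ^ 2))
    (measurableEmbedding_coe.measurableSet_image.mpr (measurableSet_rect _ _ _ _)) ?_)
  · rw [setLIntegral_const, volume_coe_image_rect hy₁, ← ENNReal.ofReal_mul (by linarith),
      ← ENNReal.ofReal_mul (by positivity), one_div_mul_eq_div]
  · rintro _ ⟨z, ⟨-, -, h3, h4⟩, rfl⟩
    rw [ENNReal.coe_nnreal_eq]
    refine ENNReal.ofReal_le_ofReal ?_
    push_cast
    simp only [Real.norm_eq_abs, coe_im, one_div]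
    rw [abs_of_pos z.im_pos, ← inv_pow]
    have := z.im_pos
    have := this.trans_le h4
    gcongr

theorem volume_rect_lt_top {x₁ x₂ y₁ y₂ : ℝ} (hy₁ : 0 < y₁) :
    volume (rect x₁ x₂ y₁ y₂) < ⊤ := by
  rcases le_total x₁ x₂ with h | h
  · exact (volume_rect_le h hy₁).trans_lt ENNReal.ofReal_lt_top
  · refine lt_of_le_of_lt (measure_mono (t := rect x₂ x₁ y₁ y₂) ?_)
      ((volume_rect_le h hy₁).trans_lt ENNReal.ofReal_lt_top)
    rintro z ⟨h1, h2, h3⟩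
    exact ⟨by linarith, by linarith, h3⟩

theorem measurable_sl_smul (g : SL(2, ℤ)) : Measurable (fun z : ℍ => g • z) :=
  (continuous_const_smul (Matrix.SpecialLinearGroup.mapGL ℝ g : GL (Fin 2) ℝ)).measurable

theorem integral_sl_smul {E : Type*} [NormedAddCommGroup E] [NormedSpace ℝ E] (g : SL(2, ℤ))
    (f : ℍ → E) : ∫ z, f (g • z) = ∫ z, f z := by
  exact integral_smul_eq_self f (g := (Matrix.SpecialLinearGroup.mapGL ℝ g : GL (Fin 2) ℝ))

theorem exists_fd_weight : ∃ (w : ℍ → ℝ) (B : ℝ), 0 < B ∧ Measurable w ∧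
    (∀ z, 0 ≤ w z) ∧ (∀ z, w z ≤ 1) ∧ (∀ z ∉ fd, w z = 0) ∧ (∀ z ∈ fd, B ≤ w z) ∧
    ∀ (z : ℍ) (G : Finset SL(2, ℤ)), (∀ g : SL(2, ℤ), g • z ∈ fd → g ∈ G) →
      ∑ g ∈ G, w (g • z) = 1 := by
  classical
  obtain ⟨F, hF⟩ := exists_finset_fd_return
  set ind : ℍ → ℝ := fd.indicator 1 with hind
  have hindm : Measurable ind := measurable_one.indicator isClosed_fd.measurableSet
  have hind0 : ∀ z, 0 ≤ ind z := Set.indicator_nonneg fun _ _ => zero_le_one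
  have hind1 : ∀ z, ind z ≤ 1 := Set.indicator_le_self' (fun _ _ => zero_le_one)
  have hΘ1 : ∀ z ∈ fd, 1 ≤ ∑ f ∈ F, ind (f • z) := by
    intro z hz
    refine le_trans ?_ (Finset.single_le_sum (f := fun f => ind (f • z)) (fun _ _ => hind0 _)
      (hF 1 z hz (by simpa using hz)))
    simp [hind, hz]
  have hΘ2 : ∀ z, ∑ f ∈ F, ind (f • z) ≤ F.card := fun z => by
    simpa using Finset.sum_le_sum fun f (_ : f ∈ F) => hind1 (f • z)
  have hFpos : 0 < (F.card : ℝ) := by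
    have := (hΘ1 I I_mem_fd).trans (hΘ2 I); linarith
  refine ⟨fun z => ind z * (∑ f ∈ F, ind (f • z))⁻¹, (F.card : ℝ)⁻¹, by positivity,
    hindm.mul (Finset.measurable_sum _ fun f _ => hindm.comp (measurable_sl_smul f)).inv,
    fun z => ?_, fun z => ?_, fun z hz => ?_, fun z hz => ?_, fun z G hG => ?_⟩
  · exact mul_nonneg (hind0 z) (inv_nonneg.2 (Finset.sum_nonneg fun _ _ => hind0 _))
  · by_cases hz : z ∈ fd
    · exact mul_le_one₀ (hind1 z) (inv_nonneg.2 (Finset.sum_nonneg fun _ _ => hind0 _))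
        (inv_le_one_of_one_le₀ (hΘ1 z hz))
    · simp [hind, hz]
  · simp [hind, hz]
  · simp only [hind, Set.indicator_of_mem hz, Pi.one_apply, one_mul]
    have := hΘ1 z hz
    exact inv_anti₀ (by linarith) (hΘ2 z)
  · set A := G.filter fun g => g • z ∈ fd with hA
    have hcard : ∀ g ∈ A, ∑ f ∈ F, ind (f • g • z) = A.card := by
      intro g hg
      have hgz := (Finset.mem_filter.1 hg).2
      have : ∑ f ∈ F, ind (f • g • z) = ∑ f ∈ F.filter (fun f => f • g • z ∈ fd), (1 : ℝ) := by
        rw [Finset.sum_filter]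
        refine Finset.sum_congr rfl fun f _ => ?_
        simp [-ModularGroup.sl_moeb, hind, Set.indicator_apply]
      rw [this, Finset.sum_const, nsmul_one, Nat.cast_inj]
      refine Finset.card_bij' (fun f _ => f * g) (fun f _ => f * g⁻¹) ?_ ?_ ?_ ?_
      · intro f hf
        have hf' := (Finset.mem_filter.1 hf).2
        rw [← mul_smul] at hf'
        exact Finset.mem_filter.2 ⟨hG _ hf', hf'⟩
      · intro f hf
        have hf' := (Finset.mem_filter.1 hf).2
        have : (f * g⁻¹) • g • z = f • z := by rw [← mul_smul]; simp
        exact Finset.mem_filter.2 ⟨hF _ _ hgz (this ▸ hf'), this ▸ hf'⟩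
      · simp
      · simp
    have hne : A.Nonempty := by
      obtain ⟨g, hg⟩ := exists_smul_mem_fd z
      exact ⟨g, Finset.mem_filter.2 ⟨hG g hg, hg⟩⟩
    have : ∑ g ∈ G, ind (g • z) * (∑ f ∈ F, ind (f • g • z))⁻¹ =
        ∑ g ∈ A, (A.card : ℝ)⁻¹ := by
      rw [hA, Finset.sum_filter, ← hA]
      refine Finset.sum_congr rfl fun g hg => ?_
      by_cases h : g • z ∈ fd
      · rw [hcard g (Finset.mem_filter.2 ⟨hg, h⟩)]; simp [-ModularGroup.sl_moeb, hind, h]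
      · simp [-ModularGroup.sl_moeb, hind, h]
    rw [this, Finset.sum_const, nsmul_eq_mul, mul_inv_cancel₀]
    exact_mod_cast hne.card_pos.ne'

end UpperHalfPlane

end

section

open UpperHalfPlane MeasureTheory ModularGroup
open scoped MatrixGroups ComplexConjugate

namespace UpperHalfPlane

theorem integrable_sl_smul {f : ℍ → ℂ} (hf : Integrable f) (g : SL(2, ℤ)) :
    Integrable (fun z => f (g • z)) :=
  (measurePreserving_smul (Matrix.SpecialLinearGroup.mapGL ℝ g : GL (Fin 2) ℝ)
    (volume : Measure ℍ)).integrable_comp_of_integrable hf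

theorem integrable_of_support_rect {f : ℍ → ℂ} (hf : Measurable f) {C : ℝ} (hC : ∀ z, ‖f z‖ ≤ C)
    {x₁ x₂ y₁ y₂ : ℝ} (hy₁ : 0 < y₁) (hs : ∀ z, f z ≠ 0 → z ∈ rect x₁ x₂ y₁ y₂) :
    Integrable f := by
  rw [← integrableOn_iff_integrable_of_support_subset (s := rect x₁ x₂ y₁ y₂) hs]
  exact IntegrableOn.of_bound (volume_rect_lt_top hy₁) hf.aestronglyMeasurable C
    (Filter.Eventually.of_forall hC)

theorem norm_integral_le_of_support_rect {f : ℍ → ℂ} (hC : ∀ z, ‖f z‖ ≤ 1)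
    {x₁ x₂ y₁ y₂ : ℝ} (hx : x₁ ≤ x₂) (hy₁ : 0 < y₁) (hy₂ : 0 ≤ y₂)
    (hs : ∀ z, f z ≠ 0 → z ∈ rect x₁ x₂ y₁ y₂) :
    ‖∫ z, f z‖ ≤ (x₂ - x₁) * y₂ / y₁ ^ 2 := by
  rw [← setIntegral_eq_integral_of_forall_compl_eq_zero (s := rect x₁ x₂ y₁ y₂)
    (fun z hz => by_contra fun h => hz (hs z h))]
  refine (norm_setIntegral_le_of_norm_le_const (volume_rect_lt_top hy₁)
    (fun z _ => hC z)).trans ?_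
  rw [one_mul]
  refine ENNReal.toReal_le_of_le_ofReal ?_ (volume_rect_le hx hy₁)
  have : 0 ≤ x₂ - x₁ := by linarith
  positivity

/-- Unfolding identity for the weighted integral over the fundamental domain. -/
theorem integral_weight_mul_sum {w : ℍ → ℝ} (hwm : Measurable w) (hw0 : ∀ z, 0 ≤ w z)
    (hw1 : ∀ z, w z ≤ 1) (hwfd : ∀ z ∉ fd, w z = 0)
    (hws : ∀ (z : ℍ) (G : Finset SL(2, ℤ)), (∀ g : SL(2, ℤ), g • z ∈ fd → g ∈ G) →
      ∑ g ∈ G, w (g • z) = 1)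
    {a : ℍ → ℂ} (ham : Measurable a) (ha1 : ∀ z, ‖a z‖ ≤ 1) {x₁ x₂ y₁ y₂ : ℝ} (hy₁ : 0 < y₁)
    (has : ∀ z, a z ≠ 0 → z ∈ rect x₁ x₂ y₁ y₂) (G H : Finset SL(2, ℤ))
    (hG : ∀ z ∈ fd, ∀ g : SL(2, ℤ), a (g • z) ≠ 0 → g ∈ G)
    (hH : ∀ (z : ℍ) (h : SL(2, ℤ)), a z ≠ 0 → a (h • z) ≠ 0 → h ∈ H)
    (P : SL(2, ℤ) → Prop) [DecidablePred P] :
    Integrable (fun z => (w z : ℂ) * ∑ g ∈ G, ∑ g' ∈ G.filter fun g' => P (g' * g⁻¹),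
      conj (a (g • z)) * a (g' • z)) ∧
    ∫ z, (w z : ℂ) * ∑ g ∈ G, ∑ g' ∈ G.filter fun g' => P (g' * g⁻¹),
      conj (a (g • z)) * a (g' • z) = ∑ h ∈ H.filter P, ∫ z, conj (a z) * a (h • z) := by
  classical
  set k : SL(2, ℤ) → SL(2, ℤ) → ℍ → ℂ := fun g h z => (w (g⁻¹ • z) : ℂ) * (conj (a z) * a (h • z))
  have hk1 : ∀ g h z, ‖k g h z‖ ≤ 1 := fun g h z => by
    simp only [k, norm_mul, RCLike.norm_conj, Complex.norm_real, Real.norm_of_nonneg (hw0 _)]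
    exact mul_le_one₀ (hw1 _) (by positivity)
      (mul_le_one₀ (ha1 _) (norm_nonneg _) (ha1 _))
  have hkm : ∀ g h, Measurable (k g h) := fun g h =>
    (Complex.measurable_ofReal.comp (hwm.comp (measurable_sl_smul _))).mul
      ((Complex.continuous_conj.measurable.comp ham).mul (ham.comp (measurable_sl_smul _)))
  have hkint : ∀ g h, Integrable (k g h) := fun g h =>
    integrable_of_support_rect (hkm g h) (hk1 g h) hy₁ fun z hz => has z fun h0 => hz (by
      simp [-ModularGroup.sl_moeb, k, h0])
  have hrew : ∀ z, (w z : ℂ) * ∑ g ∈ G, ∑ g' ∈ G.filter fun g' => P (g' * g⁻¹),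
      conj (a (g • z)) * a (g' • z) =
      ∑ g ∈ G, ∑ g' ∈ G.filter (fun g' => P (g' * g⁻¹)), k g (g' * g⁻¹) (g • z) := by
    intro z
    simp only [Finset.mul_sum]
    refine Finset.sum_congr rfl fun g _ => Finset.sum_congr rfl fun g' _ => ?_
    simp only [k, ← mul_smul, inv_mul_cancel, one_smul, inv_mul_cancel_right]
  have hinner : ∀ g ∈ G, Integrable (fun z => ∑ g' ∈ G.filter (fun g' => P (g' * g⁻¹)),
      k g (g' * g⁻¹) (g • z)) := fun g _ =>
    integrable_finsetSum _ fun g' _ => integrable_sl_smul (hkint _ _) g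
  simp only [hrew]
  refine ⟨integrable_finsetSum _ hinner, ?_⟩
  rw [integral_finsetSum _ hinner]
  have h1 : ∀ g ∈ G, ∫ z, ∑ g' ∈ G.filter (fun g' => P (g' * g⁻¹)), k g (g' * g⁻¹) (g • z) =
      ∑ h ∈ H.filter P, ∫ z, k g h z := by
    intro g hg
    rw [integral_finsetSum _ fun g' _ => integrable_sl_smul (hkint _ _) g]
    simp only [integral_sl_smul]
    have hne : ∀ h, ∫ z, k g h z ≠ 0 → h ∈ H ∧ h * g ∈ G := by
      intro h hh
      obtain ⟨z, hz⟩ : ∃ z, k g h z ≠ 0 := by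
        by_contra! hc
        exact hh (by simp [hc])
      simp only [k] at hz
      have hz1 := left_ne_zero_of_mul hz
      have hz2 := left_ne_zero_of_mul (right_ne_zero_of_mul hz)
      have hz3 := right_ne_zero_of_mul (right_ne_zero_of_mul hz)
      refine ⟨hH z h (fun h0 => hz2 (by rw [h0, map_zero])) hz3,
        hG (g⁻¹ • z) (by_contra fun hc => hz1 (by rw [hwfd _ hc, Complex.ofReal_zero])) _ ?_⟩
      rwa [← mul_smul, mul_inv_cancel_right]
    refine Finset.sum_bij_ne_zero (fun g' _ _ => g' * g⁻¹) ?_ ?_ ?_ ?_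
    · intro g' hg' hn
      exact Finset.mem_filter.2 ⟨(hne _ hn).1, (Finset.mem_filter.1 hg').2⟩
    · intro g₁ _ _ g₂ _ _ h
      exact mul_right_cancel h
    · intro h hh hn
      refine ⟨h * g, Finset.mem_filter.2 ⟨(hne _ hn).2, ?_⟩, ?_, ?_⟩
      · rw [mul_inv_cancel_right]; exact (Finset.mem_filter.1 hh).2
      · rwa [mul_inv_cancel_right]
      · rw [mul_inv_cancel_right]
    · intros; rfl
  rw [Finset.sum_congr rfl h1, Finset.sum_comm]
  refine Finset.sum_congr rfl fun h _ => ?_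
  rw [← integral_finsetSum _ fun g _ => hkint g h]
  refine integral_congr_ae (Filter.Eventually.of_forall fun z => ?_)
  simp only [k, ← Finset.sum_mul]
  by_cases hz : a z = 0
  · simp [-ModularGroup.sl_moeb, hz]
  have := hws z (G.image fun g => g⁻¹) fun γ hγ => by
    refine Finset.mem_image.2 ⟨γ⁻¹, hG _ hγ _ ?_, inv_inv _⟩
    rwa [inv_smul_smul]
  rw [Finset.sum_image fun _ _ _ _ h => inv_injective h] at this
  rw [← Complex.ofReal_sum, this, Complex.ofReal_one, one_mul]

end UpperHalfPlane

end

section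

open UpperHalfPlane MeasureTheory ModularGroup
open scoped MatrixGroups ComplexConjugate

namespace UpperHalfPlane

/-- `φ` restricted to the strip `0 ≤ Re z < 1`. -/
noncomputable def stripCut (φ : ℍ → ℂ) (z : ℍ) : ℂ := if ⌊z.re⌋ = 0 then φ z else 0

theorem measurable_stripCut {φ : ℍ → ℂ} (hφ : Measurable φ) : Measurable (stripCut φ) :=
  Measurable.ite ((Int.measurable_floor.comp measurable_re) (measurableSet_singleton 0)) hφ
    measurable_const

theorem norm_stripCut_le {φ : ℍ → ℂ} (hφ : ∀ z, ‖φ z‖ ≤ 1) (z : ℍ) : ‖stripCut φ z‖ ≤ 1 := by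
  unfold stripCut
  split_ifs
  · exact hφ z
  · simp

theorem stripCut_mem_rect {φ : ℍ → ℂ} {y₁ y₂ : ℝ}
    (hs : ∀ z, φ z ≠ 0 → y₁ ≤ z.im ∧ z.im ≤ y₂) (z : ℍ) (hz : stripCut φ z ≠ 0) :
    z ∈ rect 0 1 y₁ y₂ := by
  unfold stripCut at hz
  split_ifs at hz with h
  · rw [Int.floor_eq_zero_iff] at h
    exact ⟨h.1, h.2.le, hs z hz⟩
  · simp at hz

theorem entries_T_zpow_mul_mul (γ : SL(2, ℤ)) (j m : ℤ) :
    (T ^ j * γ * T ^ m) 1 0 = γ 1 0 ∧ (T ^ j * γ * T ^ m) 1 1 = γ 1 0 * m + γ 1 1 := by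
  constructor <;>
  simp [coe_T_zpow, Matrix.mul_apply, Fin.sum_univ_two, Matrix.SpecialLinearGroup.coe_mul, -map_zpow,
    Matrix.vecMul, dotProduct]

theorem eq_T_zpow {g : SL(2, ℤ)} (h0 : g 1 0 = 0) (h1 : g 1 1 = 1) : g = T ^ (g 0 1) := by
  have hd := Matrix.det_fin_two g.1
  rw [g.2] at hd
  have h00 : g 0 0 = 1 := by
    have : (1 : ℤ) = g 0 0 * g 1 1 - g 0 1 * g 1 0 := hd
    rw [h0, h1] at this; linarith
  ext i j
  rw [coe_T_zpow]
  fin_cases i <;> fin_cases j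
  · exact h00
  · rfl
  · exact h0
  · exact h1

/-- Unfolding over a double coset of the translation subgroup. -/
theorem hasSum_integral_T_zpow {φ : ℍ → ℂ} (hφT : ∀ z (n : ℤ), φ (T ^ n • z) = φ z)
    (γ : SL(2, ℤ)) (hintg : Integrable fun z => conj (φ z) * φ (γ • z)) :
    HasSum (fun p : ℤ × ℤ => ∫ z, conj (stripCut φ z) * stripCut φ ((T ^ p.1 * γ * T ^ p.2) • z))
      (∫ z, conj (φ z) * φ (γ • z)) := by
  set D : ℤ × ℤ → Set ℍ := fun p => {z | ⌊z.re⌋ = p.2 ∧ ⌊(γ • z).re⌋ = -p.1} with hD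
  have hDm : ∀ p, MeasurableSet (D p) := fun p =>
    ((Int.measurable_floor.comp measurable_re) (measurableSet_singleton p.2)).inter
      ((Int.measurable_floor.comp (measurable_re.comp (measurable_sl_smul γ)))
        (measurableSet_singleton (-p.1)))
  have hDd : Pairwise (Function.onFun Disjoint D) := by
    intro p q hpq
    refine Set.disjoint_left.2 fun z hp hq => hpq (Prod.ext ?_ ?_)
    · have := hp.2.symm.trans hq.2; linarith
    · exact hp.1.symm.trans hq.1
  have hDu : (⋃ p, D p) = Set.univ := by
    refine Set.eq_univ_of_forall fun z => Set.mem_iUnion.2 ⟨(-⌊(γ • z).re⌋, ⌊z.re⌋), rfl, ?_⟩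
    simp [-ModularGroup.sl_moeb]
  have := hasSum_integral_iUnion (f := fun z => conj (φ z) * φ (γ • z)) hDm hDd hintg.integrableOn
  rw [hDu, setIntegral_univ] at this
  convert! this using 2 with p
  rw [← integral_indicator (hDm p), ← integral_sl_smul (T ^ (-p.2)) fun z =>
    conj (stripCut φ z) * stripCut φ ((T ^ p.1 * γ * T ^ p.2) • z)]
  refine integral_congr_ae (Filter.Eventually.of_forall fun z => ?_)
  have h1 : ⌊(T ^ (-p.2) • z).re⌋ = ⌊z.re⌋ - p.2 := by
    rw [re_T_zpow_smul, Int.floor_add_intCast, sub_eq_add_neg]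
  have h2 : (T ^ p.1 * γ * T ^ p.2) • T ^ (-p.2) • z = T ^ p.1 • γ • z := by
    rw [← mul_smul, mul_assoc, ← zpow_add, add_neg_cancel, zpow_zero, mul_one, mul_smul]
  have h3 : ⌊(T ^ p.1 • γ • z).re⌋ = ⌊(γ • z).re⌋ + p.1 := by
    rw [re_T_zpow_smul, Int.floor_add_intCast]
  simp only [stripCut]
  rw [h2, h3, h1, hφT, hφT, Set.indicator_apply]
  simp only [hD, Set.mem_ofPred_eq]
  by_cases e1 : ⌊z.re⌋ = p.2
  · by_cases e2 : ⌊(γ • z).re⌋ = -p.1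
    · rw [if_pos (by omega), if_pos (by omega), if_pos ⟨e1, e2⟩]
    · rw [if_neg (fun h => e2 (by omega) : ¬ ⌊(γ • z).re⌋ + p.1 = 0), mul_zero,
        if_neg fun h => e2 h.2]
  · rw [if_neg (by omega), map_zero, zero_mul, if_neg fun h => e1 h.1]

theorem exists_representatives (c : ℕ) [NeZero c] : ∃ γ : (ZMod c)ˣ → SL(2, ℤ),
    ∀ u, γ u 1 0 = c ∧ ((γ u 1 1 : ℤ) : ZMod c) = u ∧
      ((γ u 0 0 : ℤ) : ZMod c) = ((u⁻¹ : (ZMod c)ˣ) : ZMod c) := by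
  have (u : (ZMod c)ˣ) : ∃ γ : SL(2, ℤ), γ 1 0 = c ∧ ((γ 1 1 : ℤ) : ZMod c) = u ∧
      ((γ 0 0 : ℤ) : ZMod c) = ((u⁻¹ : (ZMod c)ˣ) : ZMod c) := by
    set d : ℤ := (u : ZMod c).cast with hd
    set a : ℤ := ((u⁻¹ : (ZMod c)ˣ) : ZMod c).cast with ha
    have hd' : (d : ZMod c) = u := ZMod.intCast_zmod_cast _
    have ha' : (a : ZMod c) = ((u⁻¹ : (ZMod c)ˣ) : ZMod c) := ZMod.intCast_zmod_cast _
    obtain ⟨b, hb⟩ : (c : ℤ) ∣ a * d - 1 := by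
      rw [← ZMod.intCast_zmod_eq_zero_iff_dvd]
      push_cast
      rw [hd', ha', Units.inv_mul, sub_self]
    refine ⟨⟨!![a, b; c, d], ?_⟩, rfl, hd', ha'⟩
    rw [Matrix.det_fin_two_of]; linarith
  choose γ hγ using this
  exact ⟨γ, hγ⟩

/-- Summation over all matrices with a given lower left entry. -/
theorem sum_filter_eq_of_hasSum (c : ℕ) [NeZero c] (γ : (ZMod c)ˣ → SL(2, ℤ))
    (hγ : ∀ u, γ u 1 0 = c ∧ ((γ u 1 1 : ℤ) : ZMod c) = u) (F : SL(2, ℤ) → ℂ)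
    (H : Finset SL(2, ℤ)) (hH : ∀ h, F h ≠ 0 → h ∈ H) (I : (ZMod c)ˣ → ℂ)
    (hI : ∀ u, HasSum (fun p : ℤ × ℤ => F (T ^ p.1 * γ u * T ^ p.2)) (I u)) :
    ∑ h ∈ H.filter (fun h : SL(2, ℤ) => h 1 0 = (c : ℤ)), F h = ∑ u, I u := by
  have hc : (c : ℤ) ≠ 0 := by exact_mod_cast NeZero.ne c
  set Φ : (ZMod c)ˣ × (ℤ × ℤ) → SL(2, ℤ) := fun q => T ^ q.2.1 * γ q.1 * T ^ q.2.2 with hΦ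
  have hΦ10 : ∀ q, Φ q 1 0 = c := fun q => (entries_T_zpow_mul_mul _ _ _).1.trans (hγ _).1
  have hΦ11 : ∀ q, Φ q 1 1 = c * q.2.2 + γ q.1 1 1 := fun q => by
    rw [hΦ]; simp only; rw [(entries_T_zpow_mul_mul _ _ _).2, (hγ _).1]
  have hinj : Function.Injective Φ := by
    rintro ⟨u, j, m⟩ ⟨u', j', m'⟩ h
    have h11 : (c : ℤ) * m + γ u 1 1 = c * m' + γ u' 1 1 := by
      have := congrArg (fun g : SL(2, ℤ) => g 1 1) h
      simpa only [hΦ11] using this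
    have hu : u = u' := by
      have := congrArg (Int.cast : ℤ → ZMod c) h11
      push_cast at this
      simp only [CharP.cast_eq_zero, zero_mul, zero_add, (hγ _).2] at this
      exact Units.ext this
    subst hu
    have hm : m = m' := by exact mul_left_cancel₀ hc (add_right_cancel h11)
    subst hm
    have hj : T ^ j = T ^ j' := mul_right_cancel (mul_right_cancel h)
    have : (T ^ j) 0 1 = (T ^ j') 0 1 := by rw [hj]
    rw [coe_T_zpow, coe_T_zpow] at this
    simp only [Matrix.of_apply, Matrix.cons_val_zero, Matrix.cons_val_one] at this
    simp [this]
  have hrange : ∀ h : SL(2, ℤ), h 1 0 = c → h ∈ Set.range Φ := by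
    intro h h10
    have hdet : h 0 0 * h 1 1 - h 0 1 * h 1 0 = 1 := by
      have := Matrix.det_fin_two h.1; rw [h.2] at this; exact this.symm
    have hu : ((h 1 1 : ℤ) : ZMod c) * ((h 0 0 : ℤ) : ZMod c) = 1 := by
      have := congrArg (Int.cast : ℤ → ZMod c) hdet
      rw [h10] at this
      push_cast at this
      simp only [CharP.cast_eq_zero, mul_zero, sub_zero] at this
      rw [mul_comm]; exact this
    set u : (ZMod c)ˣ := Units.mkOfMulEqOne _ _ hu
    obtain ⟨m, hm⟩ : (c : ℤ) ∣ h 1 1 - γ u 1 1 := by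
      rw [← ZMod.intCast_zmod_eq_zero_iff_dvd]
      push_cast
      rw [(hγ _).2]; simp [u]
    set g := h * (γ u * T ^ m)⁻¹ with hg
    have hgh : g * (γ u * T ^ m) = h := inv_mul_cancel_right _ _
    have e := entries_T_zpow_mul_mul (γ u) 0 m
    rw [zpow_zero, one_mul, (hγ u).1] at e
    have k10 : (γ u * T ^ m) 1 0 = h 1 0 := by rw [e.1, h10]
    have k11 : (γ u * T ^ m) 1 1 = h 1 1 := by rw [e.2]; linarith
    have hdet' : (γ u * T ^ m) 0 0 * (γ u * T ^ m) 1 1 - (γ u * T ^ m) 0 1 * (γ u * T ^ m) 1 0 = 1 := by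
      have := Matrix.det_fin_two (γ u * T ^ m).1; rw [(γ u * T ^ m).2] at this; exact this.symm
    have hg10 : g 1 0 = 0 := by
      have : g 1 0 = h 1 0 * (γ u * T ^ m) 1 1 - h 1 1 * (γ u * T ^ m) 1 0 := by
        rw [hg]
        simp only [Matrix.SpecialLinearGroup.coe_mul h, Matrix.SpecialLinearGroup.coe_inv,
          Matrix.adjugate_fin_two, Matrix.mul_apply, Fin.sum_univ_two]
        simp; ring
      rw [this, k10, k11]; ring
    have hg11 : g 1 1 = 1 := by
      have : g 1 1 = h 1 1 * (γ u * T ^ m) 0 0 - h 1 0 * (γ u * T ^ m) 0 1 := by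
        rw [hg]
        simp only [Matrix.SpecialLinearGroup.coe_mul h, Matrix.SpecialLinearGroup.coe_inv,
          Matrix.adjugate_fin_two, Matrix.mul_apply, Fin.sum_univ_two]
        simp; ring
      rw [this, ← k10, ← k11]; linarith
    refine ⟨(u, g 0 1, m), ?_⟩
    simp only [hΦ]
    rw [← eq_T_zpow hg10 hg11, mul_assoc, hgh]
  set F' : SL(2, ℤ) → ℂ := fun h => if h 1 0 = (c : ℤ) then F h else 0 with hF'
  have hs : HasSum F' (∑ h ∈ H.filter (fun h : SL(2, ℤ) => h 1 0 = (c : ℤ)), F h) := by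
    rw [Finset.sum_filter]
    refine hasSum_sum_of_ne_finset_zero fun h hh => ?_
    by_contra hne
    exact hh (hH h fun h0 => hne (by simp [hF', h0]))
  have hs2 : HasSum (fun q => F (Φ q)) (∑ h ∈ H.filter (fun h : SL(2, ℤ) => h 1 0 = (c : ℤ)), F h) := by
    rw [← hinj.hasSum_iff (f := F')] at hs
    · convert! hs using 2 with q
      simp [hF', hΦ10]
    · intro h hh
      simp only [hF']
      rw [if_neg fun h10 => hh (hrange h h10)]
  exact (hs2.prod_fiberwise fun u => hI u).unique (hasSum_fintype I)

end UpperHalfPlane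

end

section

open UpperHalfPlane MeasureTheory ModularGroup
open scoped MatrixGroups ComplexConjugate

/-- The additive character `x ↦ exp(2πix)` of the reals. -/
noncomputable def expTwoPi (x : ℝ) : ℂ := Complex.exp ((2 * Real.pi * x : ℝ) * Complex.I)

theorem expTwoPi_add (x y : ℝ) : expTwoPi (x + y) = expTwoPi x * expTwoPi y := by
  unfold expTwoPi
  rw [← Complex.exp_add, ← add_mul, ← Complex.ofReal_add, mul_add]

@[simp] theorem norm_expTwoPi (x : ℝ) : ‖expTwoPi x‖ = 1 := Complex.norm_exp_ofReal_mul_I _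

@[simp] theorem expTwoPi_intCast (n : ℤ) : expTwoPi n = 1 := by
  unfold expTwoPi
  rw [Complex.exp_eq_one_iff]
  exact ⟨n, by push_cast; ring⟩

theorem expTwoPi_zero : expTwoPi 0 = 1 := by simpa using expTwoPi_intCast 0

theorem conj_expTwoPi (x : ℝ) : conj (expTwoPi x) = expTwoPi (-x) := by
  unfold expTwoPi
  rw [← Complex.exp_conj, map_mul, Complex.conj_ofReal, Complex.conj_I]
  congr 1
  push_cast
  ring

theorem continuous_expTwoPi : Continuous expTwoPi := by
  unfold expTwoPi
  fun_prop

theorem norm_expTwoPi_sub_le (x y : ℝ) : ‖expTwoPi x - expTwoPi y‖ ≤ 2 * Real.pi * |x - y| := by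
  have h : expTwoPi x - expTwoPi y = expTwoPi y * (expTwoPi (x - y) - 1) := by
    rw [mul_sub, ← expTwoPi_add]; simp
  rw [h, norm_mul, norm_expTwoPi, one_mul, expTwoPi, mul_comm]
  refine (Real.norm_exp_I_mul_ofReal_sub_one_le).trans ?_
  rw [Real.norm_eq_abs, abs_mul, abs_of_pos (by positivity)]

theorem expTwoPi_intCast_div (j : ℤ) (c : ℕ) [NeZero c] :
    expTwoPi ((j : ℝ) / c) = ZMod.stdAddChar (j : ZMod c) := by
  rw [ZMod.stdAddChar_coe]
  unfold expTwoPi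
  congr 1
  push_cast
  ring

namespace UpperHalfPlane

theorem sl_re_smul (γ : SL(2, ℤ)) (z : ℍ) :
    γ 1 0 * (γ • z).re - γ 0 0 =
      -(γ 1 0 * z.re + γ 1 1) / ((γ 1 0 * z.re + γ 1 1) ^ 2 + (γ 1 0 * z.im) ^ 2) := by
  have h := coe_specialLinearGroup_apply γ z
  have hd : ((γ 1 0 : ℂ) * z + (γ 1 1 : ℂ)) ≠ 0 := by
    have := denom_ne_zero (Matrix.SpecialLinearGroup.mapGL ℝ γ : GL (Fin 2) ℝ) z
    simpa [denom] using this
  simp only [algebraMap_int_eq, eq_intCast, Complex.ofReal_intCast] at h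
  rw [eq_div_iff hd] at h
  have hdet : γ 0 0 * γ 1 1 - γ 0 1 * γ 1 0 = 1 := by
    have := Matrix.det_fin_two γ.1; rw [γ.2] at this; exact this.symm
  have hdet' : (γ 0 0 * γ 1 1 - γ 0 1 * γ 1 0 : ℝ) = 1 := by exact_mod_cast hdet
  have hre := congrArg Complex.re h
  have him := congrArg Complex.im h
  simp [-ModularGroup.sl_moeb] at hre him
  set D := (γ 1 0 * z.re + γ 1 1) ^ 2 + (γ 1 0 * z.im) ^ 2 with hD
  have hDpos : D ≠ 0 := by
    intro h0
    have h1 : (γ 1 0 * z.im : ℝ) = 0 := by nlinarith [sq_nonneg (γ 1 0 * z.re + γ 1 1 : ℝ), sq_nonneg (γ 1 0 * z.im : ℝ)]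
    have h2 : (γ 1 0 * z.re + γ 1 1 : ℝ) = 0 := by nlinarith [sq_nonneg (γ 1 0 * z.re + γ 1 1 : ℝ), sq_nonneg (γ 1 0 * z.im : ℝ)]
    apply hd
    apply Complex.ext
    · simpa using h2
    · simpa using mul_eq_zero.1 h1
  rw [eq_div_iff hDpos, hD]
  linear_combination (γ 1 0 : ℝ) * (γ 1 0 * z.re + γ 1 1) * hre + γ 1 0 * (γ 1 0 * z.im) * him
    - (γ 1 0 * z.re + γ 1 1) * hdet'

theorem integral_add_real {E : Type*} [NormedAddCommGroup E] [NormedSpace ℝ E] (t : ℝ)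
    (f : ℝ → ℝ → E) : ∫ z : ℍ, f (z.re + t) z.im = ∫ z : ℍ, f z.re z.im := by
  set g : SL(2, ℝ) := ⟨!![1, t; 0, 1], by simp⟩
  have hg : ∀ z : ℍ, ((Matrix.SpecialLinearGroup.toGL g • z : ℍ) : ℂ) = z + t := by
    intro z
    have := coe_specialLinearGroup_apply g z
    simp [g] at this
    exact this
  have := integral_smul_eq_self (μ := (volume : Measure ℍ)) (fun z : ℍ => f z.re z.im)
    (g := Matrix.SpecialLinearGroup.toGL g)
  rw [← this]
  refine integral_congr_ae (Filter.Eventually.of_forall fun z => ?_)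
  have h1 := congrArg Complex.re (hg z)
  have h2 := congrArg Complex.im (hg z)
  simp only [coe_re, coe_im, Complex.add_re, Complex.add_im, Complex.ofReal_re,
    Complex.ofReal_im, add_zero] at h1 h2
  simp only [h1, h2]

/-- The summand `Ψ(1/Im z) e(k Re z)` of an incomplete Poincaré series. -/
noncomputable def poincareTerm (Ψ : ℝ → ℂ) (k : ℤ) (z : ℍ) : ℂ :=
  Ψ (1 / z.im) * expTwoPi (k * z.re)

theorem norm_poincareTerm_le {Ψ : ℝ → ℂ} (hΨ : ∀ t, ‖Ψ t‖ ≤ 1) (k : ℤ) (z : ℍ) :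
    ‖poincareTerm Ψ k z‖ ≤ 1 := by
  simpa [poincareTerm] using hΨ _

theorem measurable_poincareTerm {Ψ : ℝ → ℂ} (hΨ : Measurable Ψ) (k : ℤ) :
    Measurable (poincareTerm Ψ k) :=
  (hΨ.comp (measurable_const.div measurable_im)).mul
    (continuous_expTwoPi.measurable.comp (measurable_re.const_mul _))

theorem poincareTerm_T_zpow (Ψ : ℝ → ℂ) (k : ℤ) (z : ℍ) (n : ℤ) :
    poincareTerm Ψ k (T ^ n • z) = poincareTerm Ψ k z := by
  unfold poincareTerm
  rw [im_T_zpow_smul, re_T_zpow_smul, mul_add, expTwoPi_add]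
  have := expTwoPi_intCast (k * n)
  push_cast at this
  rw [this, mul_one]

/-- The kernel of the Kloosterman transform, in the coordinates `x = Re z`, `y = Im z`. -/
noncomputable def kloostermanKernel (Ψ : ℝ → ℂ) (k : ℤ) (c : ℝ) (x y : ℝ) : ℂ :=
  conj (Ψ (1 / y) * expTwoPi (k * x)) *
    (Ψ (c ^ 2 * (x ^ 2 + y ^ 2) / y) * expTwoPi (-(k * x) / (c ^ 2 * (x ^ 2 + y ^ 2))))

theorem integral_poincareTerm_mul (Ψ : ℝ → ℂ) (k : ℤ) (γ : SL(2, ℤ)) (c : ℕ) [NeZero c]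
    (hc : γ 1 0 = c) :
    ∫ z, conj (poincareTerm Ψ k z) * poincareTerm Ψ k (γ • z) =
      ZMod.stdAddChar ((k * (γ 0 0 + γ 1 1) : ℤ) : ZMod c) *
        ∫ z : ℍ, kloostermanKernel Ψ k c z.re z.im := by
  have hc0 : (c : ℝ) ≠ 0 := by exact_mod_cast NeZero.ne c
  rw [← integral_add_real ((γ 1 1 : ℝ) / c) (kloostermanKernel Ψ k c), ← integral_const_mul]
  refine integral_congr_ae (Filter.Eventually.of_forall fun z => ?_)
  have him := sl_im_smul γ z
  have hre := sl_re_smul γ z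
  rw [hc] at him hre
  push_cast at him hre
  set x := z.re
  set y := z.im
  have hy : 0 < y := z.im_pos
  set X := x + (γ 1 1 : ℝ) / c with hX
  have e1 : (c * x + γ 1 1 : ℝ) = c * X := by rw [hX]; field_simp
  rw [e1] at him hre
  have hDpos : 0 < X ^ 2 + y ^ 2 := by positivity
  have e2 : (c * X) ^ 2 + (c * y) ^ 2 = (c ^ 2 * (X ^ 2 + y ^ 2) : ℝ) := by ring
  rw [e2] at him hre
  have hre' : (γ • z).re = γ 0 0 / c + -X / (c ^ 2 * (X ^ 2 + y ^ 2)) := by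
    have : (γ • z).re = (γ 0 0 + (c * (γ • z).re - γ 0 0)) / c := by field_simp; ring
    rw [this, hre]
    field_simp
  simp only [poincareTerm, kloostermanKernel]
  rw [him, hre', ← expTwoPi_intCast_div, map_mul, map_mul, conj_expTwoPi, conj_expTwoPi, one_div_div]
  have e3 : expTwoPi (-(k * x)) = expTwoPi (-(k * X)) * expTwoPi (k * γ 1 1 / c) := by
    rw [← expTwoPi_add, hX]; congr 1; ring
  have e4 : expTwoPi (k * (γ 0 0 / c + -X / (c ^ 2 * (X ^ 2 + y ^ 2)))) =
      expTwoPi (k * γ 0 0 / c) * expTwoPi (-(k * X) / (c ^ 2 * (X ^ 2 + y ^ 2))) := by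
    rw [← expTwoPi_add]; congr 1; ring
  have e5 : expTwoPi (((k * (γ 0 0 + γ 1 1) : ℤ) : ℝ) / c) =
      expTwoPi (k * γ 0 0 / c) * expTwoPi (k * γ 1 1 / c) := by
    rw [← expTwoPi_add]; congr 1; push_cast; ring
  rw [e3, e4, e5]
  ring

theorem norm_integral_kloostermanKernel_le {Ψ : ℝ → ℂ} (hΨ1 : ∀ t, ‖Ψ t‖ ≤ 1) {y₁ y₂ : ℝ}
    (hy₁ : 0 < y₁) (hy : y₁ ≤ y₂)
    (hs : ∀ t, Ψ t ≠ 0 → 1 / y₂ ≤ t ∧ t ≤ 1 / y₁) (k : ℤ) (c : ℕ) (hc : 0 < c) :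
    ‖∫ z : ℍ, kloostermanKernel Ψ k c z.re z.im‖ ≤
      if (c : ℝ) ≤ 1 / y₁ then 2 * √(y₂ / y₁) / c * y₂ / y₁ ^ 2 else 0 := by
  have hc0 : (0 : ℝ) < c := by exact_mod_cast hc
  have hy₂ : 0 < y₂ := hy₁.trans_le hy
  have hne : ∀ z : ℍ, kloostermanKernel Ψ k c z.re z.im ≠ 0 → y₁ ≤ z.im ∧ z.im ≤ y₂ ∧
      c ^ 2 * (z.re ^ 2 + z.im ^ 2) ≤ z.im / y₁ := by
    intro z hz
    have h1 : Ψ (1 / z.im) ≠ 0 := fun h => hz (by simp [kloostermanKernel, -one_div, h])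
    have h2 : Ψ (c ^ 2 * (z.re ^ 2 + z.im ^ 2) / z.im) ≠ 0 := fun h =>
      hz (by simp [kloostermanKernel, -one_div, h])
    obtain ⟨h3, h4⟩ := hs _ h1
    have := (hs _ h2).2
    have hz0 := z.im_pos
    refine ⟨(one_div_le_one_div hz0 hy₁).1 h4, (one_div_le_one_div hy₂ hz0).1 h3, ?_⟩
    rw [div_le_div_iff₀ hz0 hy₁] at this
    rw [le_div_iff₀ hy₁]; linarith
  split_ifs with hcy
  · have := norm_integral_le_of_support_rect (f := fun z : ℍ => kloostermanKernel Ψ k c z.re z.im)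
      (fun z => ?_) (x₁ := -(√(y₂ / y₁) / c)) (x₂ := √(y₂ / y₁) / c) (y₂ := y₂)
      ?_ hy₁ hy₂.le (fun z hz => ?_)
    · refine this.trans (le_of_eq ?_); ring
    · simp only [kloostermanKernel, norm_mul, RCLike.norm_conj, norm_expTwoPi, mul_one]
      exact mul_le_one₀ (hΨ1 _) (norm_nonneg _) (hΨ1 _)
    · have : 0 ≤ √(y₂ / y₁) / c := by positivity
      linarith
    · obtain ⟨h1, h2, h3⟩ := hne z hz
      have : |z.re| ≤ √(y₂ / y₁) / c := by
        rw [le_div_iff₀ hc0, ← abs_of_pos hc0, ← abs_mul]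
        refine Real.abs_le_sqrt ?_
        calc (z.re * c) ^ 2 ≤ c ^ 2 * (z.re ^ 2 + z.im ^ 2) := by
              have : 0 ≤ (c * z.im) ^ 2 := sq_nonneg _
              linarith [this]
          _ ≤ z.im / y₁ := h3
          _ ≤ y₂ / y₁ := by gcongr
      exact ⟨(abs_le.1 this).1, (abs_le.1 this).2, h1, h2⟩
  · have : ∀ z : ℍ, kloostermanKernel Ψ k c z.re z.im = 0 := by
      intro z
      by_contra hz
      obtain ⟨h1, h2, h3⟩ := hne z hz
      have hz0 := z.im_pos
      apply hcy
      rw [le_div_iff₀ hy₁] at h3 ⊢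
      have h4 : c ^ 2 * z.im * y₁ ≤ 1 := by
        have h5 : z.im * (c ^ 2 * z.im * y₁) ≤ z.im * 1 := by
          have : 0 ≤ (c * z.re) ^ 2 * y₁ := by positivity
          linarith [this]
        exact le_of_mul_le_mul_left h5 hz0
      have h6 : (c * y₁) ^ 2 ≤ 1 := by
        refine le_trans ?_ h4
        have : 0 ≤ c ^ 2 * y₁ * (z.im - y₁) := by
          have := sub_nonneg.2 h1; positivity
        linarith [this]
      have := abs_le_of_sq_le_sq (a := (c * y₁ : ℝ)) (b := 1) (by linarith) zero_le_one
      exact (abs_le.1 this).2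
    simp [this]

end UpperHalfPlane

end

section

open UpperHalfPlane MeasureTheory ModularGroup
open scoped MatrixGroups ComplexConjugate

namespace UpperHalfPlane

/-- The matrix coefficient `⟨a, a ∘ h⟩` for the truncated Poincaré term `a`. -/
noncomputable def stripInner (Ψ : ℝ → ℂ) (k : ℤ) (h : SL(2, ℤ)) : ℂ :=
  ∫ z, conj (stripCut (poincareTerm Ψ k) z) * stripCut (poincareTerm Ψ k) (h • z)

theorem stripInner_neg (Ψ : ℝ → ℂ) (k : ℤ) (h : SL(2, ℤ)) :
    stripInner Ψ k (-h) = stripInner Ψ k h := by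
  unfold stripInner
  simp only [ModularGroup.SL_neg_smul]

theorem exists_of_stripInner_ne_zero {Ψ : ℝ → ℂ} {k : ℤ} {h : SL(2, ℤ)}
    (hh : stripInner Ψ k h ≠ 0) : ∃ z, stripCut (poincareTerm Ψ k) z ≠ 0 ∧
      stripCut (poincareTerm Ψ k) (h • z) ≠ 0 := by
  by_contra! hc
  refine hh ?_
  unfold stripInner
  rw [← integral_zero ℍ ℂ]
  refine integral_congr_ae (Filter.Eventually.of_forall fun z => ?_)
  by_cases hz : stripCut (poincareTerm Ψ k) z = 0
  · simp [-ModularGroup.sl_moeb, hz]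
  · simp [-ModularGroup.sl_moeb, hc z hz]

theorem poincareTerm_support {Ψ : ℝ → ℂ} {y₁ y₂ : ℝ} (hy₁ : 0 < y₁) (hy₂ : 0 < y₂)
    (hs : ∀ t, Ψ t ≠ 0 → 1 / y₂ ≤ t ∧ t ≤ 1 / y₁) (k : ℤ) (z : ℍ)
    (hz : poincareTerm Ψ k z ≠ 0) : y₁ ≤ z.im ∧ z.im ≤ y₂ := by
  obtain ⟨h1, h2⟩ := hs _ (left_ne_zero_of_mul hz)
  exact ⟨(one_div_le_one_div z.im_pos hy₁).1 h2, (one_div_le_one_div hy₂ z.im_pos).1 h1⟩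

theorem norm_stripInner_le {Ψ : ℝ → ℂ} (hΨ1 : ∀ t, ‖Ψ t‖ ≤ 1) {y₁ y₂ : ℝ} (hy₁ : 0 < y₁)
    (hy₂ : 0 < y₂) (hs : ∀ t, Ψ t ≠ 0 → 1 / y₂ ≤ t ∧ t ≤ 1 / y₁) (k : ℤ) (h : SL(2, ℤ)) :
    ‖stripInner Ψ k h‖ ≤ y₂ / y₁ ^ 2 := by
  have := norm_integral_le_of_support_rect (f := fun z => conj (stripCut (poincareTerm Ψ k) z) *
    stripCut (poincareTerm Ψ k) (h • z)) (x₁ := 0) (x₂ := 1) (y₁ := y₁) (y₂ := y₂)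
    (fun z => ?_) zero_le_one hy₁ hy₂.le fun z hz => ?_
  · rwa [sub_zero, one_mul] at this
  · rw [norm_mul, RCLike.norm_conj]
    exact mul_le_one₀ (norm_stripCut_le (norm_poincareTerm_le hΨ1 k) z) (norm_nonneg _)
      (norm_stripCut_le (norm_poincareTerm_le hΨ1 k) _)
  · exact stripCut_mem_rect (poincareTerm_support hy₁ hy₂ hs k) z
      fun h0 => hz (by rw [h0, map_zero, zero_mul])

theorem eq_one_or_neg_one_of_stripInner_ne_zero {Ψ : ℝ → ℂ} {k : ℤ} {h : SL(2, ℤ)}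
    (hh : stripInner Ψ k h ≠ 0) (h10 : h 1 0 = 0) : h = 1 ∨ h = -1 := by
  have key : ∀ g : SL(2, ℤ), stripInner Ψ k g ≠ 0 → g 1 0 = 0 → g 1 1 = 1 → g = 1 := by
    intro g hg g10 g11
    have e := eq_T_zpow g10 g11
    obtain ⟨z, h1, h2⟩ := exists_of_stripInner_ne_zero hg
    have h3 : ⌊z.re⌋ = 0 := by by_contra h; exact h1 (if_neg h)
    have h4 : ⌊(g • z).re⌋ = 0 := by by_contra h; exact h2 (if_neg h)
    rw [e, re_T_zpow_smul, Int.floor_add_intCast, h3, zero_add] at h4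
    rw [e, h4, zpow_zero]
  have hdet : h 0 0 * h 1 1 - h 0 1 * h 1 0 = 1 := by
    have := Matrix.det_fin_two h.1; rw [h.2] at this; exact this.symm
  rw [h10, mul_zero, sub_zero, mul_comm] at hdet
  rcases Int.eq_one_or_neg_one_of_mul_eq_one hdet with h11 | h11
  · exact Or.inl (key h hh h10 h11)
  · right
    have := key (-h) (by rwa [stripInner_neg]) (by simp [h10]) (by simp [h11])
    rw [← this, neg_neg]

theorem integrable_poincareTerm_mul {Ψ : ℝ → ℂ} (hΨ : Measurable Ψ) (hΨ1 : ∀ t, ‖Ψ t‖ ≤ 1)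
    {y₁ y₂ : ℝ} (hy₁ : 0 < y₁) (hy₂ : 0 < y₂)
    (hs : ∀ t, Ψ t ≠ 0 → 1 / y₂ ≤ t ∧ t ≤ 1 / y₁) (k : ℤ) (γ : SL(2, ℤ)) (hc : 0 < γ 1 0) :
    Integrable fun z => conj (poincareTerm Ψ k z) * poincareTerm Ψ k (γ • z) := by
  set M := √(y₂ / y₁) with hM
  refine integrable_of_support_rect (C := 1) (x₁ := -(M + |(γ 1 1 : ℝ)|)) (x₂ := M + |(γ 1 1 : ℝ)|)
    (y₂ := y₂) ?_ (fun z => ?_) hy₁ fun z hz => ?_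
  · exact (Complex.continuous_conj.measurable.comp (measurable_poincareTerm hΨ k)).mul
      ((measurable_poincareTerm hΨ k).comp (measurable_sl_smul _))
  · rw [norm_mul, RCLike.norm_conj]
    exact mul_le_one₀ (norm_poincareTerm_le hΨ1 k z) (norm_nonneg _)
      (norm_poincareTerm_le hΨ1 k _)
  · obtain ⟨h1, h2⟩ := poincareTerm_support hy₁ hy₂ hs k z fun h0 => hz (by rw [h0]; simp)
    obtain ⟨h3, -⟩ := poincareTerm_support hy₁ hy₂ hs k _ (right_ne_zero_of_mul hz)
    have hz0 := z.im_pos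
    have hcR : (1 : ℝ) ≤ γ 1 0 := by exact_mod_cast hc
    rw [sl_im_smul, le_div_iff₀ (by positivity)] at h3
    have h4 : |(γ 1 0 * z.re + γ 1 1 : ℝ)| ≤ M := by
      refine Real.abs_le_sqrt ?_
      rw [le_div_iff₀ hy₁]
      have : 0 ≤ y₁ * (γ 1 0 * z.im) ^ 2 := by positivity
      linarith
    have h5 : |(γ 1 0 * z.re : ℝ)| ≤ M + |(γ 1 1 : ℝ)| := by
      have e : (γ 1 0 * z.re : ℝ) = (γ 1 0 * z.re + γ 1 1) - γ 1 1 := by ring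
      rw [e]
      exact (abs_sub _ _).trans (by linarith)
    have h6 : |z.re| ≤ M + |(γ 1 1 : ℝ)| := by
      refine le_trans ?_ h5
      rw [abs_mul, abs_of_pos (by linarith : (0 : ℝ) < γ 1 0)]
      nlinarith [abs_nonneg z.re]
    exact ⟨(abs_le.1 h6).1, (abs_le.1 h6).2, h1, h2⟩

theorem norm_sum_stripInner_eq_le {Ψ : ℝ → ℂ} (hΨ : Measurable Ψ) (hΨ1 : ∀ t, ‖Ψ t‖ ≤ 1)
    {y₁ y₂ : ℝ} (hy₁ : 0 < y₁) (hy : y₁ ≤ y₂)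
    (hs : ∀ t, Ψ t ≠ 0 → 1 / y₂ ≤ t ∧ t ≤ 1 / y₁) (k : ℤ) (c : ℕ) (hc : 0 < c)
    (H : Finset SL(2, ℤ)) (hH : ∀ h, stripInner Ψ k h ≠ 0 → h ∈ H) :
    ‖∑ h ∈ H.filter (fun h : SL(2, ℤ) => h 1 0 = (c : ℤ)), stripInner Ψ k h‖ ≤
      if (c : ℝ) ≤ 1 / y₁ then 2 * √(y₂ / y₁) * y₂ / y₁ ^ 2 * (kloostermanNorm k c / c) else 0 := by
  have : NeZero c := ⟨hc.ne'⟩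
  obtain ⟨γ, hγ⟩ := exists_representatives c
  rw [sum_filter_eq_of_hasSum c γ (fun u => ⟨(hγ u).1, (hγ u).2.1⟩) (stripInner Ψ k) H hH
    (fun u => ∫ z, conj (poincareTerm Ψ k z) * poincareTerm Ψ k (γ u • z)) fun u =>
      hasSum_integral_T_zpow (poincareTerm_T_zpow Ψ k) (γ u)
        (integrable_poincareTerm_mul hΨ hΨ1 hy₁ (hy₁.trans_le hy) hs k _ (by
          rw [(hγ u).1]; exact_mod_cast hc))]
  simp only [integral_poincareTerm_mul Ψ k _ c (hγ _).1]
  rw [← Finset.sum_mul, norm_mul]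
  have e : ‖∑ u, (ZMod.stdAddChar ((k * (γ u 0 0 + γ u 1 1) : ℤ) : ZMod c) : ℂ)‖ =
      kloostermanNorm k c := by
    simp only [kloostermanNorm, dif_neg hc.ne', kloosterman]
    congr 1
    refine Finset.sum_congr rfl fun u _ => ?_
    congr 1
    push_cast
    rw [(hγ u).2.1, (hγ u).2.2]
    ring
  have hk0 : 0 ≤ kloostermanNorm k c := e ▸ norm_nonneg _
  rw [e]
  refine (mul_le_mul_of_nonneg_left
    (norm_integral_kloostermanKernel_le hΨ1 hy₁ hy hs k c hc) hk0).trans (le_of_eq ?_)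
  split_ifs
  · ring
  · ring

theorem norm_sum_stripInner_pos_le {Ψ : ℝ → ℂ} (hΨ : Measurable Ψ) (hΨ1 : ∀ t, ‖Ψ t‖ ≤ 1)
    {y₁ y₂ : ℝ} (hy₁ : 0 < y₁) (hy : y₁ ≤ y₂)
    (hs : ∀ t, Ψ t ≠ 0 → 1 / y₂ ≤ t ∧ t ≤ 1 / y₁) (k : ℤ) (q : ℕ)
    (H : Finset SL(2, ℤ)) (hH : ∀ h, stripInner Ψ k h ≠ 0 → h ∈ H) :
    ‖∑ h ∈ H.filter (fun h : SL(2, ℤ) => 0 < h 1 0 ∧ (q : ℤ) ∣ h 1 0), stripInner Ψ k h‖ ≤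
      2 * √(y₂ / y₁) * y₂ / y₁ ^ 2 * ∑ c ∈ (Finset.Icc 1 ⌊1 / y₁⌋₊).filter (q ∣ ·),
        kloostermanNorm k c / c := by
  classical
  set H' := H.filter (fun h : SL(2, ℤ) => 0 < h 1 0 ∧ (q : ℤ) ∣ h 1 0) with hH'
  set C := H'.image (fun h : SL(2, ℤ) => (h 1 0).toNat) with hC
  have hCmem : ∀ c ∈ C, 0 < c ∧ q ∣ c := by
    intro c hc
    obtain ⟨h, hh, rfl⟩ := Finset.mem_image.1 hc
    obtain ⟨-, h1, h2⟩ := Finset.mem_filter.1 hh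
    refine ⟨by omega, ?_⟩
    rw [← Int.natCast_dvd_natCast, Int.toNat_of_nonneg h1.le]; exact h2
  rw [← Finset.sum_fiberwise_of_maps_to (t := C) (g := fun h : SL(2, ℤ) => (h 1 0).toNat)
    fun h hh => Finset.mem_image_of_mem _ hh]
  refine (norm_sum_le _ _).trans ?_
  have hfib : ∀ c ∈ C, H'.filter (fun h : SL(2, ℤ) => (h 1 0).toNat = c) =
      H.filter (fun h : SL(2, ℤ) => h 1 0 = (c : ℤ)) := by
    intro c hc
    obtain ⟨hc0, hcq⟩ := hCmem c hc
    ext h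
    simp only [hH', Finset.mem_filter]
    constructor
    · rintro ⟨⟨h1, h2, h3⟩, h4⟩
      exact ⟨h1, by omega⟩
    · rintro ⟨h1, h2⟩
      refine ⟨⟨h1, by omega, ?_⟩, by omega⟩
      rw [h2]; exact_mod_cast hcq
  rw [Finset.mul_sum]
  calc ∑ c ∈ C, ‖∑ h ∈ H'.filter (fun h : SL(2, ℤ) => (h 1 0).toNat = c), stripInner Ψ k h‖
      ≤ ∑ c ∈ C, if (c : ℝ) ≤ 1 / y₁ then
          2 * √(y₂ / y₁) * y₂ / y₁ ^ 2 * (kloostermanNorm k c / c) else 0 := by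
        refine Finset.sum_le_sum fun c hc => ?_
        rw [hfib c hc]
        exact norm_sum_stripInner_eq_le hΨ hΨ1 hy₁ hy hs k c (hCmem c hc).1 H hH
    _ = ∑ c ∈ C.filter (fun c : ℕ => (c : ℝ) ≤ 1 / y₁),
          2 * √(y₂ / y₁) * y₂ / y₁ ^ 2 * (kloostermanNorm k c / c) := by
        rw [Finset.sum_filter]
    _ ≤ _ := by
        refine Finset.sum_le_sum_of_subset_of_nonneg ?_ fun c _ _ => ?_
        · intro c hc
          obtain ⟨h1, h2⟩ := Finset.mem_filter.1 hc
          exact Finset.mem_filter.2 ⟨Finset.mem_Icc.2 ⟨(hCmem c h1).1, Nat.le_floor h2⟩,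
            (hCmem c h1).2⟩
        · have : 0 ≤ kloostermanNorm k c := by
            unfold kloostermanNorm
            split_ifs <;> positivity
          have hy₂ := hy₁.trans_le hy
          positivity

theorem norm_sum_stripInner_le {Ψ : ℝ → ℂ} (hΨ : Measurable Ψ) (hΨ1 : ∀ t, ‖Ψ t‖ ≤ 1)
    {y₁ y₂ : ℝ} (hy₁ : 0 < y₁) (hy : y₁ ≤ y₂)
    (hs : ∀ t, Ψ t ≠ 0 → 1 / y₂ ≤ t ∧ t ≤ 1 / y₁) (k : ℤ) (q : ℕ)
    (H : Finset SL(2, ℤ)) (hH : ∀ h, stripInner Ψ k h ≠ 0 → h ∈ H) :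
    ‖∑ h ∈ H.filter (fun h : SL(2, ℤ) => (q : ℤ) ∣ h 1 0), stripInner Ψ k h‖ ≤
      y₂ / y₁ ^ 2 * (2 + 4 * √(y₂ / y₁) * ∑ c ∈ (Finset.Icc 1 ⌊1 / y₁⌋₊).filter (q ∣ ·),
        kloostermanNorm k c / c) := by
  classical
  have hy₂ := hy₁.trans_le hy
  set B := ∑ c ∈ (Finset.Icc 1 ⌊1 / y₁⌋₊).filter (q ∣ ·), kloostermanNorm k c / c
  have hpos := norm_sum_stripInner_pos_le hΨ hΨ1 hy₁ hy hs k q H hH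
  have hneg := norm_sum_stripInner_pos_le hΨ hΨ1 hy₁ hy hs k q (H.image fun h => -h) fun h hh =>
    Finset.mem_image.2 ⟨-h, hH _ (by rwa [stripInner_neg]), neg_neg h⟩
  set H' := H.filter (fun h : SL(2, ℤ) => (q : ℤ) ∣ h 1 0)
  have e1 : ∑ h ∈ H', stripInner Ψ k h = ∑ h ∈ H'.filter (fun h : SL(2, ℤ) => h 1 0 = 0),
      stripInner Ψ k h + (∑ h ∈ H.filter (fun h : SL(2, ℤ) => 0 < h 1 0 ∧ (q : ℤ) ∣ h 1 0),
      stripInner Ψ k h + ∑ h ∈ (H.image fun h => -h).filter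
        (fun h : SL(2, ℤ) => 0 < h 1 0 ∧ (q : ℤ) ∣ h 1 0), stripInner Ψ k h) := by
    rw [← Finset.sum_filter_add_sum_filter_not H' (fun h : SL(2, ℤ) => h 1 0 = 0)]
    congr 1
    rw [← Finset.sum_filter_add_sum_filter_not (H'.filter _) (fun h : SL(2, ℤ) => 0 < h 1 0)]
    congr 1
    · refine Finset.sum_congr ?_ fun _ _ => rfl
      ext h
      simp only [H', Finset.mem_filter]
      constructor
      · rintro ⟨⟨⟨h1, h2⟩, h3⟩, h4⟩; exact ⟨h1, h4, h2⟩
      · rintro ⟨h1, h2, h3⟩; exact ⟨⟨⟨h1, h3⟩, h2.ne'⟩, h2⟩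
    · refine Finset.sum_bij (fun h _ => -h) ?_ (fun _ _ _ _ h => neg_injective h) ?_
        fun h _ => (stripInner_neg Ψ k h).symm
      · intro h hh
        simp only [H', Finset.mem_filter, Finset.mem_image] at hh ⊢
        obtain ⟨⟨⟨h1, h2⟩, h3⟩, h4⟩ := hh
        refine ⟨⟨h, h1, rfl⟩, ?_, ?_⟩
        · simp only [Matrix.SpecialLinearGroup.coe_neg, Matrix.neg_apply]; omega
        · simpa using h2
      · intro h hh
        simp only [Finset.mem_filter, Finset.mem_image] at hh
        obtain ⟨⟨g, h1, rfl⟩, h2, h3⟩ := hh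
        simp only [Matrix.SpecialLinearGroup.coe_neg, Matrix.neg_apply] at h2 h3
        refine ⟨g, ?_, rfl⟩
        simp only [H', Finset.mem_filter]
        exact ⟨⟨⟨h1, by simpa using h3⟩, by omega⟩, by omega⟩
  have h0 : ‖∑ h ∈ H'.filter (fun h : SL(2, ℤ) => h 1 0 = 0), stripInner Ψ k h‖ ≤
      2 * (y₂ / y₁ ^ 2) := by
    rw [← Finset.sum_filter_ne_zero]
    refine (norm_sum_le_of_le _ fun h _ => norm_stripInner_le hΨ1 hy₁ hy₂ hs k h).trans ?_
    rw [Finset.sum_const, nsmul_eq_mul]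
    gcongr
    have : ((H'.filter (fun h : SL(2, ℤ) => h 1 0 = 0)).filter
        fun h => stripInner Ψ k h ≠ 0) ⊆ {1, -1} := by
      intro h hh
      simp only [Finset.mem_filter] at hh
      rcases eq_one_or_neg_one_of_stripInner_ne_zero hh.2 hh.1.2 with h | h <;> simp [h]
    exact_mod_cast (Finset.card_le_card this).trans Finset.card_le_two
  rw [e1]
  refine (norm_add_le _ _).trans ((add_le_add h0 ((norm_add_le _ _).trans
    (add_le_add hpos hneg))).trans (le_of_eq ?_))
  ring

end UpperHalfPlane

end

section

open UpperHalfPlane MeasureTheory ModularGroup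
open scoped MatrixGroups ComplexConjugate

theorem exists_sl_of_dvd (n : ℕ) (hn : 0 < n) (ν : ℤ) (h : (n : ℤ) ∣ ν ^ 2 + 1) :
    ∃ g : SL(2, ℤ), g 1 0 ^ 2 + g 1 1 ^ 2 = n ∧ g 0 0 * g 1 0 + g 0 1 * g 1 1 = ν := by
  induction n using Nat.strong_induction_on generalizing ν with
  | _ n ih =>
    rcases Nat.lt_or_ge 1 n with h1 | h1
    · set ν₀ : ℤ := Int.bmod ν n with hν₀
      obtain ⟨j, hj⟩ : (n : ℤ) ∣ ν - ν₀ := by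
        rw [hν₀]; exact Int.dvd_self_sub_bmod
      have hle : ν₀ ≤ n / 2 := by have := Int.bmod_le (x := ν) (m := n) hn; omega
      have hge : -(n / 2 : ℤ) ≤ ν₀ := by have := Int.le_bmod (x := ν) (m := n) hn; omega
      have hd : (n : ℤ) ∣ ν₀ ^ 2 + 1 := by
        have : ν₀ ^ 2 + 1 = (ν ^ 2 + 1) - n * (j * (ν + ν₀)) := by linear_combination -(ν + ν₀) * hj
        rw [this]; exact dvd_sub h (dvd_mul_right _ _)
      obtain ⟨m, hm⟩ := hd
      have hmpos : 0 < m := by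
        by_contra! hm0
        have : (n : ℤ) * m ≤ 0 := mul_nonpos_of_nonneg_of_nonpos (by positivity) hm0
        nlinarith [sq_nonneg ν₀]
      have hmn : m < n := by
        have h2 : 2 * ν₀ ≤ n := by omega
        have h3 : -(n : ℤ) ≤ 2 * ν₀ := by omega
        by_contra! hc
        have h4 : (n : ℤ) * n ≤ n * m := mul_le_mul_of_nonneg_left hc (by positivity)
        have h5 : (2 : ℤ) ≤ n := by exact_mod_cast h1
        nlinarith
      lift m to ℕ using hmpos.le
      obtain ⟨g, hg1, hg2⟩ := ih m (by exact_mod_cast hmn) (by exact_mod_cast hmpos) (-ν₀)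
        ⟨n, by rw [neg_sq, hm]; ring⟩
      have hdet : g 0 0 * g 1 1 - g 0 1 * g 1 0 = 1 := by
        have := Matrix.det_fin_two g.1; rw [g.2] at this; exact this.symm
      have hrow : g 0 0 ^ 2 + g 0 1 ^ 2 = n := by
        have e : (g 0 0 ^ 2 + g 0 1 ^ 2) * (m : ℤ) = n * m := by
          rw [← hm, ← hg1]
          linear_combination (g 0 0 * g 1 0 + g 0 1 * g 1 1 - ν₀) * hg2 +
            (g 0 0 * g 1 1 - g 0 1 * g 1 0 + 1) * hdet
        exact mul_right_cancel₀ (by exact_mod_cast hmpos.ne') e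
      refine ⟨⟨!![-g 1 0 + j * g 0 0, -g 1 1 + j * g 0 1; g 0 0, g 0 1], ?_⟩, ?_, ?_⟩
      · rw [Matrix.det_fin_two_of]; linear_combination hdet
      · exact hrow
      · show (-g 1 0 + j * g 0 0) * g 0 0 + (-g 1 1 + j * g 0 1) * g 0 1 = ν
        linear_combination j * hrow - hg2 - hj
    · obtain rfl : n = 1 := by omega
      refine ⟨⟨!![1, ν; 0, 1], by simp⟩, ?_, ?_⟩
      · show (0 : ℤ) ^ 2 + 1 ^ 2 = _; norm_num
      · show 1 * 0 + ν * 1 = ν; ring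

/-- The roots of `ν² ≡ -1` modulo `n`, as residues in `[0, n)`. -/
def rootsNegOne (n : ℕ) : Finset ℕ := (Finset.range n).filter fun ν => n ∣ ν ^ 2 + 1

/-- The exponential sum over the roots of `ν² ≡ -1` modulo `n` at frequency `k`. -/
noncomputable def rootSum (k : ℤ) (n : ℕ) : ℂ :=
  ∑ ν ∈ rootsNegOne n, expTwoPi (k * ((ν : ℝ) / n))

namespace UpperHalfPlane

theorem sl_smul_I_im (g : SL(2, ℤ)) :
    (g • I).im = 1 / (((g 1 0 ^ 2 + g 1 1 ^ 2 : ℤ)) : ℝ) := by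
  rw [sl_im_smul]; push_cast; simp; ring

theorem sl_det (g : SL(2, ℤ)) : g 0 0 * g 1 1 - g 0 1 * g 1 0 = 1 := by
  have := Matrix.det_fin_two g.1; rw [g.2] at this; exact this.symm

theorem sl_bottom_pos (g : SL(2, ℤ)) : 0 < g 1 0 ^ 2 + g 1 1 ^ 2 := by
  have := sl_det g
  by_contra! h
  have h1 : g 1 0 = 0 := by nlinarith [sq_nonneg (g 1 0), sq_nonneg (g 1 1)]
  have h2 : g 1 1 = 0 := by nlinarith [sq_nonneg (g 1 0), sq_nonneg (g 1 1)]
  simp [h1, h2] at this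

theorem sl_smul_I_re (g : SL(2, ℤ)) :
    (g • I).re = ((g 0 0 * g 1 0 + g 0 1 * g 1 1 : ℤ) : ℝ) / ((g 1 0 ^ 2 + g 1 1 ^ 2 : ℤ) : ℝ) := by
  have h := coe_specialLinearGroup_apply g I
  have hd : ((g 1 0 : ℂ) * I + (g 1 1 : ℂ)) ≠ 0 := by
    have := denom_ne_zero (Matrix.SpecialLinearGroup.mapGL ℝ g : GL (Fin 2) ℝ) I
    simpa [denom] using this
  have hp : (0 : ℝ) < ((g 1 0 ^ 2 + g 1 1 ^ 2 : ℤ) : ℝ) := by exact_mod_cast sl_bottom_pos g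
  have e := congrArg Complex.re h
  rw [coe_re] at e
  rw [e, Complex.div_re]
  push_cast at hp ⊢
  simp only [eq_intCast, Complex.add_re, Complex.add_im, Complex.mul_re, Complex.mul_im,
    Complex.I_re, Complex.I_im, Complex.normSq_apply, Complex.ofReal_intCast, Complex.intCast_re,
    Complex.intCast_im]
  generalize ((g 1 0 : ℤ) : ℝ) = c at *
  generalize ((g 1 1 : ℤ) : ℝ) = d at *
  have : c * c + d * d ≠ 0 := by nlinarith
  simp only [mul_zero, mul_one, sub_self, zero_add, add_zero]
  rw [← add_div, div_eq_div_iff (by rwa [add_comm]) hp.ne']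
  ring

/-- The finite set of `g` with `g • i` in the unit strip, lower bottom-row norm at most `N` and
divisible by `q`. -/
theorem finite_strip (q N : ℕ) : {g : SL(2, ℤ) | ⌊(g • I).re⌋ = 0 ∧ g 1 0 ^ 2 + g 1 1 ^ 2 ≤ N ∧
    (q : ℤ) ∣ g 1 0 ^ 2 + g 1 1 ^ 2}.Finite := by
  refine (finite_box_return (y₁ := 1 / (N + 1 : ℝ)) (by positivity) 1).subset ?_
  rintro g ⟨h1, h2, -⟩
  have hp : (1 : ℝ) ≤ ((g 1 0 ^ 2 + g 1 1 ^ 2 : ℤ) : ℝ) := by exact_mod_cast sl_bottom_pos g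
  have h2' : ((g 1 0 ^ 2 + g 1 1 ^ 2 : ℤ) : ℝ) ≤ N := by exact_mod_cast h2
  rw [Int.floor_eq_zero_iff] at h1
  refine ⟨I, ⟨by simp, ?_, by simp⟩, ⟨?_, ?_, ?_⟩⟩
  · rw [I_im, div_le_one (by positivity)]
    have : (0 : ℝ) ≤ N := by positivity
    linarith
  · rw [abs_of_nonneg h1.1]; exact h1.2.le
  · rw [sl_smul_I_im]
    exact one_div_le_one_div_of_le (by linarith) (by linarith)
  · rw [sl_smul_I_im, div_le_one (by linarith)]; exact hp

noncomputable def stripSet (q N : ℕ) : Finset SL(2, ℤ) := (finite_strip q N).toFinset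

theorem mem_stripSet {q N : ℕ} {g : SL(2, ℤ)} : g ∈ stripSet q N ↔ ⌊(g • I).re⌋ = 0 ∧
    g 1 0 ^ 2 + g 1 1 ^ 2 ≤ N ∧ (q : ℤ) ∣ g 1 0 ^ 2 + g 1 1 ^ 2 := by
  rw [stripSet, Set.Finite.mem_toFinset]; rfl

theorem sum_stripSet {M : Type*} [AddCommMonoid M] (q N : ℕ) (f : ℍ → M) (F : ℕ → ℕ → M)
    (hfF : ∀ (z : ℍ) (n ν : ℕ), 0 < n → z.im = 1 / n → z.re = ν / n → f z = F n ν) :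
    ∑ g ∈ stripSet q N, f (g • I) =
      4 • ∑ n ∈ (Finset.Icc 1 N).filter (q ∣ ·), ∑ ν ∈ rootsNegOne n, F n ν := by
  classical
  have hmem : ∀ g ∈ stripSet q N, ∃ n ν : ℕ, (n : ℤ) = g 1 0 ^ 2 + g 1 1 ^ 2 ∧
      (ν : ℤ) = g 0 0 * g 1 0 + g 0 1 * g 1 1 ∧ 0 < n ∧ n ≤ N ∧ q ∣ n ∧ ν < n ∧ n ∣ ν ^ 2 + 1 := by
    intro g hg
    obtain ⟨h1, h2, h3⟩ := mem_stripSet.1 hg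
    have hp := sl_bottom_pos g
    rw [Int.floor_eq_zero_iff, sl_smul_I_re] at h1
    obtain ⟨n, hn⟩ := Int.eq_ofNat_of_zero_le hp.le
    rw [hn] at h1 h2 h3 hp
    have hn0 : 0 < n := by exact_mod_cast hp
    have hnR : (0 : ℝ) < n := by exact_mod_cast hn0
    have h1a := h1.1
    have h1b := h1.2
    simp only [Int.cast_natCast] at h1a h1b
    rw [div_lt_one hnR] at h1b
    have h4 : 0 ≤ g 0 0 * g 1 0 + g 0 1 * g 1 1 := by
      have := mul_nonneg h1a hnR.le
      rw [div_mul_cancel₀ _ hnR.ne'] at this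
      exact_mod_cast this
    obtain ⟨ν, hν⟩ := Int.eq_ofNat_of_zero_le h4
    rw [hν] at h1b
    refine ⟨n, ν, hn.symm, hν.symm, hn0, by exact_mod_cast h2, by exact_mod_cast h3,
      by exact_mod_cast h1b, ?_⟩
    have : (n : ℤ) ∣ (ν : ℤ) ^ 2 + 1 := ⟨g 0 0 ^ 2 + g 0 1 ^ 2, by
      rw [← hν, ← hn]
      linear_combination (-(g 0 0 * g 1 1 - g 0 1 * g 1 0) - 1) * sl_det g⟩
    exact_mod_cast this
  set m : SL(2, ℤ) → (_ : ℕ) × ℕ := fun g =>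
    ⟨(g 1 0 ^ 2 + g 1 1 ^ 2).toNat, (g 0 0 * g 1 0 + g 0 1 * g 1 1).toNat⟩ with hm
  have hmaps : ∀ g ∈ stripSet q N, m g ∈ ((Finset.Icc 1 N).filter (q ∣ ·)).sigma rootsNegOne := by
    intro g hg
    obtain ⟨n, ν, h1, h2, h3, h4, h5, h6, h7⟩ := hmem g hg
    simp only [hm, ← h1, ← h2, Int.toNat_natCast, Finset.mem_sigma, Finset.mem_filter,
      Finset.mem_Icc, rootsNegOne, Finset.mem_range]
    exact ⟨⟨⟨h3, h4⟩, h5⟩, h6, h7⟩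
  rw [← Finset.sum_fiberwise_of_maps_to hmaps (fun g => f (g • I)),
    Finset.sum_sigma' _ _ (fun n ν => F n ν), Finset.smul_sum]
  refine Finset.sum_congr rfl ?_
  rintro ⟨n, ν⟩ hy
  simp only [Finset.mem_sigma, Finset.mem_filter, Finset.mem_Icc, rootsNegOne,
    Finset.mem_range] at hy
  obtain ⟨⟨⟨hn1, hnN⟩, hqn⟩, hνn, hdvd⟩ := hy
  have hnR : (0 : ℝ) < n := by exact_mod_cast hn1
  have key : ∀ g : SL(2, ℤ), (g ∈ stripSet q N ∧ m g = ⟨n, ν⟩) ↔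
      (g 1 0 ^ 2 + g 1 1 ^ 2 = n ∧ g 0 0 * g 1 0 + g 0 1 * g 1 1 = ν) := by
    intro g
    constructor
    · rintro ⟨hg, hmg⟩
      obtain ⟨n', ν', h1, h2, -⟩ := hmem g hg
      simp only [hm, ← h1, ← h2, Int.toNat_natCast, Sigma.mk.injEq, heq_eq_eq] at hmg
      rw [← h1, ← h2, hmg.1, hmg.2]; exact ⟨rfl, rfl⟩
    · rintro ⟨h1, h2⟩
      refine ⟨mem_stripSet.2 ⟨?_, ?_, ?_⟩, ?_⟩
      · rw [sl_smul_I_re, h1, h2, Int.floor_eq_zero_iff]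
        push_cast
        exact ⟨by positivity, by rw [div_lt_one hnR]; exact_mod_cast hνn⟩
      · rw [h1]; exact_mod_cast hnN
      · rw [h1]; exact_mod_cast hqn
      · simp [hm, h1, h2]
  have key2 : ∀ g : SL(2, ℤ), (g 1 0 ^ 2 + g 1 1 ^ 2 = n ∧ g 0 0 * g 1 0 + g 0 1 * g 1 1 = ν) ↔
      ((g • I).im = 1 / n ∧ (g • I).re = ν / n) := by
    intro g
    have hp : (0 : ℝ) < ((g 1 0 ^ 2 + g 1 1 ^ 2 : ℤ) : ℝ) := by exact_mod_cast sl_bottom_pos g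
    rw [sl_smul_I_im, sl_smul_I_re]
    constructor
    · rintro ⟨h1, h2⟩; rw [h1, h2]; simp
    · rintro ⟨h1, h2⟩
      have e1 : g 1 0 ^ 2 + g 1 1 ^ 2 = (n : ℤ) := by
        rw [div_eq_div_iff hp.ne' hnR.ne', one_mul, one_mul] at h1
        exact_mod_cast h1.symm
      refine ⟨e1, ?_⟩
      rw [e1, Int.cast_natCast, div_left_inj' hnR.ne'] at h2
      exact_mod_cast h2
  obtain ⟨g₀, hg₀⟩ := exists_sl_of_dvd n hn1 ν (by exact_mod_cast hdvd)
  have hfib : (stripSet q N).filter (fun g => m g = ⟨n, ν⟩) =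
      ({1, -1, S, -S} : Finset SL(2, ℤ)).image (g₀ * ·) := by
    ext g
    rw [Finset.mem_filter, key, key2]
    obtain ⟨h1, h2⟩ := (key2 g₀).1 hg₀
    have e : ((g • I).im = 1 / n ∧ (g • I).re = ν / n) ↔ (g₀⁻¹ * g) • I = I := by
      rw [mul_smul, inv_smul_eq_iff]
      constructor
      · rintro ⟨h3, h4⟩
        exact UpperHalfPlane.ext (Complex.ext (by rw [coe_re, coe_re, h4, h2])
          (by rw [coe_im, coe_im, h3, h1]))
      · intro h; rw [h]; exact ⟨h1, h2⟩
    rw [e, stabilizer_I, Finset.mem_image]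
    constructor
    · intro h; exact ⟨_, h, by group⟩
    · rintro ⟨s, hs, rfl⟩; simpa using hs
  have hcard : ((stripSet q N).filter (fun g => m g = ⟨n, ν⟩)).card = 4 := by
    rw [hfib, Finset.card_image_of_injective _ (mul_right_injective g₀)]
    decide
  rw [Finset.sum_congr rfl fun g hg => ?_, Finset.sum_const, hcard]
  rw [Finset.mem_filter, key, key2] at hg
  exact hfF _ n ν hn1 hg.1 hg.2

end UpperHalfPlane

end

section

open UpperHalfPlane MeasureTheory ModularGroup
open scoped MatrixGroups ComplexConjugate

namespace UpperHalfPlane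

theorem abs_inv_im_smul_sub_le (g : SL(2, ℤ)) {z : ℍ} {η : ℝ} (hη : η ≤ 1 / 4)
    (hx0 : 0 ≤ z.re) (hx : z.re ≤ η) (hy0 : 1 ≤ z.im) (hy : z.im ≤ 1 + η) :
    |1 / (g • z).im - ((g 1 0 ^ 2 + g 1 1 ^ 2 : ℤ) : ℝ)| ≤
      3 * η * ((g 1 0 ^ 2 + g 1 1 ^ 2 : ℤ) : ℝ) := by
  rw [sl_im_smul, one_div_div]
  push_cast
  generalize ((g 1 0 : ℤ) : ℝ) = c
  generalize ((g 1 1 : ℤ) : ℝ) = d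
  generalize z.re = x at *
  generalize z.im = y at *
  have hy' : 0 < y := by linarith
  have hη0 : 0 ≤ η := hx0.trans hx
  have e : ((c * x + d) ^ 2 + (c * y) ^ 2) / y - (c ^ 2 + d ^ 2) =
      (c ^ 2 * x ^ 2 + 2 * c * d * x - d ^ 2 * (y - 1) + c ^ 2 * (y - 1) * y) / y := by
    field_simp; ring
  rw [e, abs_div, abs_of_pos hy', div_le_iff₀ hy']
  have h0 : c ^ 2 * x ^ 2 ≤ c ^ 2 * η := by
    refine mul_le_mul_of_nonneg_left ?_ (sq_nonneg _); nlinarith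
  have h0' : 0 ≤ c ^ 2 * x ^ 2 := by positivity
  have h1 : |2 * c * d * x| ≤ (c ^ 2 + d ^ 2) * η := by
    rw [abs_mul, abs_of_nonneg hx0]
    refine mul_le_mul ?_ hx hx0 (by positivity)
    rw [abs_le]; constructor <;> nlinarith [sq_nonneg (c + d), sq_nonneg (c - d)]
  rw [abs_le] at h1
  have h2 : d ^ 2 * (y - 1) ≤ d ^ 2 * η := mul_le_mul_of_nonneg_left (by linarith) (sq_nonneg _)
  have h2' : 0 ≤ d ^ 2 * (y - 1) := mul_nonneg (sq_nonneg _) (by linarith)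
  have h3 : c ^ 2 * (y - 1) * y ≤ c ^ 2 * η * y :=
    mul_le_mul_of_nonneg_right (mul_le_mul_of_nonneg_left (by linarith) (sq_nonneg _)) hy'.le
  have h3' : 0 ≤ c ^ 2 * (y - 1) * y := mul_nonneg (mul_nonneg (sq_nonneg _) (by linarith)) hy'.le
  have h4 : 0 ≤ (c ^ 2 * η) * (y - 1) := mul_nonneg (mul_nonneg (sq_nonneg _) hη0) (by linarith)
  have h5 : 0 ≤ (d ^ 2 * η) * (y - 1) := mul_nonneg (mul_nonneg (sq_nonneg _) hη0) (by linarith)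
  have h6 : 0 ≤ c ^ 2 * η := mul_nonneg (sq_nonneg _) hη0
  have h7 : 0 ≤ d ^ 2 * η := mul_nonneg (sq_nonneg _) hη0
  rw [abs_le]; constructor <;> nlinarith

theorem abs_re_smul_sub_le (g : SL(2, ℤ)) {z : ℍ} {η : ℝ} (hη : η ≤ 1 / 4)
    (hx0 : 0 ≤ z.re) (hx : z.re ≤ η) (hy0 : 1 ≤ z.im) (hy : z.im ≤ 1 + η) :
    |(g • z).re - (g • I).re| ≤ 4 * η / ((g 1 0 ^ 2 + g 1 1 ^ 2 : ℤ) : ℝ) := by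
  have hd : ∀ z : ℍ, ((g 1 0 : ℂ) * z + (g 1 1 : ℂ)) ≠ 0 := fun z => by
    have := denom_ne_zero (Matrix.SpecialLinearGroup.mapGL ℝ g : GL (Fin 2) ℝ) z
    simpa [denom] using this
  have hn1 : (1 : ℝ) ≤ ((g 1 0 ^ 2 + g 1 1 ^ 2 : ℤ) : ℝ) := by exact_mod_cast sl_bottom_pos g
  have hkey : ((g • z : ℍ) : ℂ) - ((g • I : ℍ) : ℂ) =
      ((z : ℂ) - Complex.I) / (((g 1 0 : ℂ) * z + g 1 1) * ((g 1 0 : ℂ) * Complex.I + g 1 1)) := by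
    have h1 := hd z
    have h2 := hd I
    rw [coe_I] at h2
    have hdet : (g 0 0 : ℂ) * g 1 1 - g 0 1 * g 1 0 = 1 := by exact_mod_cast sl_det g
    rw [coe_specialLinearGroup_apply g z, coe_specialLinearGroup_apply g I, coe_I]
    simp only [eq_intCast, Complex.ofReal_intCast]
    rw [div_sub_div _ _ h1 h2]
    congr 1
    linear_combination ((z : ℂ) - Complex.I) * hdet
  have hns : ∀ w : ℍ, ‖((g 1 0 : ℂ) * w + g 1 1)‖ ^ 2 =
      (g 1 0 * w.re + g 1 1) ^ 2 + (g 1 0 * w.im) ^ 2 := fun w => by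
    rw [← Complex.normSq_eq_norm_sq, Complex.normSq_apply]
    simp [sq]
  have hI : ‖((g 1 0 : ℂ) * Complex.I + g 1 1)‖ ^ 2 = ((g 1 0 ^ 2 + g 1 1 ^ 2 : ℤ) : ℝ) := by
    have := hns I
    rw [coe_I, I_re, I_im] at this
    rw [this]; push_cast; ring
  have hprod : ((g 1 0 ^ 2 + g 1 1 ^ 2 : ℤ) : ℝ) / 2 ≤
      ‖((g 1 0 : ℂ) * z + g 1 1)‖ * ‖((g 1 0 : ℂ) * Complex.I + g 1 1)‖ := by
    have h1 := hns z
    have h2 := abs_inv_im_smul_sub_le g hη hx0 hx hy0 hy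
    rw [sl_im_smul, one_div_div, ← h1, abs_le] at h2
    have h3 : ((g 1 0 ^ 2 + g 1 1 ^ 2 : ℤ) : ℝ) / 4 ≤
        ‖((g 1 0 : ℂ) * z + g 1 1)‖ ^ 2 / z.im := by nlinarith [h2.1]
    rw [le_div_iff₀ z.im_pos] at h3
    have h4 : ‖((g 1 0 : ℂ) * Complex.I + g 1 1)‖ / 2 ≤ ‖((g 1 0 : ℂ) * z + g 1 1)‖ :=
      abs_le_of_sq_le_sq' (by nlinarith) (norm_nonneg _) |>.2
    nlinarith [norm_nonneg ((g 1 0 : ℂ) * Complex.I + g 1 1)]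
  have hnum : ‖(z : ℂ) - Complex.I‖ ≤ 2 * η := by
    refine (Complex.norm_le_abs_re_add_abs_im _).trans ?_
    simp only [Complex.sub_re, Complex.sub_im, Complex.I_re, Complex.I_im, coe_re, coe_im, sub_zero]
    rw [abs_of_nonneg hx0, abs_of_nonneg (by linarith)]
    linarith
  calc |(g • z).re - (g • I).re| = |(((g • z : ℍ) : ℂ) - ((g • I : ℍ) : ℂ)).re| := by
        rw [Complex.sub_re, coe_re, coe_re]
    _ ≤ ‖((g • z : ℍ) : ℂ) - ((g • I : ℍ) : ℂ)‖ := Complex.abs_re_le_norm _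
    _ ≤ 2 * η / (((g 1 0 ^ 2 + g 1 1 ^ 2 : ℤ) : ℝ) / 2) := by
        rw [hkey, norm_div, norm_mul]
        exact div_le_div₀ ((norm_nonneg _).trans hnum) hnum (by linarith) hprod
    _ = 4 * η / ((g 1 0 ^ 2 + g 1 1 ^ 2 : ℤ) : ℝ) := by field_simp; ring

theorem norm_poincareTerm_smul_sub_le {Ψ : ℝ → ℂ} (hΨ1 : ∀ t, ‖Ψ t‖ ≤ 1) {Λ : ℝ} (hΛ : 0 ≤ Λ)
    (hL : ∀ s t, ‖Ψ s - Ψ t‖ ≤ Λ * |s - t|) {Y : ℝ} (hY : 0 < Y) (hs : ∀ t, Ψ t ≠ 0 → Y ≤ t)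
    (k : ℤ) (g : SL(2, ℤ)) {z : ℍ} {η : ℝ}
    (hη : η ≤ 1 / 4)
    (hx0 : 0 ≤ z.re) (hx : z.re ≤ η) (hy0 : 1 ≤ z.im) (hy : z.im ≤ 1 + η) :
    ‖poincareTerm Ψ k (g • z) - poincareTerm Ψ k (g • I)‖ ≤
      Λ * (3 * η * ((g 1 0 ^ 2 + g 1 1 ^ 2 : ℤ) : ℝ)) + 8 * Real.pi * (|(k : ℝ)| / Y) * η := by
  have e1 : 1 / (g • I).im = ((g 1 0 ^ 2 + g 1 1 ^ 2 : ℤ) : ℝ) := by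
    rw [sl_smul_I_im, one_div_one_div]
  have h1 := abs_inv_im_smul_sub_le g hη hx0 hx hy0 hy
  have h2 := abs_re_smul_sub_le g hη hx0 hx hy0 hy
  unfold poincareTerm
  rw [e1]
  set n := ((g 1 0 ^ 2 + g 1 1 ^ 2 : ℤ) : ℝ)
  have e : Ψ (1 / (g • z).im) * expTwoPi (k * (g • z).re) - Ψ n * expTwoPi (k * (g • I).re) =
      (Ψ (1 / (g • z).im) - Ψ n) * expTwoPi (k * (g • z).re) +
      Ψ n * (expTwoPi (k * (g • z).re) - expTwoPi (k * (g • I).re)) := by ring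
  rw [e]
  refine (norm_add_le _ _).trans (add_le_add ?_ ?_)
  · rw [norm_mul, norm_expTwoPi, mul_one]
    exact (hL _ _).trans (mul_le_mul_of_nonneg_left h1 hΛ)
  · rcases eq_or_ne (Ψ n) 0 with h0 | h0
    · rw [h0, zero_mul, norm_zero]
      have := hx0.trans hx
      clear hL hs hΨ1
      positivity
    rw [norm_mul]
    refine (mul_le_mul (hΨ1 _) (norm_expTwoPi_sub_le _ _) (norm_nonneg _) zero_le_one).trans ?_
    rw [← mul_sub, abs_mul, one_mul]
    have hn := hs n h0
    have hη0 := hx0.trans hx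
    calc 2 * Real.pi * (|(k : ℝ)| * |(g • z).re - (g • I).re|) ≤
        2 * Real.pi * (|(k : ℝ)| * (4 * η / Y)) := by
          have h3 : 4 * η / n ≤ 4 * η / Y := div_le_div_of_nonneg_left (by linarith) hY hn
          have h4 := h2.trans h3
          have h5 := Real.pi_pos
          gcongr
      _ = _ := by ring

theorem T_zpow_mul_row_one (j : ℤ) (g : SL(2, ℤ)) (i : Fin 2) : (T ^ j * g) 1 i = g 1 i := by
  rw [Matrix.SpecialLinearGroup.coe_mul, coe_T_zpow, Matrix.mul_apply, Fin.sum_univ_two]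
  simp

theorem sum_stripCut_smul_eq {φ : ℍ → ℂ} (hφT : ∀ z (n : ℤ), φ (T ^ n • z) = φ z) (q N : ℕ) (z : ℍ)
    (G : Finset SL(2, ℤ)) (hG : ∀ g : SL(2, ℤ), stripCut φ (g • z) ≠ 0 → g ∈ G)
    (hN : ∀ g : SL(2, ℤ), φ (g • z) ≠ 0 → g 1 0 ^ 2 + g 1 1 ^ 2 ≤ N) :
    ∑ g ∈ G.filter (fun g : SL(2, ℤ) => (q : ℤ) ∣ g 1 0 ^ 2 + g 1 1 ^ 2), stripCut φ (g • z) =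
      ∑ g ∈ stripSet q N, φ (g • z) := by
  have hcut : ∀ w : ℍ, stripCut φ w ≠ 0 → ⌊w.re⌋ = 0 ∧ φ w ≠ 0 := fun w hw => by
    unfold stripCut at hw
    split_ifs at hw with h
    · exact ⟨h, hw⟩
    · exact absurd rfl hw
  refine Finset.sum_bij_ne_zero (fun g _ _ => T ^ (-⌊(g • I).re⌋) * g) ?_ ?_ ?_ ?_
  · intro g hg hne
    rw [Finset.mem_filter] at hg
    rw [mem_stripSet, T_zpow_mul_row_one, T_zpow_mul_row_one, mul_smul, re_T_zpow_smul]
    refine ⟨?_, hN g (hcut _ hne).2, hg.2⟩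
    rw [Int.floor_add_intCast]; ring
  · intro g₁ _ hne₁ g₂ _ hne₂ h
    have h1 : g₁ = T ^ (⌊(g₁ • I).re⌋ - ⌊(g₂ • I).re⌋) * g₂ := by
      rw [sub_eq_add_neg, zpow_add, mul_assoc, ← h, ← mul_assoc, ← zpow_add, add_neg_cancel,
        zpow_zero, one_mul]
    have f1 := (hcut _ hne₁).1
    rw [h1, mul_smul, re_T_zpow_smul, Int.floor_add_intCast, (hcut _ hne₂).1, zero_add] at f1
    rw [h1, f1, zpow_zero, one_mul]
  · intro g hg hne
    rw [mem_stripSet] at hg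
    have e : stripCut φ ((T ^ (-⌊(g • z).re⌋) * g) • z) = φ (g • z) := by
      rw [mul_smul, stripCut, hφT, if_pos]
      rw [re_T_zpow_smul, Int.floor_add_intCast]; ring
    refine ⟨T ^ (-⌊(g • z).re⌋) * g, ?_, by rwa [e], ?_⟩
    · rw [Finset.mem_filter, T_zpow_mul_row_one, T_zpow_mul_row_one]
      exact ⟨hG _ (by rwa [e]), hg.2.2⟩
    · simp only [mul_smul, re_T_zpow_smul, Int.floor_add_intCast, hg.1, zero_add, neg_neg]
      rw [← mul_assoc, ← zpow_add, add_neg_cancel, zpow_zero, one_mul]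
  · intro g _ hne
    rw [mul_smul, hφT, stripCut, if_pos (hcut _ hne).1]

theorem norm_sum_stripCut_sub_le {Ψ : ℝ → ℂ} (hΨ1 : ∀ t, ‖Ψ t‖ ≤ 1) {Λ : ℝ} (hΛ : 0 ≤ Λ)
    (hL : ∀ s t, ‖Ψ s - Ψ t‖ ≤ Λ * |s - t|) {X Y : ℝ} (hY : 0 < Y)
    (hs : ∀ t, Ψ t ≠ 0 → t ≤ X) (hs' : ∀ t, Ψ t ≠ 0 → Y ≤ t)
    (k : ℤ) (q : ℕ) {z : ℍ} {η : ℝ} (hη : η ≤ 1 / 4)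
    (hx0 : 0 ≤ z.re) (hx : z.re ≤ η) (hy0 : 1 ≤ z.im) (hy : z.im ≤ 1 + η)
    (G : Finset SL(2, ℤ))
    (hG : ∀ g : SL(2, ℤ), stripCut (poincareTerm Ψ k) (g • z) ≠ 0 → g ∈ G) :
    ‖∑ g ∈ G.filter (fun g : SL(2, ℤ) => (q : ℤ) ∣ g 1 0 ^ 2 + g 1 1 ^ 2),
        stripCut (poincareTerm Ψ k) (g • z) -
      4 * ∑ n ∈ (Finset.Icc 1 ⌊4 * X⌋₊).filter (q ∣ ·), Ψ n * rootSum k n‖ ≤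
    4 * (∑ n ∈ (Finset.Icc 1 ⌊4 * X⌋₊).filter (q ∣ ·), ((rootsNegOne n).card : ℝ)) *
      (η * (12 * Λ * X + 8 * Real.pi * (|(k : ℝ)| / Y))) := by
  have hη0 : 0 ≤ η := hx0.trans hx
  have hsupp : ∀ g : SL(2, ℤ), poincareTerm Ψ k (g • z) ≠ 0 →
      g 1 0 ^ 2 + g 1 1 ^ 2 ≤ ⌊4 * X⌋₊ := by
    intro g hg
    have h1 := hs _ (left_ne_zero_of_mul hg)
    have h2 := abs_le.1 (abs_inv_im_smul_sub_le g hη hx0 hx hy0 hy)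
    have hp : (1 : ℝ) ≤ ((g 1 0 ^ 2 + g 1 1 ^ 2 : ℤ) : ℝ) := by exact_mod_cast sl_bottom_pos g
    obtain ⟨n, hn⟩ := Int.eq_ofNat_of_zero_le (sl_bottom_pos g).le
    rw [hn] at hp h2 ⊢
    have : n ≤ ⌊4 * X⌋₊ := by
      apply Nat.le_floor
      simp only [Int.cast_natCast] at hp h2
      nlinarith [h2.1]
    exact_mod_cast this
  rw [sum_stripCut_smul_eq (poincareTerm_T_zpow Ψ k) q ⌊4 * X⌋₊ z G hG hsupp]
  have e1 := sum_stripSet q ⌊4 * X⌋₊ (poincareTerm Ψ k)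
    (fun n ν => Ψ n * expTwoPi (k * ((ν : ℝ) / n))) fun z n ν hn h1 h2 => by
      rw [poincareTerm, h1, h2, one_div_one_div]
  have e2 := sum_stripSet q ⌊4 * X⌋₊ (fun _ => (1 : ℝ)) (fun _ _ => 1) fun _ _ _ _ _ _ => rfl
  simp only [← Finset.mul_sum] at e1
  change _ = 4 • ∑ n ∈ (Finset.Icc 1 ⌊4 * X⌋₊).filter (q ∣ ·), Ψ n * rootSum k n at e1
  simp only [Finset.sum_const, nsmul_eq_mul, mul_one] at e1 e2
  push_cast at e1 e2
  rw [← e1, ← Finset.sum_sub_distrib, ← e2]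
  refine (norm_sum_le_of_le _ fun g hg => ?_).trans
    ((Finset.sum_const (η * (12 * Λ * X + 8 * Real.pi * (|(k : ℝ)| / Y)))).trans
      (nsmul_eq_mul _ _)).le
  refine (norm_poincareTerm_smul_sub_le hΨ1 hΛ hL hY hs' k g hη hx0 hx hy0 hy).trans ?_
  have h3 : ((g 1 0 ^ 2 + g 1 1 ^ 2 : ℤ) : ℝ) ≤ 4 * X := by
    have h4 := (mem_stripSet.1 hg).2.1
    have h5 : 1 ≤ ⌊4 * X⌋₊ := by
      have := sl_bottom_pos g
      have : (0 : ℤ) < ⌊4 * X⌋₊ := by omega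
      exact_mod_cast this
    have h6 : ((g 1 0 ^ 2 + g 1 1 ^ 2 : ℤ) : ℝ) ≤ (⌊4 * X⌋₊ : ℝ) := by exact_mod_cast h4
    exact h6.trans (Nat.floor_le (zero_le_one.trans (Nat.one_le_floor_iff _ |>.1 h5)))
  calc _ ≤ Λ * (3 * η * (4 * X)) + 8 * Real.pi * (|(k : ℝ)| / Y) * η := by gcongr
    _ = _ := by ring

end UpperHalfPlane

end

section

open UpperHalfPlane MeasureTheory ModularGroup
open scoped MatrixGroups ComplexConjugate

theorem sum_sum_filter_eq {α β : Type*} [DecidableEq β] (G : Finset α) (π : α → β) (x : α → ℂ) :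
    ∑ g ∈ G, ∑ g' ∈ G.filter (fun g' => π g = π g'), conj (x g) * x g' =
      ((∑ κ ∈ G.image π, ‖∑ g ∈ G.filter (π · = κ), x g‖ ^ 2 : ℝ) : ℂ) := by
  rw [← Finset.sum_fiberwise_of_maps_to (fun g hg => Finset.mem_image_of_mem π hg)]
  push_cast
  refine Finset.sum_congr rfl fun κ _ => ?_
  rw [← Complex.conj_mul', map_sum, Finset.sum_mul]
  refine Finset.sum_congr rfl fun g hg => ?_
  rw [Finset.mul_sum]
  refine Finset.sum_congr ?_ fun _ _ => rfl
  rw [(Finset.mem_filter.1 hg).2]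
  exact Finset.filter_congr fun _ _ => eq_comm

theorem sq_norm_sum_filter_le {α β γ : Type*} [DecidableEq β] [DecidableEq γ] (G : Finset α)
    (π : α → β) (x : α → ℂ)
    (Q : α → Prop) [DecidablePred Q] (hQ : ∀ g ∈ G, ∀ g' ∈ G, π g = π g' → Q g → Q g')
    (f : α → γ) (R : Finset γ) (hR : ∀ g ∈ G, Q g → f g ∈ R)
    (hf : ∀ g ∈ G, ∀ g' ∈ G, Q g → Q g' → f g = f g' → π g = π g') :
    ‖∑ g ∈ G.filter Q, x g‖ ^ 2 ≤
      R.card * (∑ g ∈ G, ∑ g' ∈ G.filter (fun g' => π g = π g'), conj (x g) * x g').re := by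
  rw [sum_sum_filter_eq, Complex.ofReal_re]
  have e : ∑ g ∈ G.filter Q, x g =
      ∑ κ ∈ (G.filter Q).image π, ∑ g ∈ G.filter (π · = κ), x g := by
    rw [← Finset.sum_fiberwise_of_maps_to (fun g hg => Finset.mem_image_of_mem π hg)]
    refine Finset.sum_congr rfl fun κ hκ => ?_
    obtain ⟨g₀, h0, rfl⟩ := Finset.mem_image.1 hκ
    rw [Finset.mem_filter] at h0
    refine Finset.sum_congr ?_ fun _ _ => rfl
    ext g
    simp only [Finset.mem_filter]
    exact ⟨fun h => ⟨h.1.1, h.2⟩, fun h => ⟨⟨h.1, hQ _ h0.1 _ h.1 h.2.symm h0.2⟩, h.2⟩⟩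
  have hcard : ((G.filter Q).image π).card ≤ R.card := by
    have hex : ∀ κ ∈ (G.filter Q).image π, ∃ v ∈ R, ∃ g ∈ G, Q g ∧ π g = κ ∧ f g = v := by
      intro κ hκ
      obtain ⟨g, hg, rfl⟩ := Finset.mem_image.1 hκ
      rw [Finset.mem_filter] at hg
      exact ⟨f g, hR g hg.1 hg.2, g, hg.1, hg.2, rfl, rfl⟩
    rcases isEmpty_or_nonempty γ with hγ | hγ
    · rw [Finset.card_eq_zero.2 (Finset.eq_empty_of_forall_notMem fun κ hκ =>
        hγ.elim (hex κ hκ).choose)]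
      exact Nat.zero_le _
    rcases isEmpty_or_nonempty α with hα | hα
    · rw [Finset.card_eq_zero.2 (Finset.eq_empty_of_forall_notMem fun κ hκ =>
        hα.elim (hex κ hκ).choose_spec.2.choose)]
      exact Nat.zero_le _
    choose! v hv g hg using hex
    refine Finset.card_le_card_of_injOn v hv fun κ hκ κ' hκ' h => ?_
    obtain ⟨h1, h2, h3, h4⟩ := hg κ hκ
    obtain ⟨h1', h2', h3', h4'⟩ := hg κ' hκ'
    rw [← h3, ← h3']
    exact hf _ h1 _ h1' h2 h2' (by rw [h4, h4', h])
  rw [e]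
  calc ‖∑ κ ∈ (G.filter Q).image π, ∑ g ∈ G.filter (π · = κ), x g‖ ^ 2 ≤
      (∑ κ ∈ (G.filter Q).image π, ‖∑ g ∈ G.filter (π · = κ), x g‖) ^ 2 := by
        gcongr; exact norm_sum_le _ _
    _ ≤ ((G.filter Q).image π).card *
        ∑ κ ∈ (G.filter Q).image π, ‖∑ g ∈ G.filter (π · = κ), x g‖ ^ 2 := sq_sum_le_card_mul_sum_sq
    _ ≤ R.card * ∑ κ ∈ G.image π, ‖∑ g ∈ G.filter (π · = κ), x g‖ ^ 2 := by
        gcongr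
        exact Finset.filter_subset _ _

namespace UpperHalfPlane

theorem mul_inv_one_zero (g g' : SL(2, ℤ)) :
    (g' * g⁻¹) 1 0 = g' 1 0 * g 1 1 - g' 1 1 * g 1 0 := by
  rw [Matrix.SpecialLinearGroup.coe_mul, Matrix.SpecialLinearGroup.SL2_inv_expl, Matrix.mul_apply,
    Fin.sum_univ_two]
  simp
  ring

/-- The residue `ω` with `d ≡ ω c (mod q)` attached to a bottom row `(c, d)` with
`c² + d² ≡ 0 (mod q)`. -/
def rowRoot (q : ℕ) (g : SL(2, ℤ)) : ℕ :=
  ((g 1 1 * (-(g 0 0 ^ 2 * g 1 0) - 2 * g 0 0 * g 0 1 * g 1 1 + g 0 1 ^ 2 * g 1 0) : ℤ) : ZMod q).val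

theorem cast_rowRoot_mul {q : ℕ} [NeZero q] {g : SL(2, ℤ)}
    (h : (q : ℤ) ∣ g 1 0 ^ 2 + g 1 1 ^ 2) :
    (g 1 0 : ZMod q) * (-(g 0 0 ^ 2 * g 1 0) - 2 * g 0 0 * g 0 1 * g 1 1 + g 0 1 ^ 2 * g 1 0) = 1 ∧
    (rowRoot q g : ZMod q) * g 1 0 = g 1 1 := by
  have h0 : (g 1 0 : ZMod q) ^ 2 + (g 1 1 : ZMod q) ^ 2 = 0 := by
    have := (ZMod.intCast_zmod_eq_zero_iff_dvd _ q).2 h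
    push_cast at this; exact this
  have hdet : (g 0 0 : ZMod q) * g 1 1 - g 0 1 * g 1 0 = 1 := by
    have := congrArg (Int.cast : ℤ → ZMod q) (sl_det g)
    push_cast at this
    exact this
  have h1 : (g 1 0 : ZMod q) *
      (-(g 0 0 ^ 2 * g 1 0) - 2 * g 0 0 * g 0 1 * g 1 1 + g 0 1 ^ 2 * g 1 0) = 1 := by
    linear_combination ((g 0 0 : ZMod q) * g 1 1 - g 0 1 * g 1 0 + 1) * hdet -
      (g 0 0 : ZMod q) ^ 2 * h0
  refine ⟨h1, ?_⟩
  rw [rowRoot, ZMod.natCast_zmod_val]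
  push_cast
  linear_combination (g 1 1 : ZMod q) * h1

theorem rowRoot_mem {q : ℕ} [NeZero q] {g : SL(2, ℤ)} (h : (q : ℤ) ∣ g 1 0 ^ 2 + g 1 1 ^ 2) :
    rowRoot q g ∈ rootsNegOne q := by
  rw [rootsNegOne, Finset.mem_filter, Finset.mem_range]
  refine ⟨ZMod.val_lt _, ?_⟩
  obtain ⟨h1, h2⟩ := cast_rowRoot_mul h
  have h0 : (g 1 0 : ZMod q) ^ 2 + (g 1 1 : ZMod q) ^ 2 = 0 := by
    have := (ZMod.intCast_zmod_eq_zero_iff_dvd _ q).2 h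
    push_cast at this; exact this
  rw [← ZMod.natCast_eq_zero_iff]
  push_cast
  have h3 : (g 1 0 : ZMod q) ^ 2 * ((rowRoot q g : ZMod q) ^ 2 + 1) = 0 := by
    rw [← h0, ← h2]; ring
  set e := (-((g 0 0 : ZMod q) ^ 2 * g 1 0) - 2 * g 0 0 * g 0 1 * g 1 1 + g 0 1 ^ 2 * g 1 0)
  calc (rowRoot q g : ZMod q) ^ 2 + 1 =
      ((g 1 0 : ZMod q) * e) ^ 2 * ((rowRoot q g : ZMod q) ^ 2 + 1) := by rw [h1]; ring
    _ = e ^ 2 * ((g 1 0 : ZMod q) ^ 2 * ((rowRoot q g : ZMod q) ^ 2 + 1)) := by ring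
    _ = 0 := by rw [h3, mul_zero]

/-- The right coset of `g` modulo `Γ₀(q)`. -/
noncomputable def cosetClass (q : ℕ) (g : SL(2, ℤ)) :
    Quotient (QuotientGroup.rightRel (CongruenceSubgroup.Gamma0 q)) := Quotient.mk _ g

theorem cosetClass_eq_iff {q : ℕ} {g g' : SL(2, ℤ)} :
    cosetClass q g = cosetClass q g' ↔ (q : ℤ) ∣ (g' * g⁻¹) 1 0 := by
  rw [cosetClass, cosetClass, Quotient.eq, QuotientGroup.rightRel_apply,
    CongruenceSubgroup.Gamma0_mem, ZMod.intCast_zmod_eq_zero_iff_dvd]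

theorem sq_norm_sum_coset_le (q : ℕ) [NeZero q] (G : Finset SL(2, ℤ)) (x : SL(2, ℤ) → ℂ) :
    ‖∑ g ∈ G.filter (fun g : SL(2, ℤ) => (q : ℤ) ∣ g 1 0 ^ 2 + g 1 1 ^ 2), x g‖ ^ 2 ≤
      (rootsNegOne q).card *
        (∑ g ∈ G, ∑ g' ∈ G.filter (fun g' : SL(2, ℤ) => (q : ℤ) ∣ (g' * g⁻¹) 1 0),
          conj (x g) * x g').re := by
  classical
  have := sq_norm_sum_filter_le G (cosetClass q) x
    (fun g : SL(2, ℤ) => (q : ℤ) ∣ g 1 0 ^ 2 + g 1 1 ^ 2) ?_ (rowRoot q) (rootsNegOne q)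
    (fun g _ h => rowRoot_mem h) ?_
  · convert this using 7 with g hg
    exact cosetClass_eq_iff.symm
  · intro g _ g' _ h hg
    rw [cosetClass_eq_iff, mul_inv_one_zero] at h
    obtain ⟨h1, -⟩ := cast_rowRoot_mul hg
    have h2 := (ZMod.intCast_zmod_eq_zero_iff_dvd _ q).2 h
    have h3 := (ZMod.intCast_zmod_eq_zero_iff_dvd _ q).2 hg
    rw [← ZMod.intCast_zmod_eq_zero_iff_dvd]
    push_cast at h2 h3 ⊢
    set e := (-((g 0 0 : ZMod q) ^ 2 * g 1 0) - 2 * g 0 0 * g 0 1 * g 1 1 + g 0 1 ^ 2 * g 1 0)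
    have h4 : (g 1 0 : ZMod q) ^ 2 * ((g' 1 0 : ZMod q) ^ 2 + (g' 1 1 : ZMod q) ^ 2) = 0 := by
      linear_combination (g' 1 0 : ZMod q) ^ 2 * h3 -
        ((g' 1 0 : ZMod q) * g 1 1 + (g' 1 1 : ZMod q) * g 1 0) * h2
    linear_combination e ^ 2 * h4 - ((g 1 0 : ZMod q) * e + 1) *
      ((g' 1 0 : ZMod q) ^ 2 + (g' 1 1 : ZMod q) ^ 2) * h1
  · intro g _ g' _ hg hg' h
    rw [cosetClass_eq_iff, mul_inv_one_zero, ← ZMod.intCast_zmod_eq_zero_iff_dvd]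
    push_cast
    rw [← (cast_rowRoot_mul hg).2, ← (cast_rowRoot_mul hg').2, h]
    ring

theorem mem_fd_of_mem_rect {η : ℝ} (hη : η ≤ 1 / 4) {z : ℍ} (hz : z ∈ rect 0 η 1 (1 + η)) :
    z ∈ fd := by
  obtain ⟨h1, h2, h3, h4⟩ := hz
  refine ⟨?_, ?_⟩
  · rw [Complex.normSq_apply, coe_re, coe_im]; nlinarith
  · rw [abs_of_nonneg h1]; linarith

theorem mem_box_of_smul {X₁ X₂ : ℝ} (hX₁ : 2 ≤ X₁) (hX : X₁ ≤ X₂) {z : ℍ} (hz : z ∈ fd)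
    {g : SL(2, ℤ)} (hg : g • z ∈ rect 0 1 (1 / X₂) (1 / X₁)) :
    z ∈ box (1 / X₂) X₂ ∧ g • z ∈ box (1 / X₂) X₂ := by
  obtain ⟨h1, h2, h3, h4⟩ := hg
  have hX2 : 0 < X₂ := by linarith
  have him := three_le_four_mul_im_sq_of_mem_fd hz
  have hp := z.im_pos
  have him' : 1 / 2 < z.im := by nlinarith
  have hle : 1 / X₁ ≤ 1 / 2 := one_div_le_one_div_of_le (by norm_num) hX₁
  have hle2 : 1 / X₂ ≤ 1 / 2 := one_div_le_one_div_of_le (by norm_num) (hX₁.trans hX)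
  have hre := hz.2
  refine ⟨⟨by linarith, by linarith, ?_⟩, ⟨by rw [abs_of_nonneg h1]; exact h2, h3, by linarith⟩⟩
  have e := sl_im_smul g z
  by_cases hc : g 1 0 = 0
  · exfalso
    have hd : (g 1 1 : ℝ) ^ 2 = 1 := by
      have := sl_det g
      rw [hc, mul_zero, sub_zero] at this
      have h5 := Int.isUnit_iff.1 (IsUnit.of_mul_eq_one_right _ this)
      rcases h5 with h | h <;> rw [h] <;> norm_num
    rw [hc] at e
    simp only [Int.cast_zero, zero_mul, zero_add, hd, ne_eq, OfNat.ofNat_ne_zero,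
      not_false_eq_true, zero_pow, add_zero, div_one] at e
    linarith
  · have hc1 : (1 : ℝ) ≤ (g 1 0 : ℝ) ^ 2 := by
      have : 0 < g 1 0 ^ 2 := by positivity
      exact_mod_cast this
    have h5 : (g • z).im ≤ 1 / z.im := by
      rw [e, div_le_div_iff₀ (by nlinarith [sq_nonneg (g 1 0 * z.re + g 1 1 : ℝ), sq_pos_of_pos hp]) hp]
      nlinarith [sq_nonneg (g 1 0 * z.re + g 1 1 : ℝ), sq_pos_of_pos hp]
    exact (one_div_le_one_div hX2 hp).1 (h3.trans h5)

theorem exists_norm_sum_rootSum_le : ∃ C > 0, ∀ (Ψ : ℝ → ℂ) (_ : ∀ t, ‖Ψ t‖ ≤ 1) (Λ : ℝ)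
    (_ : 0 ≤ Λ) (_ : ∀ s t, ‖Ψ s - Ψ t‖ ≤ Λ * |s - t|) (X₁ X₂ : ℝ) (_ : 2 ≤ X₁) (_ : X₁ ≤ X₂)
    (_ : ∀ t, Ψ t ≠ 0 → X₁ ≤ t ∧ t ≤ X₂) (k : ℤ) (q : ℕ) (_ : 0 < q) (η : ℝ) (_ : 0 < η)
    (_ : η ≤ 1 / 4),
    ‖∑ n ∈ (Finset.Icc 1 ⌊4 * X₂⌋₊).filter (q ∣ ·), Ψ n * rootSum k n‖ ≤
      2 * (∑ n ∈ (Finset.Icc 1 ⌊4 * X₂⌋₊).filter (q ∣ ·), ((rootsNegOne n).card : ℝ)) *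
        (η * (12 * Λ * X₂ + 8 * Real.pi * (|(k : ℝ)| / X₁))) +
      √(C * ((rootsNegOne q).card + 1) / η ^ 2 * (X₂ ^ 2 / X₁ * (2 + 4 * √(X₂ / X₁) *
        ∑ c ∈ (Finset.Icc 1 ⌊X₂⌋₊).filter (q ∣ ·), kloostermanNorm k c / c))) := by
  classical
  obtain ⟨w, B, hB, hwm, hw0, hw1, hwfd, hwB, hws⟩ := exists_fd_weight
  refine ⟨1 / B, by positivity, ?_⟩
  intro Ψ hΨ1 Λ hΛ hL X₁ X₂ hX₁ hX hs k q hq η hη0 hη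
  have : NeZero q := ⟨hq.ne'⟩
  have hX1p : 0 < X₁ := by linarith
  have hX2p : 0 < X₂ := by linarith
  set W := ∑ n ∈ (Finset.Icc 1 ⌊4 * X₂⌋₊).filter (q ∣ ·), Ψ n * rootSum k n with hW
  set err := (∑ n ∈ (Finset.Icc 1 ⌊4 * X₂⌋₊).filter (q ∣ ·), ((rootsNegOne n).card : ℝ)) *
        (η * (12 * Λ * X₂ + 8 * Real.pi * (|(k : ℝ)| / X₁))) with herr
  have herr0 : 0 ≤ err := by
    clear hws hwfd hwB hw0 hw1 hs
    exact mul_nonneg (Finset.sum_nonneg fun _ _ => Nat.cast_nonneg _) (by positivity)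
  rcases le_or_gt ‖W‖ (2 * err) with hsmall | hbig
  · refine hsmall.trans (le_add_of_le_of_nonneg (le_of_eq ?_) (Real.sqrt_nonneg _))
    rw [herr]; ring
  refine le_add_of_nonneg_of_le (by rw [mul_assoc]; exact mul_nonneg zero_le_two herr0) (Real.le_sqrt_of_sq_le ?_)
  have hΨm : Measurable Ψ := by
    have : LipschitzWith ⟨Λ, hΛ⟩ Ψ := LipschitzWith.of_dist_le_mul fun s t => by
      rw [dist_eq_norm, Real.dist_eq]; exact hL s t
    exact this.continuous.measurable
  have hy₁ : 0 < 1 / X₂ := by positivity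
  have hy : 1 / X₂ ≤ 1 / X₁ := one_div_le_one_div_of_le hX1p hX
  have hs' : ∀ t, Ψ t ≠ 0 → 1 / (1 / X₁) ≤ t ∧ t ≤ 1 / (1 / X₂) := by simpa using hs
  set a := stripCut (poincareTerm Ψ k) with ha
  have ham : Measurable a := measurable_stripCut (measurable_poincareTerm hΨm k)
  have ha1 : ∀ z, ‖a z‖ ≤ 1 := norm_stripCut_le (norm_poincareTerm_le hΨ1 k)
  have has : ∀ z, a z ≠ 0 → z ∈ rect 0 1 (1 / X₂) (1 / X₁) :=
    stripCut_mem_rect (poincareTerm_support hy₁ (hy₁.trans_le hy) hs' k)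
  set G := (finite_box_return hy₁ X₂).toFinset with hG
  set H := (finite_box_return hy₁ (1 / X₁)).toFinset with hH
  have hGmem : ∀ z ∈ fd, ∀ g : SL(2, ℤ), a (g • z) ≠ 0 → g ∈ G := fun z hz g hg => by
    rw [hG, Set.Finite.mem_toFinset]
    exact ⟨z, mem_box_of_smul hX₁ hX hz (has _ hg)⟩
  have hrb : ∀ z, z ∈ rect 0 1 (1 / X₂) (1 / X₁) → z ∈ box (1 / X₂) (1 / X₁) :=
    fun z ⟨h1, h2, h3, h4⟩ => ⟨by rw [abs_of_nonneg h1]; exact h2, h3, h4⟩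
  have hHmem : ∀ (z : ℍ) (h : SL(2, ℤ)), a z ≠ 0 → a (h • z) ≠ 0 → h ∈ H := fun z h h1 h2 => by
    rw [hH, Set.Finite.mem_toFinset]
    exact ⟨z, hrb _ (has _ h1), hrb _ (has _ h2)⟩
  obtain ⟨hintg, hval⟩ := integral_weight_mul_sum hwm hw0 hw1 hwfd hws ham ha1 hy₁ has G H hGmem hHmem
    (fun h : SL(2, ℤ) => (q : ℤ) ∣ h 1 0)
  set S : ℍ → ℂ := fun z => ∑ g ∈ G, ∑ g' ∈ G.filter fun g' : SL(2, ℤ) => (q : ℤ) ∣ (g' * g⁻¹) 1 0,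
      conj (a (g • z)) * a (g' • z) with hS
  set RHS := X₂ ^ 2 / X₁ * (2 + 4 * √(X₂ / X₁) *
        ∑ c ∈ (Finset.Icc 1 ⌊X₂⌋₊).filter (q ∣ ·), kloostermanNorm k c / c) with hRHS
  have hup : (∫ z, (w z : ℂ) * S z).re ≤ RHS := by
    refine (Complex.re_le_norm _).trans ?_
    rw [hval]
    have := norm_sum_stripInner_le hΨm hΨ1 hy₁ hy hs' k q H fun h hh => by
      obtain ⟨z, h1, h2⟩ := exists_of_stripInner_ne_zero hh
      exact hHmem z h h1 h2
    refine this.trans (le_of_eq ?_)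
    rw [hRHS, one_div_one_div, show 1 / X₁ / (1 / X₂) ^ 2 = X₂ ^ 2 / X₁ by field_simp,
      show 1 / X₁ / (1 / X₂) = X₂ / X₁ by field_simp]
  set K : ℝ := (rootsNegOne q).card + 1 with hK
  have hS0 : ∀ z, ‖∑ g ∈ G.filter (fun g : SL(2, ℤ) => (q : ℤ) ∣ g 1 0 ^ 2 + g 1 1 ^ 2),
      a (g • z)‖ ^ 2 ≤ K * (S z).re ∧ 0 ≤ (S z).re := fun z => by
    have h1 := sq_norm_sum_coset_le q G fun g => a (g • z)
    have h2 : 0 ≤ (S z).re := by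
      have := sum_sum_filter_eq G (cosetClass q) fun g => a (g • z)
      simp only [cosetClass_eq_iff] at this
      simp only [hS]
      rw [this, Complex.ofReal_re]
      positivity
    refine ⟨h1.trans ?_, h2⟩
    exact mul_le_mul_of_nonneg_right (by rw [hK]; linarith) h2
  have hlow : ∀ z, (rect 0 η 1 (1 + η)).indicator (fun _ => B * (2 * ‖W‖) ^ 2) z ≤
      K * ((w z : ℂ) * S z).re := fun z => by
    have e : ((w z : ℂ) * S z).re = w z * (S z).re := Complex.re_ofReal_mul _ _
    rw [e]
    by_cases hz : z ∈ rect 0 η 1 (1 + η)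
    · rw [Set.indicator_of_mem hz]
      have hzfd := mem_fd_of_mem_rect hη hz
      have h1 := norm_sum_stripCut_sub_le hΨ1 hΛ hL hX1p (fun t ht => (hs t ht).2)
        (fun t ht => (hs t ht).1) k q hη hz.1 hz.2.1
        hz.2.2.1 hz.2.2.2 G (hGmem z hzfd)
      have h2 : 2 * ‖W‖ ≤ ‖∑ g ∈ G.filter (fun g : SL(2, ℤ) => (q : ℤ) ∣ g 1 0 ^ 2 + g 1 1 ^ 2),
          a (g • z)‖ := by
        have h3 := norm_sub_norm_le (4 * W) (∑ g ∈ G.filter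
          (fun g : SL(2, ℤ) => (q : ℤ) ∣ g 1 0 ^ 2 + g 1 1 ^ 2), a (g • z))
        have h4 : ‖4 * W‖ = 4 * ‖W‖ := by rw [norm_mul, Complex.norm_ofNat]
        rw [norm_sub_rev, h4] at h3
        rw [mul_assoc] at h1
        have h5 := h3.trans h1
        rw [← herr] at h5
        linarith
      have h5 : (2 * ‖W‖) ^ 2 ≤ K * (S z).re :=
        (pow_le_pow_left₀ (by positivity) h2 2).trans (hS0 z).1
      calc B * (2 * ‖W‖) ^ 2 ≤ w z * (K * (S z).re) :=
            mul_le_mul (hwB z hzfd) h5 (by positivity) (hw0 z)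
        _ = _ := by ring
    · rw [Set.indicator_of_notMem hz]
      exact mul_nonneg (by positivity) (mul_nonneg (hw0 z) (hS0 z).2)
  have hfin : volume (rect 0 η 1 (1 + η)) < ⊤ := volume_rect_lt_top zero_lt_one
  have hmono := integral_mono
    ((integrable_indicator_iff (measurableSet_rect _ _ _ _)).2 (integrableOn_const hfin.ne))
    (hintg.re.const_mul K) hlow
  rw [integral_indicator (measurableSet_rect _ _ _ _), setIntegral_const, integral_const_mul,
    smul_eq_mul] at hmono
  have hre : ∫ z, RCLike.re ((w z : ℂ) * S z) = (∫ z, (w z : ℂ) * S z).re := integral_re hintg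
  rw [hre] at hmono
  have hvol : η ^ 2 / 4 ≤ volume.real (rect 0 η 1 (1 + η)) := by
    have h1 := le_volume_rect (x₁ := 0) (x₂ := η) (y₁ := 1) (y₂ := 1 + η) hη0.le zero_lt_one
    rw [← ENNReal.ofReal_toReal hfin.ne, ENNReal.ofReal_le_ofReal_iff ENNReal.toReal_nonneg] at h1
    refine le_trans ?_ h1
    rw [sub_zero, add_sub_cancel_left, div_le_div_iff₀ (by norm_num) (by positivity)]
    have : (1 + η) ^ 2 ≤ 4 := by nlinarith
    nlinarith [mul_le_mul_of_nonneg_left this (sq_nonneg η)]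
  have hfinal : η ^ 2 / 4 * (B * (2 * ‖W‖) ^ 2) ≤ K * RHS :=
    (mul_le_mul_of_nonneg_right hvol (by positivity)).trans
      (hmono.trans (mul_le_mul_of_nonneg_left hup (by positivity)))
  calc ‖W‖ ^ 2 = η ^ 2 / 4 * (B * (2 * ‖W‖) ^ 2) * (1 / (B * η ^ 2)) := by field_simp; norm_num
    _ ≤ K * RHS * (1 / (B * η ^ 2)) := by gcongr
    _ = 1 / B * K / η ^ 2 * RHS := by field_simp

end UpperHalfPlane

end

theorem mem_rootsNegOne {n ν : ℕ} : ν ∈ rootsNegOne n ↔ ν < n ∧ n ∣ ν ^ 2 + 1 := by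
  rw [rootsNegOne, Finset.mem_filter, Finset.mem_range]

theorem mod_mem_rootsNegOne {m n ν : ℕ} (hm : 0 < m) (h : m ∣ n) (hν : n ∣ ν ^ 2 + 1) :
    ν % m ∈ rootsNegOne m := by
  refine mem_rootsNegOne.2 ⟨Nat.mod_lt _ hm, ?_⟩
  refine (Nat.modEq_zero_iff_dvd.1 ?_)
  exact (((Nat.mod_modEq ν m).pow 2).add_right 1).trans (Nat.modEq_zero_iff_dvd.2 (h.trans hν))

theorem card_rootsNegOne_prime_pow_le {p : ℕ} (k : ℕ) (hp : p.Prime) :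
    (rootsNegOne (p ^ k)).card ≤ 2 := by
  rcases hp.eq_two_or_odd' with rfl | hodd
  · match k with
    | 0 => exact (Finset.card_filter_le _ _).trans (by simp)
    | 1 => exact (Finset.card_filter_le _ _).trans (by simp)
    | k + 2 =>
      rw [Finset.card_eq_zero.2]
      · omega
      · refine Finset.eq_empty_of_forall_notMem fun ν hν => ?_
        have h4 : 4 ∣ ν ^ 2 + 1 := dvd_trans ⟨2 ^ k, by ring⟩ (mem_rootsNegOne.1 hν).2
        have h := Nat.mod_two_eq_zero_or_one ν
        rcases Nat.even_or_odd' ν with ⟨c, rfl | rfl⟩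
        · have : (2 * c) ^ 2 = 4 * c ^ 2 := by ring
          omega
        · have : (2 * c + 1) ^ 2 = 4 * (c ^ 2 + c) + 1 := by ring
          omega
  · rcases (rootsNegOne (p ^ k)).eq_empty_or_nonempty with h | ⟨a, ha⟩
    · simp [h]
    · refine (Finset.card_le_card (t := {a, p ^ k - a}) fun b hb => ?_).trans Finset.card_le_two
      rw [mem_rootsNegOne] at ha hb
      rw [Finset.mem_insert, Finset.mem_singleton]
      have hpa : IsCoprime (p : ℤ) a ∨ k = 0 := by
        rcases Nat.eq_zero_or_pos k with hk | hk
        · exact Or.inr hk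
        left
        rw [Nat.isCoprime_iff_coprime, hp.coprime_iff_not_dvd]
        intro hpa
        have h1 : p ∣ a ^ 2 + 1 := (dvd_pow_self p hk.ne').trans ha.2
        have h2 : p ∣ 1 := (Nat.dvd_add_right (hpa.trans (dvd_pow_self a two_ne_zero))).1 h1
        exact hp.one_lt.ne' (Nat.dvd_one.1 h2)
      rcases hpa with hpa | rfl
      swap
      · rw [pow_zero] at *; omega
      have hd : ((p : ℤ) ^ k) ∣ ((a : ℤ) - b) * (a + b) := by
        have h1 : ((p : ℤ) ^ k) ∣ (a : ℤ) ^ 2 + 1 := by exact_mod_cast ha.2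
        have h2 : ((p : ℤ) ^ k) ∣ (b : ℤ) ^ 2 + 1 := by exact_mod_cast hb.2
        have := dvd_sub h1 h2
        rwa [show (a : ℤ) ^ 2 + 1 - (b ^ 2 + 1) = (a - b) * (a + b) by ring] at this
      have hp' : Prime (p : ℤ) := Nat.prime_iff_prime_int.1 hp
      have h2a : ¬ (p : ℤ) ∣ 2 * a := by
        intro h
        rcases hp'.dvd_or_dvd h with h | h
        · have h3 : p ∣ 2 := by exact_mod_cast h
          have := (Nat.prime_dvd_prime_iff_eq hp Nat.prime_two).1 h3
          subst this
          exact absurd hodd (by decide)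
        · exact hp'.not_isUnit (hpa.isUnit_of_dvd' dvd_rfl h)
      by_cases hc : (p : ℤ) ∣ (a : ℤ) - b
      · have hc' : ¬ (p : ℤ) ∣ a + b := fun h => h2a (by
          have := dvd_add hc h
          rwa [show (a : ℤ) - b + (a + b) = 2 * a by ring] at this)
        have h3 : ((p : ℤ) ^ k) ∣ (a : ℤ) - b :=
          (((Prime.coprime_iff_not_dvd hp').2 hc').pow_left).dvd_of_dvd_mul_right hd
        left
        have h4 := Int.eq_zero_of_abs_lt_dvd h3 (by
          rw [abs_lt]
          have := ha.1; have := hb.1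
          have e : ((p : ℤ) ^ k) = ((p ^ k : ℕ) : ℤ) := by push_cast; rfl
          rw [e]; constructor <;> omega)
        omega
      · have h3 : ((p : ℤ) ^ k) ∣ (a : ℤ) + b :=
          (((Prime.coprime_iff_not_dvd hp').2 hc).pow_left).dvd_of_dvd_mul_left hd
        have h4 : p ^ k ∣ a + b := by exact_mod_cast h3
        obtain ⟨c, hc⟩ := h4
        have := ha.1; have := hb.1
        have : c < 2 := by
          by_contra! hcon
          have := Nat.mul_le_mul_left (p ^ k) hcon
          omega
        interval_cases c <;> omega

theorem card_rootsNegOne_mul_le {m n : ℕ} (h : m.Coprime n) :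
    (rootsNegOne (m * n)).card ≤ (rootsNegOne m).card * (rootsNegOne n).card := by
  rw [← Finset.card_product]
  refine Finset.card_le_card_of_injOn (fun ν => (ν % m, ν % n)) ?_ ?_
  · intro ν hν
    have h1 := mem_rootsNegOne.1 (Finset.mem_coe.1 hν)
    have hpos : 0 < m * n := by omega
    rw [Finset.mem_coe, Finset.mem_product]
    exact ⟨mod_mem_rootsNegOne (Nat.pos_of_mul_pos_right hpos) (dvd_mul_right _ _) h1.2,
      mod_mem_rootsNegOne (Nat.pos_of_mul_pos_left hpos) (dvd_mul_left _ _) h1.2⟩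
  · intro a ha b hb hab
    have h1 := mem_rootsNegOne.1 (Finset.mem_coe.1 ha)
    have h2 := mem_rootsNegOne.1 (Finset.mem_coe.1 hb)
    rw [Prod.mk.injEq] at hab
    exact Nat.ModEq.eq_of_lt_of_lt ((Nat.modEq_and_modEq_iff_modEq_mul h).1 hab) h1.1 h2.1

theorem card_rootsNegOne_le (n : ℕ) : (rootsNegOne n).card ≤ n.divisors.card := by
  induction n using Nat.recOnPosPrimePosCoprime with
  | prime_pow p k hp hk =>
    refine (card_rootsNegOne_prime_pow_le k hp).trans ?_
    rw [Nat.divisors_prime_pow hp, Finset.card_map, Finset.card_range]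
    omega
  | zero => simp [rootsNegOne]
  | one => exact (Finset.card_filter_le _ _).trans (by simp)
  | coprime a b ha hb hab iha ihb =>
    rw [hab.card_divisors_mul]
    exact (card_rootsNegOne_mul_le hab).trans (Nat.mul_le_mul iha ihb)

theorem norm_rootSum_le (k : ℤ) (n : ℕ) : ‖rootSum k n‖ ≤ (rootsNegOne n).card := by
  rw [rootSum]
  refine (norm_sum_le _ _).trans ?_
  simp

theorem tauThree_le (n : ℕ) : tauThree n ≤ n.divisors.card ^ 2 := by
  rw [tauThree, sq]
  refine (Finset.sum_le_card_nsmul _ _ n.divisors.card fun d hd => ?_).trans (by simp)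
  have := Nat.mem_divisors.1 hd
  exact Finset.card_le_card (Nat.divisors_subset_of_dvd this.2 this.1)

/-- Moments of the divisor function. -/
theorem sum_Icc_card_divisors_pow_div_le (j N : ℕ) :
    ∑ n ∈ Finset.Icc 1 N, (n.divisors.card : ℝ) ^ j / n ≤ (1 + Real.log N) ^ 2 ^ j := by
  induction j with
  | zero => simpa using sum_Icc_inv_le N
  | succ j ih =>
    have key : ∑ n ∈ Finset.Icc 1 N, (n.divisors.card : ℝ) ^ (j + 1) / n ≤
        ∑ d ∈ Finset.Icc 1 N, ∑ m ∈ Finset.Icc 1 (N / d),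
          ((d.divisors.card : ℝ) ^ j / d) * ((m.divisors.card : ℝ) ^ j / m) := by
      have e : ∑ n ∈ Finset.Icc 1 N, (n.divisors.card : ℝ) ^ (j + 1) / n =
          ∑ n ∈ Finset.Icc 1 N, ∑ d ∈ n.divisors, (n.divisors.card : ℝ) ^ j / n := by
        refine Finset.sum_congr rfl fun n _ => ?_
        rw [Finset.sum_const, nsmul_eq_mul, pow_succ]; ring
      rw [e, sum_Icc_sum_divisors N (fun _ n => (n.divisors.card : ℝ) ^ j / n)]
      refine Finset.sum_le_sum fun d hd => Finset.sum_le_sum fun m hm => ?_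
      rw [div_mul_div_comm, ← mul_pow]
      push_cast
      have h1 : ((d * m).divisors.card : ℝ) ≤ d.divisors.card * m.divisors.card := by
        exact_mod_cast card_divisors_mul_le d m
      gcongr
    have hb : ∀ d ∈ Finset.Icc 1 N, ∑ m ∈ Finset.Icc 1 (N / d),
        ((d.divisors.card : ℝ) ^ j / d) * ((m.divisors.card : ℝ) ^ j / m) ≤
        ((d.divisors.card : ℝ) ^ j / d) * (1 + Real.log N) ^ 2 ^ j := by
      intro d hd
      rw [← Finset.mul_sum]
      refine mul_le_mul_of_nonneg_left ?_ (by positivity)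
      refine le_trans ?_ ih
      refine Finset.sum_le_sum_of_subset_of_nonneg
        (Finset.Icc_subset_Icc_right (Nat.div_le_self _ _)) fun _ _ _ => by positivity
    refine key.trans ((Finset.sum_le_sum hb).trans ?_)
    rw [← Finset.sum_mul, pow_succ 2 j, mul_two, pow_add]
    refine mul_le_mul_of_nonneg_right ih ?_
    have := one_add_log_nonneg N
    positivity

theorem sum_Icc_card_divisors_pow_le (j N : ℕ) :
    ∑ n ∈ Finset.Icc 1 N, (n.divisors.card : ℝ) ^ j ≤ N * (1 + Real.log N) ^ 2 ^ j := by
  refine le_trans ?_ (mul_le_mul_of_nonneg_left (sum_Icc_card_divisors_pow_div_le j N)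
    (Nat.cast_nonneg N))
  rw [Finset.mul_sum]
  refine Finset.sum_le_sum fun n hn => ?_
  rw [Finset.mem_Icc] at hn
  have h1 : (0 : ℝ) < n := by exact_mod_cast hn.1
  have h2 : (n : ℝ) ≤ N := by exact_mod_cast hn.2
  rw [mul_div_assoc', le_div_iff₀ h1, mul_comm]
  gcongr

theorem sum_filter_dvd_card_divisors_pow_le (j N q : ℕ) (hq : 0 < q) :
    ∑ n ∈ (Finset.Icc 1 N).filter (q ∣ ·), (n.divisors.card : ℝ) ^ j ≤
      (q.divisors.card : ℝ) ^ j * (N / q) * (1 + Real.log N) ^ 2 ^ j := by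
  rw [sum_Icc_filter_dvd q N hq]
  have h0 := one_add_log_nonneg (N / q)
  calc ∑ m ∈ Finset.Icc 1 (N / q), ((q * m).divisors.card : ℝ) ^ j
      ≤ ∑ m ∈ Finset.Icc 1 (N / q), (q.divisors.card : ℝ) ^ j * (m.divisors.card : ℝ) ^ j := by
        refine Finset.sum_le_sum fun m _ => ?_
        rw [← mul_pow]
        have h1 : ((q * m).divisors.card : ℝ) ≤ q.divisors.card * m.divisors.card := by
          exact_mod_cast card_divisors_mul_le q m
        gcongr
    _ = (q.divisors.card : ℝ) ^ j * ∑ m ∈ Finset.Icc 1 (N / q), (m.divisors.card : ℝ) ^ j := by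
        rw [Finset.mul_sum]
    _ ≤ (q.divisors.card : ℝ) ^ j * (((N / q : ℕ) : ℝ) * (1 + Real.log (N / q : ℕ)) ^ 2 ^ j) := by
        gcongr
        exact sum_Icc_card_divisors_pow_le j _
    _ ≤ (q.divisors.card : ℝ) ^ j * ((N / q : ℝ) * (1 + Real.log N) ^ 2 ^ j) := by
        refine mul_le_mul_of_nonneg_left ?_ (by positivity)
        exact mul_le_mul Nat.cast_div_le
          (pow_le_pow_left₀ h0 (one_add_log_mono (Nat.div_le_self _ _)) _) (pow_nonneg h0 _)
          (by positivity)
    _ = _ := by ring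

theorem sqrt_le_of_le_sq {a b : ℝ} (hb : 0 ≤ b) (h : a ≤ b ^ 2) : √a ≤ b :=
  (Real.sqrt_le_sqrt h).trans (Real.sqrt_sq hb).le

theorem kloostermanNorm_nonneg (k : ℤ) (c : ℕ) : 0 ≤ kloostermanNorm k c := by
  unfold kloostermanNorm
  split_ifs
  · exact le_rfl
  · exact norm_nonneg _

set_option maxHeartbeats 1000000 in
theorem exists_norm_sum_dvd_rootSum_le : ∃ C > 0, ∀ (Ψ : ℝ → ℂ) (_ : ∀ t, ‖Ψ t‖ ≤ 1) (Λ : ℝ)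
    (_ : 0 ≤ Λ) (_ : ∀ s t, ‖Ψ s - Ψ t‖ ≤ Λ * |s - t|) (X₁ X₂ : ℝ) (_ : 2 ≤ X₁) (_ : X₁ ≤ X₂)
    (_ : ∀ t, Ψ t ≠ 0 → X₁ ≤ t ∧ t ≤ X₂) (k : ℤ) (_ : k ≠ 0) (q : ℕ) (_ : Squarefree q)
    (_ : (q : ℝ) ≤ √X₂) (η : ℝ) (_ : 0 < η) (_ : η ≤ 1 / 4),
    ‖∑ n ∈ (Finset.Icc 1 ⌊4 * X₂⌋₊).filter (q ∣ ·), Ψ n * rootSum k n‖ ≤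
      C * ((1 + Real.log (4 * X₂)) ^ 2 * (η * q.divisors.card * (X₂ / q) * (Λ * X₂ + |(k : ℝ)| / X₁) +
        q.divisors.card ^ 2 * k.natAbs.divisors.card * √(Nat.gcd k.natAbs q) * (X₂ / X₁) *
          √(X₂ * √X₂) / (√q * η))) := by
  obtain ⟨C, hC, h⟩ := UpperHalfPlane.exists_norm_sum_rootSum_le
  refine ⟨8 * 30 + √(20 * C), by positivity, ?_⟩
  intro Ψ hΨ Λ hΛ hlip X₁ X₂ hX₁ hX hsupp k hk q hq hqX η hη hη4
  have hq0 : 0 < q := Nat.pos_of_ne_zero hq.ne_zero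
  refine (h Ψ hΨ Λ hΛ hlip X₁ X₂ hX₁ hX hsupp k q hq0 η hη hη4).trans ?_
  clear h hΨ hlip hsupp
  have hX₁0 : 0 < X₁ := by linarith
  have hX₂0 : 0 < X₂ := by linarith
  set ℓ := 1 + Real.log (4 * X₂) with hℓ
  have hℓ1 : 1 ≤ ℓ := by
    have := Real.log_nonneg (by linarith : (1 : ℝ) ≤ 4 * X₂)
    linarith
  have hlogle : ∀ N : ℕ, (N : ℝ) ≤ 4 * X₂ → 1 + Real.log N ≤ ℓ := by
    intro N hN
    rcases Nat.eq_zero_or_pos N with rfl | hN0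
    · simpa using hℓ1
    · have := Real.log_le_log (by exact_mod_cast hN0 : (0 : ℝ) < N) hN
      linarith
  have hN4 : (⌊4 * X₂⌋₊ : ℝ) ≤ 4 * X₂ := Nat.floor_le (by linarith)
  have hN1 : (⌊X₂⌋₊ : ℝ) ≤ X₂ := Nat.floor_le (by linarith)
  set τ : ℝ := (q.divisors.card : ℝ) with hτ
  have hτ1 : 1 ≤ τ := by
    rw [hτ]; exact_mod_cast Finset.card_pos.2 ⟨1, Nat.one_mem_divisors.2 hq.ne_zero⟩
  set κ : ℝ := (k.natAbs.divisors.card : ℝ) with hκ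
  have hκ1 : 1 ≤ κ := by
    rw [hκ]
    exact_mod_cast Finset.card_pos.2 ⟨1, Nat.one_mem_divisors.2 (Int.natAbs_ne_zero.2 hk)⟩
  set G : ℝ := (Nat.gcd k.natAbs q : ℝ) with hG
  have hG1 : 1 ≤ G := by
    rw [hG]; exact_mod_cast Nat.gcd_pos_of_pos_right _ hq0
  have hq0' : (0 : ℝ) < q := by exact_mod_cast hq0
  set R := X₂ / X₁ with hR
  have hR1 : 1 ≤ R := (one_le_div hX₁0).2 hX
  have h1 : ∑ n ∈ (Finset.Icc 1 ⌊4 * X₂⌋₊).filter (q ∣ ·), ((rootsNegOne n).card : ℝ) ≤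
      4 * (τ * (X₂ / q) * ℓ ^ 2) := by
    calc ∑ n ∈ (Finset.Icc 1 ⌊4 * X₂⌋₊).filter (q ∣ ·), ((rootsNegOne n).card : ℝ)
        ≤ ∑ n ∈ (Finset.Icc 1 ⌊4 * X₂⌋₊).filter (q ∣ ·), (n.divisors.card : ℝ) ^ 1 := by
          refine Finset.sum_le_sum fun n _ => ?_
          rw [pow_one]; exact_mod_cast card_rootsNegOne_le n
      _ ≤ τ ^ 1 * (⌊4 * X₂⌋₊ / q) * (1 + Real.log ⌊4 * X₂⌋₊) ^ 2 ^ 1 :=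
          sum_filter_dvd_card_divisors_pow_le 1 _ q hq0
      _ ≤ τ ^ 1 * (4 * X₂ / q) * ℓ ^ 2 := by
          have := one_add_log_nonneg ⌊4 * X₂⌋₊
          have := hlogle _ hN4
          rw [pow_one 2]
          refine mul_le_mul ?_ (pow_le_pow_left₀ (by assumption) this _) (by positivity)
            (by positivity)
          gcongr
      _ = _ := by ring
  have hKS : ∑ c ∈ (Finset.Icc 1 ⌊X₂⌋₊).filter (q ∣ ·), kloostermanNorm k c / c ≤
      2 * τ ^ 3 * κ ^ 2 * G / q * √X₂ * ℓ ^ 3 := by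
    refine (sum_kloostermanNorm_div_le k hk q ⌊X₂⌋₊ hq).trans ?_
    have h3 : (tauThree k.natAbs : ℝ) ≤ κ ^ 2 := by
      rw [hκ]; exact_mod_cast tauThree_le k.natAbs
    have := one_add_log_nonneg ⌊X₂⌋₊
    have h4 := hlogle ⌊X₂⌋₊ (by linarith)
    gcongr
  have hs : 0 < √X₂ := Real.sqrt_pos.2 hX₂0
  have hsR : 1 ≤ √R := Real.one_le_sqrt.2 hR1
  have hin : 2 + 4 * √R * ∑ c ∈ (Finset.Icc 1 ⌊X₂⌋₊).filter (q ∣ ·), kloostermanNorm k c / c ≤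
      10 * (√R * τ ^ 3 * κ ^ 2 * G * (√X₂ / q) * ℓ ^ 3) := by
    have h5 : 1 ≤ √X₂ / q := (one_le_div hq0').2 hqX
    have h6 : (1 : ℝ) ≤ √R * τ ^ 3 * κ ^ 2 * G * (√X₂ / q) * ℓ ^ 3 := by
      have := one_le_pow₀ hτ1 (n := 3)
      have := one_le_pow₀ hκ1 (n := 2)
      have := one_le_pow₀ hℓ1 (n := 3)
      refine one_le_mul_of_one_le_of_one_le (one_le_mul_of_one_le_of_one_le
        (one_le_mul_of_one_le_of_one_le (one_le_mul_of_one_le_of_one_le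
          (one_le_mul_of_one_le_of_one_le ?_ ?_) ?_) ?_) ?_) ?_ <;> assumption
    have h7 : 4 * √R * ∑ c ∈ (Finset.Icc 1 ⌊X₂⌋₊).filter (q ∣ ·), kloostermanNorm k c / c ≤
      8 * (√R * τ ^ 3 * κ ^ 2 * G * (√X₂ / q) * ℓ ^ 3) := by
      refine (mul_le_mul_of_nonneg_left hKS (by positivity)).trans (le_of_eq ?_)
      ring
    linarith
  have hρ : ((rootsNegOne q).card : ℝ) + 1 ≤ 2 * τ := by
    have : ((rootsNegOne q).card : ℝ) ≤ τ := by
      rw [hτ]; exact_mod_cast card_rootsNegOne_le q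
    linarith
  have hKS0 : 0 ≤ ∑ c ∈ (Finset.Icc 1 ⌊X₂⌋₊).filter (q ∣ ·), kloostermanNorm k c / c :=
    Finset.sum_nonneg fun c _ => div_nonneg (kloostermanNorm_nonneg k c) (Nat.cast_nonneg c)
  have h2 : √(C * ((rootsNegOne q).card + 1) / η ^ 2 * (X₂ ^ 2 / X₁ * (2 + 4 * √R *
      ∑ c ∈ (Finset.Icc 1 ⌊X₂⌋₊).filter (q ∣ ·), kloostermanNorm k c / c))) ≤
      √(20 * C) * (ℓ ^ 2 * (τ ^ 2 * κ * √G * R * √(X₂ * √X₂) / (√q * η))) := by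
    refine sqrt_le_of_le_sq (by positivity) ?_
    calc C * ((rootsNegOne q).card + 1) / η ^ 2 * (X₂ ^ 2 / X₁ * (2 + 4 * √R *
          ∑ c ∈ (Finset.Icc 1 ⌊X₂⌋₊).filter (q ∣ ·), kloostermanNorm k c / c))
        ≤ C * (2 * τ) / η ^ 2 * (X₂ ^ 2 / X₁ *
          (10 * (√R * τ ^ 3 * κ ^ 2 * G * (√X₂ / q) * ℓ ^ 3))) := by
          gcongr
      _ = 20 * C * (τ ^ 4 * κ ^ 2 * G * (X₂ * √X₂) / (q * η ^ 2)) * (R * √R * ℓ ^ 3) := by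
          rw [hR]; field_simp; ring
      _ ≤ 20 * C * (τ ^ 4 * κ ^ 2 * G * (X₂ * √X₂) / (q * η ^ 2)) * (R * R * ℓ ^ 4) := by
          have : √R ≤ R := by
            rw [Real.sqrt_le_left (by positivity)]; nlinarith
          have : ℓ ^ 3 ≤ ℓ ^ 4 := pow_le_pow_right₀ hℓ1 (by norm_num)
          gcongr
      _ = √(20 * C) ^ 2 * (τ ^ 4 * κ ^ 2 * √G ^ 2 * √(X₂ * √X₂) ^ 2 / (√q ^ 2 * η ^ 2)) *
          (R * R * ℓ ^ 4) := by
          have e1 : √(20 * C) ^ 2 = 20 * C := Real.sq_sqrt (by positivity)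
          have e2 : √G ^ 2 = G := Real.sq_sqrt (by linarith)
          have e3 : √(X₂ * √X₂) ^ 2 = X₂ * √X₂ := Real.sq_sqrt (by positivity)
          have e4 : √(q : ℝ) ^ 2 = q := Real.sq_sqrt hq0'.le
          rw [e1, e2, e3, e4]
      _ = _ := by ring
  have hπ : 12 * Λ * X₂ + 8 * Real.pi * (|(k : ℝ)| / X₁) ≤ 30 * (Λ * X₂ + |(k : ℝ)| / X₁) := by
    have h8 := Real.pi_lt_d2
    have h9 : 0 ≤ Λ * X₂ := by positivity
    have h9' : 0 ≤ |(k : ℝ)| / X₁ := by positivity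
    nlinarith
  have h10 : 2 * (∑ n ∈ (Finset.Icc 1 ⌊4 * X₂⌋₊).filter (q ∣ ·), ((rootsNegOne n).card : ℝ)) *
      (η * (12 * Λ * X₂ + 8 * Real.pi * (|(k : ℝ)| / X₁))) ≤
      8 * 30 * (ℓ ^ 2 * (η * τ * (X₂ / q) * (Λ * X₂ + |(k : ℝ)| / X₁))) := by
    calc _ ≤ 2 * (4 * (τ * (X₂ / q) * ℓ ^ 2)) * (η * (30 * (Λ * X₂ + |(k : ℝ)| / X₁))) := by
          gcongr
      _ = _ := by ring
  have hA : 0 ≤ ℓ ^ 2 * (η * τ * (X₂ / q) * (Λ * X₂ + |(k : ℝ)| / X₁)) := by positivity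
  have hB : 0 ≤ ℓ ^ 2 * (τ ^ 2 * κ * √G * R * √(X₂ * √X₂) / (√q * η)) := by positivity
  have hs' : 0 ≤ √(20 * C) := Real.sqrt_nonneg _
  calc _ ≤ 8 * 30 * (ℓ ^ 2 * (η * τ * (X₂ / q) * (Λ * X₂ + |(k : ℝ)| / X₁))) +
        √(20 * C) * (ℓ ^ 2 * (τ ^ 2 * κ * √G * R * √(X₂ * √X₂) / (√q * η))) := add_le_add h10 h2
    _ ≤ (8 * 30 + √(20 * C)) * (ℓ ^ 2 * (η * τ * (X₂ / q) * (Λ * X₂ + |(k : ℝ)| / X₁))) +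
        (8 * 30 + √(20 * C)) * (ℓ ^ 2 * (τ ^ 2 * κ * √G * R * √(X₂ * √X₂) / (√q * η))) :=
      add_le_add (mul_le_mul_of_nonneg_right (by linarith) hA)
        (mul_le_mul_of_nonneg_right (by linarith) hB)
    _ = _ := by ring

theorem sum_divisors_moebius_eq_ite (n : ℕ) :
    ∑ d ∈ n.divisors, ArithmeticFunction.moebius d = if n = 1 then 1 else 0 := by
  rw [← ArithmeticFunction.coe_mul_zeta_apply, ArithmeticFunction.moebius_mul_coe_zeta,
    ArithmeticFunction.one_apply]

theorem two_pow_le_card_divisors {W m d : ℕ} (hW : 0 < W) (hd : d ∣ primorial W) (h : W ^ m < d) :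
    2 ^ m ≤ d.divisors.card := by
  have hd0 : d ≠ 0 := by omega
  have hsq := (squarefree_primorial W).squarefree_of_dvd hd
  have hmem : ∀ p ∈ d.primeFactors, 1 ≤ p ∧ p ≤ W := fun p hp => by
    have hp' := Nat.mem_primeFactors.1 hp
    exact ⟨hp'.1.one_lt.le, (hp'.1.dvd_primorial_iff).1 (hp'.2.1.trans hd)⟩
  have hm : m ≤ d.primeFactors.card := by
    by_contra! hcon
    have h1 : d ≤ W ^ d.primeFactors.card := by
      conv_lhs => rw [← Nat.prod_primeFactors_of_squarefree hsq]
      exact Finset.prod_le_pow_card _ _ _ fun p hp => (hmem p hp).2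
    have := Nat.pow_le_pow_right hW hcon.le
    omega
  rw [Nat.card_divisors hd0]
  refine (Nat.pow_le_pow_right two_pos hm).trans ?_
  refine Finset.pow_card_le_prod _ _ _ fun p hp => ?_
  have hp' := Nat.mem_primeFactors.1 hp
  have := hp'.1.factorization_pos_of_dvd hd0 hp'.2.1
  omega

/-- One minus the number of elements of `E` dividing `n`. -/
def signedWeight (E : Finset ℕ) (n : ℕ) : ℤ := 1 - ((E.filter (· ∣ n)).card : ℤ)

theorem abs_signedWeight_le {E : Finset ℕ} (hE : 1 ∉ E) {n : ℕ} (hn : n ≠ 0) :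
    |signedWeight E n| ≤ n.divisors.card := by
  have h1 : (E.filter (· ∣ n)).card + 1 ≤ n.divisors.card := by
    rw [← Finset.card_insert_of_notMem (a := 1) (by simp [hE])]
    refine Finset.card_le_card fun d hd => ?_
    rw [Finset.mem_insert, Finset.mem_filter] at hd
    rw [Nat.mem_divisors]
    rcases hd with rfl | hd
    · exact ⟨one_dvd _, hn⟩
    · exact ⟨hd.2, hn⟩
  unfold signedWeight
  rw [abs_le]; constructor <;> omega

theorem signedWeight_eq_sum {E : Finset ℕ} (hE : 1 ∉ E) (n : ℕ) :
    signedWeight E n = ∑ e ∈ (insert 1 E).filter (· ∣ n), (if e = 1 then 1 else -1 : ℤ) := by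
  have h : ∀ e ∈ E.filter (· ∣ n), (if e = 1 then 1 else -1 : ℤ) = -1 := fun e he =>
    if_neg (by rintro rfl; exact hE (Finset.mem_filter.1 he).1)
  rw [Finset.filter_insert, if_pos (one_dvd n), Finset.sum_insert (by simp [hE]), if_pos rfl,
    Finset.sum_congr rfl h]
  rw [signedWeight, Finset.sum_const, nsmul_eq_mul]; ring

/-- Fundamental lemma: the sum over integers free of primes up to `W`, weighted by
`signedWeight`, in terms of sums over multiples of moduli. -/
theorem norm_sum_coprime_primorial_le (f : ℕ → ℂ) (hf : ∀ n, ‖f n‖ ≤ n.divisors.card)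
    (N W m : ℕ) (hW : 0 < W) (E : Finset ℕ) (hE : ∀ e ∈ E, e.Prime ∧ W < e) :
    ‖∑ n ∈ (Finset.Icc 1 N).filter (fun n => n.Coprime (primorial W)), signedWeight E n * f n‖ ≤
      ∑ e ∈ insert 1 E, ∑ d ∈ (primorial W).divisors.filter (· ≤ W ^ m),
        ‖∑ n ∈ (Finset.Icc 1 N).filter (e * d ∣ ·), f n‖ +
      (∑ n ∈ Finset.Icc 1 N, (n.divisors.card : ℝ) ^ 4) / 2 ^ m := by
  classical
  have hE1 : 1 ∉ E := fun h => Nat.not_prime_one (hE 1 h).1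
  set P := primorial W with hP
  have hP0 : P ≠ 0 := primorial_ne_zero W
  set A : ℕ → ℤ := fun n => ∑ d ∈ (P.divisors.filter (· ≤ W ^ m)).filter (· ∣ n),
    ArithmeticFunction.moebius d with hA
  set B : ℕ → ℤ := fun n => ∑ d ∈ (P.divisors.filter (¬ · ≤ W ^ m)).filter (· ∣ n),
    ArithmeticFunction.moebius d with hB
  have hAB : ∀ n, (if n.Coprime P then 1 else 0 : ℤ) = A n + B n := fun n => by
    have h1 := sum_divisors_moebius_eq_ite (n.gcd P)
    rw [hA, hB]
    simp only [Finset.filter_filter]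
    rw [← Finset.sum_filter_add_sum_filter_not (n.gcd P).divisors (· ≤ W ^ m)] at h1
    rw [show (if n.Coprime P then 1 else 0 : ℤ) = if n.gcd P = 1 then 1 else 0 from rfl, ← h1]
    congr 1 <;>
    · refine Finset.sum_congr ?_ fun _ _ => rfl
      ext d
      simp only [Finset.mem_filter, Nat.mem_divisors, Nat.dvd_gcd_iff]
      have := Nat.gcd_ne_zero_right (m := n) hP0
      tauto
  have hBle : ∀ n ≠ 0, |(B n : ℝ)| ≤ (n.divisors.card : ℝ) ^ 2 / 2 ^ m := fun n hn => by
    rw [le_div_iff₀ (by positivity)]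
    rcases ((P.divisors.filter (¬ · ≤ W ^ m)).filter (· ∣ n)).eq_empty_or_nonempty with h | ⟨d, hd⟩
    · rw [hB]; simp only [h, Finset.sum_empty]; simp
    · rw [Finset.mem_filter, Finset.mem_filter, Nat.mem_divisors] at hd
      have h1 := two_pow_le_card_divisors hW hd.1.1.1 (not_le.1 hd.1.2)
      have h2 : 2 ^ m ≤ n.divisors.card := h1.trans
        (Finset.card_le_card (Nat.divisors_subset_of_dvd hn hd.2))
      have h3 : |B n| ≤ n.divisors.card := by
        refine (Finset.abs_sum_le_sum_abs _ _).trans ?_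
        refine (Finset.sum_le_card_nsmul _ _ 1 fun d _ => ArithmeticFunction.abs_moebius_le_one).trans ?_
        rw [nsmul_one]
        norm_cast
        refine Finset.card_le_card fun d hd => ?_
        exact Nat.mem_divisors.2 ⟨(Finset.mem_filter.1 hd).2, hn⟩
      have h3' : |(B n : ℝ)| ≤ n.divisors.card := by exact_mod_cast h3
      have h2' : (2 : ℝ) ^ m ≤ n.divisors.card := by exact_mod_cast h2
      rw [sq]
      exact mul_le_mul h3' h2' (by positivity) (by positivity)
  have hsplit : ∑ n ∈ (Finset.Icc 1 N).filter (fun n => n.Coprime P), (signedWeight E n : ℂ) * f n =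
      ∑ n ∈ Finset.Icc 1 N, (signedWeight E n : ℂ) * A n * f n +
      ∑ n ∈ Finset.Icc 1 N, (signedWeight E n : ℂ) * B n * f n := by
    rw [Finset.sum_filter, ← Finset.sum_add_distrib]
    refine Finset.sum_congr rfl fun n _ => ?_
    have h1 : ((if n.Coprime P then 1 else 0 : ℤ) : ℂ) = A n + B n := by rw [hAB n]; push_cast; rfl
    have h2 : (if n.Coprime P then (signedWeight E n : ℂ) * f n else 0) =
        (signedWeight E n : ℂ) * ((if n.Coprime P then 1 else 0 : ℤ) : ℂ) * f n := by
      split_ifs <;> simp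
    rw [h2, h1]; ring
  rw [hsplit]
  refine (norm_add_le _ _).trans (add_le_add ?_ ?_)
  · have hre : ∑ n ∈ Finset.Icc 1 N, (signedWeight E n : ℂ) * A n * f n =
        ∑ e ∈ insert 1 E, ∑ d ∈ P.divisors.filter (· ≤ W ^ m),
          ((if e = 1 then 1 else -1 : ℤ) : ℂ) * (ArithmeticFunction.moebius d : ℂ) *
          ∑ n ∈ (Finset.Icc 1 N).filter (e * d ∣ ·), f n := by
      have h1 : ∀ e ∈ insert 1 E, ∀ d ∈ P.divisors.filter (· ≤ W ^ m),
          ((if e = 1 then 1 else -1 : ℤ) : ℂ) * (ArithmeticFunction.moebius d : ℂ) *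
          ∑ n ∈ (Finset.Icc 1 N).filter (e * d ∣ ·), f n =
          ∑ n ∈ Finset.Icc 1 N, (if e ∣ n then ((if e = 1 then 1 else -1 : ℤ) : ℂ) else 0) *
            (if d ∣ n then (ArithmeticFunction.moebius d : ℂ) else 0) * f n := by
        intro e he d hd
        have hcop : e.Coprime d := by
          rcases Finset.mem_insert.1 he with rfl | he
          · exact Nat.coprime_one_left d
          · rw [(hE e he).1.coprime_iff_not_dvd]
            intro h
            have h2 := h.trans (Nat.mem_divisors.1 (Finset.mem_filter.1 hd).1).1
            have := ((hE e he).1.dvd_primorial_iff).1 h2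
            have := (hE e he).2
            omega
        rw [Finset.sum_filter, Finset.mul_sum]
        refine Finset.sum_congr rfl fun n _ => ?_
        have h3 : e * d ∣ n ↔ e ∣ n ∧ d ∣ n :=
          ⟨fun h => ⟨(dvd_mul_right _ _).trans h, (dvd_mul_left _ _).trans h⟩,
            fun h => hcop.mul_dvd_of_dvd_of_dvd h.1 h.2⟩
        by_cases h4 : e ∣ n <;> by_cases h5 : d ∣ n <;> simp [h3, h4, h5]
      rw [Finset.sum_congr rfl fun e he => Finset.sum_congr rfl fun d hd => h1 e he d hd]
      rw [Finset.sum_congr rfl fun e _ => Finset.sum_comm, Finset.sum_comm]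
      refine Finset.sum_congr rfl fun n _ => ?_
      rw [signedWeight_eq_sum hE1, hA]
      simp only [Finset.sum_filter (· ∣ n)]
      push_cast
      rw [mul_assoc, Finset.sum_mul]
      refine Finset.sum_congr rfl fun e _ => ?_
      rw [Finset.sum_mul, Finset.mul_sum]
      refine Finset.sum_congr rfl fun d _ => ?_
      ring
    rw [hre]
    refine norm_sum_le_of_le _ fun e _ => norm_sum_le_of_le _ fun d _ => ?_
    rw [norm_mul]
    refine mul_le_of_le_one_left (norm_nonneg _) ?_
    rw [norm_mul, Complex.norm_intCast, Complex.norm_intCast]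
    refine mul_le_one₀ ?_ (abs_nonneg _) ?_
    · split_ifs <;> simp
    · exact_mod_cast ArithmeticFunction.abs_moebius_le_one
  · rw [Finset.sum_div]
    refine norm_sum_le_of_le _ fun n hn => ?_
    have hn0 : n ≠ 0 := by have := (Finset.mem_Icc.1 hn).1; omega
    rw [norm_mul, norm_mul, Complex.norm_intCast, Complex.norm_intCast]
    have h1 : |(signedWeight E n : ℝ)| ≤ n.divisors.card := by
      exact_mod_cast abs_signedWeight_le hE1 hn0
    calc |(signedWeight E n : ℝ)| * |(B n : ℝ)| * ‖f n‖
        ≤ n.divisors.card * ((n.divisors.card : ℝ) ^ 2 / 2 ^ m) * n.divisors.card := by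
          have := hBle n hn0
          have := hf n
          gcongr
      _ = _ := by ring

/-- Weights on the scale `x = exp (u ^ 20)`, with polynomial control in `u`. -/
structure IsScaleWeight (u : ℝ) (Ψ : ℝ → ℂ) : Prop where
  norm_le : ∀ t, ‖Ψ t‖ ≤ 1
  lipschitz : ∀ s t, ‖Ψ s - Ψ t‖ ≤ u ^ 100 / Real.exp (u ^ 20) * |s - t|
  support : ∀ t, Ψ t ≠ 0 → Real.exp (u ^ 20) / u ^ 20 ≤ t ∧ t ≤ 2 * Real.exp (u ^ 20)

theorem two_mul_le_exp {y : ℝ} (hy : 2 ≤ y) : 2 * y ≤ Real.exp y := by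
  have := Real.quadratic_le_exp_of_nonneg (by linarith : 0 ≤ y)
  nlinarith

theorem log_mul_exp_pow_le {u c : ℝ} (hu : 2 ≤ u) (hc0 : 1 ≤ c) (hc : c ≤ 2 ^ 10) :
    1 + Real.log (c * Real.exp (u ^ 20)) ≤ 2 * u ^ 20 := by
  rw [Real.log_mul (by linarith) (Real.exp_pos _).ne', Real.log_exp]
  have h1 : Real.log c ≤ 2 ^ 10 := by
    have := Real.log_le_sub_one_of_pos (by linarith : 0 < c)
    linarith
  have h2 : (2 : ℝ) ^ 20 ≤ u ^ 20 := pow_le_pow_left₀ (by norm_num) hu 20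
  linarith

theorem exists_norm_sum_dvd_scale_le : ∃ C > 0, ∀ (u : ℝ) (_ : 2 ≤ u) (Ψ : ℝ → ℂ)
    (_ : IsScaleWeight u Ψ) (k : ℤ) (_ : k ≠ 0) (_ : (k.natAbs : ℝ) ≤ u ^ 40) (q : ℕ)
    (_ : Squarefree q) (_ : (q : ℝ) ^ 2 ≤ Real.exp (u ^ 20)),
    ‖∑ n ∈ (Finset.Icc 1 ⌊8 * Real.exp (u ^ 20)⌋₊).filter (q ∣ ·), Ψ n * rootSum k n‖ ≤
      C * (u ^ 140 * q.divisors.card ^ 2 * (Real.exp (-u ^ 10) * (Real.exp (u ^ 20) / q) +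
        Real.exp (u ^ 10) * (√(Real.exp (u ^ 20) * √(Real.exp (u ^ 20))) / √q))) := by
  obtain ⟨C, hC, h⟩ := exists_norm_sum_dvd_rootSum_le
  refine ⟨C * 24, by positivity, ?_⟩
  intro u hu Ψ hΨ k hk hk' q hq hqx
  have hu0 : 0 < u := by linarith
  have hy2 : 2 ≤ u ^ 20 := by
    have : (2 : ℝ) ^ 20 ≤ u ^ 20 := pow_le_pow_left₀ (by norm_num) hu 20
    linarith
  have hη4 : Real.exp (-u ^ 10) ≤ 1 / 4 := by
    rw [Real.exp_neg, one_div]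
    refine inv_anti₀ (by norm_num) ?_
    have h1 : (2 : ℝ) ^ 10 ≤ u ^ 10 := pow_le_pow_left₀ (by norm_num) hu 10
    linarith [Real.add_one_le_exp (u ^ 10)]
  have hx2 := two_mul_le_exp hy2
  have hℓ := log_mul_exp_pow_le (c := 8) hu (by norm_num) (by norm_num)
  have hinv : (Real.exp (-u ^ 10))⁻¹ = Real.exp (u ^ 10) := by rw [Real.exp_neg, inv_inv]
  set x := Real.exp (u ^ 20) with hx
  have hx0 : 0 < x := Real.exp_pos _
  have hX₁ : 2 ≤ x / u ^ 20 := by rw [le_div_iff₀ (by positivity)]; linarith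
  have hX : x / u ^ 20 ≤ 2 * x := by
    rw [div_le_iff₀ (by positivity)]; nlinarith
  have hqX : (q : ℝ) ≤ √(2 * x) := by
    refine Real.le_sqrt_of_sq_le (by linarith)
  have hmain := h Ψ hΨ.norm_le (u ^ 100 / x) (by positivity) hΨ.lipschitz (x / u ^ 20) (2 * x) hX₁ hX
    hΨ.support k hk q hq hqX _ (Real.exp_pos _) hη4
  clear h
  rw [← mul_assoc, show (4 : ℝ) * 2 = 8 by norm_num] at hmain
  refine hmain.trans ?_
  have hR : 2 * x / (x / u ^ 20) = 2 * u ^ 20 := by field_simp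
  have hΛ : u ^ 100 / x * (2 * x) = 2 * u ^ 100 := by field_simp
  rw [hR, hΛ]
  set η := Real.exp (-u ^ 10) with hη
  have hη0 : 0 < η := Real.exp_pos _
  set τ : ℝ := (q.divisors.card : ℝ) with hτ
  have hτ1 : 1 ≤ τ := by
    rw [hτ]; exact_mod_cast Finset.card_pos.2 ⟨1, Nat.one_mem_divisors.2 hq.ne_zero⟩
  have hk1 : (1 : ℝ) ≤ k.natAbs := by exact_mod_cast Nat.pos_of_ne_zero (Int.natAbs_ne_zero.2 hk)
  have hκ : (k.natAbs.divisors.card : ℝ) ≤ u ^ 40 :=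
    le_trans (by exact_mod_cast Nat.card_divisors_le_self _) hk'
  have hq0 : 0 < q := Nat.pos_of_ne_zero hq.ne_zero
  have hG : √(Nat.gcd k.natAbs q : ℝ) ≤ u ^ 40 := by
    have h1 : (Nat.gcd k.natAbs q : ℝ) ≤ k.natAbs := by
      exact_mod_cast Nat.gcd_le_left _ (Nat.pos_of_ne_zero (Int.natAbs_ne_zero.2 hk))
    have h2 : (1 : ℝ) ≤ u ^ 40 := one_le_pow₀ (by linarith)
    refine sqrt_le_of_le_sq (by positivity) ?_
    nlinarith
  have hkX : |(k : ℝ)| / (x / u ^ 20) ≤ u ^ 100 := by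
    have h1 : |(k : ℝ)| = k.natAbs := by rw [Nat.cast_natAbs]; push_cast; rfl
    rw [h1]
    refine (div_le_self (Nat.cast_nonneg _) (by linarith)).trans (hk'.trans ?_)
    exact pow_le_pow_right₀ (by linarith) (by norm_num)
  have hsx : √(2 * x * √(2 * x)) ≤ 2 * √(x * √x) := by
    refine sqrt_le_of_le_sq (by positivity) ?_
    rw [mul_pow, Real.sq_sqrt (by positivity), Real.sqrt_mul (by norm_num)]
    have h1 : √2 ≤ 2 := sqrt_le_of_le_sq (by norm_num) (by norm_num)
    have : 0 ≤ x * √x := by positivity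
    nlinarith
  have hq0' : (0 : ℝ) < q := by exact_mod_cast hq0
  have hsq : 0 < √(q : ℝ) := Real.sqrt_pos.2 hq0'
  have hl0 : 0 ≤ 1 + Real.log (8 * x) := by
    have := Real.log_nonneg (by linarith : 1 ≤ 8 * x)
    linarith
  have e1 : η * τ * (2 * x / q) * (2 * u ^ 100 + |(k : ℝ)| / (x / u ^ 20)) ≤
      6 * u ^ 100 * (τ ^ 2 * (η * (x / q))) := by
    have h1 : τ ≤ τ ^ 2 := by nlinarith
    calc η * τ * (2 * x / q) * (2 * u ^ 100 + |(k : ℝ)| / (x / u ^ 20))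
        ≤ η * τ ^ 2 * (2 * x / q) * (2 * u ^ 100 + u ^ 100) := by gcongr
      _ = _ := by ring
  have e2 : τ ^ 2 * k.natAbs.divisors.card * √(Nat.gcd k.natAbs q : ℝ) * (2 * u ^ 20) *
      √(2 * x * √(2 * x)) / (√q * η) ≤
      4 * u ^ 100 * (τ ^ 2 * (Real.exp (u ^ 10) * (√(x * √x) / √q))) := by
    calc _ ≤ τ ^ 2 * u ^ 40 * u ^ 40 * (2 * u ^ 20) * (2 * √(x * √x)) / (√q * η) := by gcongr
      _ = 4 * u ^ 100 * (τ ^ 2 * (η⁻¹ * (√(x * √x) / √q))) := by field_simp; ring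
      _ = _ := by rw [hinv]
  have f1 : 0 ≤ τ ^ 2 * (η * (x / q)) := by positivity
  have f2 : 0 ≤ τ ^ 2 * (Real.exp (u ^ 10) * (√(x * √x) / √q)) := by positivity
  calc _ ≤ C * ((2 * u ^ 20) ^ 2 * (6 * u ^ 100 * (τ ^ 2 * (η * (x / q))) +
        4 * u ^ 100 * (τ ^ 2 * (Real.exp (u ^ 10) * (√(x * √x) / √q))))) := by
        refine mul_le_mul_of_nonneg_left ?_ hC.le
        refine mul_le_mul (pow_le_pow_left₀ hl0 hℓ 2) (add_le_add e1 e2) ?_ (by positivity)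
        positivity
    _ ≤ C * ((2 * u ^ 20) ^ 2 * (6 * u ^ 100 * (τ ^ 2 * (η * (x / q))) +
        6 * u ^ 100 * (τ ^ 2 * (Real.exp (u ^ 10) * (√(x * √x) / √q))))) := by
        gcongr
        norm_num
    _ = _ := by ring

theorem pow_le_factorial_mul_exp {y : ℝ} (hy : 0 ≤ y) (n : ℕ) :
    y ^ n ≤ n.factorial * Real.exp y := by
  have := Real.pow_div_factorial_le_exp y hy n
  rwa [div_le_iff₀ (by positivity), mul_comm] at this

theorem pow_le_mul_two_pow_floor {y : ℝ} (hy : 0 ≤ y) (n : ℕ) :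
    y ^ n ≤ 2 * (2 ^ n * n.factorial) * 2 ^ ⌊y⌋₊ := by
  have h1 := pow_le_factorial_mul_exp (by linarith : 0 ≤ y / 2) n
  rw [div_pow, div_le_iff₀ (by positivity)] at h1
  have h2 : y / 2 ≤ 1 / 2 + ⌊y⌋₊ * (1 / 2) := by have := Nat.lt_floor_add_one y; linarith
  have h4 : Real.exp (1 / 2) ≤ 2 := by
    have h5 := Real.exp_one_lt_d9
    have h6 : Real.exp (1 / 2) ^ 2 = Real.exp 1 := by rw [← Real.exp_nat_mul]; norm_num
    nlinarith [Real.exp_pos (1 / 2)]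
  have h3 : Real.exp (y / 2) ≤ 2 * 2 ^ ⌊y⌋₊ := by
    refine (Real.exp_le_exp.2 h2).trans ?_
    rw [Real.exp_add, Real.exp_nat_mul]
    gcongr
  calc y ^ n ≤ n.factorial * Real.exp (y / 2) * 2 ^ n := h1
    _ ≤ n.factorial * (2 * 2 ^ ⌊y⌋₊) * 2 ^ n := by gcongr
    _ = _ := by ring

theorem norm_scaleWeight_mul_rootSum_le {u : ℝ} {Ψ : ℝ → ℂ} (hΨ : IsScaleWeight u Ψ) (k : ℤ)
    (n : ℕ) : ‖Ψ n * rootSum k n‖ ≤ n.divisors.card := by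
  rw [norm_mul]
  refine (mul_le_of_le_one_left (norm_nonneg _) (hΨ.norm_le _)).trans
    ((norm_rootSum_le k n).trans ?_)
  exact_mod_cast card_rootsNegOne_le n

/-- A single Type I modulus. -/
theorem exists_norm_sum_dvd_mul_scale_le : ∃ C > 0, ∀ (u : ℝ) (_ : 5 ≤ u) (Ψ : ℝ → ℂ)
    (_ : IsScaleWeight u Ψ) (k : ℤ) (_ : k ≠ 0) (_ : (k.natAbs : ℝ) ≤ u ^ 40) (e d : ℕ)
    (_ : Squarefree (e * d)) (_ : (e : ℝ) ≤ Real.exp (u ^ 20 / 2 - u ^ 11))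
    (_ : (d : ℝ) ≤ Real.exp (u ^ 10)),
    ‖∑ n ∈ (Finset.Icc 1 ⌊8 * Real.exp (u ^ 20)⌋₊).filter (e * d ∣ ·), Ψ n * rootSum k n‖ ≤
      C * (u ^ 140 * Real.exp (-u ^ 10) * Real.exp (u ^ 20)) *
        (((e.divisors.card : ℝ) ^ 2 / e) * ((d.divisors.card : ℝ) ^ 2 / d)) := by
  obtain ⟨C, hC, h⟩ := exists_norm_sum_dvd_scale_le
  refine ⟨2 * C, by positivity, ?_⟩
  intro u hu Ψ hΨ k hk hk' e d hsq he hd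
  have hu0 : 0 < u := by linarith
  have h11 : u ^ 11 = u * u ^ 10 := by ring
  have h10 : 0 < u ^ 10 := by positivity
  have hq : ((e * d : ℕ) : ℝ) ≤ Real.exp (u ^ 20 / 2 - u ^ 11 + u ^ 10) := by
    rw [Real.exp_add]; push_cast; gcongr
  have hq2 : ((e * d : ℕ) : ℝ) ^ 2 ≤ Real.exp (u ^ 20) := by
    refine (pow_le_pow_left₀ (Nat.cast_nonneg _) hq 2).trans ?_
    rw [← Real.exp_nat_mul, Real.exp_le_exp]
    push_cast
    nlinarith
  refine (h u (by linarith) Ψ hΨ k hk hk' (e * d) hsq hq2).trans ?_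
  clear h
  have hq0 : 0 < e * d := Nat.pos_of_ne_zero hsq.ne_zero
  have hq0' : (0 : ℝ) < (e * d : ℕ) := by exact_mod_cast hq0
  have hτ : ((e * d).divisors.card : ℝ) ≤ e.divisors.card * d.divisors.card := by
    exact_mod_cast card_divisors_mul_le e d
  have hsx : √(Real.exp (u ^ 20) * √(Real.exp (u ^ 20))) = Real.exp (u ^ 20 * 3 / 4) := by
    rw [← Real.exp_half, ← Real.exp_add, ← Real.exp_half]; congr 1; ring
  have hkey : Real.exp (u ^ 10) * (√(Real.exp (u ^ 20) * √(Real.exp (u ^ 20))) / √(e * d : ℕ)) ≤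
      Real.exp (-u ^ 10) * (Real.exp (u ^ 20) / (e * d : ℕ)) := by
    have h1 : √((e * d : ℕ) : ℝ) ≤ Real.exp (u ^ 20 / 4 - u ^ 11 / 2 + u ^ 10 / 2) := by
      refine (Real.sqrt_le_sqrt hq).trans ?_
      rw [← Real.exp_half, Real.exp_le_exp]; apply le_of_eq; ring
    have h2 : (1 : ℝ) / √(e * d : ℕ) = √(e * d : ℕ) / (e * d : ℕ) := by
      rw [Real.sqrt_div_self', one_div]
    rw [hsx]
    calc _ = Real.exp (u ^ 10) * Real.exp (u ^ 20 * 3 / 4) * (1 / √(e * d : ℕ)) := by ring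
      _ = Real.exp (u ^ 10) * Real.exp (u ^ 20 * 3 / 4) * √(e * d : ℕ) / (e * d : ℕ) := by
        rw [h2]; ring
      _ ≤ Real.exp (u ^ 10) * Real.exp (u ^ 20 * 3 / 4) *
          Real.exp (u ^ 20 / 4 - u ^ 11 / 2 + u ^ 10 / 2) / (e * d : ℕ) := by gcongr
      _ ≤ (Real.exp (-u ^ 10) * Real.exp (u ^ 20)) / (e * d : ℕ) := by
        refine div_le_div_of_nonneg_right ?_ hq0'.le
        rw [← Real.exp_add, ← Real.exp_add, ← Real.exp_add, Real.exp_le_exp]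
        nlinarith
      _ = _ := by ring
  have hx0 : 0 ≤ Real.exp (-u ^ 10) * (Real.exp (u ^ 20) / (e * d : ℕ)) := by positivity
  calc _ ≤ C * (u ^ 140 * (e.divisors.card * d.divisors.card : ℝ) ^ 2 *
        (Real.exp (-u ^ 10) * (Real.exp (u ^ 20) / (e * d : ℕ)) +
        Real.exp (-u ^ 10) * (Real.exp (u ^ 20) / (e * d : ℕ)))) := by
        gcongr
    _ = _ := by push_cast; ring

/-- Type I estimate over integers without small prime factors. -/
theorem exists_norm_sum_coprime_scale_le : ∃ C > 0, ∀ (u : ℝ) (_ : 5 ≤ u) (Ψ : ℝ → ℂ)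
    (_ : IsScaleWeight u Ψ) (k : ℤ) (_ : k ≠ 0) (_ : (k.natAbs : ℝ) ≤ u ^ 40) (E : Finset ℕ)
    (_ : ∀ e ∈ E, e.Prime ∧ ⌊Real.exp (u ^ 5)⌋₊ < e ∧ (e : ℝ) ≤ Real.exp (u ^ 20 / 2 - u ^ 11)),
    ‖∑ n ∈ (Finset.Icc 1 ⌊8 * Real.exp (u ^ 20)⌋₊).filter
        (fun n => n.Coprime (primorial ⌊Real.exp (u ^ 5)⌋₊)),
      signedWeight E n * (Ψ n * rootSum k n)‖ ≤ C * (Real.exp (u ^ 20) / u ^ 29) := by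
  obtain ⟨C, hC, h⟩ := exists_norm_sum_dvd_mul_scale_le
  refine ⟨C * (256 * Nat.factorial 33) + 8 * 2 ^ 16 * (2 * (2 ^ 70 * Nat.factorial 70)),
    by positivity, ?_⟩
  intro u hu Ψ hΨ k hk hk' E hE
  have hu0 : 0 < u := by linarith
  set W := ⌊Real.exp (u ^ 5)⌋₊ with hW
  set m := ⌊u ^ 5⌋₊ with hm
  have hW0 : 0 < W := Nat.floor_pos.2 (Real.one_le_exp (by positivity))
  refine (norm_sum_coprime_primorial_le _ (norm_scaleWeight_mul_rootSum_le hΨ k) _ W m hW0 E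
    fun e he => ⟨(hE e he).1, (hE e he).2.1⟩).trans ?_
  have hWm : ((W ^ m : ℕ) : ℝ) ≤ Real.exp (u ^ 10) := by
    push_cast
    calc (W : ℝ) ^ m ≤ Real.exp (u ^ 5) ^ m :=
          pow_le_pow_left₀ (Nat.cast_nonneg _) (Nat.floor_le (Real.exp_pos _).le) _
      _ = Real.exp (m * u ^ 5) := by rw [Real.exp_nat_mul]
      _ ≤ Real.exp (u ^ 10) := by
        rw [Real.exp_le_exp]
        have : (m : ℝ) ≤ u ^ 5 := Nat.floor_le (by positivity)
        calc (m : ℝ) * u ^ 5 ≤ u ^ 5 * u ^ 5 := by gcongr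
          _ = _ := by ring
  set x := Real.exp (u ^ 20) with hx
  have hx1 : 1 ≤ x := Real.one_le_exp (by positivity)
  have hE1 : ∀ e ∈ insert 1 E, Nat.Coprime e (primorial W) ∧ Squarefree e ∧
      (e : ℝ) ≤ Real.exp (u ^ 20 / 2 - u ^ 11) := by
    intro e he
    rcases Finset.mem_insert.1 he with rfl | he
    · refine ⟨Nat.coprime_one_left _, squarefree_one, ?_⟩
      rw [Nat.cast_one]
      refine Real.one_le_exp ?_
      have h1 : (5 : ℝ) ^ 9 ≤ u ^ 9 := pow_le_pow_left₀ (by norm_num) hu 9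
      have h2 : u ^ 20 = u ^ 9 * u ^ 11 := by ring
      have h3 : 0 < u ^ 11 := by positivity
      nlinarith
    · obtain ⟨h1, h2, h3⟩ := hE e he
      refine ⟨?_, h1.squarefree, h3⟩
      rw [h1.coprime_iff_not_dvd, h1.dvd_primorial_iff]; omega
  set G := u ^ 140 * Real.exp (-u ^ 10) * x with hG
  have hsub : ∀ a : ℕ, 0 < a → (a : ℝ) ≤ x → a ∈ Finset.Icc 1 ⌊x⌋₊ := fun a ha hax =>
    Finset.mem_Icc.2 ⟨ha, Nat.le_floor hax⟩
  have hlog : ∑ n ∈ Finset.Icc 1 ⌊x⌋₊, (n.divisors.card : ℝ) ^ 2 / n ≤ (2 * u ^ 20) ^ 4 := by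
    refine (sum_Icc_card_divisors_pow_div_le 2 _).trans ?_
    refine pow_le_pow_left₀ (one_add_log_nonneg _) ?_ 4
    refine le_trans ?_ (log_mul_exp_pow_le (c := 1) (by linarith : 2 ≤ u) le_rfl (by norm_num))
    rw [one_mul]
    have := Real.log_le_log (by exact_mod_cast Nat.floor_pos.2 hx1) (Nat.floor_le (by linarith : 0 ≤ x))
    linarith
  have hfirst : ∑ e ∈ insert 1 E, ∑ d ∈ (primorial W).divisors.filter (· ≤ W ^ m),
      ‖∑ n ∈ (Finset.Icc 1 ⌊8 * x⌋₊).filter (e * d ∣ ·), Ψ n * rootSum k n‖ ≤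
      C * G * ((2 * u ^ 20) ^ 4 * (2 * u ^ 20) ^ 4) := by
    calc _ ≤ ∑ e ∈ insert 1 E, ∑ d ∈ (primorial W).divisors.filter (· ≤ W ^ m),
          C * G * (((e.divisors.card : ℝ) ^ 2 / e) * ((d.divisors.card : ℝ) ^ 2 / d)) := by
          refine Finset.sum_le_sum fun e he => Finset.sum_le_sum fun d hd => ?_
          rw [Finset.mem_filter, Nat.mem_divisors] at hd
          obtain ⟨h1, h2, h3⟩ := hE1 e he
          refine h u hu Ψ hΨ k hk hk' e d ?_ h3 (le_trans (by exact_mod_cast hd.2) hWm)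
          exact (Nat.squarefree_mul (h1.coprime_dvd_right hd.1.1)).2
            ⟨h2, (squarefree_primorial W).squarefree_of_dvd hd.1.1⟩
      _ = C * G * ((∑ e ∈ insert 1 E, (e.divisors.card : ℝ) ^ 2 / e) *
          ∑ d ∈ (primorial W).divisors.filter (· ≤ W ^ m), (d.divisors.card : ℝ) ^ 2 / d) := by
          rw [Finset.sum_mul_sum, Finset.mul_sum]
          refine Finset.sum_congr rfl fun e _ => ?_
          rw [Finset.mul_sum]
      _ ≤ _ := by
          clear h
          have hG0 : 0 ≤ C * G := by positivity
          refine mul_le_mul_of_nonneg_left ?_ hG0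
          refine mul_le_mul (le_trans (Finset.sum_le_sum_of_subset_of_nonneg ?_ ?_) hlog)
            (le_trans (Finset.sum_le_sum_of_subset_of_nonneg ?_ ?_) hlog) ?_ (by positivity)
          · intro e he
            obtain ⟨h1, h2, h3⟩ := hE1 e he
            refine hsub e (Nat.pos_of_ne_zero h2.ne_zero) (h3.trans ?_)
            rw [hx, Real.exp_le_exp]
            have h4 : 0 < u ^ 20 := by positivity
            have h5 : 0 < u ^ 11 := by positivity
            linarith
          · intros; positivity
          · intro d hd
            rw [Finset.mem_filter, Nat.mem_divisors] at hd
            refine hsub d (Nat.pos_of_dvd_of_pos hd.1.1 (primorial_pos W))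
              (le_trans (le_trans (by exact_mod_cast hd.2) hWm) ?_)
            rw [hx, Real.exp_le_exp]
            exact pow_le_pow_right₀ (by linarith) (by norm_num)
          · intros; positivity
          · exact Finset.sum_nonneg fun _ _ => by positivity
  have hsecond : (∑ n ∈ Finset.Icc 1 ⌊8 * x⌋₊, (n.divisors.card : ℝ) ^ 4) / 2 ^ m ≤
      8 * x * (2 * u ^ 20) ^ 16 / 2 ^ m := by
    refine div_le_div_of_nonneg_right ?_ (by positivity)
    refine (sum_Icc_card_divisors_pow_le 4 _).trans ?_
    have h1 : (⌊8 * x⌋₊ : ℝ) ≤ 8 * x := Nat.floor_le (by linarith)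
    refine mul_le_mul h1 (pow_le_pow_left₀ (one_add_log_nonneg _) ?_ 16)
      (pow_nonneg (one_add_log_nonneg _) _) (by linarith)
    refine le_trans ?_ (log_mul_exp_pow_le (c := 8) (by linarith : 2 ≤ u) (by norm_num) (by norm_num))
    have := Real.log_le_log (by exact_mod_cast Nat.floor_pos.2 (by linarith)) h1
    linarith
  rw [add_mul]
  refine add_le_add (hfirst.trans ?_) (hsecond.trans ?_)
  · have h1 := pow_le_factorial_mul_exp (by positivity : 0 ≤ u ^ 10) 33
    rw [hG, Real.exp_neg]
    rw [mul_div_assoc', le_div_iff₀ (by positivity)]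
    have h2 : u ^ 329 ≤ Nat.factorial 33 * Real.exp (u ^ 10) := by
      refine le_trans ?_ h1
      rw [← pow_mul]
      exact pow_le_pow_right₀ (by linarith) (by norm_num)
    have h3 : (Real.exp (u ^ 10))⁻¹ * u ^ 329 ≤ Nat.factorial 33 := by
      rw [inv_mul_le_iff₀ (Real.exp_pos _), mul_comm]; exact h2
    calc _ = C * 256 * x * ((Real.exp (u ^ 10))⁻¹ * u ^ 329) := by ring
      _ ≤ C * 256 * x * Nat.factorial 33 := by clear h; gcongr
      _ = _ := by ring
  · have h1 := pow_le_mul_two_pow_floor (by positivity : 0 ≤ u ^ 5) 70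
    rw [← hm] at h1
    have h2 : u ^ 349 ≤ 2 * (2 ^ 70 * Nat.factorial 70) * 2 ^ m := by
      refine le_trans ?_ h1
      rw [← pow_mul]
      exact pow_le_pow_right₀ (by linarith) (by norm_num)
    rw [mul_div_assoc', div_le_div_iff₀ (by positivity) (by positivity)]
    calc _ = 8 * 2 ^ 16 * x * u ^ 349 := by ring
      _ ≤ 8 * 2 ^ 16 * x * (2 * (2 ^ 70 * Nat.factorial 70) * 2 ^ m) := by clear h; gcongr
      _ = _ := by ring

section

open ComplexConjugate

theorem expTwoPi_mul_mod_div (k : ℤ) {n : ℕ} (hn : 0 < n) (a : ℕ) :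
    expTwoPi (k * (((a % n : ℕ) : ℝ) / n)) = expTwoPi (k * ((a : ℝ) / n)) := by
  have hn' : (n : ℝ) ≠ 0 := by exact_mod_cast hn.ne'
  have h1 : (a : ℝ) = (a % n : ℕ) + n * (a / n : ℕ) := by exact_mod_cast (Nat.mod_add_div a n).symm
  generalize a % n = r at *
  generalize a / n = t at *
  have h2 : (k : ℝ) * ((a : ℝ) / n) = k * ((r : ℝ) / n) + ((k * t : ℤ) : ℝ) := by
    rw [h1]
    push_cast
    field_simp
  rw [h2, expTwoPi_add, expTwoPi_intCast, mul_one]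

/-- The part of `rootSum k n` coming from the roots congruent to `μ` modulo `l`. -/
noncomputable def rootSumMod (k : ℤ) (n l μ : ℕ) : ℂ :=
  ∑ ν ∈ (rootsNegOne n).filter (· % l = μ), expTwoPi (k * ((ν : ℝ) / n))

theorem sum_rootSumMod (k : ℤ) {n l : ℕ} (hn : 0 < n) (h : l ∣ n) :
    ∑ μ ∈ rootsNegOne l, rootSumMod k n l μ = rootSum k n := by
  unfold rootSumMod rootSum
  exact Finset.sum_fiberwise_of_maps_to (fun ν hν => mod_mem_rootsNegOne
    (Nat.pos_of_dvd_of_pos h hn) h (mem_rootsNegOne.1 hν).2) _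

theorem norm_rootSumMod_le (k : ℤ) (n l μ : ℕ) :
    ‖rootSumMod k n l μ‖ ≤ ((rootsNegOne n).filter (· % l = μ)).card := by
  unfold rootSumMod
  refine (norm_sum_le_of_le _ fun ν _ => (norm_expTwoPi _).le).trans ?_
  simp

theorem sum_norm_rootSumMod_sq_le (k : ℤ) {n l : ℕ} (hn : 0 < n) (h : l ∣ n) :
    ∑ μ ∈ rootsNegOne l, ‖rootSumMod k n l μ‖ ^ 2 ≤ (n.divisors.card : ℝ) ^ 2 := by
  have h1 : ∑ μ ∈ rootsNegOne l, (((rootsNegOne n).filter (· % l = μ)).card : ℝ) =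
      (rootsNegOne n).card := by
    rw [Finset.card_eq_sum_card_fiberwise (fun ν hν => mod_mem_rootsNegOne
      (Nat.pos_of_dvd_of_pos h hn) h (mem_rootsNegOne.1 hν).2)]
    push_cast; rfl
  have h2 : ((rootsNegOne n).card : ℝ) ≤ n.divisors.card := by exact_mod_cast card_rootsNegOne_le n
  calc _ ≤ ∑ μ ∈ rootsNegOne l, (((rootsNegOne n).filter (· % l = μ)).card : ℝ) ^ 2 := by
        refine Finset.sum_le_sum fun μ _ => ?_
        exact pow_le_pow_left₀ (norm_nonneg _) (norm_rootSumMod_le k n l μ) 2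
    _ ≤ (∑ μ ∈ rootsNegOne l, (((rootsNegOne n).filter (· % l = μ)).card : ℝ)) ^ 2 :=
        Finset.sum_sq_le_sq_sum_of_nonneg fun _ _ => Nat.cast_nonneg _
    _ ≤ _ := by rw [h1]; gcongr

theorem sum_rootSumMod_mul_conj (k : ℤ) {p q l : ℕ} (hp : 0 < p) (hq : 0 < q) (hl : 0 < l)
    (hpq : p.Coprime q) :
    ∑ μ ∈ rootsNegOne l, rootSumMod k (p * l) l μ * conj (rootSumMod k (q * l) l μ) =
      rootSum (k * ((q : ℤ) - p)) (p * q * l) := by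
  have hpl : 0 < p * l := Nat.mul_pos hp hl
  have hql : 0 < q * l := Nat.mul_pos hq hl
  have hlcm : (p * l).lcm (q * l) = p * q * l := by
    rw [Nat.lcm_mul_right, hpq.lcm_eq_mul]
  have hgcd : (p * l).gcd (q * l) = l := by
    rw [Nat.gcd_mul_right, hpq.gcd_eq_one, one_mul]
  have h1 : ∀ μ ∈ rootsNegOne l, rootSumMod k (p * l) l μ * conj (rootSumMod k (q * l) l μ) =
      ∑ y ∈ ((rootsNegOne (p * l) ×ˢ rootsNegOne (q * l)).filter
        (fun y => y.1 % l = y.2 % l)).filter (fun y => y.1 % l = μ),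
        expTwoPi (k * ((y.1 : ℝ) / (p * l : ℕ))) * conj (expTwoPi (k * ((y.2 : ℝ) / (q * l : ℕ)))) := by
    intro μ _
    unfold rootSumMod
    rw [map_sum, Finset.sum_mul_sum, ← Finset.sum_product']
    refine Finset.sum_congr ?_ fun _ _ => rfl
    ext y
    simp only [Finset.mem_product, Finset.mem_filter]
    constructor
    · rintro ⟨⟨h1, h2⟩, h3, h4⟩; exact ⟨⟨⟨h1, h3⟩, h2.trans h4.symm⟩, h2⟩
    · rintro ⟨⟨⟨h1, h3⟩, h4⟩, h2⟩; exact ⟨⟨h1, h2⟩, h3, h4.symm.trans h2⟩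
  rw [Finset.sum_congr rfl h1, Finset.sum_fiberwise_of_maps_to]
  swap
  · intro y hy
    rw [Finset.mem_filter, Finset.mem_product] at hy
    exact mod_mem_rootsNegOne hl (dvd_mul_left _ _) (mem_rootsNegOne.1 hy.1.1).2
  rw [rootSum]
  symm
  refine Finset.sum_bij (fun ν _ => (ν % (p * l), ν % (q * l))) ?_ ?_ ?_ ?_
  · intro ν hν
    rw [Finset.mem_filter, Finset.mem_product]
    have h2 := (mem_rootsNegOne.1 hν).2
    refine ⟨⟨mod_mem_rootsNegOne hpl ⟨q, by ring⟩ h2, mod_mem_rootsNegOne hql ⟨p, by ring⟩ h2⟩, ?_⟩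
    simp only
    rw [Nat.mod_mod_of_dvd _ (dvd_mul_left _ _), Nat.mod_mod_of_dvd _ (dvd_mul_left _ _)]
  · intro a ha b hb hab
    simp only [Prod.mk.injEq] at hab
    have h2 : a ≡ b [MOD p * q * l] := by
      rw [← hlcm]
      exact Nat.mod_lcm hab.1 hab.2
    exact Nat.ModEq.eq_of_lt_of_lt h2 (mem_rootsNegOne.1 ha).1 (mem_rootsNegOne.1 hb).1
  · rintro ⟨a, b⟩ hab
    rw [Finset.mem_filter, Finset.mem_product] at hab
    obtain ⟨⟨ha, hb⟩, hab⟩ := hab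
    simp only at ha hb hab
    rw [mem_rootsNegOne] at ha hb
    have h2 : a ≡ b [MOD (p * l).gcd (q * l)] := by rw [hgcd]; exact hab
    have h3 := Nat.chineseRemainder'_lt_lcm h2 hpl.ne' hql.ne'
    obtain ⟨hν1, hν2⟩ := (Nat.chineseRemainder' h2).2
    rw [hlcm] at h3
    generalize (Nat.chineseRemainder' h2 : ℕ) = ν at *
    refine ⟨ν, mem_rootsNegOne.2 ⟨h3, ?_⟩, ?_⟩
    · rw [← hlcm]
      refine Nat.lcm_dvd ?_ ?_
      · exact Nat.modEq_zero_iff_dvd.1 (((hν1.pow 2).add_right 1).trans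
          (Nat.modEq_zero_iff_dvd.2 ha.2))
      · exact Nat.modEq_zero_iff_dvd.1 (((hν2.pow 2).add_right 1).trans
          (Nat.modEq_zero_iff_dvd.2 hb.2))
    · simp only [Prod.mk.injEq]
      exact ⟨Nat.mod_eq_of_modEq hν1 ha.1, Nat.mod_eq_of_modEq hν2 hb.1⟩
  · intro ν _
    simp only
    rw [expTwoPi_mul_mod_div k hpl, expTwoPi_mul_mod_div k hql, conj_expTwoPi, ← expTwoPi_add]
    congr 1
    have hp' : (p : ℝ) ≠ 0 := by exact_mod_cast hp.ne'
    have hq' : (q : ℝ) ≠ 0 := by exact_mod_cast hq.ne'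
    have hl' : (l : ℝ) ≠ 0 := by exact_mod_cast hl.ne'
    push_cast
    field_simp
    ring

end

section

open ComplexConjugate

theorem sum_Icc_mul_eq_sum_filter_dvd {q M K : ℕ} (hq : 0 < q) (hM : q * M ≤ K) (f : ℕ → ℂ)
    (hf : ∀ l, M < l → f (q * l) = 0) :
    ∑ l ∈ Finset.Icc 1 M, f (q * l) = ∑ n ∈ (Finset.Icc 1 K).filter (q ∣ ·), f n := by
  rw [sum_Icc_filter_dvd q K hq]
  refine Finset.sum_subset ?_ ?_
  · refine Finset.Icc_subset_Icc le_rfl ?_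
    rw [Nat.le_div_iff_mul_le hq, mul_comm]; exact hM
  · intro l hl hl'
    rw [Finset.mem_Icc] at hl hl'
    exact hf l (by omega)

/-- The product of two dilates of a weight. -/
noncomputable def correlationWeight (Ψ : ℝ → ℂ) (p q : ℕ) (t : ℝ) : ℂ :=
  Ψ (t / q) * conj (Ψ (t / p))

theorem IsScaleWeight.norm_correlationWeight_le {u : ℝ} {Ψ : ℝ → ℂ} (hΨ : IsScaleWeight u Ψ)
    (p q : ℕ) (t : ℝ) : ‖correlationWeight Ψ p q t‖ ≤ 1 := by
  unfold correlationWeight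
  rw [norm_mul, RCLike.norm_conj]
  exact mul_le_one₀ (hΨ.norm_le _) (norm_nonneg _) (hΨ.norm_le _)

theorem IsScaleWeight.correlationWeight_lipschitz {u : ℝ} {Ψ : ℝ → ℂ} (hΨ : IsScaleWeight u Ψ)
    (hu0 : 0 < u) {N p q : ℕ} (hN : 0 < N) (hp : N ≤ p) (hq : N ≤ q) (s t : ℝ) :
    ‖correlationWeight Ψ p q s - correlationWeight Ψ p q t‖ ≤
      2 * (u ^ 100 / Real.exp (u ^ 20)) / N * |s - t| := by
  have hN0' : (0 : ℝ) < N := by exact_mod_cast hN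
  have e : correlationWeight Ψ p q s - correlationWeight Ψ p q t =
      (Ψ (s / q) - Ψ (t / q)) * conj (Ψ (s / p)) +
      Ψ (t / q) * conj (Ψ (s / p) - Ψ (t / p)) := by
    unfold correlationWeight; rw [map_sub]; ring
  have aux : ∀ r : ℕ, N ≤ r → ‖Ψ (s / r) - Ψ (t / r)‖ ≤
      u ^ 100 / Real.exp (u ^ 20) * (|s - t| / N) := fun r hNr => by
    have hr : (N : ℝ) ≤ r := by exact_mod_cast hNr
    refine (hΨ.lipschitz _ _).trans ?_
    rw [← sub_div, abs_div, Nat.abs_cast]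
    gcongr
  have h1 := aux q hq
  have h2 := aux p hp
  have h3 := hΨ.norm_le (s / p)
  have h4 := hΨ.norm_le (t / q)
  clear aux
  rw [e]
  calc _ ≤ ‖Ψ (s / q) - Ψ (t / q)‖ * ‖conj (Ψ (s / p))‖ +
        ‖Ψ (t / q)‖ * ‖conj (Ψ (s / p) - Ψ (t / p))‖ := by
        rw [← norm_mul, ← norm_mul]; exact norm_add_le _ _
    _ ≤ u ^ 100 / Real.exp (u ^ 20) * (|s - t| / N) * 1 +
        1 * (u ^ 100 / Real.exp (u ^ 20) * (|s - t| / N)) := by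
        rw [RCLike.norm_conj, RCLike.norm_conj]
        gcongr
    _ = _ := by ring

theorem IsScaleWeight.correlationWeight_support {u : ℝ} {Ψ : ℝ → ℂ} (hΨ : IsScaleWeight u Ψ)
    (hu0 : 0 < u) {N p q : ℕ} (hN : 0 < N) (hq : N ≤ q) (hq2 : q < 2 * N) (t : ℝ)
    (ht : correlationWeight Ψ p q t ≠ 0) :
    N * (Real.exp (u ^ 20) / u ^ 20) ≤ t ∧ t ≤ 4 * Real.exp (u ^ 20) * N := by
  have hqR1 : (N : ℝ) ≤ q := by exact_mod_cast hq
  have hqR2 : (q : ℝ) ≤ 2 * N := by exact_mod_cast hq2.le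
  have hq0 : (0 : ℝ) < q := by exact_mod_cast hN.trans_le hq
  have h1 := hΨ.support (t / q) (left_ne_zero_of_mul ht)
  rw [le_div_iff₀ hq0, div_le_iff₀ hq0] at h1
  constructor
  · refine le_trans ?_ h1.1
    rw [mul_comm]; gcongr
  · refine h1.2.trans ?_
    calc 2 * Real.exp (u ^ 20) * q ≤ 2 * Real.exp (u ^ 20) * (2 * N) := by gcongr
      _ = _ := by ring

theorem IsScaleWeight.sum_correlationWeight {u : ℝ} {Ψ : ℝ → ℂ} (hΨ : IsScaleWeight u Ψ)
    {N p q : ℕ} (hN : 0 < N) (hp1 : N ≤ p) (hp2 : p < 2 * N) (hq1 : N ≤ q) (hq2 : q < 2 * N)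
    (F : ℕ → ℂ) :
    ∑ l ∈ Finset.Icc 1 ⌊2 * Real.exp (u ^ 20) / N⌋₊, Ψ (p * l : ℕ) * conj (Ψ (q * l : ℕ)) *
      F (p * q * l) =
    ∑ n ∈ (Finset.Icc 1 ⌊4 * (4 * Real.exp (u ^ 20) * N)⌋₊).filter (p * q ∣ ·),
      correlationWeight Ψ p q n * F n := by
  have hp0 : (0 : ℝ) < p := by exact_mod_cast hN.trans_le hp1
  have hq0 : (0 : ℝ) < q := by exact_mod_cast hN.trans_le hq1
  have hN0' : (0 : ℝ) < N := by exact_mod_cast hN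
  have hpR1 : (N : ℝ) ≤ p := by exact_mod_cast hp1
  have hpR2 : (p : ℝ) ≤ 2 * N := by exact_mod_cast hp2.le
  have hqR2 : (q : ℝ) ≤ 2 * N := by exact_mod_cast hq2.le
  have hx0 : 0 < Real.exp (u ^ 20) := Real.exp_pos _
  have hsupp := hΨ.support
  generalize Real.exp (u ^ 20) = x at *
  have h1 : (⌊2 * x / N⌋₊ : ℝ) ≤ 2 * x / N := Nat.floor_le (by positivity)
  have h4 := Nat.lt_floor_add_one (2 * x / N)
  generalize ⌊2 * x / N⌋₊ = M at *
  rw [← sum_Icc_mul_eq_sum_filter_dvd (M := M) (K := ⌊4 * (4 * x * N)⌋₊)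
    (Nat.mul_pos (hN.trans_le hp1) (hN.trans_le hq1)) _ (fun n => correlationWeight Ψ p q n * F n)]
  · refine Finset.sum_congr rfl fun l _ => ?_
    congr 1
    unfold correlationWeight
    congr 2
    · push_cast; field_simp
    · congr 1; push_cast; field_simp
  · intro l hl
    rw [mul_eq_zero]; left
    by_contra hcon
    have h1 := (hsupp _ (left_ne_zero_of_mul hcon)).2
    have h2 : ((p * q * l : ℕ) : ℝ) / q = p * l := by push_cast; field_simp
    rw [h2] at h1
    have h3 : (M : ℝ) + 1 ≤ l := by exact_mod_cast hl
    rw [div_lt_iff₀ hN0'] at h4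
    have h5 : (N : ℝ) * (M + 1) ≤ p * l := by gcongr
    linarith
  · refine Nat.le_floor ?_
    push_cast
    calc (p : ℝ) * q * M ≤ (2 * N) * (2 * N) * (2 * x / N) := by gcongr
      _ = 8 * x * N := by field_simp; ring
      _ ≤ _ := by nlinarith [mul_pos hx0 hN0']

theorem gcd_mul_sub_eq_one {k : ℤ} (hk : k ≠ 0) {N p q : ℕ} (hkN : k.natAbs < N) (hp : p.Prime)
    (hq : q.Prime) (hpq : p ≠ q) (hp1 : N ≤ p) (hq1 : N ≤ q) :
    Nat.gcd (k * ((q : ℤ) - p)).natAbs (p * q) = 1 := by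
  have h1 : ∀ r : ℕ, r.Prime → N ≤ r → ¬ r ∣ k.natAbs := fun r hr hNr hd => by
    have := Nat.le_of_dvd (Nat.pos_of_ne_zero (Int.natAbs_ne_zero.2 hk)) hd
    omega
  have hd : ∀ r : ℕ, r.Prime → r = p ∨ r = q → ¬ (r : ℤ) ∣ (q : ℤ) - p := by
    rintro r hr (rfl | rfl) hd
    · have h2 : (r : ℤ) ∣ q := by simpa using dvd_add hd (dvd_refl (r : ℤ))
      exact hpq ((Nat.prime_dvd_prime_iff_eq hr hq).1 (by exact_mod_cast h2))
    · have h2 : (r : ℤ) ∣ p := by simpa using dvd_sub (dvd_refl (r : ℤ)) hd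
      exact hpq ((Nat.prime_dvd_prime_iff_eq hr hp).1 (by exact_mod_cast h2)).symm
  have h3 : ∀ r : ℕ, r.Prime → N ≤ r → r = p ∨ r = q →
      Nat.Coprime (k * ((q : ℤ) - p)).natAbs r := by
    intro r hr hNr hor
    rw [Nat.coprime_comm, hr.coprime_iff_not_dvd, Int.natAbs_mul, hr.dvd_mul]
    rintro (h4 | h4)
    · exact h1 r hr hNr h4
    · exact hd r hr hor (Int.natCast_dvd.2 h4)
  exact Nat.Coprime.mul_right (h3 p hp hp1 (Or.inl rfl)) (h3 q hq hq1 (Or.inr rfl))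

/-- The numerical inequality behind the off-diagonal estimate. -/
theorem offdiagonal_bound {ℓ L v η τ' κ τ x N R Q B B' K C : ℝ} (hC : 0 ≤ C) (hv : 0 ≤ v)
    (hη : 0 < η) (hN : 0 < N) (hx : 0 < x) (hL : 0 ≤ L)
    (hℓ0 : 0 ≤ ℓ) (hℓ : ℓ ≤ 3 * L) (hτ' : 0 ≤ τ') (hτ'4 : τ' ≤ 4) (hR : N * N ≤ R)
    (hQ : N ≤ Q) (hK0 : 0 ≤ K) (hK : K ≤ v) (hκ : 0 ≤ κ) (hκτ : κ ≤ L ^ 2 * τ) (hτ : 1 ≤ τ)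
    (hB' : 0 ≤ B') (hBB' : B' ≤ 4 * B) (hB : B * η⁻¹ ≤ x * η) (hLv : L ^ 3 ≤ v) :
    C * (ℓ ^ 2 * (η * τ' * (4 * x * N / R) * (8 * v + K) +
      τ' ^ 2 * κ * (4 * L) * B' / (Q * η))) ≤
    C * (9 * (16 * 9 + 16 * 4 * 4)) * (L ^ 2 * v * η * (x / N) * τ) := by
  have hB0 : 0 ≤ B := by linarith
  have hR0 : 0 < R := by nlinarith
  have hQ0 : 0 < Q := by linarith
  have e1 : η * τ' * (4 * x * N / R) * (8 * v + K) ≤ 16 * 9 * (v * η * (x / N) * τ) := by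
    calc _ ≤ η * 4 * (4 * x * N / (N * N)) * (8 * v + v) := by gcongr
      _ = 16 * 9 * (v * η * (x / N) * 1) := by field_simp; ring
      _ ≤ _ := by gcongr
  have e2 : τ' ^ 2 * κ * (4 * L) * B' / (Q * η) ≤ 16 * 4 * 4 * (v * η * (x / N) * τ) := by
    have hL3 : 0 ≤ L ^ 3 := by positivity
    calc _ ≤ 4 ^ 2 * (L ^ 2 * τ) * (4 * L) * (4 * B) / (N * η) := by gcongr
      _ = 16 * 4 * 4 * (L ^ 3 * (B * η⁻¹) / N * τ) := by field_simp; ring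
      _ ≤ 16 * 4 * 4 * (v * (x * η) / N * τ) := by gcongr
      _ = _ := by ring
  have e0 : ℓ ^ 2 ≤ (3 * L) ^ 2 := pow_le_pow_left₀ hℓ0 hℓ 2
  calc _ ≤ C * ((3 * L) ^ 2 * (16 * 9 * (v * η * (x / N) * τ) +
        16 * 4 * 4 * (v * η * (x / N) * τ))) := by
        refine mul_le_mul_of_nonneg_left ?_ hC
        refine mul_le_mul e0 (add_le_add e1 e2) ?_ (by positivity)
        positivity
    _ = _ := by ring

set_option maxHeartbeats 1000000 in
/-- The off-diagonal terms in the Type II estimate. -/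
theorem exists_norm_sum_correlation_le : ∃ C > 0, ∀ (u : ℝ) (_ : 5 ≤ u) (Ψ : ℝ → ℂ)
    (_ : IsScaleWeight u Ψ) (k : ℤ) (_ : k ≠ 0) (_ : (k.natAbs : ℝ) ≤ u ^ 40) (N : ℕ)
    (_ : k.natAbs < N) (_ : (N : ℝ) ≤ Real.exp (u ^ 20 / 3 - u ^ 11)) (p q : ℕ) (_ : p.Prime)
    (_ : q.Prime) (_ : p ≠ q) (_ : N ≤ p) (_ : p < 2 * N) (_ : N ≤ q) (_ : q < 2 * N),
    ‖∑ l ∈ Finset.Icc 1 ⌊2 * Real.exp (u ^ 20) / N⌋₊, Ψ (p * l : ℕ) * conj (Ψ (q * l : ℕ)) *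
      rootSum (k * ((q : ℤ) - p)) (p * q * l)‖ ≤
      C * (u ^ 140 * Real.exp (-u ^ 10) * (Real.exp (u ^ 20) / N) *
        ((q : ℤ) - p).natAbs.divisors.card) := by
  obtain ⟨C, hC, h⟩ := exists_norm_sum_dvd_rootSum_le
  refine ⟨C * (9 * (16 * 9 + 16 * 4 * 4)), by positivity, ?_⟩
  intro u hu Ψ hΨ k hk hk' N hkN hN p q hp hq hpq hp1 hp2 hq1 hq2
  have hu0 : 0 < u := by linarith
  have hN0 : 0 < N := by omega
  have hN0' : (0 : ℝ) < N := by exact_mod_cast hN0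
  have hN1 : (1 : ℝ) ≤ N := by exact_mod_cast hN0
  have hη4 : Real.exp (-u ^ 10) ≤ 1 / 4 := by
    rw [Real.exp_neg, one_div]
    refine inv_anti₀ (by norm_num) ?_
    have h1 : (2 : ℝ) ^ 10 ≤ u ^ 10 := pow_le_pow_left₀ (by norm_num) (by linarith) 10
    linarith [Real.add_one_le_exp (u ^ 10)]
  have hy2 : 2 ≤ u ^ 20 := by
    have : (2 : ℝ) ^ 20 ≤ u ^ 20 := pow_le_pow_left₀ (by norm_num) (by linarith) 20
    linarith
  have hx2 := two_mul_le_exp hy2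
  have hℓ := log_mul_exp_pow_le (c := 16) (by linarith : 2 ≤ u) (by norm_num) (by norm_num)
  have h10 : 0 < u ^ 10 := by positivity
  have h11 : u ^ 11 = u * u ^ 10 := by ring
  have hu11 : 5 * u ^ 10 ≤ u ^ 11 := by rw [h11]; gcongr
  have hN3 : 4 * (N : ℝ) ^ 3 ≤ Real.exp (u ^ 20) := by
    have h1 : (N : ℝ) ^ 3 ≤ Real.exp (u ^ 20 / 3 - u ^ 11) ^ 3 := pow_le_pow_left₀ hN0'.le hN 3
    rw [← Real.exp_nat_mul] at h1
    have h2 : ((3 : ℕ) : ℝ) * (u ^ 20 / 3 - u ^ 11) ≤ u ^ 20 + -u ^ 10 := by push_cast; linarith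
    have h3 := h1.trans (Real.exp_le_exp.2 h2)
    rw [Real.exp_add] at h3
    have h4 : Real.exp (u ^ 20) * Real.exp (-u ^ 10) ≤ Real.exp (u ^ 20) * (1 / 4) := by gcongr
    linarith
  have hlogN : Real.log N ≤ u ^ 20 := by
    rw [Real.log_le_iff_le_exp hN0']
    refine hN.trans (Real.exp_le_exp.2 ?_)
    linarith
  have hBkey : √(Real.exp (u ^ 20) * N * √(Real.exp (u ^ 20) * N)) * Real.exp (u ^ 10) ≤
      Real.exp (u ^ 20) * Real.exp (-u ^ 10) := by
    have h1 : Real.exp (u ^ 20) * N ≤ Real.exp (u ^ 20 * 4 / 3 - u ^ 11) := by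
      calc _ ≤ Real.exp (u ^ 20) * Real.exp (u ^ 20 / 3 - u ^ 11) := by gcongr
        _ = _ := by rw [← Real.exp_add]; congr 1; ring
    have h2 : √(Real.exp (u ^ 20) * N * √(Real.exp (u ^ 20) * N)) ≤
        Real.exp (u ^ 20 - u ^ 11 * 3 / 4) := by
      calc _ ≤ √(Real.exp (u ^ 20 * 4 / 3 - u ^ 11) * √(Real.exp (u ^ 20 * 4 / 3 - u ^ 11))) := by
            gcongr
        _ = _ := by
            rw [← Real.exp_half, ← Real.exp_add, ← Real.exp_half]; congr 1; ring
    refine (mul_le_mul_of_nonneg_right h2 (Real.exp_pos _).le).trans ?_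
    rw [← Real.exp_add, ← Real.exp_add, Real.exp_le_exp]
    linarith
  set x := Real.exp (u ^ 20) with hx
  have hx0 : 0 < x := Real.exp_pos _
  have hp0 : (0 : ℝ) < p := by exact_mod_cast hp.pos
  have hq0 : (0 : ℝ) < q := by exact_mod_cast hq.pos
  have hpR1 : (N : ℝ) ≤ p := by exact_mod_cast hp1
  have hpR2 : (p : ℝ) ≤ 2 * N := by exact_mod_cast hp2.le
  have hqR1 : (N : ℝ) ≤ q := by exact_mod_cast hq1
  have hqR2 : (q : ℝ) ≤ 2 * N := by exact_mod_cast hq2.le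
  set k' : ℤ := k * ((q : ℤ) - p) with hk'def
  have hk'0 : k' ≠ 0 := by
    refine mul_ne_zero hk ?_
    rw [sub_ne_zero]; exact_mod_cast hpq.symm
  have hX₁ : 2 ≤ N * (x / u ^ 20) := by
    have : 2 ≤ x / u ^ 20 := by rw [le_div_iff₀ (by positivity)]; linarith
    nlinarith
  have hX₁₂ : N * (x / u ^ 20) ≤ 4 * x * N := by
    have : x / u ^ 20 ≤ x := div_le_self hx0.le (by linarith)
    nlinarith
  have hpqN : ((p * q : ℕ) : ℝ) ≤ √(4 * x * N) := by
    refine Real.le_sqrt_of_sq_le ?_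
    push_cast
    calc ((p : ℝ) * q) ^ 2 ≤ ((2 * N) * (2 * N)) ^ 2 := by gcongr
      _ = 4 * N * (4 * (N : ℝ) ^ 3) := by ring
      _ ≤ 4 * N * x := by gcongr
      _ = _ := by ring
  have hpqsq : Squarefree (p * q) :=
    (Nat.squarefree_mul ((Nat.coprime_primes hp hq).2 hpq)).2 ⟨hp.squarefree, hq.squarefree⟩
  have hmain := h (correlationWeight Ψ p q) (hΨ.norm_correlationWeight_le p q)
    (2 * (u ^ 100 / x) / N) (by positivity)
    (hΨ.correlationWeight_lipschitz hu0 hN0 hp1 hq1) (N * (x / u ^ 20)) (4 * x * N)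
    hX₁ hX₁₂ (hΨ.correlationWeight_support hu0 hN0 hq1 hq2) k' hk'0 (p * q) hpqsq hpqN
    (Real.exp (-u ^ 10)) (Real.exp_pos _) hη4
  clear h
  rw [hΨ.sum_correlationWeight hN0 hp1 hp2 hq1 hq2 (rootSum k')]
  refine hmain.trans ?_
  have hcop : Nat.gcd k'.natAbs (p * q) = 1 := gcd_mul_sub_eq_one hk hkN hp hq hpq hp1 hq1
  have hτpq : (((p * q).divisors.card : ℕ) : ℝ) ≤ 4 := by
    have h1 := card_divisors_mul_le p q
    rw [hp.divisors, hq.divisors] at h1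
    have h2 : ({1, p} : Finset ℕ).card ≤ 2 := Finset.card_le_two
    have h3 : ({1, q} : Finset ℕ).card ≤ 2 := Finset.card_le_two
    have h4 : (p * q).divisors.card ≤ 2 * 2 := h1.trans (Nat.mul_le_mul h2 h3)
    exact_mod_cast h4
  have hτk : (k'.natAbs.divisors.card : ℝ) ≤ u ^ 40 * ((q : ℤ) - p).natAbs.divisors.card := by
    have h1 : k'.natAbs.divisors.card ≤ k.natAbs.divisors.card * ((q : ℤ) - p).natAbs.divisors.card := by
      rw [hk'def, Int.natAbs_mul]; exact card_divisors_mul_le _ _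
    have h2 : (k.natAbs.divisors.card : ℝ) ≤ u ^ 40 :=
      le_trans (by exact_mod_cast Nat.card_divisors_le_self _) hk'
    calc (k'.natAbs.divisors.card : ℝ) ≤ k.natAbs.divisors.card * ((q : ℤ) - p).natAbs.divisors.card := by
          exact_mod_cast h1
      _ ≤ _ := by gcongr
  have hτ1 : (1 : ℝ) ≤ ((q : ℤ) - p).natAbs.divisors.card := by
    have h0 : ((q : ℤ) - p).natAbs ≠ 0 := by omega
    exact_mod_cast Finset.card_pos.2 ⟨1, Nat.one_mem_divisors.2 h0⟩
  have hdN : |((q : ℤ) - p : ℝ)| ≤ N := by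
    push_cast
    rw [abs_le]; constructor <;> linarith
  have hkX : |(k' : ℝ)| / (N * (x / u ^ 20)) ≤ u ^ 100 := by
    have h1 : |(k' : ℝ)| ≤ u ^ 40 * N := by
      rw [hk'def]; push_cast
      rw [abs_mul]
      have h2 : |(k : ℝ)| = k.natAbs := by rw [Nat.cast_natAbs]; push_cast; rfl
      rw [h2]
      push_cast at hdN
      gcongr
    rw [div_le_iff₀ (by positivity)]
    have h3 : 1 ≤ x / u ^ 20 := by rw [le_div_iff₀ (by positivity)]; linarith
    refine h1.trans ?_
    have h4 : u ^ 40 ≤ u ^ 100 := pow_le_pow_right₀ (by linarith) (by norm_num)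
    calc u ^ 40 * N ≤ u ^ 100 * (N * 1) := by rw [mul_one]; gcongr
      _ ≤ _ := by gcongr
  have hΛX : 2 * (u ^ 100 / x) / N * (4 * x * N) = 8 * u ^ 100 := by field_simp; ring
  have hXX : 4 * x * N / (N * (x / u ^ 20)) = 4 * u ^ 20 := by field_simp
  have hlog : 1 + Real.log (4 * (4 * x * N)) ≤ 3 * u ^ 20 := by
    rw [show 4 * (4 * x * N) = (16 * x) * N by ring, Real.log_mul (by positivity) hN0'.ne']
    linarith
  have hlog0 : 0 ≤ 1 + Real.log (4 * (4 * x * N)) := by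
    have h1 : 1 ≤ x * N := one_le_mul_of_one_le_of_one_le (by linarith) hN1
    have := Real.log_nonneg (by linarith : 1 ≤ 4 * (4 * x * N))
    linarith
  have hs : √(4 * x * N * √(4 * x * N)) ≤ 4 * √(x * N * √(x * N)) := by
    refine sqrt_le_of_le_sq (by positivity) ?_
    rw [mul_pow, Real.sq_sqrt (by positivity), mul_assoc 4 x, Real.sqrt_mul (by norm_num)]
    have h1 : √4 ≤ 2 := sqrt_le_of_le_sq (by norm_num) (by norm_num)
    have h2 : 0 ≤ x * N * √(x * N) := by positivity
    have h3 : 4 * (x * N) * (√4 * √(x * N)) ≤ 4 * (x * N) * (2 * √(x * N)) := by gcongr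
    linarith
  have hNpq : (N : ℝ) ≤ √(p * q : ℕ) := by
    refine Real.le_sqrt_of_sq_le ?_
    push_cast; rw [sq]; gcongr
  have hNpq' : (N : ℝ) * N ≤ (p * q : ℕ) := by push_cast; gcongr
  rw [hcop, hΛX, hXX, Nat.cast_one, Real.sqrt_one, mul_one]
  set η := Real.exp (-u ^ 10) with hη
  have hη0 : 0 < η := Real.exp_pos _
  have hηinv : Real.exp (u ^ 10) = η⁻¹ := by rw [hη, Real.exp_neg, inv_inv]
  rw [hηinv] at hBkey
  rw [show u ^ 140 = (u ^ 20) ^ 2 * u ^ 100 by ring]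
  refine offdiagonal_bound hC.le (by positivity) hη0 hN0' hx0 (by positivity) hlog0 hlog
    (Nat.cast_nonneg _) hτpq hNpq' hNpq (by positivity) hkX (Nat.cast_nonneg _) ?_ hτ1
    (by positivity) hs hBkey ?_
  · rwa [← pow_mul]
  · rw [← pow_mul]; exact pow_le_pow_right₀ (by linarith) (by norm_num)

end

section

open ComplexConjugate

theorem norm_sum_bilinear_sq_le {ι : Type*} (P : Finset ι) (S : Finset ℕ) (R : ℕ → Finset ℕ)
    (b : ℕ → ℂ) (a : ι → ℕ → ℕ → ℂ) :
    ‖∑ p ∈ P, ∑ l ∈ S, b l * ∑ μ ∈ R l, a p l μ‖ ^ 2 ≤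
      (∑ l ∈ S, (R l).card * ‖b l‖ ^ 2) *
        ∑ p ∈ P, ∑ q ∈ P, ‖∑ l ∈ S, ∑ μ ∈ R l, a p l μ * conj (a q l μ)‖ := by
  have h1 : ∑ p ∈ P, ∑ l ∈ S, b l * ∑ μ ∈ R l, a p l μ =
      ∑ y ∈ S.sigma R, b y.1 * ∑ p ∈ P, a p y.1 y.2 := by
    rw [Finset.sum_sigma, Finset.sum_comm]
    refine Finset.sum_congr rfl fun l _ => ?_
    rw [← Finset.mul_sum, Finset.sum_comm, Finset.mul_sum]
  have h2 : ∑ y ∈ S.sigma R, ‖b y.1‖ ^ 2 = ∑ l ∈ S, (R l).card * ‖b l‖ ^ 2 := by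
    rw [Finset.sum_sigma]
    refine Finset.sum_congr rfl fun l _ => ?_
    simp only
    rw [Finset.sum_const, nsmul_eq_mul]
  have h3 : ∑ y ∈ S.sigma R, ‖∑ p ∈ P, a p y.1 y.2‖ ^ 2 ≤
      ∑ p ∈ P, ∑ q ∈ P, ‖∑ l ∈ S, ∑ μ ∈ R l, a p l μ * conj (a q l μ)‖ := by
    have h4 : ((∑ y ∈ S.sigma R, ‖∑ p ∈ P, a p y.1 y.2‖ ^ 2 : ℝ) : ℂ) =
        ∑ p ∈ P, ∑ q ∈ P, ∑ l ∈ S, ∑ μ ∈ R l, a p l μ * conj (a q l μ) := by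
      have h5 : ∀ p q, ∑ l ∈ S, ∑ μ ∈ R l, a p l μ * conj (a q l μ) =
          ∑ y ∈ S.sigma R, a p y.1 y.2 * conj (a q y.1 y.2) := fun p q => by rw [Finset.sum_sigma]
      simp only [h5]
      rw [Finset.sum_congr rfl fun p _ => Finset.sum_comm, Finset.sum_comm]
      push_cast
      refine Finset.sum_congr rfl fun y _ => ?_
      rw [← Complex.mul_conj', map_sum, Finset.sum_mul_sum]
    have h6 : (∑ y ∈ S.sigma R, ‖∑ p ∈ P, a p y.1 y.2‖ ^ 2 : ℝ) =
        ‖((∑ y ∈ S.sigma R, ‖∑ p ∈ P, a p y.1 y.2‖ ^ 2 : ℝ) : ℂ)‖ := by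
      rw [Complex.norm_real, Real.norm_of_nonneg (Finset.sum_nonneg fun _ _ => by positivity)]
    rw [h6, h4]
    exact norm_sum_le_of_le _ fun p _ => norm_sum_le _ _
  rw [h1]
  calc _ ≤ (∑ y ∈ S.sigma R, ‖b y.1‖ * ‖∑ p ∈ P, a p y.1 y.2‖) ^ 2 := by
        refine pow_le_pow_left₀ (norm_nonneg _) ?_ 2
        exact norm_sum_le_of_le _ fun y _ => (norm_mul _ _).le
    _ ≤ (∑ y ∈ S.sigma R, ‖b y.1‖ ^ 2) * ∑ y ∈ S.sigma R, ‖∑ p ∈ P, a p y.1 y.2‖ ^ 2 :=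
        Finset.sum_mul_sq_le_sq_mul_sq _ _ _
    _ ≤ _ := by
        rw [h2]
        exact mul_le_mul_of_nonneg_left h3 (Finset.sum_nonneg fun _ _ => by positivity)

theorem sum_erase_natAbs_sub_le {N p : ℕ} {P : Finset ℕ} (hP : ∀ q ∈ P, N ≤ q ∧ q < 2 * N)
    (hp : p ∈ P) (g : ℕ → ℝ) (hg : ∀ h, 0 ≤ g h) :
    ∑ q ∈ P.erase p, g ((q : ℤ) - p).natAbs ≤ 2 * ∑ h ∈ Finset.Icc 1 N, g h := by
  have hmaps : ∀ q ∈ P.erase p, ((q : ℤ) - p).natAbs ∈ Finset.Icc 1 N := fun q hq => by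
    rw [Finset.mem_erase] at hq
    have h1 := hP q hq.2
    have h2 := hP p hp
    have h3 := hq.1
    rw [Finset.mem_Icc]
    omega
  rw [← Finset.sum_fiberwise_of_maps_to hmaps, Finset.mul_sum]
  refine Finset.sum_le_sum fun h _ => ?_
  have h1 : ∑ q ∈ (P.erase p).filter (fun q : ℕ => ((q : ℤ) - p).natAbs = h),
      g ((q : ℤ) - p).natAbs =
      ∑ q ∈ (P.erase p).filter (fun q : ℕ => ((q : ℤ) - p).natAbs = h), g h :=
    Finset.sum_congr rfl fun q hq => by rw [(Finset.mem_filter.1 hq).2]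
  rw [h1, Finset.sum_const, nsmul_eq_mul]
  refine mul_le_mul_of_nonneg_right ?_ (hg h)
  have h2 : (P.erase p).filter (fun q : ℕ => ((q : ℤ) - p).natAbs = h) ⊆ {p + h, p - h} := by
    intro q hq
    have h3 := (Finset.mem_filter.1 hq).2
    rw [Finset.mem_insert, Finset.mem_singleton]
    omega
  exact_mod_cast (Finset.card_le_card h2).trans Finset.card_le_two

theorem pow_forty_lt_exp {u : ℝ} (hu : 5 ≤ u) : u ^ 40 < Real.exp (u ^ 5) := by
  have h5 : (5 : ℝ) ^ 5 ≤ u ^ 5 := pow_le_pow_left₀ (by norm_num) hu 5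
  have h1 := pow_le_factorial_mul_exp (by positivity : 0 ≤ u ^ 5) 10
  have h2 : u ^ 40 = (u ^ 5) ^ 8 := by ring
  rw [h2]
  generalize u ^ 5 = y at *
  have h3 : (Nat.factorial 10 : ℝ) = 3628800 := by norm_num [Nat.factorial]
  rw [h3] at h1
  have hy : 0 < y ^ 8 := by have : 0 < y := by linarith
                            positivity
  have h4 : (3628801 : ℝ) ≤ y ^ 2 := by nlinarith
  have h6 : y ^ 10 = y ^ 8 * y ^ 2 := by ring
  nlinarith

/-- Type II estimate on a dyadic block. -/
theorem exists_norm_sum_typeTwo_le : ∃ C > 0, ∀ (u : ℝ) (_ : 5 ≤ u) (Ψ : ℝ → ℂ)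
    (_ : IsScaleWeight u Ψ) (k : ℤ) (_ : k ≠ 0) (_ : (k.natAbs : ℝ) ≤ u ^ 40) (N : ℕ)
    (_ : Real.exp (u ^ 5) ≤ N) (_ : (N : ℝ) ≤ Real.exp (u ^ 20 / 3 - u ^ 11)) (P : Finset ℕ)
    (_ : ∀ p ∈ P, p.Prime ∧ N ≤ p ∧ p < 2 * N) (b : ℕ → ℂ) (_ : ∀ l, ‖b l‖ ≤ l.divisors.card),
    ‖∑ p ∈ P, ∑ l ∈ Finset.Icc 1 ⌊2 * Real.exp (u ^ 20) / N⌋₊,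
      b l * (Ψ (p * l : ℕ) * rootSum k (p * l))‖ ≤ C * (Real.exp (u ^ 20) / u ^ 60) := by
  obtain ⟨C, hC, h⟩ := exists_norm_sum_correlation_le
  refine ⟨√(65536 * Nat.factorial 72 + 4096 * C * Nat.factorial 46), by positivity, ?_⟩
  intro u hu Ψ hΨ k hk hk' N hN1 hN2 P hP b hb
  have hu0 : 0 < u := by linarith
  have hN0' : (0 : ℝ) < N := (Real.exp_pos _).trans_le hN1
  have hN0 : 0 < N := by exact_mod_cast hN0'
  have hkN : k.natAbs < N := by
    have h1 := (hk'.trans_lt (pow_forty_lt_exp hu)).trans_le hN1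
    exact_mod_cast h1
  have hoff := fun p hp q hq (hpq : p ≠ q) => h u hu Ψ hΨ k hk hk' N hkN hN2 p q (hP p hp).1
    (hP q hq).1 hpq (hP p hp).2.1 (hP p hp).2.2 (hP q hq).2.1 (hP q hq).2.2
  clear h
  have hx1 : 1 ≤ Real.exp (u ^ 20) := Real.one_le_exp (by positivity)
  have hℓ := log_mul_exp_pow_le (c := 2) (by linarith : 2 ≤ u) (by norm_num) (by norm_num)
  have hη1 := pow_le_factorial_mul_exp (by positivity : 0 ≤ u ^ 10) 46
  have hN3 : u ^ 360 ≤ Nat.factorial 72 * N := by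
    have h1 := pow_le_factorial_mul_exp (by positivity : 0 ≤ u ^ 5) 72
    rw [← pow_mul] at h1
    refine h1.trans ?_
    gcongr
  have hlogN : 1 + Real.log N ≤ 2 * u ^ 20 := by
    refine le_trans ?_ hℓ
    have : Real.log N ≤ Real.log (2 * Real.exp (u ^ 20)) := by
      refine Real.log_le_log hN0' (hN2.trans ?_)
      have h1 : Real.exp (u ^ 20 / 3 - u ^ 11) ≤ Real.exp (u ^ 20) := by
        rw [Real.exp_le_exp]
        have h4 : 0 < u ^ 20 := by positivity
        have h5 : 0 < u ^ 11 := by positivity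
        linarith
      linarith
    linarith
  set x := Real.exp (u ^ 20) with hx
  have hMx : (⌊2 * x / N⌋₊ : ℝ) ≤ 2 * x / N := Nat.floor_le (by positivity)
  set M := ⌊2 * x / N⌋₊ with hM
  have hlogM : 1 + Real.log M ≤ 2 * u ^ 20 := by
    refine le_trans ?_ hℓ
    rcases Nat.eq_zero_or_pos M with h0 | h0
    · rw [h0, Nat.cast_zero, Real.log_zero]
      have := Real.log_nonneg (by linarith : 1 ≤ 2 * x)
      linarith
    · have h1 : (N : ℝ) ≥ 1 := by exact_mod_cast hN0
      have h2 : 2 * x / N ≤ 2 * x := div_le_self (by linarith) h1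
      have := Real.log_le_log (by exact_mod_cast h0) (hMx.trans h2)
      linarith
  have hτpow : ∀ j : ℕ, ∑ l ∈ Finset.Icc 1 M, (l.divisors.card : ℝ) ^ j ≤
      2 * x / N * (2 * u ^ 20) ^ 2 ^ j := fun j => by
    refine (sum_Icc_card_divisors_pow_le j M).trans ?_
    exact mul_le_mul hMx (pow_le_pow_left₀ (one_add_log_nonneg _) hlogM _)
      (pow_nonneg (one_add_log_nonneg _) _) (by positivity)
  set a : ℕ → ℕ → ℕ → ℂ := fun p l μ => Ψ (p * l : ℕ) * rootSumMod k (p * l) l μ with ha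
  have hrew : ∑ p ∈ P, ∑ l ∈ Finset.Icc 1 M, b l * (Ψ (p * l : ℕ) * rootSum k (p * l)) =
      ∑ p ∈ P, ∑ l ∈ Finset.Icc 1 M, b l * ∑ μ ∈ rootsNegOne l, a p l μ := by
    refine Finset.sum_congr rfl fun p hp => Finset.sum_congr rfl fun l hl => ?_
    rw [ha]; simp only
    rw [← Finset.mul_sum, sum_rootSumMod k (Nat.mul_pos (hP p hp).1.pos (Finset.mem_Icc.1 hl).1)
      (dvd_mul_left _ _)]
  have hfirst : ∑ l ∈ Finset.Icc 1 M, ((rootsNegOne l).card : ℝ) * ‖b l‖ ^ 2 ≤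
      2 * x / N * (2 * u ^ 20) ^ 8 := by
    refine le_trans (Finset.sum_le_sum fun l _ => ?_) (hτpow 3)
    have h1 : ((rootsNegOne l).card : ℝ) ≤ l.divisors.card := by
      exact_mod_cast card_rootsNegOne_le l
    have h2 := hb l
    calc _ ≤ (l.divisors.card : ℝ) * (l.divisors.card : ℝ) ^ 2 := by clear hb; gcongr
      _ = _ := by ring
  have hdiag : ∀ p ∈ P, ‖∑ l ∈ Finset.Icc 1 M, ∑ μ ∈ rootsNegOne l, a p l μ * conj (a p l μ)‖ ≤
      4 * (2 * x / N * (2 * u ^ 20) ^ 4) := fun p hp => by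
    refine le_trans (norm_sum_le_of_le _ fun l hl => ?_)
      (le_trans (Finset.mul_sum _ _ _).symm.le (mul_le_mul_of_nonneg_left (hτpow 2) (by norm_num)))
    have hpl : 0 < p * l := Nat.mul_pos (hP p hp).1.pos (Finset.mem_Icc.1 hl).1
    refine (norm_sum_le_of_le (f := fun μ => a p l μ * conj (a p l μ))
      (n := fun μ => ‖rootSumMod k (p * l) l μ‖ ^ 2) _ fun μ _ => ?_).trans
      ((sum_norm_rootSumMod_sq_le k hpl (dvd_mul_left _ _)).trans ?_)
    · rw [ha]; simp only
      rw [norm_mul, RCLike.norm_conj, ← sq, norm_mul]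
      refine pow_le_pow_left₀ (by positivity) ?_ 2
      exact mul_le_of_le_one_left (norm_nonneg _) (hΨ.norm_le _)
    · have h1 : (p * l).divisors.card ≤ 2 * l.divisors.card := by
        refine (card_divisors_mul_le p l).trans (Nat.mul_le_mul_right _ ?_)
        rw [(hP p hp).1.divisors]; exact Finset.card_le_two
      have h2 : ((p * l).divisors.card : ℝ) ≤ 2 * l.divisors.card := by exact_mod_cast h1
      calc ((p * l).divisors.card : ℝ) ^ 2 ≤ (2 * l.divisors.card : ℝ) ^ 2 := by gcongr
        _ = _ := by ring
  have hoff' : ∀ p ∈ P, ∀ q ∈ P.erase p,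
      ‖∑ l ∈ Finset.Icc 1 M, ∑ μ ∈ rootsNegOne l, a p l μ * conj (a q l μ)‖ ≤
      C * (u ^ 140 * Real.exp (-u ^ 10) * (x / N) * ((q : ℤ) - p).natAbs.divisors.card) := by
    intro p hp q hq
    rw [Finset.mem_erase] at hq
    refine le_trans (le_of_eq ?_) (hoff p hp q hq.2 (Ne.symm hq.1))
    congr 1
    refine Finset.sum_congr rfl fun l hl => ?_
    rw [← sum_rootSumMod_mul_conj k (hP p hp).1.pos (hP q hq.2).1.pos (Finset.mem_Icc.1 hl).1
      ((Nat.coprime_primes (hP p hp).1 (hP q hq.2).1).2 (Ne.symm hq.1)), Finset.mul_sum]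
    refine Finset.sum_congr rfl fun μ _ => ?_
    rw [ha]; simp only [map_mul]; ring
  clear hoff
  have hPcard : (P.card : ℝ) ≤ N := by
    have h1 : P ⊆ Finset.Ico N (2 * N) := fun p hp => Finset.mem_Ico.2 (hP p hp).2
    have h2 := Finset.card_le_card h1
    rw [Nat.card_Ico] at h2
    have h3 : P.card ≤ N := by omega
    exact_mod_cast h3
  have hsecond : ∑ p ∈ P, ∑ q ∈ P,
      ‖∑ l ∈ Finset.Icc 1 M, ∑ μ ∈ rootsNegOne l, a p l μ * conj (a q l μ)‖ ≤
      N * (4 * (2 * x / N * (2 * u ^ 20) ^ 4) +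
        C * (u ^ 140 * Real.exp (-u ^ 10) * (x / N)) * (2 * (N * (2 * u ^ 20) ^ 2))) := by
    refine (Finset.sum_le_card_nsmul _ _ (4 * (2 * x / N * (2 * u ^ 20) ^ 4) +
        C * (u ^ 140 * Real.exp (-u ^ 10) * (x / N)) * (2 * (N * (2 * u ^ 20) ^ 2))) ?_).trans ?_
    · intro p hp
      rw [← Finset.add_sum_erase P _ hp]
      refine add_le_add (hdiag p hp) ?_
      refine (Finset.sum_le_sum (hoff' p hp)).trans ?_
      rw [← Finset.mul_sum, ← Finset.mul_sum, ← mul_assoc]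
      refine mul_le_mul_of_nonneg_left ?_ (by positivity)
      refine (sum_erase_natAbs_sub_le (fun q hq => (hP q hq).2) hp (fun h => (h.divisors.card : ℝ))
        (fun _ => Nat.cast_nonneg _)).trans ?_
      refine mul_le_mul_of_nonneg_left ?_ (by norm_num)
      have h1 := sum_Icc_card_divisors_pow_le 1 N
      simp only [pow_one] at h1
      refine h1.trans (mul_le_mul_of_nonneg_left ?_ hN0'.le)
      exact pow_le_pow_left₀ (one_add_log_nonneg _) hlogN 2
    · rw [nsmul_eq_mul]
      refine mul_le_mul_of_nonneg_right hPcard (by positivity)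
  have hsq := norm_sum_bilinear_sq_le P (Finset.Icc 1 M) rootsNegOne b a
  rw [← hrew] at hsq
  have hfin : (2 * x / N * (2 * u ^ 20) ^ 8) * (N * (4 * (2 * x / N * (2 * u ^ 20) ^ 4) +
        C * (u ^ 140 * Real.exp (-u ^ 10) * (x / N)) * (2 * (N * (2 * u ^ 20) ^ 2)))) ≤
      (65536 * Nat.factorial 72 + 4096 * C * Nat.factorial 46) * (x / u ^ 60) ^ 2 := by
    have e1 : u ^ 360 / N ≤ Nat.factorial 72 := by rw [div_le_iff₀ hN0']; exact hN3
    have e2 : u ^ 460 * Real.exp (-u ^ 10) ≤ Nat.factorial 46 := by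
      rw [Real.exp_neg, ← div_eq_mul_inv, div_le_iff₀ (Real.exp_pos _)]
      rw [← pow_mul] at hη1
      exact hη1
    have hv : 0 ≤ (x / u ^ 60) ^ 2 := by positivity
    calc _ = (65536 * (u ^ 360 / N) + 4096 * C * (u ^ 460 * Real.exp (-u ^ 10))) *
          (x / u ^ 60) ^ 2 := by field_simp; ring
      _ ≤ _ := by gcongr
  have hfinal := (hsq.trans (mul_le_mul hfirst hsecond
    (Finset.sum_nonneg fun _ _ => Finset.sum_nonneg fun _ _ => norm_nonneg _)
    (by positivity))).trans hfin
  refine abs_le_of_sq_le_sq' ?_ (by positivity) |>.2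
  rw [mul_pow, Real.sq_sqrt (by positivity)]
  exact hfinal

end

theorem signedWeight_mul_prime {E : Finset ℕ} (hE : ∀ e ∈ E, e.Prime) {p : ℕ} (hp : p.Prime)
    (hpE : p ∉ E) (l : ℕ) : signedWeight E (p * l) = signedWeight E l := by
  unfold signedWeight
  congr 3
  refine Finset.filter_congr fun e he => ?_
  rw [(hE e he).dvd_mul, Nat.prime_dvd_prime_iff_eq (hE e he) hp]
  constructor
  · rintro (rfl | h)
    · exact absurd he hpE
    · exact h
  · exact Or.inr

/-- The coefficients of the bilinear part in Ramaré's identity. -/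
noncomputable def ramareWeight (W : ℕ) (E P : Finset ℕ) (l : ℕ) : ℂ :=
  if l.Coprime (primorial W) then signedWeight E l / (1 + (P.filter (· ∣ l)).card) else 0

theorem norm_ramareWeight_le (W : ℕ) {E : Finset ℕ} (hE : ∀ e ∈ E, e.Prime) (P : Finset ℕ) {l : ℕ}
    (hl : l ≠ 0) : ‖ramareWeight W E P l‖ ≤ l.divisors.card := by
  unfold ramareWeight
  split_ifs with h
  · have h1 : |(signedWeight E l : ℝ)| ≤ l.divisors.card := by
      exact_mod_cast abs_signedWeight_le (fun h => Nat.not_prime_one (hE 1 h)) hl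
    rw [norm_div, Complex.norm_intCast]
    have h2 : ‖(1 + (P.filter (· ∣ l)).card : ℂ)‖ = 1 + ((P.filter (· ∣ l)).card : ℝ) := by
      have : (1 + (P.filter (· ∣ l)).card : ℂ) = ((1 + (P.filter (· ∣ l)).card : ℕ) : ℂ) := by
        push_cast; rfl
      rw [this, Complex.norm_natCast]; push_cast; rfl
    rw [h2]
    refine (div_le_self (abs_nonneg _) ?_).trans h1
    have : (0 : ℝ) ≤ (P.filter (· ∣ l)).card := Nat.cast_nonneg _
    linarith
  · simp

/-- Ramaré's identity, up to the contribution of integers divisible by the square of a prime. -/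
theorem norm_ramare_identity_le (f : ℕ → ℂ) (hf : ∀ n, ‖f n‖ ≤ n.divisors.card) (N W : ℕ)
    {E P : Finset ℕ} (hE : ∀ e ∈ E, e.Prime) (hP : ∀ p ∈ P, p.Prime ∧ W < p ∧ p ∉ E) :
    ‖∑ n ∈ (Finset.Icc 1 N).filter (fun n => n.Coprime (primorial W)), signedWeight E n * f n -
      ∑ n ∈ (Finset.Icc 1 N).filter (fun n => n.Coprime (primorial W) ∧ ∀ p ∈ P, ¬ p ∣ n),
        signedWeight E n * f n -
      ∑ p ∈ P, ∑ l ∈ Finset.Icc 1 (N / p), ramareWeight W E P l * f (p * l)‖ ≤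
    ∑ p ∈ P, 2 * ∑ n ∈ (Finset.Icc 1 N).filter (p ^ 2 ∣ ·), (n.divisors.card : ℝ) ^ 2 := by
  classical
  set ω : ℕ → ℕ := fun n => (P.filter (· ∣ n)).card with hω
  set c : ℕ → ℂ := fun n => if n.Coprime (primorial W) then signedWeight E n * f n / ω n else 0
    with hc
  have hmain : ∑ n ∈ (Finset.Icc 1 N).filter (fun n => n.Coprime (primorial W)),
      signedWeight E n * f n -
      ∑ n ∈ (Finset.Icc 1 N).filter (fun n => n.Coprime (primorial W) ∧ ∀ p ∈ P, ¬ p ∣ n),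
        signedWeight E n * f n = ∑ p ∈ P, ∑ l ∈ Finset.Icc 1 (N / p), c (p * l) := by
    have h1 : ∀ p ∈ P, ∑ l ∈ Finset.Icc 1 (N / p), c (p * l) =
        ∑ n ∈ Finset.Icc 1 N, if p ∣ n then c n else 0 := fun p hp => by
      rw [← sum_Icc_filter_dvd p N (hP p hp).1.pos, Finset.sum_filter]
    rw [Finset.sum_congr rfl h1, Finset.sum_comm, Finset.sum_filter, Finset.sum_filter,
      ← Finset.sum_sub_distrib]
    refine Finset.sum_congr rfl fun n _ => ?_
    rw [← Finset.sum_filter, Finset.sum_const, nsmul_eq_mul, show c n = if n.Coprime (primorial W) then signedWeight E n * f n / ω n else 0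
        from rfl]
    by_cases hn : n.Coprime (primorial W)
    · rw [if_pos hn, if_pos hn]
      by_cases h0 : ω n = 0
      · have h2 : ∀ p ∈ P, ¬ p ∣ n := fun p hp hd => by
          have := Finset.card_eq_zero.1 h0
          exact Finset.notMem_empty p (this ▸ Finset.mem_filter.2 ⟨hp, hd⟩)
        rw [if_pos ⟨hn, h2⟩, sub_self]
        have h3 : (P.filter (· ∣ n)).card = 0 := h0
        rw [h3, Nat.cast_zero, zero_mul]
      · have h2 : ¬ ∀ p ∈ P, ¬ p ∣ n := fun h2 => h0 (by
          rw [hω]; exact Finset.card_eq_zero.2 (Finset.filter_eq_empty_iff.2 fun p hp => h2 p hp))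
        rw [if_neg (fun h => h2 h.2), sub_zero]
        have h3 : ((P.filter (· ∣ n)).card : ℂ) = (ω n : ℂ) := rfl
        rw [h3]
        have h4 : (ω n : ℂ) ≠ 0 := by exact_mod_cast h0
        field_simp
    · rw [if_neg hn, if_neg hn, if_neg (fun h => hn h.1), sub_zero, mul_zero]
  rw [hmain, ← Finset.sum_sub_distrib]
  refine norm_sum_le_of_le _ fun p hp => ?_
  obtain ⟨hpp, hpW, hpE⟩ := hP p hp
  have hcop : p.Coprime (primorial W) := by
    rw [hpp.coprime_iff_not_dvd, hpp.dvd_primorial_iff]; omega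
  have hE1 : 1 ∉ E := fun h => Nat.not_prime_one (hE 1 h)
  have hrough : ∀ l, (p * l).Coprime (primorial W) ↔ l.Coprime (primorial W) := fun l => by
    rw [Nat.coprime_mul_iff_left]; exact and_iff_right hcop
  have hRHS : 2 * ∑ n ∈ (Finset.Icc 1 N).filter (p ^ 2 ∣ ·), (n.divisors.card : ℝ) ^ 2 =
      ∑ l ∈ Finset.Icc 1 (N / p), if p ∣ l then 2 * ((p * l).divisors.card : ℝ) ^ 2 else 0 := by
    rw [← Finset.sum_filter, sum_Icc_filter_dvd p _ hpp.pos,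
      sum_Icc_filter_dvd (p ^ 2) _ (pow_pos hpp.pos 2), Finset.mul_sum, Nat.div_div_eq_div_mul, sq]
    refine Finset.sum_congr rfl fun j _ => ?_
    rw [mul_assoc]
  rw [hRHS, ← Finset.sum_sub_distrib]
  refine norm_sum_le_of_le _ fun l hl => ?_
  have hl0 : l ≠ 0 := by have := (Finset.mem_Icc.1 hl).1; omega
  have hpl0 : p * l ≠ 0 := mul_ne_zero hpp.ne_zero hl0
  split_ifs with hd
  · have hτ : (l.divisors.card : ℝ) ≤ (p * l).divisors.card := by
      exact_mod_cast Finset.card_le_card (Nat.divisors_subset_of_dvd hpl0 (dvd_mul_left _ _))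
    have h1 : ‖ramareWeight W E P l * f (p * l)‖ ≤ ((p * l).divisors.card : ℝ) ^ 2 := by
      rw [norm_mul, sq]
      exact mul_le_mul ((norm_ramareWeight_le W hE P hl0).trans hτ) (hf _) (norm_nonneg _)
        (Nat.cast_nonneg _)
    have h2 : ‖c (p * l)‖ ≤ ((p * l).divisors.card : ℝ) ^ 2 := by
      rw [hc]; simp only
      split_ifs
      · have h3 : |(signedWeight E (p * l) : ℝ)| ≤ (p * l).divisors.card := by
          exact_mod_cast abs_signedWeight_le hE1 hpl0
        rw [norm_div, norm_mul, Complex.norm_intCast, Complex.norm_natCast, sq]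
        have h4 : (1 : ℝ) ≤ ω (p * l) := by
          exact_mod_cast Finset.card_pos.2 ⟨p, Finset.mem_filter.2 ⟨hp, dvd_mul_right _ _⟩⟩
        refine (div_le_self (by positivity) h4).trans ?_
        exact mul_le_mul h3 (hf _) (norm_nonneg _) (Nat.cast_nonneg _)
      · rw [norm_zero]; positivity
    calc _ ≤ ‖c (p * l)‖ + ‖ramareWeight W E P l * f (p * l)‖ := norm_sub_le _ _
      _ ≤ _ := by linarith
  · have hωl : ω (p * l) = 1 + ω l := by
      rw [hω]; simp only
      have h1 : P.filter (· ∣ p * l) = insert p (P.filter (· ∣ l)) := by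
        ext q
        simp only [Finset.mem_filter, Finset.mem_insert]
        constructor
        · rintro ⟨hq, hqd⟩
          rcases (hP q hq).1.dvd_mul.1 hqd with h | h
          · exact Or.inl ((Nat.prime_dvd_prime_iff_eq (hP q hq).1 hpp).1 h)
          · exact Or.inr ⟨hq, h⟩
        · rintro (rfl | ⟨hq, hqd⟩)
          · exact ⟨hp, dvd_mul_right _ _⟩
          · exact ⟨hq, hqd.mul_left _⟩
      rw [h1, Finset.card_insert_of_notMem (by simp [hd]), add_comm]
    have h1 : c (p * l) = ramareWeight W E P l * f (p * l) := by
      rw [hc, ramareWeight]; simp only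
      rw [hωl, signedWeight_mul_prime hE hpp hpE]
      by_cases h : l.Coprime (primorial W)
      · rw [if_pos ((hrough l).2 h), if_pos h]
        push_cast
        rw [hω]; ring
      · rw [if_neg (fun h' => h ((hrough l).1 h')), if_neg h, zero_mul]
    rw [h1, sub_self, norm_zero]

theorem sum_prod_prime_sq_error_le {u : ℝ} (hu : 5 ≤ u) {P : Finset ℕ} {Z : ℕ}
    (hP : ∀ p ∈ P, p.Prime ∧ ⌊Real.exp (u ^ 5)⌋₊ < p ∧ p ≤ Z) :
    ∑ p ∈ P, 2 * ∑ n ∈ (Finset.Icc 1 ⌊8 * Real.exp (u ^ 20)⌋₊).filter (p ^ 2 ∣ ·),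
      (n.divisors.card : ℝ) ^ 2 ≤ 4608 * (Nat.factorial 22 : ℝ) * (Real.exp (u ^ 20) / u ^ 29) := by
  set N := ⌊8 * Real.exp (u ^ 20)⌋₊ with hN
  set W := ⌊Real.exp (u ^ 5)⌋₊ with hW
  have hu0 : 0 < u := by linarith
  have hNle : (N : ℝ) ≤ 8 * Real.exp (u ^ 20) := Nat.floor_le (by positivity)
  have hN0 : 1 ≤ N := Nat.le_floor (by
    have := Real.one_le_exp (show (0 : ℝ) ≤ u ^ 20 by positivity); push_cast; linarith)
  have hlog : 1 + Real.log N ≤ 2 * u ^ 20 := by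
    have h1 : Real.log N ≤ Real.log (8 * Real.exp (u ^ 20)) :=
      Real.log_le_log (by exact_mod_cast hN0) hNle
    have h2 := log_mul_exp_pow_le (u := u) (by linarith) (c := 8) (by norm_num) (by norm_num)
    linarith
  have hWe : Real.exp (u ^ 5) ≤ 2 * W := by
    have h1 := Nat.lt_floor_add_one (Real.exp (u ^ 5))
    have h2 : (1 : ℝ) ≤ W := by
      exact_mod_cast Nat.le_floor (by
        have := Real.one_le_exp (show (0 : ℝ) ≤ u ^ 5 by positivity); push_cast; linarith)
    linarith
  have hW0 : W ≠ 0 := fun h => by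
    rw [h] at hWe; have := Real.exp_pos (u ^ 5); norm_num at hWe; linarith
  have hterm : ∀ p ∈ P, 2 * ∑ n ∈ (Finset.Icc 1 N).filter (p ^ 2 ∣ ·), (n.divisors.card : ℝ) ^ 2 ≤
      2304 * Real.exp (u ^ 20) * u ^ 80 * ((p : ℝ) ^ 2)⁻¹ := fun p hp => by
    have hpp := (hP p hp).1
    have h1 := sum_filter_dvd_card_divisors_pow_le 2 N (p ^ 2) (pow_pos hpp.pos 2)
    have h2 : (p ^ 2).divisors.card = 3 := by
      rw [Nat.divisors_prime_pow hpp]; simp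
    rw [h2] at h1
    have h3 : (1 + Real.log N) ^ 2 ^ 2 ≤ (2 * u ^ 20) ^ 4 :=
      pow_le_pow_left₀ (one_add_log_nonneg N) hlog 4
    have hp0 : (0 : ℝ) < (p : ℝ) ^ 2 := by have := hpp.pos; positivity
    have h4 : ((3 : ℕ) : ℝ) ^ 2 * ((N : ℝ) / ((p ^ 2 : ℕ) : ℝ)) * (1 + Real.log N) ^ 2 ^ 2 ≤
        9 * (8 * Real.exp (u ^ 20) / (p : ℝ) ^ 2) * (2 * u ^ 20) ^ 4 := by
      push_cast
      have h5 : (N : ℝ) / (p : ℝ) ^ 2 ≤ 8 * Real.exp (u ^ 20) / (p : ℝ) ^ 2 :=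
        div_le_div_of_nonneg_right hNle hp0.le
      refine mul_le_mul ?_ h3 (pow_nonneg (one_add_log_nonneg N) _) (by positivity)
      linarith
    calc _ ≤ 2 * (9 * (8 * Real.exp (u ^ 20) / (p : ℝ) ^ 2) * (2 * u ^ 20) ^ 4) := by linarith
      _ = _ := by rw [div_eq_mul_inv]; ring
  refine (Finset.sum_le_sum hterm).trans ?_
  rw [← Finset.mul_sum]
  have hsum : ∑ p ∈ P, ((p : ℝ) ^ 2)⁻¹ ≤ 2 / Real.exp (u ^ 5) := by
    have h1 : ∑ p ∈ P, ((p : ℝ) ^ 2)⁻¹ ≤ ∑ p ∈ Finset.Ioc W (W + Z), ((p : ℝ) ^ 2)⁻¹ := by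
      refine Finset.sum_le_sum_of_subset_of_nonneg (fun p hp => ?_) fun _ _ _ => by positivity
      have := hP p hp
      rw [Finset.mem_Ioc]; omega
    have h2 := sum_Ioc_inv_sq_le_sub (α := ℝ) hW0 (Nat.le_add_right W Z)
    have h3 : (0 : ℝ) ≤ ((W + Z : ℕ) : ℝ)⁻¹ := by positivity
    have h4 : ((W : ℝ))⁻¹ ≤ 2 / Real.exp (u ^ 5) := by
      have hWp : (0 : ℝ) < W := by exact_mod_cast Nat.pos_of_ne_zero hW0
      rw [inv_eq_one_div, div_le_div_iff₀ hWp (Real.exp_pos _)]; linarith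
    linarith
  refine (mul_le_mul_of_nonneg_left hsum (by positivity)).trans ?_
  have h1 := pow_le_factorial_mul_exp (show (0 : ℝ) ≤ u ^ 5 by positivity) 22
  have h2 : u ^ 109 ≤ (u ^ 5) ^ 22 := by
    rw [← pow_mul]; exact pow_le_pow_right₀ (by linarith) (by norm_num)
  rw [mul_div_assoc', mul_div_assoc', div_le_div_iff₀ (Real.exp_pos _) (by positivity)]
  calc _ = 4608 * Real.exp (u ^ 20) * u ^ 109 := by ring
    _ ≤ 4608 * Real.exp (u ^ 20) * ((Nat.factorial 22 : ℝ) * Real.exp (u ^ 5)) :=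
        mul_le_mul_of_nonneg_left (h2.trans h1) (by positivity)
    _ = _ := by ring

theorem sum_Icc_div_eq_sum_Icc_of_support {u : ℝ} {Ψ : ℝ → ℂ} (hΨ : IsScaleWeight u Ψ) (k : ℤ)
    (b : ℕ → ℂ) {N p : ℕ} (hN : 0 < N) (hp : N ≤ p ∧ p < 2 * N) :
    ∑ l ∈ Finset.Icc 1 (⌊8 * Real.exp (u ^ 20)⌋₊ / p), b l * (Ψ (p * l : ℕ) * rootSum k (p * l)) =
      ∑ l ∈ Finset.Icc 1 ⌊2 * Real.exp (u ^ 20) / N⌋₊,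
        b l * (Ψ (p * l : ℕ) * rootSum k (p * l)) := by
  have hx := Real.exp_pos (u ^ 20)
  have hNr : (0 : ℝ) < N := by exact_mod_cast hN
  have hpN : (N : ℝ) ≤ p := by exact_mod_cast hp.1
  have hpN2 : (p : ℝ) ≤ 2 * N := by exact_mod_cast hp.2.le
  symm
  refine Finset.sum_subset (fun l hl => ?_) fun l _ hl' => ?_
  · rw [Finset.mem_Icc] at hl ⊢
    refine ⟨hl.1, (Nat.le_div_iff_mul_le (by omega)).2 (Nat.le_floor ?_)⟩
    have h1 : (l : ℝ) ≤ 2 * Real.exp (u ^ 20) / N := (Nat.le_floor_iff (by positivity)).1 hl.2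
    rw [le_div_iff₀ hNr] at h1
    push_cast
    have h2 : (l : ℝ) * p ≤ l * (2 * N) := mul_le_mul_of_nonneg_left hpN2 (Nat.cast_nonneg _)
    linarith
  · suffices h : Ψ (p * l : ℕ) = 0 by rw [h]; ring
    by_contra h
    apply hl'
    have h1 := (hΨ.support _ h).2
    have hl1 : 1 ≤ l := by
      rcases Nat.eq_zero_or_pos l with h0 | h0
      · simp_all
      · exact h0
    refine Finset.mem_Icc.2 ⟨hl1, Nat.le_floor ?_⟩
    rw [le_div_iff₀ hNr]
    push_cast at h1
    have h2 : (l : ℝ) * N ≤ l * p := mul_le_mul_of_nonneg_left hpN (Nat.cast_nonneg _)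
    linarith

/-- The bilinear part of Ramaré's identity over primes up to `exp (u ^ 20 / 3 - u ^ 11)`. -/
theorem exists_norm_sum_bilinear_le : ∃ C > 0, ∀ u : ℝ, 5 ≤ u → ∀ Ψ : ℝ → ℂ, IsScaleWeight u Ψ →
    ∀ k : ℤ, k ≠ 0 → (k.natAbs : ℝ) ≤ u ^ 40 → ∀ P : Finset ℕ,
    (∀ p ∈ P, p.Prime ∧ ⌊Real.exp (u ^ 5)⌋₊ < p ∧ (p : ℝ) ≤ Real.exp (u ^ 20 / 3 - u ^ 11)) →
    ∀ b : ℕ → ℂ, (∀ l, l ≠ 0 → ‖b l‖ ≤ l.divisors.card) →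
    ‖∑ p ∈ P, ∑ l ∈ Finset.Icc 1 (⌊8 * Real.exp (u ^ 20)⌋₊ / p),
      b l * (Ψ (p * l : ℕ) * rootSum k (p * l))‖ ≤ C * (Real.exp (u ^ 20) / u ^ 29) := by
  obtain ⟨C, hC, hII⟩ := exists_norm_sum_typeTwo_le
  refine ⟨3 * C, by positivity, fun u hu Ψ hΨ k hk hku P hP b hb => ?_⟩
  have hu0 : 0 < u := by linarith
  set W := ⌊Real.exp (u ^ 5)⌋₊ with hW
  set b' : ℕ → ℂ := fun l => if l = 0 then 0 else b l with hb'
  have hb1 : ∀ l, ‖b' l‖ ≤ l.divisors.card := fun l => by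
    by_cases h : l = 0
    · rw [hb']; simp [h]
    · rw [hb']; simpa [h] using hb l h
  set F : ℕ → ℂ := fun p => ∑ l ∈ Finset.Icc 1 (⌊8 * Real.exp (u ^ 20)⌋₊ / p),
      b l * (Ψ (p * l : ℕ) * rootSum k (p * l)) with hF
  have hx1 : Real.exp (u ^ 20 / 3 - u ^ 11) ≤ Real.exp (u ^ 20) :=
    Real.exp_le_exp.2 (by
      have h1 : 0 < u ^ 20 := by positivity
      have h2 : 0 < u ^ 11 := by positivity
      linarith)
  set J := ⌊2 * u ^ 20⌋₊ + 1 with hJ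
  have hblock : ∀ p ∈ P, (W + 1) * 2 ^ Nat.log 2 (p / (W + 1)) ≤ p ∧
      p < 2 * ((W + 1) * 2 ^ Nat.log 2 (p / (W + 1))) := fun p hp => by
    have hp1 := (hP p hp).2.1
    have h1 : p / (W + 1) ≠ 0 := (Nat.div_pos hp1 (by omega)).ne'
    constructor
    · have h2 := Nat.pow_log_le_self 2 h1
      have h3 := Nat.mul_div_le p (W + 1)
      exact (Nat.mul_le_mul_left _ h2).trans h3
    · have h2 := Nat.lt_pow_succ_log_self (b := 2) (by norm_num) (p / (W + 1))
      have h3 : p < (W + 1) * 2 ^ (Nat.log 2 (p / (W + 1)) + 1) := by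
        rw [mul_comm]; exact (Nat.div_lt_iff_lt_mul (by omega)).1 h2
      rw [pow_succ] at h3
      linarith
  have hmaps : ∀ p ∈ P, Nat.log 2 (p / (W + 1)) ∈ Finset.range J := fun p hp => by
    rw [Finset.mem_range, hJ, Nat.lt_succ_iff]
    refine Nat.le_floor ?_
    have h1 : (2 : ℝ) ^ Nat.log 2 (p / (W + 1)) ≤ Real.exp (u ^ 20) := by
      have h2 : 2 ^ Nat.log 2 (p / (W + 1)) ≤ p :=
        (Nat.le_mul_of_pos_left _ (Nat.succ_pos W)).trans (hblock p hp).1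
      have h3 : (2 : ℝ) ^ Nat.log 2 (p / (W + 1)) ≤ p := by exact_mod_cast h2
      exact h3.trans ((hP p hp).2.2.trans hx1)
    have h2 := Real.log_le_log (by positivity) h1
    rw [Real.log_exp, Real.log_pow] at h2
    have h3 := Real.log_two_gt_d9
    have h4 : (0 : ℝ) ≤ (Nat.log 2 (p / (W + 1)) : ℝ) := Nat.cast_nonneg _
    have h5 : (Nat.log 2 (p / (W + 1)) : ℝ) * (1 / 2) ≤
        (Nat.log 2 (p / (W + 1)) : ℝ) * Real.log 2 :=
      mul_le_mul_of_nonneg_left (by linarith) h4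
    linarith
  have hJle : (J : ℝ) ≤ 3 * u ^ 20 := by
    have h1 : ((⌊2 * u ^ 20⌋₊ : ℕ) : ℝ) ≤ 2 * u ^ 20 := Nat.floor_le (by positivity)
    have h2 : (1 : ℝ) ≤ u ^ 20 := one_le_pow₀ (by linarith)
    rw [hJ]; push_cast; linarith
  rw [← Finset.sum_fiberwise_of_maps_to hmaps]
  have hj : ∀ j ∈ Finset.range J,
      ‖∑ p ∈ P.filter (fun p => Nat.log 2 (p / (W + 1)) = j), F p‖ ≤
        C * (Real.exp (u ^ 20) / u ^ 60) := fun j _ => by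
    rcases (P.filter (fun p => Nat.log 2 (p / (W + 1)) = j)).eq_empty_or_nonempty with h0 | h0
    · rw [h0, Finset.sum_empty, norm_zero]; positivity
    have hNpos : 0 < (W + 1) * 2 ^ j := by positivity
    have hmem : ∀ p ∈ P.filter (fun p => Nat.log 2 (p / (W + 1)) = j), p.Prime ∧
        (W + 1) * 2 ^ j ≤ p ∧ p < 2 * ((W + 1) * 2 ^ j) := fun p hp => by
      obtain ⟨hp1, rfl⟩ := Finset.mem_filter.1 hp
      exact ⟨(hP p hp1).1, hblock p hp1⟩
    have hN1 : Real.exp (u ^ 5) ≤ (((W + 1) * 2 ^ j : ℕ) : ℝ) := by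
      have h1 := (Nat.lt_floor_add_one (Real.exp (u ^ 5))).le
      have h2 : ((W + 1 : ℕ) : ℝ) ≤ (((W + 1) * 2 ^ j : ℕ) : ℝ) := by
        exact_mod_cast Nat.le_mul_of_pos_right _ (by positivity)
      push_cast at h2 ⊢
      exact h1.trans h2
    have hN2 : (((W + 1) * 2 ^ j : ℕ) : ℝ) ≤ Real.exp (u ^ 20 / 3 - u ^ 11) := by
      obtain ⟨p, hp⟩ := h0
      have h1 : (((W + 1) * 2 ^ j : ℕ) : ℝ) ≤ p := by exact_mod_cast (hmem p hp).2.1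
      exact h1.trans (hP p (Finset.mem_filter.1 hp).1).2.2
    have h1 := hII u hu Ψ hΨ k hk hku ((W + 1) * 2 ^ j) hN1 hN2 _ hmem b' hb1
    convert h1 using 2
    refine Finset.sum_congr rfl fun p hp => ?_
    rw [hF]
    simp only
    rw [sum_Icc_div_eq_sum_Icc_of_support hΨ k b hNpos (hmem p hp).2]
    refine Finset.sum_congr rfl fun l hl => ?_
    have hl0 : l ≠ 0 := by have := (Finset.mem_Icc.1 hl).1; omega
    rw [hb']; simp only [if_neg hl0]
  refine (norm_sum_le_of_le _ hj).trans ?_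
  rw [Finset.sum_const, Finset.card_range, nsmul_eq_mul]
  have h1 : Real.exp (u ^ 20) / u ^ 60 ≤ Real.exp (u ^ 20) / u ^ 49 :=
    div_le_div_of_nonneg_left (Real.exp_pos _).le (by positivity)
      (pow_le_pow_right₀ (by linarith) (by norm_num))
  calc (J : ℝ) * (C * (Real.exp (u ^ 20) / u ^ 60))
      ≤ (3 * u ^ 20) * (C * (Real.exp (u ^ 20) / u ^ 49)) :=
        mul_le_mul hJle (mul_le_mul_of_nonneg_left h1 hC.le) (by positivity) (by positivity)
    _ = 3 * C * (Real.exp (u ^ 20) / u ^ 29) := by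
        field_simp

/-- The sum of the sieve weight over integers without prime factors up to
`exp (u ^ 20 / 3 - u ^ 11)`. -/
theorem exists_norm_sum_coprime_primorial_le : ∃ C > 0, ∀ u : ℝ, 5 ≤ u → ∀ Ψ : ℝ → ℂ,
    IsScaleWeight u Ψ → ∀ k : ℤ, k ≠ 0 → (k.natAbs : ℝ) ≤ u ^ 40 → ∀ E : Finset ℕ,
    (∀ e ∈ E, e.Prime ∧ ⌊Real.exp (u ^ 20 / 3 - u ^ 11)⌋₊ < e ∧
      (e : ℝ) ≤ Real.exp (u ^ 20 / 2 - u ^ 11)) →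
    ‖∑ n ∈ (Finset.Icc 1 ⌊8 * Real.exp (u ^ 20)⌋₊).filter
      (fun n => n.Coprime (primorial ⌊Real.exp (u ^ 20 / 3 - u ^ 11)⌋₊)),
      signedWeight E n * (Ψ n * rootSum k n)‖ ≤ C * (Real.exp (u ^ 20) / u ^ 29) := by
  obtain ⟨C₁, hC₁, hI⟩ := exists_norm_sum_coprime_scale_le
  obtain ⟨C₂, hC₂, hII⟩ := exists_norm_sum_bilinear_le
  refine ⟨C₁ + C₂ + 4608 * (Nat.factorial 22 : ℝ), by positivity,
    fun u hu Ψ hΨ k hk hku E hE => ?_⟩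
  have hu0 : 0 < u := by linarith
  set W := ⌊Real.exp (u ^ 5)⌋₊ with hW
  set Z := ⌊Real.exp (u ^ 20 / 3 - u ^ 11)⌋₊ with hZ
  set N := ⌊8 * Real.exp (u ^ 20)⌋₊ with hN
  have hWZ : W ≤ Z := by
    refine Nat.floor_mono (Real.exp_le_exp.2 ?_)
    have h1 : u ^ 5 ≤ u ^ 11 := pow_le_pow_right₀ (by linarith) (by norm_num)
    have h2 : 6 * u ^ 11 ≤ u ^ 20 := by
      have h3 : (5 : ℝ) ^ 9 ≤ u ^ 9 := pow_le_pow_left₀ (by norm_num) hu 9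
      calc 6 * u ^ 11 ≤ u ^ 9 * u ^ 11 :=
            mul_le_mul_of_nonneg_right (by norm_num at h3; linarith) (by positivity)
        _ = u ^ 20 := by ring
    linarith
  set P := (Finset.Icc 1 Z).filter (fun p => p.Prime ∧ W < p) with hPdef
  have hP : ∀ p ∈ P, p.Prime ∧ W < p ∧ p ≤ Z := fun p hp => by
    rw [hPdef, Finset.mem_filter, Finset.mem_Icc] at hp
    exact ⟨hp.2.1, hp.2.2, hp.1.2⟩
  have hcop : ∀ n : ℕ, n.Coprime (primorial Z) ↔ n.Coprime (primorial W) ∧ ∀ p ∈ P, ¬ p ∣ n :=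
    fun n => by
    constructor
    · refine fun h => ⟨?_, fun p hp hd => ?_⟩
      · refine Nat.Coprime.coprime_dvd_right ?_ h
        exact Finset.prod_dvd_prod_of_subset _ _ _ (Finset.filter_subset_filter _
          (Finset.range_mono (by omega)))
      · have hp1 := hP p hp
        have h2 : p ∣ primorial Z := hp1.1.dvd_primorial_iff.2 hp1.2.2
        exact Nat.not_coprime_of_dvd_of_dvd hp1.1.one_lt hd h2 h
    · rintro ⟨h1, h2⟩
      refine Nat.coprime_of_dvd fun p hp hpn hpZ => ?_
      have hpZ' : p ≤ Z := hp.dvd_primorial_iff.1 hpZ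
      rcases le_or_gt p W with h | h
      · exact Nat.not_coprime_of_dvd_of_dvd hp.one_lt hpn (hp.dvd_primorial_iff.2 h) h1
      · exact h2 p (Finset.mem_filter.2 ⟨Finset.mem_Icc.2 ⟨hp.one_lt.le, hpZ'⟩, hp, h⟩) hpn
  rw [Finset.filter_congr fun n _ => hcop n]
  have hPE : ∀ p ∈ P, p.Prime ∧ W < p ∧ p ∉ E := fun p hp =>
    ⟨(hP p hp).1, (hP p hp).2.1, fun h => by have := (hP p hp).2.2; have := (hE p h).2.1; omega⟩
  have hram := norm_ramare_identity_le (fun n => Ψ n * rootSum k n)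
    (fun n => norm_scaleWeight_mul_rootSum_le hΨ k n) N W (fun e he => (hE e he).1) hPE
  have h1 := hI u hu Ψ hΨ k hk hku E fun e he =>
    ⟨(hE e he).1, hWZ.trans_lt (hE e he).2.1, (hE e he).2.2⟩
  have h2 := hII u hu Ψ hΨ k hk hku P
    (fun p hp => ⟨(hP p hp).1, (hP p hp).2.1,
      (Nat.le_floor_iff (Real.exp_pos _).le).1 (hP p hp).2.2⟩) (ramareWeight W E P)
    (fun l hl => norm_ramareWeight_le W (fun e he => (hE e he).1) P hl)
  have h3 := sum_prod_prime_sq_error_le hu hP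
  have htri : ∀ a s t : ℂ, ‖s‖ ≤ ‖a‖ + ‖t‖ + ‖a - s - t‖ := fun a s t => by
    have : s = a - t - (a - s - t) := by ring
    calc ‖s‖ = ‖a - t - (a - s - t)‖ := by rw [← this]
      _ ≤ ‖a - t‖ + ‖a - s - t‖ := norm_sub_le _ _
      _ ≤ _ := by have := norm_sub_le a t; linarith
  refine (htri _ _ _).trans ((add_le_add (add_le_add h1 h2) (hram.trans h3)).trans (le_of_eq ?_))
  ring

theorem card_filter_prime_le {y : ℝ} (hy : 1 < y) :
    (((Finset.Icc 1 ⌊y⌋₊).filter Nat.Prime).card : ℝ) ≤ 5 * y / Real.log y := by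
  have h1 := Chebyshev.pi_le_log4_mul_div hy
  have h2 : ((Finset.Icc 1 ⌊y⌋₊).filter Nat.Prime).card = ⌊y⌋₊.primeCounting := by
    rw [Nat.primeCounting, Nat.primeCounting', Nat.count_eq_card_filter_range]
    congr 1
    ext p
    simp only [Finset.mem_filter, Finset.mem_Icc, Finset.mem_range]
    exact ⟨fun h => ⟨by omega, h.2⟩, fun h => ⟨⟨h.2.one_lt.le, by omega⟩, h.2⟩⟩
  rw [h2]
  refine h1.trans ?_
  have hlog : 0 < Real.log y := Real.log_pos hy
  have hs : 0 < √y := Real.sqrt_pos.2 (by linarith)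
  rw [Real.log_sqrt (by linarith)]
  have h3 : Real.log y ≤ 2 * √y := by
    have := Real.log_le_sub_one_of_pos hs
    rw [Real.log_sqrt (by linarith)] at this
    linarith
  have h4 : √y ≤ 2 * y / Real.log y := by
    rw [le_div_iff₀ hlog]
    calc √y * Real.log y ≤ √y * (2 * √y) := mul_le_mul_of_nonneg_left h3 hs.le
      _ = 2 * y := by rw [show √y * (2 * √y) = 2 * (√y * √y) by ring,
          Real.mul_self_sqrt (by linarith)]
  have h5 : Real.log 4 * y / (Real.log y / 2) ≤ 3 * y / Real.log y := by
    have h6 : Real.log 4 ≤ 3 / 2 := by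
      rw [show (4 : ℝ) = 2 ^ 2 by norm_num, Real.log_pow]
      have := Real.log_two_lt_d9
      push_cast; linarith
    rw [show Real.log 4 * y / (Real.log y / 2) = (2 * Real.log 4 * y) / Real.log y by
      field_simp]
    refine div_le_div_of_nonneg_right ?_ hlog.le
    exact mul_le_mul_of_nonneg_right (by linarith) (by linarith)
  calc _ ≤ 3 * y / Real.log y + 2 * y / Real.log y := add_le_add h5 h4
    _ = _ := by ring

theorem sum_prime_inv_le {a b : ℝ} (ha : 0 < a) (hab : a ≤ b) {P : Finset ℕ}
    (hP : ∀ p ∈ P, p.Prime ∧ Real.exp a < p ∧ (p : ℝ) ≤ Real.exp b) :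
    ∑ p ∈ P, (p : ℝ)⁻¹ ≤ 15 * ((b - a + 1) / a) := by
  set J := ⌊b - a⌋₊ + 1 with hJ
  have hlog : ∀ p ∈ P, 0 ≤ Real.log p - a := fun p hp => by
    have h1 := (hP p hp).2.1
    have := Real.log_le_log (Real.exp_pos _) h1.le
    rw [Real.log_exp] at this
    linarith
  have hmaps : ∀ p ∈ P, ⌊Real.log p - a⌋₊ ∈ Finset.range J := fun p hp => by
    rw [Finset.mem_range, hJ, Nat.lt_succ_iff]
    refine Nat.floor_mono ?_
    have h1 := (hP p hp).2
    have := Real.log_le_log ((Real.exp_pos _).trans h1.1) h1.2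
    rw [Real.log_exp] at this
    linarith
  rw [← Finset.sum_fiberwise_of_maps_to hmaps]
  have hj : ∀ j ∈ Finset.range J,
      ∑ p ∈ P.filter (fun p : ℕ => ⌊Real.log p - a⌋₊ = j), (p : ℝ)⁻¹ ≤ 15 / a := fun j _ => by
    have hy : 1 < Real.exp (a + j + 1) := by
      rw [← Real.exp_zero]; exact Real.exp_lt_exp.2 (by positivity)
    have hmem : ∀ p ∈ P.filter (fun p : ℕ => ⌊Real.log p - a⌋₊ = j),
        Real.exp (a + j) ≤ p ∧ (p : ℝ) ≤ Real.exp (a + j + 1) := fun p hp => by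
      obtain ⟨hp1, rfl⟩ := Finset.mem_filter.1 hp
      have hp0 : (0 : ℝ) < p := (Real.exp_pos _).trans (hP p hp1).2.1
      have h1 := Nat.floor_le (hlog p hp1)
      have h2 := Nat.lt_floor_add_one (Real.log p - a)
      constructor
      · rw [← Real.le_log_iff_exp_le hp0]; linarith
      · rw [← Real.log_le_iff_le_exp hp0]; linarith
    have hcard : ((P.filter (fun p : ℕ => ⌊Real.log p - a⌋₊ = j)).card : ℝ) ≤
        5 * Real.exp (a + j + 1) / (a + j + 1) := by
      have h1 := card_filter_prime_le hy
      rw [Real.log_exp] at h1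
      refine le_trans ?_ h1
      exact_mod_cast Finset.card_le_card fun p hp => by
        have hpp := (hP p (Finset.mem_filter.1 hp).1).1
        exact Finset.mem_filter.2 ⟨Finset.mem_Icc.2 ⟨hpp.one_lt.le, Nat.le_floor (hmem p hp).2⟩, hpp⟩
    calc ∑ p ∈ P.filter (fun p : ℕ => ⌊Real.log p - a⌋₊ = j), (p : ℝ)⁻¹
        ≤ ∑ p ∈ P.filter (fun p : ℕ => ⌊Real.log p - a⌋₊ = j), (Real.exp (a + j))⁻¹ :=
          Finset.sum_le_sum fun p hp => inv_anti₀ (Real.exp_pos _) (hmem p hp).1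
      _ = (P.filter (fun p : ℕ => ⌊Real.log p - a⌋₊ = j)).card * (Real.exp (a + j))⁻¹ := by
          rw [Finset.sum_const, nsmul_eq_mul]
      _ ≤ 5 * Real.exp (a + j + 1) / (a + j + 1) * (Real.exp (a + j))⁻¹ :=
          mul_le_mul_of_nonneg_right hcard (by positivity)
      _ = 5 * Real.exp 1 / (a + j + 1) := by
          rw [Real.exp_add (a + j) 1]; field_simp
      _ ≤ 15 / a := by
          have h3 := Real.exp_one_lt_d9
          have h4 : (0 : ℝ) ≤ j := Nat.cast_nonneg j
          rw [div_le_div_iff₀ (by positivity) ha]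
          have h5 : 5 * Real.exp 1 * a ≤ 15 * a := mul_le_mul_of_nonneg_right (by linarith) ha.le
          linarith
  refine (Finset.sum_le_sum hj).trans ?_
  rw [Finset.sum_const, Finset.card_range, nsmul_eq_mul]
  have h1 : ((⌊b - a⌋₊ : ℕ) : ℝ) ≤ b - a := Nat.floor_le (by linarith)
  have h2 : (J : ℝ) ≤ b - a + 1 := by rw [hJ]; push_cast; linarith
  calc (J : ℝ) * (15 / a) ≤ (b - a + 1) * (15 / a) :=
        mul_le_mul_of_nonneg_right h2 (by positivity)
    _ = _ := by ring

/-- The number of products `m i * q ≤ X` with `q` prime. -/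
theorem card_biUnion_image_prime_le {ι : Type*} (S : Finset ι) (m : ι → ℕ) {X l : ℝ} (hl : 0 < l)
    (hm : ∀ i ∈ S, 0 < m i ∧ (m i : ℝ) * Real.exp l ≤ X) :
    ((S.biUnion fun i => ((Finset.Icc 1 ⌊X / m i⌋₊).filter Nat.Prime).image (m i * ·)).card : ℝ) ≤
      5 * X / l * ∑ i ∈ S, ((m i : ℝ))⁻¹ := by
  have h1 : ((S.biUnion fun i => ((Finset.Icc 1 ⌊X / m i⌋₊).filter Nat.Prime).image
      (m i * ·)).card : ℝ) ≤ ∑ i ∈ S, (((Finset.Icc 1 ⌊X / m i⌋₊).filter Nat.Prime).card : ℝ) := by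
    exact_mod_cast Finset.card_biUnion_le.trans (Finset.sum_le_sum fun i _ => Finset.card_image_le)
  refine h1.trans ?_
  rw [Finset.mul_sum]
  refine Finset.sum_le_sum fun i hi => ?_
  have hmi : (0 : ℝ) < m i := by exact_mod_cast (hm i hi).1
  have hy : Real.exp l ≤ X / m i := by rw [le_div_iff₀ hmi, mul_comm]; exact (hm i hi).2
  have hy1 : 1 < X / m i := (Real.one_lt_exp_iff.2 hl).trans_le hy
  have hll : l ≤ Real.log (X / m i) := (Real.le_log_iff_exp_le (by linarith)).2 hy
  refine (card_filter_prime_le hy1).trans ?_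
  calc 5 * (X / m i) / Real.log (X / m i) ≤ 5 * (X / m i) / l :=
        div_le_div_of_nonneg_left (by linarith) hl hll
    _ = _ := by rw [div_eq_mul_inv X]; ring

theorem eq_mul_prime_of_coprime_primorial {n Z : ℕ} (hn1 : 1 < n) (hn : n.Coprime (primorial Z))
    (hnp : ¬ n.Prime) (hlt : n < (Z + 1) ^ 4) :
    (∃ p q, p.Prime ∧ q.Prime ∧ Z < p ∧ p ≤ q ∧ n = p * q) ∨
      ∃ p q r, p.Prime ∧ q.Prime ∧ r.Prime ∧ Z < p ∧ p ≤ q ∧ q ≤ r ∧ n = p * q * r := by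
  have hZ : ∀ p, p.Prime → p ∣ n → Z < p := fun p hp hd => by
    by_contra h
    exact Nat.not_coprime_of_dvd_of_dvd hp.one_lt hd (hp.dvd_primorial_iff.2 (not_lt.1 h)) hn
  have hp := Nat.minFac_prime (n := n) (by omega)
  obtain ⟨m, hm⟩ := Nat.minFac_dvd n
  have hpl : ∀ q, q.Prime → q ∣ n → n.minFac ≤ q := fun q hq hd =>
    Nat.minFac_le_of_dvd hq.two_le hd
  generalize n.minFac = p at hp hm hpl
  have hm1 : m ≠ 1 := by rintro rfl; rw [mul_one] at hm; exact hnp (hm ▸ hp)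
  by_cases hmp : m.Prime
  · exact Or.inl ⟨p, m, hp, hmp, hZ p hp ⟨m, hm⟩, hpl m hmp ⟨p, by rw [hm, mul_comm]⟩, hm⟩
  right
  have hq := Nat.minFac_prime hm1
  obtain ⟨r, hr⟩ := Nat.minFac_dvd m
  have hql : ∀ s, s.Prime → s ∣ m → m.minFac ≤ s := fun s hs hd =>
    Nat.minFac_le_of_dvd hs.two_le hd
  generalize m.minFac = q at hq hr hql
  have hr1 : r ≠ 1 := by rintro rfl; rw [mul_one] at hr; exact hmp (hr ▸ hq)
  have hqn : q ∣ n := ⟨p * r, by rw [hm, hr]; ring⟩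
  have hrn : r ∣ n := ⟨p * q, by rw [hm, hr]; ring⟩
  have hn0 : n ≠ 0 := by omega
  by_cases hrp : r.Prime
  · exact ⟨p, q, r, hp, hq, hrp, hZ p hp ⟨m, hm⟩, hpl q hq hqn,
      hql r hrp ⟨q, by rw [hr, mul_comm]⟩, by rw [hm, hr]; ring⟩
  exfalso
  have hs := Nat.minFac_prime hr1
  obtain ⟨t, ht⟩ := Nat.minFac_dvd r
  generalize r.minFac = s at hs ht
  have ht1 : t ≠ 1 := by rintro rfl; rw [mul_one] at ht; exact hrp (ht ▸ hs)
  have htn : t ∣ n := (Dvd.intro_left s ht.symm).trans hrn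
  have h1 : Z < p := hZ p hp ⟨m, hm⟩
  have h2 : Z < q := hZ q hq hqn
  have h3 : Z < s := hZ s hs ((Dvd.intro t ht.symm).trans hrn)
  have h4 : Z < t := by
    have ht0 : t ≠ 0 := by rintro rfl; rw [zero_dvd_iff] at htn; exact hn0 htn
    exact (hZ _ (Nat.minFac_prime ht1) ((Nat.minFac_dvd t).trans htn)).trans_le
      (Nat.minFac_le (Nat.pos_of_ne_zero ht0))
  have h5 : (Z + 1) * (Z + 1) * ((Z + 1) * (Z + 1)) ≤ p * q * (s * t) :=
    Nat.mul_le_mul (Nat.mul_le_mul h1 h2) (Nat.mul_le_mul h3 h4)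
  have h6 : n = p * q * (s * t) := by rw [hm, hr, ht]; ring
  have h7 : (Z + 1) ^ 4 = (Z + 1) * (Z + 1) * ((Z + 1) * (Z + 1)) := by ring
  omega

theorem signedWeight_mul_prime_eq_zero {E : Finset ℕ} (hE : ∀ e ∈ E, e.Prime) {p q : ℕ}
    (hp : p ∈ E) (hq : q.Prime) (hqE : q ∉ E) : signedWeight E (p * q) = 0 := by
  rw [mul_comm, signedWeight_mul_prime hE hq hqE]
  unfold signedWeight
  have h1 : E.filter (· ∣ p) = {p} := by
    ext e
    rw [Finset.mem_filter, Finset.mem_singleton]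
    exact ⟨fun h => (Nat.prime_dvd_prime_iff_eq (hE e h.1) (hE p hp)).1 h.2,
      by rintro rfl; exact ⟨hp, dvd_rfl⟩⟩
  rw [h1]; simp

theorem signedWeight_eq_one {E : Finset ℕ} {n : ℕ} (h : ∀ e ∈ E, ¬ e ∣ n) :
    signedWeight E n = 1 := by
  unfold signedWeight
  rw [Finset.filter_eq_empty_iff.2 fun e he => h e he]; simp

theorem pow_eleven_le_pow_twenty {u : ℝ} (hu : 5 ≤ u) : 1000 * u ^ 11 ≤ u ^ 20 := by
  have h1 : (5 : ℝ) ^ 9 ≤ u ^ 9 := pow_le_pow_left₀ (by norm_num) hu 9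
  calc 1000 * u ^ 11 ≤ u ^ 9 * u ^ 11 :=
        mul_le_mul_of_nonneg_right (by norm_num at h1; linarith) (by positivity)
    _ = u ^ 20 := by ring

/-- The set of products of two or three large primes has small cardinality. -/
theorem exists_finset_prod_primes {u : ℝ} (hu : 5 ≤ u) : ∃ T : Finset ℕ,
    (T.card : ℝ) ≤ 2000000 * (Real.exp (u ^ 20) / u ^ 29) ∧
    (∀ p q : ℕ, p.Prime → q.Prime → Real.exp (u ^ 20 / 2 - u ^ 11) < p → p ≤ q →
      ((p * q : ℕ) : ℝ) ≤ 2 * Real.exp (u ^ 20) → p * q ∈ T) ∧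
    (∀ p q r : ℕ, p.Prime → q.Prime → r.Prime → Real.exp (u ^ 20 / 3 - u ^ 11) < p → p ≤ q →
      q ≤ r → ((p * q * r : ℕ) : ℝ) ≤ 2 * Real.exp (u ^ 20) → p * q * r ∈ T) := by
  classical
  have hu0 : 0 < u := by linarith
  have hM : 1 ≤ u ^ 11 := one_le_pow₀ (by linarith)
  have hML := pow_eleven_le_pow_twenty hu
  have hpow29 : u ^ 29 = u ^ 20 * u ^ 9 := by ring
  have hratio : u ^ 11 / u ^ 20 = 1 / u ^ 9 := by
    rw [div_eq_div_iff (by positivity) (by positivity)]; ring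
  have hu9 : 0 < u ^ 9 := by positivity
  have hu91 : 1 ≤ u ^ 9 := one_le_pow₀ (by linarith)
  generalize u ^ 9 = K at hpow29 hratio hu9 hu91
  rw [hpow29]
  generalize u ^ 11 = M at *
  generalize u ^ 20 = L at *
  clear hpow29 hu hu0
  have hL : 0 < L := by linarith
  have hX : 2 * Real.exp L ≤ Real.exp (L + 1) := by
    rw [Real.exp_add]
    have := Real.exp_one_gt_d9
    have := Real.exp_pos L
    nlinarith
  set X := 2 * Real.exp L with hXdef
  have hXp : 0 < X := by positivity
  set b₁ := (L + 1) / 2 with hb₁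
  set b₂ := (2 * L / 3 + M + 1) / 2 with hb₂
  set P₁ := (Finset.Icc 1 ⌊Real.exp b₁⌋₊).filter
    (fun p : ℕ => p.Prime ∧ Real.exp (L / 2 - M) < p) with hP₁
  set P₂ := (Finset.Icc 1 ⌊Real.exp b₂⌋₊).filter
    (fun p : ℕ => p.Prime ∧ Real.exp (L / 3 - M) < p) with hP₂
  have hmem₁ : ∀ p, p ∈ P₁ ↔ p.Prime ∧ Real.exp (L / 2 - M) < p ∧ (p : ℝ) ≤ Real.exp b₁ := by
    intro p
    rw [hP₁, Finset.mem_filter, Finset.mem_Icc, Nat.le_floor_iff (Real.exp_pos _).le]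
    exact ⟨fun h => ⟨h.2.1, h.2.2, h.1.2⟩, fun h => ⟨⟨h.1.one_lt.le, h.2.2⟩, h.1, h.2.1⟩⟩
  have hmem₂ : ∀ p, p ∈ P₂ ↔ p.Prime ∧ Real.exp (L / 3 - M) < p ∧ (p : ℝ) ≤ Real.exp b₂ := by
    intro p
    rw [hP₂, Finset.mem_filter, Finset.mem_Icc, Nat.le_floor_iff (Real.exp_pos _).le]
    exact ⟨fun h => ⟨h.2.1, h.2.2, h.1.2⟩, fun h => ⟨⟨h.1.one_lt.le, h.2.2⟩, h.1, h.2.1⟩⟩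
  clear_value P₁ P₂
  have hs₁ : ∑ p ∈ P₁, (p : ℝ)⁻¹ ≤ 135 / K := by
    refine (sum_prime_inv_le (a := L / 2 - M) (b := b₁) (by linarith) (by linarith)
      fun p hp => (hmem₁ p).1 hp).trans ?_
    have h1 : (b₁ - (L / 2 - M) + 1) / (L / 2 - M) ≤ 3 * M / (L / 3) :=
      div_le_div₀ (by linarith) (by linarith) (by linarith) (by linarith)
    calc _ ≤ 15 * (3 * M / (L / 3)) := by linarith
      _ = 135 * (M / L) := by field_simp; norm_num
      _ = 135 / K := by rw [hratio]; ring
  have hs₂ : ∑ p ∈ P₂, (p : ℝ)⁻¹ ≤ 180 / K := by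
    refine (sum_prime_inv_le (a := L / 3 - M) (b := b₂) (by linarith) (by linarith)
      fun p hp => (hmem₂ p).1 hp).trans ?_
    have h1 : (b₂ - (L / 3 - M) + 1) / (L / 3 - M) ≤ 3 * M / (L / 4) :=
      div_le_div₀ (by linarith) (by linarith) (by linarith) (by linarith)
    calc _ ≤ 15 * (3 * M / (L / 4)) := by linarith
      _ = 180 * (M / L) := by field_simp; norm_num
      _ = 180 / K := by rw [hratio]; ring
  set T₁ := P₁.biUnion fun p => ((Finset.Icc 1 ⌊X / ((id p : ℕ) : ℝ)⌋₊).filter Nat.Prime).image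
    (id p * ·) with hT₁
  set T₂ := (P₂ ×ˢ P₂).biUnion fun p =>
    ((Finset.Icc 1 ⌊X / ((p.1 * p.2 : ℕ) : ℝ)⌋₊).filter Nat.Prime).image (p.1 * p.2 * ·) with hT₂
  have hc₁ : (T₁.card : ℝ) ≤ 5 * X / (L / 6) * (135 / K) := by
    refine (card_biUnion_image_prime_le P₁ id (X := X) (l := L / 6) (by positivity)
      fun p hp => ⟨((hmem₁ p).1 hp).1.pos, ?_⟩).trans
      (mul_le_mul_of_nonneg_left hs₁ (by positivity))
    calc (p : ℝ) * Real.exp (L / 6) ≤ Real.exp b₁ * Real.exp (L / 6) :=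
          mul_le_mul_of_nonneg_right ((hmem₁ p).1 hp).2.2 (Real.exp_pos _).le
      _ ≤ Real.exp L := by rw [← Real.exp_add]; exact Real.exp_le_exp.2 (by linarith)
      _ ≤ X := by have := Real.exp_pos L; linarith
  have hc₂ : (T₂.card : ℝ) ≤ 5 * X / (L / 6) * (180 / K * (180 / K)) := by
    refine (card_biUnion_image_prime_le (P₂ ×ˢ P₂) (fun p => p.1 * p.2) (X := X) (l := L / 6)
      (by positivity) fun p hp => ?_).trans
      (mul_le_mul_of_nonneg_left ?_ (by positivity))
    · obtain ⟨h1, h2⟩ := Finset.mem_product.1 hp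
      have h1 := (hmem₂ _).1 h1
      have h2 := (hmem₂ _).1 h2
      refine ⟨Nat.mul_pos h1.1.pos h2.1.pos, ?_⟩
      push_cast
      calc (p.1 : ℝ) * p.2 * Real.exp (L / 6) ≤
          Real.exp b₂ * Real.exp b₂ * Real.exp (L / 6) :=
            mul_le_mul_of_nonneg_right (mul_le_mul h1.2.2 h2.2.2 (Nat.cast_nonneg _)
              (Real.exp_pos _).le) (Real.exp_pos _).le
        _ ≤ Real.exp L := by
            rw [← Real.exp_add, ← Real.exp_add]; exact Real.exp_le_exp.2 (by linarith)
        _ ≤ X := by have := Real.exp_pos L; linarith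
    · have h1 : ∑ p ∈ P₂ ×ˢ P₂, (((p.1 * p.2 : ℕ) : ℝ))⁻¹ =
          (∑ p ∈ P₂, (p : ℝ)⁻¹) * ∑ p ∈ P₂, (p : ℝ)⁻¹ := by
        rw [Finset.sum_mul_sum, Finset.sum_product]
        refine Finset.sum_congr rfl fun p _ => Finset.sum_congr rfl fun q _ => ?_
        push_cast; rw [mul_inv]
      rw [h1]
      exact mul_le_mul hs₂ hs₂ (Finset.sum_nonneg fun _ _ => by positivity) (by positivity)
  refine ⟨T₁ ∪ T₂, ?_, fun p q hp hq hpY hpq hle => ?_, fun p q r hp hq hr hpZ hpq hqr hle => ?_⟩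
  · have h1 : ((T₁ ∪ T₂).card : ℝ) ≤ T₁.card + T₂.card := by
      exact_mod_cast Finset.card_union_le _ _
    have h2 : 180 / K * (180 / K) ≤ 180 / K * 180 :=
      mul_le_mul_of_nonneg_left (div_le_self (by norm_num) hu91) (by positivity)
    have h3 : 5 * X / (L / 6) * (180 / K * (180 / K)) ≤ 5 * X / (L / 6) * (180 / K * 180) :=
      mul_le_mul_of_nonneg_left h2 (by positivity)
    have h4 : 5 * X / (L / 6) * (135 / K) + 5 * X / (L / 6) * (180 / K * 180) =
        1952100 * (Real.exp L / (L * K)) := by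
      rw [hXdef]; field_simp; norm_num
    have h5 : 0 ≤ Real.exp L / (L * K) := by positivity
    linarith
  · refine Finset.mem_union_left _ (Finset.mem_biUnion.2 ⟨p, (hmem₁ p).2 ⟨hp, hpY, ?_⟩,
      Finset.mem_image.2 ⟨q, Finset.mem_filter.2 ⟨Finset.mem_Icc.2 ⟨hq.one_lt.le,
        Nat.le_floor ?_⟩, hq⟩, rfl⟩⟩)
    · refine (mul_self_le_mul_self_iff (Nat.cast_nonneg _) (Real.exp_pos _).le).2 ?_
      rw [← Real.exp_add]
      have h1 : (p : ℝ) * p ≤ ((p * q : ℕ) : ℝ) := by exact_mod_cast Nat.mul_le_mul_left p hpq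
      refine h1.trans (hle.trans (hX.trans (Real.exp_le_exp.2 (by linarith))))
    · have hp0 : (0 : ℝ) < p := by exact_mod_cast hp.pos
      rw [id, le_div_iff₀ hp0, mul_comm]
      exact_mod_cast hle
  · have hp0 : (0 : ℝ) < p := by exact_mod_cast hp.pos
    have hq0 : (0 : ℝ) < q := by exact_mod_cast hq.pos
    have hqb : (q : ℝ) ≤ Real.exp b₂ := by
      refine (mul_self_le_mul_self_iff (Nat.cast_nonneg _) (Real.exp_pos _).le).2 ?_
      refine le_of_mul_le_mul_left ?_ (Real.exp_pos (L / 3 - M))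
      rw [← Real.exp_add, ← Real.exp_add]
      have h1 : (p : ℝ) * (q * q) ≤ ((p * q * r : ℕ) : ℝ) := by
        rw [← mul_assoc]; exact_mod_cast Nat.mul_le_mul_left (p * q) hqr
      calc Real.exp (L / 3 - M) * ((q : ℝ) * q) ≤ p * (q * q) :=
            mul_le_mul_of_nonneg_right hpZ.le (by positivity)
        _ ≤ Real.exp (L + 1) := h1.trans (hle.trans hX)
        _ ≤ _ := Real.exp_le_exp.2 (by linarith)
    have hpq' : (p : ℝ) ≤ q := by exact_mod_cast hpq
    refine Finset.mem_union_right _ (Finset.mem_biUnion.2 ⟨(p, q), Finset.mem_product.2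
      ⟨(hmem₂ p).2 ⟨hp, hpZ, hpq'.trans hqb⟩, (hmem₂ q).2 ⟨hq, hpZ.trans_le hpq', hqb⟩⟩,
      Finset.mem_image.2 ⟨r, Finset.mem_filter.2 ⟨Finset.mem_Icc.2 ⟨hr.one_lt.le,
        Nat.le_floor ?_⟩, hr⟩, rfl⟩⟩)
    have h0 : (0 : ℝ) < ((p * q : ℕ) : ℝ) := by push_cast; positivity
    rw [le_div_iff₀ h0, mul_comm]
    exact_mod_cast hle

/-- Equidistribution of the roots of `ν ^ 2 + 1` to prime moduli, with a power of logarithm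
saving. -/
theorem exists_norm_sum_prime_rootSum_le : ∃ C > 0, ∀ u : ℝ, 5 ≤ u → ∀ Ψ : ℝ → ℂ,
    IsScaleWeight u Ψ → ∀ k : ℤ, k ≠ 0 → (k.natAbs : ℝ) ≤ u ^ 40 →
    ‖∑ p ∈ (Finset.Icc 1 ⌊8 * Real.exp (u ^ 20)⌋₊).filter Nat.Prime, Ψ p * rootSum k p‖ ≤
      C * (Real.exp (u ^ 20) / u ^ 29) := by
  classical
  obtain ⟨C, hC, hrough⟩ := exists_norm_sum_coprime_primorial_le
  refine ⟨C + 64 * 2000000, by positivity, fun u hu Ψ hΨ k hk hku => ?_⟩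
  obtain ⟨T, hTcard, hT₁, hT₂⟩ := exists_finset_prod_primes hu
  have hu0 : 0 < u := by linarith
  have hML := pow_eleven_le_pow_twenty hu
  have hM : 1 ≤ u ^ 11 := one_le_pow₀ (by linarith)
  set Y := Real.exp (u ^ 20 / 2 - u ^ 11) with hY
  set z := Real.exp (u ^ 20 / 3 - u ^ 11) with hz
  set N := ⌊8 * Real.exp (u ^ 20)⌋₊ with hN
  set E := (Finset.Icc 1 ⌊Y⌋₊).filter (fun p => p.Prime ∧ ⌊z⌋₊ < p) with hEdef
  have hE : ∀ e, e ∈ E ↔ e.Prime ∧ ⌊z⌋₊ < e ∧ (e : ℝ) ≤ Y := by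
    intro p
    rw [hEdef, Finset.mem_filter, Finset.mem_Icc, Nat.le_floor_iff (Real.exp_pos _).le]
    exact ⟨fun h => ⟨h.2.1, h.2.2, h.1.2⟩, fun h => ⟨⟨h.1.one_lt.le, h.2.2⟩, h.1, h.2.1⟩⟩
  clear_value E
  have hEp : ∀ e ∈ E, e.Prime := fun e he => ((hE e).1 he).1
  have hYY : Y * Y < Real.exp (u ^ 20) / u ^ 20 := by
    rw [lt_div_iff₀ (by positivity), hY, ← Real.exp_add]
    have h1 : u ^ 20 < Real.exp (u ^ 11) :=
      (pow_le_pow_right₀ (by linarith) (by norm_num : 20 ≤ 40)).trans_lt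
        ((pow_forty_lt_exp hu).trans_le (Real.exp_le_exp.2
          (pow_le_pow_right₀ (by linarith) (by norm_num))))
    calc _ < Real.exp (u ^ 20 / 2 - u ^ 11 + (u ^ 20 / 2 - u ^ 11)) * Real.exp (u ^ 11) :=
          mul_lt_mul_of_pos_left h1 (Real.exp_pos _)
      _ ≤ Real.exp (u ^ 20) := by
          rw [← Real.exp_add]; exact Real.exp_le_exp.2 (by linarith)
  have hY1 : 1 ≤ Y := Real.one_le_exp (by linarith)
  have hzY : z ≤ Y := Real.exp_le_exp.2 (by
    have : 0 ≤ u ^ 20 := by positivity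
    linarith)
  have hz4 : 2 * Real.exp (u ^ 20) < z ^ 4 := by
    rw [hz, ← Real.exp_nat_mul]
    have h1 : 2 * Real.exp (u ^ 20) < Real.exp 1 * Real.exp (u ^ 20) :=
      mul_lt_mul_of_pos_right (by have := Real.exp_one_gt_d9; linarith) (Real.exp_pos _)
    refine h1.trans_le ?_
    rw [← Real.exp_add]
    refine Real.exp_le_exp.2 ?_
    push_cast; linarith
  set g : ℕ → ℂ := fun n =>
    (if n.Coprime (primorial ⌊z⌋₊) then signedWeight E n * (Ψ n * rootSum k n) else 0) -
      if n.Prime then Ψ n * rootSum k n else 0 with hg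
  have hgT : ∀ n, n ≠ 0 → ‖g n‖ ≤ if n ∈ T then 64 else 0 := fun n hn0 => by
    have hgn : g n = (if n.Coprime (primorial ⌊z⌋₊) then
      signedWeight E n * (Ψ n * rootSum k n) else 0) -
      if n.Prime then Ψ n * rootSum k n else 0 := rfl
    rw [hgn]
    clear_value g
    by_cases hΨn : Ψ n = 0
    · rw [hΨn]; simp only [zero_mul, mul_zero, ite_self, sub_zero, norm_zero]
      split_ifs <;> norm_num
    obtain ⟨hs1, hs2⟩ := hΨ.support _ hΨn
    have hnY : Y * Y < n := hYY.trans_le hs1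
    by_cases hnp : n.Prime
    · have hYn : Y < n := (le_mul_of_one_le_left (by linarith) hY1).trans_lt hnY
      have h1 : n.Coprime (primorial ⌊z⌋₊) := by
        rw [hnp.coprime_iff_not_dvd, hnp.dvd_primorial_iff, Nat.le_floor_iff (Real.exp_pos _).le]
        intro h
        linarith
      have h2 : signedWeight E n = 1 := signedWeight_eq_one fun e he hd => by
        have h3 := (hE e).1 he
        rw [Nat.prime_dvd_prime_iff_eq h3.1 hnp] at hd
        rw [hd] at h3
        linarith [h3.2.2]
      rw [if_pos h1, if_pos hnp, h2, Int.cast_one, one_mul, sub_self, norm_zero]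
      split_ifs <;> norm_num
    rw [if_neg hnp, sub_zero]
    by_cases hc : n.Coprime (primorial ⌊z⌋₊)
    swap
    · rw [if_neg hc, norm_zero]; split_ifs <;> norm_num
    rw [if_pos hc]
    have hn1 : 1 < n := by
      have : (1 : ℝ) < n := by
        have : 1 ≤ Y * Y := one_le_mul_of_one_le_of_one_le hY1 hY1
        linarith
      exact_mod_cast this
    have hlt : n < (⌊z⌋₊ + 1) ^ 4 := by
      have h1 : (n : ℝ) < ((⌊z⌋₊ : ℝ) + 1) ^ 4 :=
        (hs2.trans_lt hz4).trans_le (pow_le_pow_left₀ (Real.exp_pos _).le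
          (Nat.lt_floor_add_one z).le 4)
      exact_mod_cast h1
    have hbound : ∀ t : ℕ, n.divisors.card ≤ t → t ≤ 8 →
        ‖(signedWeight E n : ℂ) * (Ψ n * rootSum k n)‖ ≤ 64 := fun t ht ht8 => by
      have h1 : |(signedWeight E n : ℝ)| ≤ n.divisors.card := by
        exact_mod_cast abs_signedWeight_le (fun h => Nat.not_prime_one (hEp 1 h)) hn0
      have h2 : (n.divisors.card : ℝ) ≤ 8 := by exact_mod_cast ht.trans ht8
      have h3 := norm_scaleWeight_mul_rootSum_le hΨ k n
      rw [norm_mul, Complex.norm_intCast]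
      calc _ ≤ (8 : ℝ) * 8 := mul_le_mul (h1.trans h2) (h3.trans h2) (norm_nonneg _) (by norm_num)
        _ = 64 := by norm_num
    have hτ : ∀ p : ℕ, p.Prime → p.divisors.card = 2 := fun p hp => by
      rw [hp.divisors, Finset.card_pair hp.one_lt.ne]
    rcases eq_mul_prime_of_coprime_primorial hn1 hc hnp hlt with
      ⟨p, q, hp, hq, hpz, hpq, rfl⟩ | ⟨p, q, r, hp, hq, hr, hpz, hpq, hqr, rfl⟩
    · by_cases hpY : (p : ℝ) ≤ Y
      · have hqE : q ∉ E := fun hqE => by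
          have h1 := ((hE q).1 hqE).2.2
          have h2 : (p : ℝ) * q ≤ Y * Y := mul_le_mul hpY h1 (Nat.cast_nonneg _) (by linarith)
          push_cast at hnY
          linarith
        rw [signedWeight_mul_prime_eq_zero hEp ((hE p).2 ⟨hp, hpz, hpY⟩) hq hqE, Int.cast_zero,
          zero_mul, norm_zero]
        split_ifs <;> norm_num
      · rw [if_pos (hT₁ p q hp hq (not_le.1 hpY) hpq hs2)]
        refine hbound 4 ((card_divisors_mul_le p q).trans ?_) (by norm_num)
        rw [hτ p hp, hτ q hq]
    · have hpz' : z < p := (Nat.floor_lt (Real.exp_pos _).le).1 hpz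
      rw [if_pos (hT₂ p q r hp hq hr hpz' hpq hqr hs2)]
      refine hbound 8 ((card_divisors_mul_le (p * q) r).trans ?_) (by norm_num)
      rw [hτ r hr]
      have := card_divisors_mul_le p q
      rw [hτ p hp, hτ q hq] at this
      omega
  have h1 := hrough u hu Ψ hΨ k hk hku E fun e he => (hE e).1 he
  have h2 : ‖∑ n ∈ Finset.Icc 1 N, g n‖ ≤ 64 * (T.card : ℝ) := by
    refine (norm_sum_le_of_le _ fun n hn => hgT n
      (by have := (Finset.mem_Icc.1 hn).1; omega)).trans ?_
    rw [← Finset.sum_filter, Finset.sum_const, nsmul_eq_mul, mul_comm]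
    refine mul_le_mul_of_nonneg_left ?_ (by norm_num)
    exact_mod_cast Finset.card_le_card fun n hn => (Finset.mem_filter.1 hn).2
  rw [hg, Finset.sum_sub_distrib, ← Finset.sum_filter, ← Finset.sum_filter] at h2
  have h3 := norm_le_norm_add_norm_sub
    (∑ n ∈ (Finset.Icc 1 N).filter (fun n => n.Coprime (primorial ⌊z⌋₊)),
      (signedWeight E n : ℂ) * (Ψ n * rootSum k n))
    (∑ p ∈ (Finset.Icc 1 N).filter Nat.Prime, Ψ p * rootSum k p)
  calc _ ≤ _ := h3
    _ ≤ _ := add_le_add h1 h2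
    _ ≤ _ := by linarith

theorem fract_sq_sub_fract_le (y : ℝ) : Int.fract y ^ 2 - Int.fract y ≤ y ^ 2 - y := by
  have h0 := Int.fract_nonneg y
  have h1 := (Int.fract_lt_one y).le
  have h2 : y = ⌊y⌋ + Int.fract y := (Int.floor_add_fract y).symm
  set f := Int.fract y with hf
  set k := ⌊y⌋ with hk
  clear_value f k
  subst h2
  suffices h : 0 ≤ (k : ℝ) * (k - 1 + 2 * f) by nlinarith
  rcases lt_trichotomy k 0 with h | h | h
  · have : (k : ℝ) ≤ -1 := by exact_mod_cast Int.le_sub_one_of_lt h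
    exact mul_nonneg_of_nonpos_of_nonpos (by linarith) (by linarith)
  · rw [h]; simp
  · have : (1 : ℝ) ≤ k := by exact_mod_cast h
    exact mul_nonneg (by linarith) (by linarith)

theorem fract_sq_sub_fract_add_le (t d : ℝ) :
    (Int.fract (t + d) ^ 2 - Int.fract (t + d)) / 2 - (Int.fract t ^ 2 - Int.fract t) / 2 ≤
      d * (Int.fract t - 1 / 2) + d ^ 2 / 2 := by
  have h1 := fract_sq_sub_fract_le (Int.fract t + d)
  have h2 : Int.fract (Int.fract t + d) = Int.fract (t + d) := by
    rw [Int.fract_eq_fract]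
    exact ⟨-⌊t⌋, by rw [Int.fract]; push_cast; ring⟩
  rw [h2] at h1
  linarith

theorem abs_fract_sq_sub_sum_cos_le (t : ℝ) {H : ℕ} (hH : H ≠ 0) :
    |(Int.fract t ^ 2 - Int.fract t) / 2 + 1 / 12 -
      ∑ h ∈ Finset.Icc 1 H, 1 / (2 * Real.pi ^ 2 * h ^ 2) * Real.cos (2 * Real.pi * (h * t))| ≤
      1 / (2 * Real.pi ^ 2) * (H : ℝ)⁻¹ := by
  have hsum := hasSum_one_div_nat_pow_mul_cos (k := 1) one_ne_zero (x := Int.fract t)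
    ⟨Int.fract_nonneg t, (Int.fract_lt_one t).le⟩
  have hB : ((Polynomial.bernoulli (2 * 1)).map (algebraMap ℚ ℝ)).eval (Int.fract t) =
      Int.fract t ^ 2 - Int.fract t + 1 / 6 := by
    simp only [mul_one, Polynomial.bernoulli, Finset.sum_range_succ, Finset.sum_range_zero,
      Polynomial.map_add, Polynomial.map_monomial, Polynomial.eval_add, Polynomial.eval_monomial,
      bernoulli_zero, bernoulli_one, bernoulli_two, Nat.choose]
    norm_num
    ring
  rw [hB] at hsum
  have hcos : ∀ h : ℕ, Real.cos (2 * Real.pi * h * Int.fract t) =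
      Real.cos (2 * Real.pi * (h * t)) := fun h => by
    rw [Int.fract, show 2 * Real.pi * h * (t - ⌊t⌋) =
      2 * Real.pi * (h * t) - ((h * ⌊t⌋ : ℤ) : ℝ) * (2 * Real.pi) by push_cast; ring,
      Real.cos_sub_int_mul_two_pi]
  have hπ := Real.pi_pos
  have hlim := (hsum.tendsto_sum_nat.comp (Filter.tendsto_add_atTop_nat 1)).const_mul
    (1 / (2 * Real.pi ^ 2))
  have hval : 1 / (2 * Real.pi ^ 2) * ((-1) ^ (1 + 1) * (2 * Real.pi) ^ (2 * 1) / 2 /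
      (Nat.factorial (2 * 1) : ℝ) * (Int.fract t ^ 2 - Int.fract t + 1 / 6)) =
      (Int.fract t ^ 2 - Int.fract t) / 2 + 1 / 12 := by
    rw [show Nat.factorial (2 * 1) = 2 from rfl]
    push_cast
    field_simp
    ring
  rw [hval] at hlim
  refine le_of_tendsto (hlim.sub_const _).abs ?_
  filter_upwards [Filter.eventually_ge_atTop H] with M hM
  have h1 : 1 / (2 * Real.pi ^ 2) * ∑ i ∈ Finset.range (M + 1),
      1 / (i : ℝ) ^ (2 * 1) * Real.cos (2 * Real.pi * i * Int.fract t) =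
      ∑ h ∈ Finset.Icc 1 M, 1 / (2 * Real.pi ^ 2 * h ^ 2) *
        Real.cos (2 * Real.pi * (h * t)) := by
    rw [Finset.range_eq_Ico, Finset.sum_eq_sum_Ico_succ_bot (by omega), Nat.cast_zero,
      zero_pow (by norm_num), div_zero, zero_mul, zero_add, zero_add, Finset.mul_sum]
    refine Finset.sum_congr rfl fun h _ => ?_
    rw [hcos, ← mul_assoc]
    congr 1
    rw [div_mul_div_comm, one_mul]
  simp only [Function.comp_apply]
  rw [h1, ← Finset.sum_sdiff (Finset.Icc_subset_Icc_right hM), add_sub_cancel_right]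
  refine (Finset.abs_sum_le_sum_abs _ _).trans ?_
  have h2 : Finset.Icc 1 M \ Finset.Icc 1 H = Finset.Ioc H M := by
    ext i; simp only [Finset.mem_sdiff, Finset.mem_Icc, Finset.mem_Ioc]; omega
  rw [h2]
  have h3 := sum_Ioc_inv_sq_le_sub (α := ℝ) hH hM
  have h4 : (0 : ℝ) ≤ (M : ℝ)⁻¹ := by positivity
  calc _ ≤ ∑ i ∈ Finset.Ioc H M, 1 / (2 * Real.pi ^ 2) * ((i : ℝ) ^ 2)⁻¹ := by
        refine Finset.sum_le_sum fun i _ => ?_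
        rw [abs_mul, abs_of_nonneg (by positivity)]
        refine (mul_le_of_le_one_right (by positivity) (Real.abs_cos_le_one _)).trans (le_of_eq ?_)
        rw [← one_div, div_mul_div_comm, one_mul]
    _ = 1 / (2 * Real.pi ^ 2) * ∑ i ∈ Finset.Ioc H M, ((i : ℝ) ^ 2)⁻¹ := by rw [Finset.mul_sum]
    _ ≤ _ := mul_le_mul_of_nonneg_left (by linarith) (by positivity)

/-- An Erdős–Turán type inequality: exponential sums control averages of the sawtooth function. -/
theorem abs_sum_mul_fract_sub_half_le {ι : Type*} (S : Finset ι) {w : ι → ℝ} (t : ι → ℝ)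
    (hw : ∀ i ∈ S, 0 ≤ w i) {H : ℕ} (hH : H ≠ 0) {η B : ℝ} (hη : 0 < η)
    (hB : ∀ h ∈ Finset.Icc 1 H, ‖∑ i ∈ S, w i * expTwoPi (h * t i)‖ ≤ B) :
    |∑ i ∈ S, w i * (Int.fract (t i) - 1 / 2)| ≤
      (1 + Real.log H) * B + (1 / (H * η) + η) * ∑ i ∈ S, w i := by
  have hπ := Real.pi_gt_three
  have hB0 : 0 ≤ B := (norm_nonneg _).trans
    (hB 1 (Finset.mem_Icc.2 ⟨le_rfl, Nat.one_le_iff_ne_zero.2 hH⟩))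
  have hW : 0 ≤ ∑ i ∈ S, w i := Finset.sum_nonneg hw
  set K : ℝ → ℝ := fun y => ∑ h ∈ Finset.Icc 1 H,
    1 / (2 * Real.pi ^ 2 * h ^ 2) * Real.cos (2 * Real.pi * (h * y)) with hK
  have hre : ∀ y : ℝ, (expTwoPi y).re = Real.cos (2 * Real.pi * y) := fun y => by
    rw [expTwoPi, Complex.exp_re]
    simp
  have hHp : (0 : ℝ) < H := by exact_mod_cast Nat.pos_of_ne_zero hH
  have hpt : ∀ y d : ℝ, K (y + d) - K y - ((H : ℝ)⁻¹ + d ^ 2) ≤ d * (Int.fract y - 1 / 2) :=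
    fun y d => by
    have h1 := fract_sq_sub_fract_add_le y d
    have h2 := abs_le.1 (abs_fract_sq_sub_sum_cos_le (y + d) hH)
    have h3 := abs_le.1 (abs_fract_sq_sub_sum_cos_le y hH)
    have h4 : 1 / (2 * Real.pi ^ 2) * (H : ℝ)⁻¹ ≤ 1 / 2 * (H : ℝ)⁻¹ := by
      refine mul_le_mul_of_nonneg_right ?_ (by positivity)
      exact div_le_div_of_nonneg_left (by norm_num) (by norm_num) (by nlinarith)
    have h5 : 0 ≤ d ^ 2 := sq_nonneg d
    rw [hK]
    simp only
    linarith [h2.1, h3.2]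
  have hdiff : ∀ d : ℝ, |∑ i ∈ S, w i * (K (t i + d) - K (t i))| ≤
      |d| * ((1 + Real.log H) * B) := fun d => by
    have h1 : ∑ i ∈ S, w i * (K (t i + d) - K (t i)) = (∑ h ∈ Finset.Icc 1 H,
        ((1 / (2 * Real.pi ^ 2 * h ^ 2) : ℝ) : ℂ) * ((expTwoPi (h * d) - 1) *
          ∑ i ∈ S, w i * expTwoPi (h * t i))).re := by
      rw [Complex.re_sum, hK]
      simp only [← Finset.sum_sub_distrib, Finset.mul_sum]
      rw [Finset.sum_comm]
      refine Finset.sum_congr rfl fun h _ => ?_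
      rw [Complex.re_sum]
      refine Finset.sum_congr rfl fun i _ => ?_
      have h2 : ((1 / (2 * Real.pi ^ 2 * h ^ 2) : ℝ) : ℂ) * ((expTwoPi (h * d) - 1) *
          (w i * expTwoPi (h * t i))) = ((1 / (2 * Real.pi ^ 2 * h ^ 2) * w i : ℝ) : ℂ) *
          (expTwoPi (h * (t i + d)) - expTwoPi (h * t i)) := by
        rw [mul_add, expTwoPi_add]; push_cast; ring
      rw [h2, Complex.re_ofReal_mul, Complex.sub_re, hre, hre]
      ring
    rw [h1]
    refine (Complex.abs_re_le_norm _).trans ?_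
    have h2 := sum_Icc_inv_le H
    calc _ ≤ ∑ h ∈ Finset.Icc 1 H, |d| * B * (h : ℝ)⁻¹ := by
          refine norm_sum_le_of_le _ fun h hh => ?_
          have hh0 : (0 : ℝ) < h := by
            have := (Finset.mem_Icc.1 hh).1
            exact_mod_cast this
          have h3 : ‖expTwoPi (h * d) - 1‖ ≤ 2 * Real.pi * (h * |d|) := by
            have := norm_expTwoPi_sub_le (h * d) 0
            rwa [expTwoPi_zero, sub_zero, abs_mul, abs_of_pos hh0] at this
          rw [norm_mul, norm_mul, Complex.norm_real, Real.norm_of_nonneg (by positivity)]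
          calc _ ≤ 1 / (2 * Real.pi ^ 2 * (h : ℝ) ^ 2) * (2 * Real.pi * (h * |d|) * B) :=
                mul_le_mul_of_nonneg_left (mul_le_mul h3 (hB h hh) (norm_nonneg _)
                  (by positivity)) (by positivity)
            _ = 1 / Real.pi * (|d| * B * (h : ℝ)⁻¹) := by field_simp
            _ ≤ _ := mul_le_of_le_one_left (by positivity)
                ((div_le_one (by linarith)).2 (by linarith))
      _ = |d| * B * ∑ h ∈ Finset.Icc 1 H, (h : ℝ)⁻¹ := by rw [Finset.mul_sum]
      _ ≤ |d| * B * (1 + Real.log H) := mul_le_mul_of_nonneg_left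
          (by simpa only [one_div] using h2) (by positivity)
      _ = _ := by ring
  have hone : ∀ d : ℝ, |d| = η → -(η * ((1 + Real.log H) * B)) - ((H : ℝ)⁻¹ + η ^ 2) *
      ∑ i ∈ S, w i ≤ d * ∑ i ∈ S, w i * (Int.fract (t i) - 1 / 2) := fun d hd => by
    have h1 := (abs_le.1 (hdiff d)).1
    rw [hd] at h1
    have hd2 : d ^ 2 = η ^ 2 := by rw [← sq_abs, hd]
    have h2 : ∑ i ∈ S, w i * (K (t i + d) - K (t i)) - ((H : ℝ)⁻¹ + η ^ 2) * ∑ i ∈ S, w i ≤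
        d * ∑ i ∈ S, w i * (Int.fract (t i) - 1 / 2) := by
      rw [Finset.mul_sum, Finset.mul_sum, ← Finset.sum_sub_distrib]
      refine Finset.sum_le_sum fun i hi => ?_
      have h3 := mul_le_mul_of_nonneg_left (hpt (t i) d) (hw i hi)
      rw [hd2] at h3
      linarith
    linarith
  have h1 := hone η (abs_of_pos hη)
  have h2 := hone (-η) (by rw [abs_neg, abs_of_pos hη])
  have h3 : η * ((1 + Real.log H) * B + (1 / (H * η) + η) * ∑ i ∈ S, w i) =
      η * ((1 + Real.log H) * B) + ((H : ℝ)⁻¹ + η ^ 2) * ∑ i ∈ S, w i := by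
    field_simp
  refine abs_le.2 ⟨le_of_mul_le_mul_left ?_ hη, le_of_mul_le_mul_left ?_ hη⟩
  · rw [mul_neg, h3]; linarith
  · rw [h3]; linarith

/-- The trapezoid vanishing outside `[a, b]` and equal to `1` on `[a + l, b - l]`. -/
noncomputable def trapezoid (a b l t : ℝ) : ℝ := max 0 (min 1 (min ((t - a) / l) ((b - t) / l)))

theorem trapezoid_nonneg (a b l t : ℝ) : 0 ≤ trapezoid a b l t := le_max_left _ _

theorem trapezoid_le_one (a b l t : ℝ) : trapezoid a b l t ≤ 1 :=
  max_le zero_le_one (min_le_left _ _)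

theorem mem_Icc_of_trapezoid_ne_zero {a b l t : ℝ} (hl : 0 < l) (h : trapezoid a b l t ≠ 0) :
    a ≤ t ∧ t ≤ b := by
  constructor
  · by_contra! h1
    refine h (max_eq_left ((min_le_right _ _).trans ((min_le_left _ _).trans ?_)))
    exact div_nonpos_of_nonpos_of_nonneg (by linarith) hl.le
  · by_contra! h1
    refine h (max_eq_left ((min_le_right _ _).trans ((min_le_right _ _).trans ?_)))
    exact div_nonpos_of_nonpos_of_nonneg (by linarith) hl.le

theorem trapezoid_eq_one {a b l t : ℝ} (hl : 0 < l) (h1 : a + l ≤ t) (h2 : t ≤ b - l) :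
    trapezoid a b l t = 1 := by
  unfold trapezoid
  rw [min_eq_left (le_min ((one_le_div hl).2 (by linarith)) ((one_le_div hl).2 (by linarith))),
    max_eq_right zero_le_one]

theorem abs_trapezoid_sub_le {a b l : ℝ} (hl : 0 < l) (s t : ℝ) :
    |trapezoid a b l s - trapezoid a b l t| ≤ |s - t| / l := by
  unfold trapezoid
  refine (abs_max_sub_max_le_max _ _ _ _).trans (max_le (by simp; positivity) ?_)
  refine (abs_min_sub_min_le_max _ _ _ _).trans (max_le (by simp; positivity) ?_)
  refine (abs_min_sub_min_le_max _ _ _ _).trans (max_le ?_ ?_)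
  · rw [← sub_div, abs_div, abs_of_pos hl, show s - a - (t - a) = s - t by ring]
  · rw [← sub_div, abs_div, abs_of_pos hl, show b - s - (b - t) = t - s by ring, abs_sub_comm]

theorem norm_mul_mul_sub_le {x x' y y' : ℝ} {z z' : ℂ} (hx' : |x'| ≤ 1)
    (hy : |y| ≤ 1) (hy' : |y'| ≤ 1) (hz : ‖z‖ ≤ 1) :
    ‖(x : ℂ) * y * z - x' * y' * z'‖ ≤ |x - x'| + |y - y'| + ‖z - z'‖ := by
  have h : (x : ℂ) * y * z - x' * y' * z' = ((x - x' : ℝ) : ℂ) * y * z +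
      x' * ((y - y' : ℝ) : ℂ) * z + x' * y' * (z - z') := by push_cast; ring
  rw [h]
  refine norm_add₃_le.trans ?_
  simp only [norm_mul, Complex.norm_real, Real.norm_eq_abs]
  have h1 : |x - x'| * |y| * ‖z‖ ≤ |x - x'| := by
    rw [mul_assoc]
    exact mul_le_of_le_one_right (abs_nonneg _) (mul_le_one₀ hy (norm_nonneg _) hz)
  have h2 : |x'| * |y - y'| * ‖z‖ ≤ |y - y'| :=
    (mul_le_of_le_one_right (by positivity) hz).trans (mul_le_of_le_one_left (abs_nonneg _) hx')
  have h3 : |x'| * |y'| * ‖z - z'‖ ≤ ‖z - z'‖ :=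
    mul_le_of_le_one_left (norm_nonneg _) (mul_le_one₀ hx' (abs_nonneg _) hy')
  linarith

theorem abs_log_sub_log_le {a x y : ℝ} (ha : 0 < a) (hx : a ≤ x) (hy : a ≤ y) :
    |Real.log x - Real.log y| ≤ |x - y| / a := by
  have key : ∀ x y : ℝ, a ≤ x → a ≤ y → Real.log x - Real.log y ≤ |x - y| / a := by
    intro x y hx hy
    have hx0 : 0 < x := ha.trans_le hx
    have hy0 : 0 < y := ha.trans_le hy
    rw [← Real.log_div hx0.ne' hy0.ne']
    calc Real.log (x / y) ≤ x / y - 1 := Real.log_le_sub_one_of_pos (by positivity)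
      _ = (x - y) / y := by rw [sub_div, div_self hy0.ne']
      _ ≤ |x - y| / y := div_le_div_of_nonneg_right (le_abs_self _) hy0.le
      _ ≤ |x - y| / a := div_le_div_of_nonneg_left (abs_nonneg _) ha hy
  refine abs_le.2 ⟨?_, key x y hx hy⟩
  have := key y x hy hx
  rw [abs_sub_comm] at this
  linarith

theorem abs_inv_sub_inv_le {a x y : ℝ} (ha : 0 < a) (hx : a ≤ x) (hy : a ≤ y) :
    |x⁻¹ - y⁻¹| ≤ |x - y| / (a * a) := by
  have hx0 : 0 < x := ha.trans_le hx
  have hy0 : 0 < y := ha.trans_le hy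
  rw [inv_sub_inv hx0.ne' hy0.ne', abs_div, abs_sub_comm, abs_of_pos (mul_pos hx0 hy0)]
  exact div_le_div_of_nonneg_left (abs_nonneg _) (by positivity) (mul_le_mul hx hy ha.le hx0.le)

/-- The smooth weight with phase `h m / t` on `[n / u ^ 10, 2 n]`, where `n = exp (u ^ 20)`. -/
noncomputable def phaseWeight (u c t : ℝ) : ℂ :=
  (trapezoid (Real.exp (u ^ 20) / u ^ 10) (2 * Real.exp (u ^ 20)) (Real.exp (u ^ 20) / u ^ 40) t :
    ℂ) * (Real.log (max (Real.exp (u ^ 20) / u ^ 10) (min t (2 * Real.exp (u ^ 20)))) /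
      (2 * u ^ 20) : ℝ) *
    expTwoPi (c * (max (Real.exp (u ^ 20) / u ^ 10) (min t (2 * Real.exp (u ^ 20))))⁻¹)

theorem isScaleWeight_phaseWeight {u c : ℝ} (hu : 5 ≤ u) (hc : |c| ≤ u ^ 20 * Real.exp (u ^ 20)) :
    IsScaleWeight u (phaseWeight u c) := by
  have hu0 : 0 < u := by linarith
  have hu1 : 1 ≤ u := by linarith
  have hone : ∀ k : ℕ, 1 ≤ u ^ k := fun k => one_le_pow₀ hu1
  set x := Real.exp (u ^ 20) with hx
  have hxp : 0 < x := Real.exp_pos _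
  set a := x / u ^ 10 with ha
  have hap : 0 < a := by positivity
  have ha1 : 1 ≤ a := by
    rw [ha, one_le_div (by positivity), hx]
    exact (pow_le_pow_right₀ hu1 (by norm_num)).trans
      ((by linarith : u ^ 20 ≤ u ^ 20 + 1).trans (Real.add_one_le_exp _))
  have hab : a ≤ 2 * x := by
    have : a ≤ x := div_le_self hxp.le (hone 10)
    linarith
  set τ : ℝ → ℝ := fun t => max a (min t (2 * x)) with hτ
  have hτa : ∀ t, a ≤ τ t := fun t => le_max_left _ _
  have hτb : ∀ t, τ t ≤ 2 * x := fun t => max_le hab (min_le_right _ _)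
  have hτL : ∀ s t, |τ s - τ t| ≤ |s - t| := fun s t => by
    refine (abs_max_sub_max_le_max _ _ _ _).trans (max_le (by simp) ?_)
    exact (abs_min_sub_min_le_max _ _ _ _).trans (max_le le_rfl (by simp))
  have hΨ : ∀ t, phaseWeight u c t = (trapezoid a (2 * x) (x / u ^ 40) t : ℂ) *
      ((Real.log (τ t) / (2 * u ^ 20) : ℝ) : ℂ) * expTwoPi (c * (τ t)⁻¹) := fun t => rfl
  have hlog : ∀ t, |Real.log (τ t) / (2 * u ^ 20)| ≤ 1 := fun t => by
    have h0 : 0 ≤ Real.log (τ t) := Real.log_nonneg (ha1.trans (hτa t))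
    rw [abs_of_nonneg (by positivity), div_le_one (by positivity)]
    have h1 := Real.log_le_log (hap.trans_le (hτa t)) (hτb t)
    have h2 := log_mul_exp_pow_le (u := u) (by linarith) (c := 2) (by norm_num) (by norm_num)
    linarith
  have htr : ∀ t, |trapezoid a (2 * x) (x / u ^ 40) t| ≤ 1 := fun t => by
    rw [abs_of_nonneg (trapezoid_nonneg _ _ _ _)]; exact trapezoid_le_one _ _ _ _
  refine ⟨fun t => ?_, fun s t => ?_, fun t ht => ?_⟩
  · rw [hΨ, norm_mul, norm_mul, Complex.norm_real, Complex.norm_real, norm_expTwoPi, mul_one]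
    exact mul_le_one₀ (htr t) (norm_nonneg _) (hlog t)
  · rw [hΨ, hΨ]
    refine (norm_mul_mul_sub_le (htr t) (hlog s) (hlog t) (norm_expTwoPi _).le).trans ?_
    have h1 : |trapezoid a (2 * x) (x / u ^ 40) s - trapezoid a (2 * x) (x / u ^ 40) t| ≤
        u ^ 40 / x * |s - t| := by
      refine (abs_trapezoid_sub_le (by positivity) s t).trans (le_of_eq ?_)
      field_simp
    have h2 : |Real.log (τ s) / (2 * u ^ 20) - Real.log (τ t) / (2 * u ^ 20)| ≤
        u ^ 40 / x * |s - t| := by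
      rw [← sub_div, abs_div, abs_of_pos (show 0 < 2 * u ^ 20 by positivity)]
      calc _ ≤ |Real.log (τ s) - Real.log (τ t)| :=
            div_le_self (abs_nonneg _) (by have := hone 20; linarith)
        _ ≤ |τ s - τ t| / a := abs_log_sub_log_le hap (hτa s) (hτa t)
        _ ≤ |s - t| / a := div_le_div_of_nonneg_right (hτL s t) hap.le
        _ = u ^ 10 / x * |s - t| := by rw [ha]; field_simp
        _ ≤ _ := mul_le_mul_of_nonneg_right (div_le_div_of_nonneg_right
            (pow_le_pow_right₀ hu1 (by norm_num)) hxp.le) (abs_nonneg _)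
    have h3 : ‖expTwoPi (c * (τ s)⁻¹) - expTwoPi (c * (τ t)⁻¹)‖ ≤ 8 * (u ^ 40 / x * |s - t|) := by
      have hπ := Real.pi_lt_d2
      calc _ ≤ 2 * Real.pi * |c * (τ s)⁻¹ - c * (τ t)⁻¹| := norm_expTwoPi_sub_le _ _
        _ = 2 * Real.pi * (|c| * |(τ s)⁻¹ - (τ t)⁻¹|) := by rw [← mul_sub, abs_mul]
        _ ≤ 8 * ((u ^ 20 * x) * (|s - t| / (a * a))) := by
            refine mul_le_mul (by linarith) (mul_le_mul hc ?_ (abs_nonneg _) (by positivity))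
              (by positivity) (by norm_num)
            exact (abs_inv_sub_inv_le hap (hτa s) (hτa t)).trans
              (div_le_div_of_nonneg_right (hτL s t) (by positivity))
        _ = _ := by rw [ha]; field_simp
    have h4 : 10 * (u ^ 40 / x) ≤ u ^ 100 / x := by
      rw [mul_div_assoc']
      refine div_le_div_of_nonneg_right ?_ hxp.le
      have h5 : (5 : ℝ) ^ 2 ≤ u ^ 60 :=
        (pow_le_pow_left₀ (by norm_num) hu 2).trans (pow_le_pow_right₀ hu1 (by norm_num))
      calc 10 * u ^ 40 ≤ u ^ 60 * u ^ 40 :=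
            mul_le_mul_of_nonneg_right (by linarith) (by positivity)
        _ = u ^ 100 := by ring
    have h5 := mul_le_mul_of_nonneg_right h4 (abs_nonneg (s - t))
    linarith
  · rw [hΨ] at ht
    have h1 : trapezoid a (2 * x) (x / u ^ 40) t ≠ 0 := fun h => ht (by rw [h]; simp)
    have h2 := mem_Icc_of_trapezoid_ne_zero (by positivity) h1
    exact ⟨(div_le_div_of_nonneg_left hxp.le (by positivity)
      (pow_le_pow_right₀ hu1 (by norm_num))).trans h2.1, h2.2⟩

theorem phaseWeight_mul_eq {u c t : ℝ} (hu : 0 < u) : (2 * u ^ 20 : ℂ) * phaseWeight u c t =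
    (trapezoid (Real.exp (u ^ 20) / u ^ 10) (2 * Real.exp (u ^ 20)) (Real.exp (u ^ 20) / u ^ 40) t *
      Real.log t : ℝ) * expTwoPi (c * t⁻¹) := by
  unfold phaseWeight
  by_cases h : trapezoid (Real.exp (u ^ 20) / u ^ 10) (2 * Real.exp (u ^ 20))
    (Real.exp (u ^ 20) / u ^ 40) t = 0
  · rw [h]; simp
  obtain ⟨h1, h2⟩ := mem_Icc_of_trapezoid_ne_zero (by positivity) h
  rw [min_eq_left h2, max_eq_right h1]
  have : (u : ℂ) ≠ 0 := by exact_mod_cast hu.ne'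
  push_cast
  field_simp

theorem sum_filter_prime_log_le {N : ℕ} {y : ℝ} (hN : (N : ℝ) ≤ y) :
    ∑ p ∈ (Finset.Icc 1 N).filter Nat.Prime, Real.log p ≤ 2 * y := by
  have h1 := Chebyshev.theta_le_log4_mul_x (x := (N : ℝ)) (Nat.cast_nonneg _)
  rw [Chebyshev.theta, Nat.floor_natCast] at h1
  have h2 : Finset.Ioc 0 N = Finset.Icc 1 N := by
    ext i; simp only [Finset.mem_Ioc, Finset.mem_Icc]; omega
  rw [h2] at h1
  have h3 : Real.log 4 ≤ 2 := by
    rw [show (4 : ℝ) = 2 ^ 2 by norm_num, Real.log_pow]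
    have := Real.log_two_lt_d9
    push_cast; linarith
  have h4 : (0 : ℝ) ≤ N := Nat.cast_nonneg _
  have h5 := mul_le_mul_of_nonneg_right h3 h4
  linarith

/-- The smoothed sum of the sawtooth function at the roots of `ν ^ 2 + 1` modulo primes. -/
theorem exists_abs_sum_trapezoid_fract_le : ∃ C > 0, ∀ u : ℝ, 5 ≤ u → ∀ m : ℕ,
    (m : ℝ) ≤ Real.exp (u ^ 20) →
    |∑ p ∈ (Finset.Icc 1 ⌊8 * Real.exp (u ^ 20)⌋₊).filter Nat.Prime,
      trapezoid (Real.exp (u ^ 20) / u ^ 10) (2 * Real.exp (u ^ 20))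
        (Real.exp (u ^ 20) / u ^ 40) p * Real.log p *
        ∑ ν ∈ rootsNegOne p, (Int.fract (((m : ℝ) - ν) / p) - 1 / 2)| ≤
      C * ((1 + Real.log u) * (Real.exp (u ^ 20) / u ^ 9)) := by
  obtain ⟨C, hC, hprime⟩ := exists_norm_sum_prime_rootSum_le
  refine ⟨40 * C + 96, by positivity, fun u hu m hm => ?_⟩
  have hu0 : 0 < u := by linarith
  have hu1 : 1 ≤ u := by linarith
  set x := Real.exp (u ^ 20) with hx
  have hxp : 0 < x := Real.exp_pos _
  set χ : ℕ → ℝ := fun p => trapezoid (x / u ^ 10) (2 * x) (x / u ^ 40) p with hχ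
  set Q := (Finset.Icc 1 ⌊8 * x⌋₊).filter Nat.Prime with hQ
  have hlog0 : ∀ p ∈ Q, 0 ≤ Real.log p := fun p hp => Real.log_natCast_nonneg p
  have hχ0 : ∀ p, 0 ≤ χ p := fun p => trapezoid_nonneg _ _ _ _
  set H := ⌊u ^ 20⌋₊ with hH
  have hHle : (H : ℝ) ≤ u ^ 20 := Nat.floor_le (by positivity)
  have hu20 : 1 ≤ u ^ 20 := one_le_pow₀ hu1
  have hH1 : 1 ≤ H := Nat.le_floor (by exact_mod_cast hu20)
  have hHge : u ^ 20 ≤ 2 * H := by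
    have h1 := Nat.lt_floor_add_one (u ^ 20)
    have h2 : (1 : ℝ) ≤ H := by exact_mod_cast hH1
    linarith
  have hET := abs_sum_mul_fract_sub_half_le (Q.sigma rootsNegOne)
    (w := fun i => χ i.1 * Real.log i.1) (fun i => ((m : ℝ) - i.2) / i.1)
    (fun i hi => mul_nonneg (hχ0 _) (hlog0 _ (Finset.mem_sigma.1 hi).1)) (H := H) (by omega)
    (η := 1 / u ^ 10) (B := 2 * C * (x / u ^ 9)) (by positivity) (fun h hh => ?_)
  · rw [Finset.sum_sigma, Finset.sum_sigma] at hET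
    simp only [← Finset.mul_sum] at hET
    have hlogu : 0 ≤ Real.log u := Real.log_nonneg hu1
    have hlogH : Real.log H ≤ 20 * Real.log u := by
      have h1 := Real.log_le_log (by exact_mod_cast hH1) hHle
      rw [Real.log_pow] at h1
      exact_mod_cast h1
    have hW : ∑ p ∈ Q, ∑ ν ∈ rootsNegOne p, χ p * Real.log p ≤ 32 * x := by
      calc _ ≤ ∑ p ∈ Q, 2 * Real.log p := by
            refine Finset.sum_le_sum fun p hp => ?_
            have hpp : p.Prime := (Finset.mem_filter.1 hp).2
            have h1 := card_rootsNegOne_prime_pow_le 1 hpp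
            rw [pow_one] at h1
            rw [Finset.sum_const, nsmul_eq_mul]
            refine mul_le_mul (by exact_mod_cast h1) ?_ (mul_nonneg (hχ0 _) (hlog0 p hp))
              (by norm_num)
            exact mul_le_of_le_one_left (hlog0 p hp) (trapezoid_le_one _ _ _ _)
        _ ≤ _ := by
            rw [← Finset.mul_sum]
            have := sum_filter_prime_log_le (N := ⌊8 * x⌋₊) (Nat.floor_le (by positivity))
            linarith
    have hη : 1 / ((H : ℝ) * (1 / u ^ 10)) + 1 / u ^ 10 ≤ 3 / u ^ 9 := by
      have h1 : 1 / ((H : ℝ) * (1 / u ^ 10)) ≤ 2 / u ^ 10 := by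
        rw [div_le_div_iff₀ (by positivity) (by positivity)]
        have h2 : 2 * ((H : ℝ) * (1 / u ^ 10)) ≥ u ^ 20 * (1 / u ^ 10) := by
          have := mul_le_mul_of_nonneg_right hHge (show 0 ≤ 1 / u ^ 10 by positivity)
          linarith
        have h3 : u ^ 20 * (1 / u ^ 10) = u ^ 10 := by field_simp
        linarith
      have h2 : 3 / u ^ 10 ≤ 3 / u ^ 9 := div_le_div_of_nonneg_left (by norm_num)
        (by positivity) (pow_le_pow_right₀ hu1 (by norm_num))
      have h3 : 2 / u ^ 10 + 1 / u ^ 10 = 3 / u ^ 10 := by ring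
      linarith
    refine hET.trans ?_
    have h1 : (1 + Real.log H) * (2 * C * (x / u ^ 9)) ≤
        20 * (1 + Real.log u) * (2 * C * (x / u ^ 9)) :=
      mul_le_mul_of_nonneg_right (by linarith) (by positivity)
    have h2 : (1 / ((H : ℝ) * (1 / u ^ 10)) + 1 / u ^ 10) *
        ∑ p ∈ Q, ∑ ν ∈ rootsNegOne p, χ p * Real.log p ≤ 3 / u ^ 9 * (32 * x) :=
      mul_le_mul hη hW (Finset.sum_nonneg fun p hp => Finset.sum_nonneg fun ν _ =>
        mul_nonneg (hχ0 _) (hlog0 p hp)) (by positivity)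
    have h3 : 3 / u ^ 9 * (32 * x) = 96 * (x / u ^ 9) := by ring
    have h4 : 0 ≤ Real.log u * (96 * (x / u ^ 9)) := by positivity
    simp only [← Finset.mul_sum] at h2
    linarith
  · rw [Finset.mem_Icc] at hh
    have hh0 : (0 : ℝ) ≤ h := Nat.cast_nonneg h
    have hhu : (h : ℝ) ≤ u ^ 20 := (Nat.cast_le.2 hh.2).trans hHle
    have hΨ : IsScaleWeight u (phaseWeight u (h * m)) := isScaleWeight_phaseWeight hu (by
      rw [abs_of_nonneg (by positivity)]
      exact mul_le_mul hhu hm (Nat.cast_nonneg _) (by positivity))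
    have h1 := hprime u hu _ hΨ (-h) (by omega) (by
      rw [Int.natAbs_neg, Int.natAbs_natCast]
      exact hhu.trans (pow_le_pow_right₀ hu1 (by norm_num)))
    have h2 : ∑ i ∈ Q.sigma rootsNegOne, ((χ i.1 * Real.log i.1 : ℝ) : ℂ) *
        expTwoPi (h * (((m : ℝ) - i.2) / i.1)) =
        (2 * u ^ 20 : ℂ) * ∑ p ∈ Q, phaseWeight u (h * m) p * rootSum (-h) p := by
      rw [Finset.sum_sigma, Finset.mul_sum]
      refine Finset.sum_congr rfl fun p _ => ?_
      simp only
      rw [← mul_assoc, phaseWeight_mul_eq hu0, rootSum, Finset.mul_sum]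
      refine Finset.sum_congr rfl fun ν _ => ?_
      rw [mul_assoc _ (expTwoPi _), ← expTwoPi_add]
      congr 2
      push_cast; ring
    rw [h2, norm_mul]
    have h3 : ‖(2 * u ^ 20 : ℂ)‖ = 2 * u ^ 20 := by
      rw [norm_mul, norm_pow, Complex.norm_real, Real.norm_of_nonneg hu0.le]; norm_num
    rw [h3]
    calc 2 * u ^ 20 * _ ≤ 2 * u ^ 20 * (C * (x / u ^ 29)) :=
          mul_le_mul_of_nonneg_left h1 (by positivity)
      _ = _ := by field_simp

theorem card_filter_dvd_sq_add_one_eq {p : ℕ} (hp : 0 < p) (n : ℕ) :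
    (((Finset.Icc 1 n).filter (fun i => p ∣ i ^ 2 + 1)).card : ℝ) =
      ∑ ν ∈ rootsNegOne p, ((n : ℝ) / p + Int.fract (((0 : ℕ) - (ν : ℝ)) / p) -
        Int.fract (((n : ℝ) - ν) / p)) := by
  have hp0 : (0 : ℝ) < p := by exact_mod_cast hp
  have hmod : ∀ i, p ∣ i ^ 2 + 1 ↔ p ∣ (i % p) ^ 2 + 1 := fun i =>
    (((Nat.mod_modEq i p).pow 2).add_right 1).symm.dvd_iff dvd_rfl
  have hmaps : ∀ i ∈ (Finset.Icc 1 n).filter (fun i => p ∣ i ^ 2 + 1), i % p ∈ rootsNegOne p :=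
    fun i hi => mem_rootsNegOne.2 ⟨Nat.mod_lt _ hp, (hmod i).1 (Finset.mem_filter.1 hi).2⟩
  rw [Finset.card_eq_sum_card_fiberwise hmaps, Nat.cast_sum]
  refine Finset.sum_congr rfl fun ν hν => ?_
  obtain ⟨hν1, hν2⟩ := mem_rootsNegOne.1 hν
  have h1 : ((Finset.Icc 1 n).filter (fun i => p ∣ i ^ 2 + 1)).filter (fun i => i % p = ν) =
      (Finset.Ioc 0 n).filter (fun i => i ≡ ν [MOD p]) := by
    ext i
    simp only [Finset.mem_filter, Finset.mem_Icc, Finset.mem_Ioc, Nat.ModEq, Nat.mod_eq_of_lt hν1]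
    constructor
    · rintro ⟨⟨h, -⟩, h'⟩
      exact ⟨⟨by omega, h.2⟩, h'⟩
    · rintro ⟨h, h'⟩
      exact ⟨⟨⟨by omega, h.2⟩, (hmod i).2 (by rwa [h'])⟩, h'⟩
  rw [h1]
  have h2 := Nat.Ioc_filter_modEq_card 0 n hp ν
  have h3 : ⌊(((0 : ℕ) : ℚ) - ν) / p⌋ ≤ ⌊((n : ℚ) - ν) / p⌋ := by
    refine Int.floor_le_floor (div_le_div_of_nonneg_right ?_ (Nat.cast_nonneg _))
    have : (0 : ℚ) ≤ n := Nat.cast_nonneg _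
    push_cast
    linarith
  rw [max_eq_left (by linarith)] at h2
  have h4 : ∀ m : ℕ, ⌊((m : ℚ) - ν) / p⌋ = ⌊((m : ℝ) - ν) / p⌋ := fun m => by
    rw [← Rat.floor_cast (α := ℝ)]; push_cast; rfl
  rw [h4, h4] at h2
  have h5 : (((Finset.Ioc 0 n).filter (fun i => i ≡ ν [MOD p])).card : ℝ) =
      (⌊((n : ℝ) - ν) / p⌋ : ℝ) - ⌊(((0 : ℕ) : ℝ) - ν) / p⌋ := by exact_mod_cast h2
  rw [h5, Int.fract, Int.fract]
  push_cast
  field_simp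
  ring

theorem card_rootsNegOne_of_mod_four_eq_one {p : ℕ} (hp : p.Prime) (h : p % 4 = 1) :
    (rootsNegOne p).card = 2 := by
  have h1 := card_rootsNegOne_prime_pow_le 1 hp
  rw [pow_one] at h1
  refine le_antisymm h1 ?_
  have := Fact.mk hp
  obtain ⟨y, hy⟩ := (ZMod.exists_sq_eq_neg_one_iff (p := p)).2 (by omega)
  have hdvd : ∀ z : ZMod p, z ^ 2 = -1 → z.val ∈ rootsNegOne p := fun z hz =>
    mem_rootsNegOne.2 ⟨z.val_lt, by
      rw [← ZMod.natCast_eq_zero_iff]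
      push_cast
      rw [ZMod.natCast_zmod_val, hz]; ring⟩
  have hne : y.val ≠ (-y).val := fun h2 => by
    have h3 : y = -y := ZMod.val_injective p h2
    have h4 : (2 : ZMod p) * y = 0 := by
      rw [two_mul]; nth_rewrite 2 [h3]; ring
    rcases mul_eq_zero.1 h4 with h5 | h5
    · have h6 : ((2 : ℕ) : ZMod p) = 0 := by exact_mod_cast h5
      rw [ZMod.natCast_eq_zero_iff] at h6
      have h7 := Nat.le_of_dvd (by norm_num) h6
      have h8 := hp.two_le
      omega
    · rw [h5] at hy
      simp at hy
  rw [← Finset.card_pair hne]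
  refine Finset.card_le_card fun z hz => ?_
  rw [Finset.mem_insert, Finset.mem_singleton] at hz
  rcases hz with rfl | rfl
  · exact hdvd y (by rw [sq, ← hy])
  · exact hdvd (-y) (by rw [neg_sq, sq, ← hy])

theorem rootsNegOne_of_mod_four_eq_three {p : ℕ} (hp : p.Prime) (h : p % 4 = 3) :
    rootsNegOne p = ∅ := by
  refine Finset.eq_empty_of_forall_notMem fun ν hν => ?_
  have := Fact.mk hp
  have h1 := (mem_rootsNegOne.1 hν).2
  rw [← ZMod.natCast_eq_zero_iff] at h1
  push_cast at h1
  exact ZMod.exists_sq_eq_neg_one_iff.1 ⟨(ν : ZMod p), by linear_combination -h1⟩ h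

/-- The sawtooth function summed over the roots of `-1` modulo `p`. -/
noncomputable def rootSawtooth (m p : ℕ) : ℝ :=
  ∑ ν ∈ rootsNegOne p, (Int.fract (((m : ℝ) - ν) / p) - 1 / 2)

theorem abs_rootSawtooth_le {p : ℕ} (hp : p.Prime) (m : ℕ) : |rootSawtooth m p| ≤ 1 := by
  have h1 := card_rootsNegOne_prime_pow_le 1 hp
  rw [pow_one] at h1
  refine (Finset.abs_sum_le_sum_abs _ _).trans ?_
  calc _ ≤ ∑ ν ∈ rootsNegOne p, (1 / 2 : ℝ) := Finset.sum_le_sum fun ν _ => by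
        have h2 := Int.fract_nonneg (((m : ℝ) - ν) / p)
        have h3 := (Int.fract_lt_one (((m : ℝ) - ν) / p)).le
        rw [abs_le]; constructor <;> linarith
    _ ≤ 1 := by
        rw [Finset.sum_const, nsmul_eq_mul]
        have : ((rootsNegOne p).card : ℝ) ≤ 2 := by exact_mod_cast h1
        linarith

theorem summand_eq {p : ℕ} (hp : p.Prime) (hp2 : p ≠ 2) (n : ℕ) :
    (if p % 4 = 1 then (((Finset.Icc 1 n).filter (fun i => p ∣ i ^ 2 + 1)).card : ℝ) else 0) *
        Real.log p - (1 + (if p % 4 = 1 then (1 : ℝ) else -1)) * n * Real.log p / ((p : ℝ) - 1) =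
      Real.log p * (rootSawtooth 0 p - rootSawtooth n p) -
        (if p % 4 = 1 then 2 * n * Real.log p / (p * ((p : ℝ) - 1)) else 0) := by
  have hodd := hp.eq_two_or_odd.resolve_left hp2
  have hp1 : (1 : ℝ) < p := by exact_mod_cast hp.one_lt
  have hp0 : (p : ℝ) ≠ 0 := by linarith
  have hp1' : (p : ℝ) - 1 ≠ 0 := by linarith
  by_cases h : p % 4 = 1
  · rw [if_pos h, if_pos h, if_pos h, card_filter_dvd_sq_add_one_eq hp.pos]
    have h1 : ∑ ν ∈ rootsNegOne p, ((n : ℝ) / p + Int.fract (((0 : ℕ) - (ν : ℝ)) / p) -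
        Int.fract (((n : ℝ) - ν) / p)) = 2 * (n / p) + (rootSawtooth 0 p - rootSawtooth n p) := by
      unfold rootSawtooth
      rw [← Finset.sum_sub_distrib]
      have h2 : (2 : ℝ) * (n / p) = ∑ ν ∈ rootsNegOne p, (n : ℝ) / p := by
        rw [Finset.sum_const, card_rootsNegOne_of_mod_four_eq_one hp h, nsmul_eq_mul]
        norm_num
      rw [h2, ← Finset.sum_add_distrib]
      exact Finset.sum_congr rfl fun ν _ => by ring
    rw [h1]
    field_simp
    ring
  · rw [if_neg h, if_neg h, if_neg h]
    have h1 := rootsNegOne_of_mod_four_eq_three hp (by omega)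
    simp [rootSawtooth, h1]

theorem exp_rpow_two_thirds_bounds {u : ℝ} (hu : 5 ≤ u) :
    Real.exp (u ^ 20) ^ ((2 : ℝ) / 3) ≤ Real.exp (u ^ 20) / u ^ 10 ∧
      u ^ 40 ≤ Real.exp (u ^ 20) ^ ((2 : ℝ) / 3) := by
  have hu0 : 0 < u := by linarith
  have hu1 : 1 ≤ u := by linarith
  have h1 := pow_forty_lt_exp hu
  have h2 : u ^ 5 ≤ u ^ 20 / 3 := by
    have h3 : 3 * 1 ≤ u ^ 15 := by
      have := pow_le_pow_left₀ (by norm_num) hu 15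
      norm_num at this
      linarith
    have h4 := mul_le_mul_of_nonneg_left h3 (show 0 ≤ u ^ 5 by positivity)
    have h5 : u ^ 5 * u ^ 15 = u ^ 20 := by ring
    linarith
  have h3 : 0 ≤ u ^ 20 := by positivity
  rw [← Real.exp_mul]
  refine ⟨?_, h1.le.trans (Real.exp_le_exp.2 (by linarith))⟩
  rw [le_div_iff₀ (by positivity)]
  calc _ ≤ Real.exp (u ^ 20 * (2 / 3)) * Real.exp (u ^ 20 / 3) := by
        refine mul_le_mul_of_nonneg_left ?_ (Real.exp_pos _).le
        exact (pow_le_pow_right₀ hu1 (by norm_num)).trans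
          (h1.le.trans (Real.exp_le_exp.2 h2))
    _ = _ := by rw [← Real.exp_add]; congr 1; ring

theorem sum_filter_div_mul_sub_one_le {n : ℕ} {y L : ℝ} (hy : 2 ≤ y) (hyn : y ≤ 2 * n)
    (hL : Real.log (2 * n) ≤ L) :
    ∑ p ∈ (Finset.range (2 * n + 1)).filter (fun p : ℕ => p.Prime ∧ y ≤ (p : ℝ)),
      2 * n * Real.log p / (p * ((p : ℝ) - 1)) ≤ 8 * n * L / y := by
  have hy0 : 0 < y := by linarith
  set k := ⌈y⌉₊ - 1 with hk
  have hk1 : 2 ≤ ⌈y⌉₊ := by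
    have := Nat.ceil_le_ceil hy
    rwa [show (2 : ℝ) = (2 : ℕ) by norm_num, Nat.ceil_natCast] at this
  have hky : y / 2 ≤ k := by
    have h1 := Nat.le_ceil y
    have h2 : (k : ℝ) = ⌈y⌉₊ - 1 := by rw [hk, Nat.cast_sub (by omega)]; norm_num
    linarith
  have hkn : k ≤ 2 * n := by
    have h1 : ⌈y⌉₊ ≤ 2 * n := Nat.ceil_le.2 (by push_cast; exact hyn)
    omega
  have hn : (0 : ℝ) < 2 * n := by linarith
  have hL0 : 0 ≤ L := (Real.log_nonneg (by linarith)).trans hL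
  have hsub : (Finset.range (2 * n + 1)).filter (fun p : ℕ => p.Prime ∧ y ≤ (p : ℝ)) ⊆
      Finset.Ioc k (2 * n) := fun p hp => by
    rw [Finset.mem_filter, Finset.mem_range] at hp
    have h1 : ⌈y⌉₊ ≤ p := Nat.ceil_le.2 hp.2.2
    rw [Finset.mem_Ioc]; omega
  have hsq := sum_Ioc_inv_sq_le_sub (α := ℝ) (k := k) (n := 2 * n) (by omega) hkn
  calc _ ≤ ∑ p ∈ (Finset.range (2 * n + 1)).filter (fun p : ℕ => p.Prime ∧ y ≤ (p : ℝ)),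
        4 * n * L * ((p : ℝ) ^ 2)⁻¹ := by
        refine Finset.sum_le_sum fun p hp => ?_
        rw [Finset.mem_filter, Finset.mem_range] at hp
        have hp2 : (2 : ℝ) ≤ p := by exact_mod_cast hp.2.1.two_le
        have hp3 : (p : ℝ) ≤ 2 * n := by exact_mod_cast Nat.lt_succ_iff.1 hp.1
        have h1 : Real.log p ≤ L := (Real.log_le_log (by linarith) hp3).trans hL
        rw [← div_eq_mul_inv, div_le_div_iff₀ (by nlinarith) (by positivity)]
        have h2 : (p : ℝ) ^ 2 ≤ 2 * (p * (p - 1)) := by nlinarith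
        calc 2 * n * Real.log p * (p : ℝ) ^ 2 ≤ 2 * n * L * (2 * (p * (p - 1))) :=
              mul_le_mul (mul_le_mul_of_nonneg_left h1 hn.le) h2 (by positivity) (by positivity)
          _ = _ := by ring
    _ ≤ ∑ p ∈ Finset.Ioc k (2 * n), 4 * n * L * ((p : ℝ) ^ 2)⁻¹ :=
        Finset.sum_le_sum_of_subset_of_nonneg hsub fun _ _ _ => by positivity
    _ ≤ 4 * n * L * (2 / y) := by
        rw [← Finset.mul_sum]
        refine mul_le_mul_of_nonneg_left (hsq.trans ?_) (by positivity)
        have h1 : (0 : ℝ) ≤ ((2 * n : ℕ) : ℝ)⁻¹ := by positivity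
        have h2 : (k : ℝ)⁻¹ ≤ 2 / y := by
          rw [← inv_div]; exact inv_anti₀ (by positivity) hky
        linarith
    _ = _ := by ring

theorem card_filter_sub_lt_le {n : ℕ} {l : ℝ} (hl : 0 ≤ l) :
    (((Finset.range (2 * n + 1)).filter (fun p : ℕ => 2 * (n : ℝ) - l < p)).card : ℝ) ≤ l + 1 := by
  have hsub : (Finset.range (2 * n + 1)).filter (fun p : ℕ => 2 * (n : ℝ) - l < p) ⊆
      Finset.Icc (2 * n - ⌊l⌋₊) (2 * n) := fun p hp => by
    rw [Finset.mem_filter, Finset.mem_range] at hp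
    have h1 : 2 * n - p ≤ ⌊l⌋₊ := Nat.le_floor (by
      rw [Nat.cast_sub (by omega)]; push_cast; linarith)
    rw [Finset.mem_Icc]; omega
  have h1 : ((Finset.range (2 * n + 1)).filter (fun p : ℕ => 2 * (n : ℝ) - l < p)).card ≤
      ⌊l⌋₊ + 1 := (Finset.card_le_card hsub).trans (by rw [Nat.card_Icc]; omega)
  have h2 := Nat.floor_le hl
  have h3 : (((Finset.range (2 * n + 1)).filter (fun p : ℕ => 2 * (n : ℝ) - l < p)).card : ℝ) ≤
      ⌊l⌋₊ + 1 := by exact_mod_cast h1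
  linarith

theorem sum_one_sub_trapezoid_le {n : ℕ} {y a l L : ℝ} (hl : 0 < l) (ha : 0 ≤ a)
    (hn : 1 ≤ n) (hL : Real.log (2 * n) ≤ L) :
    ∑ p ∈ (Finset.range (2 * n + 1)).filter (fun p : ℕ => p.Prime ∧ y ≤ (p : ℝ)),
      (1 - trapezoid a (2 * n) l p) * Real.log p ≤ 2 * (a + l) + (l + 1) * L := by
  set S := (Finset.range (2 * n + 1)).filter (fun p : ℕ => p.Prime ∧ y ≤ (p : ℝ)) with hS
  have hn1 : (1 : ℝ) ≤ n := by exact_mod_cast hn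
  have hL0 : 0 ≤ L := (Real.log_nonneg (by linarith)).trans hL
  have hlow := sum_filter_prime_log_le (N := ⌊a + l⌋₊) (Nat.floor_le (by positivity))
  set A := (Finset.Icc 1 ⌊a + l⌋₊).filter Nat.Prime with hA
  set B := (Finset.range (2 * n + 1)).filter (fun p : ℕ => 2 * (n : ℝ) - l < p) with hB
  have hB' := card_filter_sub_lt_le (n := n) hl.le
  have hlog : ∀ p : ℕ, 0 ≤ Real.log p := Real.log_natCast_nonneg
  have hpt : ∀ p ∈ S, (1 - trapezoid a (2 * n) l p) * Real.log p ≤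
      (if p ∈ A then Real.log p else 0) + (if p ∈ B then L else 0) := by
    intro p hp
    rw [hS, Finset.mem_filter, Finset.mem_range] at hp
    have hp3 : (p : ℝ) ≤ 2 * n := by exact_mod_cast Nat.lt_succ_iff.1 hp.1
    have hpL : Real.log p ≤ L :=
      (Real.log_le_log (by exact_mod_cast hp.2.1.pos) hp3).trans hL
    have h0 : (1 - trapezoid a (2 * n) l p) * Real.log p ≤ Real.log p :=
      mul_le_of_le_one_left (hlog p) (by linarith [trapezoid_nonneg a (2 * n) l p])
    by_cases h1 : (p : ℝ) ≤ a + l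
    · rw [if_pos (show p ∈ A from Finset.mem_filter.2 ⟨Finset.mem_Icc.2 ⟨hp.2.1.pos,
        Nat.le_floor h1⟩, hp.2.1⟩)]
      have : 0 ≤ if p ∈ B then L else 0 := by split_ifs <;> simp [hL0]
      linarith
    · have hA0 : 0 ≤ if p ∈ A then Real.log p else 0 := by
        split_ifs
        · exact hlog p
        · exact le_rfl
      by_cases h2 : 2 * (n : ℝ) - l < p
      · rw [if_pos (show p ∈ B from Finset.mem_filter.2 ⟨Finset.mem_range.2 hp.1, h2⟩)]
        linarith
      · rw [trapezoid_eq_one hl (le_of_not_ge h1) (le_of_not_gt h2), sub_self, zero_mul]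
        have : 0 ≤ if p ∈ B then L else 0 := by split_ifs <;> simp [hL0]
        linarith
  refine (Finset.sum_le_sum hpt).trans ?_
  rw [Finset.sum_add_distrib, ← Finset.sum_filter, ← Finset.sum_filter]
  refine add_le_add ?_ ?_
  · refine le_trans (Finset.sum_le_sum_of_subset_of_nonneg (t := A) (fun p hp =>
      (Finset.mem_filter.1 hp).2) fun p _ _ => hlog p) hlow
  · rw [Finset.sum_const, nsmul_eq_mul]
    refine mul_le_mul_of_nonneg_right (le_trans ?_ hB') hL0
    have h3 : (S.filter (fun p => p ∈ B)).card ≤ B.card :=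
      Finset.card_le_card fun p hp => (Finset.mem_filter.1 hp).2
    exact Nat.cast_le.2 h3

theorem exists_abs_medium_sum_le : ∃ C > 0, ∀ (u : ℝ) (n : ℕ), 5 ≤ u → Real.exp (u ^ 20) = n →
    |∑ p ∈ (Finset.range (2 * n + 1)).filter
          (fun p : ℕ => p.Prime ∧ (n : ℝ) ^ ((2 : ℝ) / 3) ≤ (p : ℝ)),
        ((if p % 4 = 1 then (((Finset.Icc 1 n).filter (fun i => p ∣ i ^ 2 + 1)).card : ℝ) else 0) *
          Real.log p - (1 + (if p % 4 = 1 then (1 : ℝ) else -1)) * n * Real.log p /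
            ((p : ℝ) - 1))| ≤
      C * ((1 + Real.log u) * (n / u ^ 9)) := by
  obtain ⟨C, hC, hsmooth⟩ := exists_abs_sum_trapezoid_fract_le
  refine ⟨2 * C + 32, by positivity, fun u n hu hun => ?_⟩
  have hu0 : 0 < u := by linarith
  have hu1 : 1 ≤ u := by linarith
  obtain ⟨hya, hy40⟩ := exp_rpow_two_thirds_bounds hu
  have h20 := Real.add_one_le_exp (u ^ 20)
  have h0 := hsmooth u hu 0 (by rw [Nat.cast_zero]; positivity)
  have hm := hsmooth u hu n hun.ge
  rw [hun] at hya hy40 h0 hm h20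
  set y := (n : ℝ) ^ ((2 : ℝ) / 3) with hy
  set a := (n : ℝ) / u ^ 10 with ha
  set l := (n : ℝ) / u ^ 40 with hl
  set S := (Finset.range (2 * n + 1)).filter (fun p : ℕ => p.Prime ∧ y ≤ (p : ℝ)) with hS
  set Q := (Finset.Icc 1 ⌊8 * (n : ℝ)⌋₊).filter Nat.Prime with hQ
  have hn0 : (0 : ℝ) < n := hun ▸ Real.exp_pos _
  have hn1 : 1 ≤ n := by exact_mod_cast hn0
  have hl0 : 0 < l := by positivity
  have ha0 : 0 < a := by positivity
  have hu9 : 1 ≤ u ^ 9 := one_le_pow₀ hu1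
  have hu20 : 1 ≤ u ^ 20 := one_le_pow₀ hu1
  have hy3 : 3 ≤ y := by
    have : u ^ 1 ≤ u ^ 40 := pow_le_pow_right₀ hu1 (by norm_num)
    rw [pow_one] at this
    linarith
  have hlogu : 0 ≤ Real.log u := Real.log_nonneg hu1
  have hL : Real.log (2 * n) ≤ 2 * u ^ 20 := by
    rw [Real.log_mul (by norm_num) hn0.ne', ← hun, Real.log_exp]
    have := Real.log_two_lt_d9
    linarith
  have hln : a ≤ n := div_le_self hn0.le (one_le_pow₀ hu1)
  have htail := sum_filter_div_mul_sub_one_le (n := n) (y := y) (by linarith) (by linarith) hL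
  have hcut := sum_one_sub_trapezoid_le (n := n) (y := y) hl0 ha0.le hn1 hL
  rw [← hS] at htail hcut
  have hprime : ∀ p ∈ S, p.Prime := fun p hp => (Finset.mem_filter.1 hp).2.1
  have hsum : ∀ m : ℕ, ∑ p ∈ S, trapezoid a (2 * n) l p * Real.log p * rootSawtooth m p =
      ∑ p ∈ Q, trapezoid a (2 * n) l p * Real.log p * rootSawtooth m p := fun m => by
    refine Finset.sum_subset (fun p hp => ?_) (fun p hp hpS => ?_)
    · rw [hS, Finset.mem_filter, Finset.mem_range] at hp
      refine Finset.mem_filter.2 ⟨Finset.mem_Icc.2 ⟨hp.2.1.pos, Nat.le_floor ?_⟩, hp.2.1⟩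
      have : (p : ℝ) ≤ 2 * n := by exact_mod_cast Nat.lt_succ_iff.1 hp.1
      linarith
    · by_contra hne
      have h1 : trapezoid a (2 * n) l p ≠ 0 := fun h => hne (by rw [h]; ring)
      obtain ⟨h2, h3⟩ := mem_Icc_of_trapezoid_ne_zero hl0 h1
      refine hpS (Finset.mem_filter.2 ⟨Finset.mem_range.2 (Nat.lt_succ_iff.2 ?_),
        (Finset.mem_filter.1 hp).2, hya.trans h2⟩)
      exact_mod_cast h3
  have hsplit : ∑ p ∈ S, ((if p % 4 = 1 then
        (((Finset.Icc 1 n).filter (fun i => p ∣ i ^ 2 + 1)).card : ℝ) else 0) *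
          Real.log p - (1 + (if p % 4 = 1 then (1 : ℝ) else -1)) * n * Real.log p /
            ((p : ℝ) - 1)) =
      ∑ p ∈ S, trapezoid a (2 * n) l p * Real.log p * rootSawtooth 0 p -
      ∑ p ∈ S, trapezoid a (2 * n) l p * Real.log p * rootSawtooth n p +
      ∑ p ∈ S, (1 - trapezoid a (2 * n) l p) * Real.log p *
        (rootSawtooth 0 p - rootSawtooth n p) -
      ∑ p ∈ S, (if p % 4 = 1 then 2 * n * Real.log p / (p * ((p : ℝ) - 1)) else 0) := by
    rw [← Finset.sum_sub_distrib, ← Finset.sum_add_distrib, ← Finset.sum_sub_distrib]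
    refine Finset.sum_congr rfl fun p hp => ?_
    have hp2 : p ≠ 2 := fun h => by
      have h1 : y ≤ (p : ℝ) := (Finset.mem_filter.1 hp).2.2
      rw [h] at h1
      norm_num at h1
      linarith
    rw [summand_eq (hprime p hp) hp2]
    ring
  have hcut' : |∑ p ∈ S, (1 - trapezoid a (2 * n) l p) * Real.log p *
        (rootSawtooth 0 p - rootSawtooth n p)| ≤
      2 * (2 * (a + l) + (l + 1) * (2 * u ^ 20)) := by
    refine (Finset.abs_sum_le_sum_abs _ _).trans ?_
    refine le_trans ?_ (mul_le_mul_of_nonneg_left hcut (by norm_num))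
    rw [Finset.mul_sum]
    refine Finset.sum_le_sum fun p hp => ?_
    have h1 : 0 ≤ (1 - trapezoid a (2 * n) l p) * Real.log p :=
      mul_nonneg (by linarith [trapezoid_le_one a (2 * n) l p]) (Real.log_natCast_nonneg p)
    rw [abs_mul, abs_of_nonneg h1, mul_comm]
    refine mul_le_mul_of_nonneg_right ?_ h1
    have h2 := abs_rootSawtooth_le (hprime p hp) 0
    have h3 := abs_rootSawtooth_le (hprime p hp) n
    have h4 := abs_sub (rootSawtooth 0 p) (rootSawtooth n p)
    linarith
  have htail' : |∑ p ∈ S, (if p % 4 = 1 then 2 * n * Real.log p / (p * ((p : ℝ) - 1)) else 0)| ≤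
      8 * n * (2 * u ^ 20) / y := by
    have hnn : ∀ p ∈ S, 0 ≤ 2 * n * Real.log p / (p * ((p : ℝ) - 1)) := fun p hp => by
      have h1 : (1 : ℝ) ≤ p := by exact_mod_cast (hprime p hp).one_le
      exact div_nonneg (mul_nonneg (by positivity) (Real.log_natCast_nonneg p))
        (mul_nonneg (by linarith) (by linarith))
    have hite : ∀ p ∈ S, |if p % 4 = 1 then 2 * n * Real.log p / (p * ((p : ℝ) - 1)) else 0| ≤
        2 * n * Real.log p / (p * ((p : ℝ) - 1)) := fun p hp => by
      split_ifs
      · rw [abs_of_nonneg (hnn p hp)]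
      · rw [abs_zero]
        exact hnn p hp
    exact ((Finset.abs_sum_le_sum_abs _ _).trans (Finset.sum_le_sum hite)).trans htail
  set R := (n : ℝ) / u ^ 9 with hR
  have hR0 : 0 < R := by positivity
  have hdivR : ∀ k, 9 ≤ k → (n : ℝ) / u ^ k ≤ R := fun k hk =>
    div_le_div_of_nonneg_left hn0.le (by positivity) (pow_le_pow_right₀ hu1 hk)
  have haR : a ≤ R := hdivR 10 (by norm_num)
  have hlR : l ≤ R := hdivR 40 (by norm_num)
  have hn40 : u ^ 40 ≤ n := hy40.trans (hya.trans hln)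
  have hl1 : 1 ≤ l := (one_le_div (by positivity)).2 hn40
  have hlu : l * u ^ 20 ≤ R := by
    have h1 : l * u ^ 20 = n / u ^ 20 := by rw [hl]; field_simp
    rw [h1]
    exact hdivR 20 (by norm_num)
  have huR : u ^ 20 ≤ R := (le_mul_of_one_le_left (by positivity) hl1).trans hlu
  have hyR : 8 * n * (2 * u ^ 20) / y ≤ 16 * R := by
    have h1 : n * u ^ 20 / y ≤ R := by
      refine (div_le_div_of_nonneg_left (by positivity) (by positivity) hy40).trans ?_
      have h2 : n * u ^ 20 / u ^ 40 = n / u ^ 20 := by field_simp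
      rw [h2]
      exact hdivR 20 (by norm_num)
    calc _ = 16 * (n * u ^ 20 / y) := by ring
      _ ≤ _ := by linarith
  have h0' : |∑ p ∈ S, trapezoid a (2 * n) l p * Real.log p * rootSawtooth 0 p| ≤
      C * ((1 + Real.log u) * R) := by
    rw [hsum 0]; exact h0
  have hm' : |∑ p ∈ S, trapezoid a (2 * n) l p * Real.log p * rootSawtooth n p| ≤
      C * ((1 + Real.log u) * R) := by
    rw [hsum n]; exact hm
  rw [hsplit]
  refine (abs_sub _ _).trans ?_
  refine (add_le_add ((abs_add_le _ _).trans (add_le_add (abs_sub _ _) le_rfl)) le_rfl).trans ?_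
  have hfin : 0 ≤ Real.log u * R := by positivity
  have hlul : (l + 1) * (2 * u ^ 20) = 2 * (l * u ^ 20) + 2 * u ^ 20 := by ring
  rw [hlul] at hcut'
  linarith

theorem exists_forall_le_mul_div_of_forall_ge {f a b : ℕ → ℝ} {N k : ℕ}
    (hab : ∀ n, k ≤ n → 0 < a n / b n)
    (h : ∃ C > 0, ∀ n, k ≤ n → N ≤ n → f n ≤ C * a n / b n) :
    ∃ C > 0, ∀ n, k ≤ n → f n ≤ C * a n / b n := by
  obtain ⟨C, hC, h⟩ := h
  have hs : 0 ≤ ∑ i ∈ Finset.range N, |f i / (a i / b i)| :=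
    Finset.sum_nonneg fun _ _ => abs_nonneg _
  refine ⟨C + ∑ i ∈ Finset.range N, |f i / (a i / b i)|, by linarith, fun n hn => ?_⟩
  rw [mul_div_assoc]
  rcases le_or_gt N n with h1 | h1
  · have h2 := h n hn h1
    rw [mul_div_assoc] at h2
    exact h2.trans (mul_le_mul_of_nonneg_right (by linarith) (hab n hn).le)
  · rw [← div_le_iff₀ (hab n hn)]
    have h2 := Finset.single_le_sum (f := fun i => |f i / (a i / b i)|) (fun _ _ => abs_nonneg _)
      (Finset.mem_range.2 h1)
    have h3 := le_abs_self (f n / (a n / b n))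
    linarith

theorem one_add_log_div_pow_nine_le {δ u : ℝ} (hδ : δ < 8 / 9) (hu : 1 ≤ u) :
    (1 + Real.log u) / u ^ 9 ≤ (1 + 1 / (9 - 10 * δ)) / (u ^ 20) ^ (δ / 2) := by
  have hu0 : 0 < u := by linarith
  have hε : 0 < 9 - 10 * δ := by linarith
  have h1 := Real.log_le_rpow_div hu0.le hε
  have h2 : 1 ≤ u ^ (9 - 10 * δ) := Real.one_le_rpow hu hε.le
  have h3 : (u ^ 20) ^ (δ / 2) * u ^ (9 - 10 * δ) = u ^ 9 := by
    rw [← Real.rpow_natCast, ← Real.rpow_mul hu0.le, ← Real.rpow_add hu0, ← Real.rpow_natCast]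
    congr 1
    push_cast
    ring
  rw [div_le_div_iff₀ (by positivity) (by positivity), ← h3]
  calc _ ≤ ((1 + 1 / (9 - 10 * δ)) * u ^ (9 - 10 * δ)) * (u ^ 20) ^ (δ / 2) := by
        refine mul_le_mul_of_nonneg_right ?_ (by positivity)
        rw [add_mul, one_mul, one_div_mul_eq_div]
        linarith
    _ = _ := by ring

open scoped Classical

/-- For every `δ < 8/9` there exists `C > 0` such that for all `n ≥ 2`,
`|Σ_{n^{2/3} ≤ p ≤ 2n} α*_p(n)·log p − Σ_{n^{2/3} ≤ p ≤ 2n} (1+(−1/p))·n·log p/(p−1)|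
  ≤ C·n/(log n)^{δ/2}`. -/
theorem medium_primes_alphastar_contribution (δ : ℝ) (hδ : δ < 8 / 9) :
    ∃ C > 0, ∀ n : ℕ, 2 ≤ n →
      |(∑ p ∈ (Finset.range (2 * n + 1)).filter
            (fun p : ℕ => p.Prime ∧ (n : ℝ) ^ ((2 : ℝ) / 3) ≤ (p : ℝ)),
          (if p % 4 = 1
            then (((Finset.Icc 1 n).filter (fun i => p ∣ i ^ 2 + 1)).card : ℝ)
            else 0) * Real.log p)
        - ∑ p ∈ (Finset.range (2 * n + 1)).filter
            (fun p : ℕ => p.Prime ∧ (n : ℝ) ^ ((2 : ℝ) / 3) ≤ (p : ℝ)),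
          (1 + (if p % 4 = 1 then (1 : ℝ) else -1)) * n * Real.log p / ((p : ℝ) - 1)|
      ≤ C * n / (Real.log n) ^ (δ / 2) := by
  obtain ⟨C, hC, hmain⟩ := exists_abs_medium_sum_le
  have hε : 0 < 9 - 10 * δ := by linarith
  have hpos : ∀ n : ℕ, 2 ≤ n → 0 < (n : ℝ) / Real.log n ^ (δ / 2) := fun n hn => by
    have h1 : 0 < Real.log n := Real.log_pos (by exact_mod_cast hn)
    have h2 : (0 : ℝ) < n := by exact_mod_cast (by omega : 0 < n)
    positivity
  refine exists_forall_le_mul_div_of_forall_ge (N := ⌈Real.exp (5 ^ 20)⌉₊) (k := 2)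
    (a := fun n => (n : ℝ)) (b := fun n => Real.log n ^ (δ / 2)) hpos
    ⟨C * (1 + 1 / (9 - 10 * δ)), by positivity, fun n hn hN => ?_⟩
  have hn0 : (0 : ℝ) < n := by exact_mod_cast (by omega : 0 < n)
  have hlog : (5 : ℝ) ^ 20 ≤ Real.log n := (Real.le_log_iff_exp_le hn0).2 (Nat.ceil_le.1 hN)
  have hlog0 : 0 ≤ Real.log n := le_trans (by positivity) hlog
  obtain ⟨u, hu, hun⟩ : ∃ u : ℝ, 5 ≤ u ∧ u ^ 20 = Real.log n := by
    have h1 : (Real.log n ^ ((20 : ℕ) : ℝ)⁻¹) ^ 20 = Real.log n :=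
      Real.rpow_inv_natCast_pow hlog0 (by norm_num)
    refine ⟨_, ?_, h1⟩
    rw [← h1] at hlog
    exact le_of_pow_le_pow_left₀ (by norm_num) (by positivity) hlog
  rw [← Finset.sum_sub_distrib]
  refine (hmain u n hu (by rw [hun, Real.exp_log hn0])).trans ?_
  rw [mul_assoc, mul_div_assoc, ← hun]
  refine mul_le_mul_of_nonneg_left ?_ hC.le
  calc (1 + Real.log u) * ((n : ℝ) / u ^ 9) = n * ((1 + Real.log u) / u ^ 9) := by ring
    _ ≤ n * ((1 + 1 / (9 - 10 * δ)) / (u ^ 20) ^ (δ / 2)) :=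
        mul_le_mul_of_nonneg_left (one_add_log_div_pow_nine_le hδ (by linarith)) hn0.le
    _ = _ := by ring
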